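/- S_N obeys the Edgeworth expansions of order r in a conditionally stable way if and only if for every nonzero resonant point t and every ℓ, sup over all indices 1 ≤ j_1,...,j_ℓ ≤ N of || E[e^{itS_N} | X_{j_1},...,X_{j_ℓ}] ||_{L¹} is o_ℓ(σ_N^{−(r−1)}). -/

import Mathlib

open MeasureTheory ProbabilityTheory Filter Finset
open scoped ENNReal Topology

noncomputable section

namespace EdgeworthMC

variable {Ω E : Type*} [MeasurableSpace Ω] [MeasurableSpace E]

/-- The standard Gaussian density `𝔤(u) = (2π)^{-1/2} e^{-u²/2}`. -/
def gaussDensity (u : ℝ) : ℝ := (Real.sqrt (2 * Real.pi))⁻¹ * Real.exp (-u ^ 2 / 2)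

/-- `UEChain μ X κ C` : the process `X` is a Markov chain (with respect to the probability
measure `μ`) with transition kernels `κ n` from the state at time `n` to the state at time
`n+1`, and the chain is uniformly elliptic with ellipticity constant `C`:
`C⁻¹ ℙ(X_{n+1} ∈ A) ≤ ℙ(X_{n+1} ∈ A | X_n = x) ≤ C ℙ(X_{n+1} ∈ A)` for a.e. `x`. -/
def UEChain (μ : Measure Ω) (X : ℕ → Ω → E) (κ : ℕ → Kernel E E) (C : ℝ) : Prop :=
  IsProbabilityMeasure μ ∧
  (∀ n, Measurable (X n)) ∧
  (∀ n, IsMarkovKernel (κ n)) ∧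
  (∀ n (A : Set E), MeasurableSet A →
      (μ[fun ω => A.indicator (fun _ => (1 : ℝ)) (X (n + 1) ω) |
          ⨆ i : Fin (n + 1), MeasurableSpace.comap (X i) (inferInstance : MeasurableSpace E)]
        =ᵐ[μ] fun ω => (κ n (X n ω) A).toReal)) ∧
  (∀ n (A : Set E), MeasurableSet A → ∀ᵐ ω ∂μ,
      κ n (X n ω) A ≤ ENNReal.ofReal C * Measure.map (X (n + 1)) μ A ∧
      Measure.map (X (n + 1)) μ A ≤ ENNReal.ofReal C * κ n (X n ω) A)

/-- Partial sums `S_N = ∑_{n=1}^N f_n(X_n)`. -/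
def S (X : ℕ → Ω → E) (f : ℕ → E → ℤ) (N : ℕ) (ω : Ω) : ℤ :=
  ∑ n ∈ Finset.Icc 1 N, f n (X n ω)

/-- `V_N = Var(S_N)`. -/
def VN (μ : Measure Ω) (X : ℕ → Ω → E) (f : ℕ → E → ℤ) (N : ℕ) : ℝ :=
  variance (fun ω => ((S X f N ω : ℝ))) μ

/-- `σ_N = √V_N`. -/
def sigN (μ : Measure Ω) (X : ℕ → Ω → E) (f : ℕ → E → ℤ) (N : ℕ) : ℝ :=
  Real.sqrt (VN μ X f N)

/-- `a_N = 𝔼(S_N)`. -/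
def meanS (μ : Measure Ω) (X : ℕ → Ω → E) (f : ℕ → E → ℤ) (N : ℕ) : ℝ :=
  ∫ ω, ((S X f N ω : ℝ)) ∂μ

/-- The second largest value among the (finitely many) values of `p`, counted with
multiplicity: it equals `min_j max_{j' ≠ j} p j'`. -/
def secondLargest {ι : Type*} (p : ι → ℝ) : ℝ := ⨅ j, sSup (p '' {j}ᶜ)

/-- `q_n(m)` : the second largest value among `ℙ(Y_n ≡ j mod m)`, `j = 0,…,m-1`. -/
def qres (μ : Measure Ω) (X : ℕ → Ω → E) (f : ℕ → E → ℤ) (n m : ℕ) : ℝ :=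
  secondLargest (fun j : ZMod m => (μ {ω | ((f n (X n ω) : ZMod m)) = j}).toReal)

/-- `M_N = min_{2 ≤ m ≤ 2K} ∑_{n=1}^N q_n(m)`. -/
def MN (μ : Measure Ω) (X : ℕ → Ω → E) (f : ℕ → E → ℤ) (K N : ℕ) : ℝ :=
  sInf ((fun m => ∑ n ∈ Finset.Icc 1 N, qres μ X f n m) '' (Set.Icc 2 (2 * K)))

/-- `S_N` obeys the Edgeworth expansion of order `r` : there are polynomials `P_{b,N}`,
with coefficients uniformly bounded in `N` and degrees not depending on `N`, such that
uniformly in `k ∈ ℤ`,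
`ℙ(S_N = k) = ∑_{b=1}^r σ_N^{-b} P_{b,N}(k_N) 𝔤(k_N) + o(σ_N^{-r})`
where `k_N = (k - 𝔼 S_N)/σ_N`. -/
def Edgeworth (μ : Measure Ω) (X : ℕ → Ω → E) (f : ℕ → E → ℤ) (r : ℕ) : Prop :=
  ∃ (D : ℕ) (Cb : ℝ) (P : ℕ → ℕ → Polynomial ℝ),
    (∀ b N, (P b N).natDegree ≤ D) ∧
    (∀ b N i, |(P b N).coeff i| ≤ Cb) ∧
    ∀ ε > 0, ∃ N₀, ∀ N ≥ N₀, ∀ k : ℤ,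
      |(μ {ω | S X f N ω = k}).toReal -
          ∑ b ∈ Finset.Icc 1 r, (sigN μ X f N)⁻¹ ^ b *
            (P b N).eval (((k : ℝ) - meanS μ X f N) / sigN μ X f N) *
            gaussDensity (((k : ℝ) - meanS μ X f N) / sigN μ X f N)|
        ≤ ε * (sigN μ X f N)⁻¹ ^ r

/-- The σ-algebra generated by `X_{j 1}, …, X_{j ℓ}`. -/
def sigmaOf (X : ℕ → Ω → E) {ℓ : ℕ} (j : Fin ℓ → ℕ) : MeasurableSpace Ω :=
  ⨆ i : Fin ℓ, MeasurableSpace.comap (X (j i)) (inferInstance : MeasurableSpace E)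

/-- Conditional probability of the event `s` given the σ-algebra `m`. -/
def condProb (μ : Measure Ω) (m : MeasurableSpace Ω) (s : Set Ω) : Ω → ℝ :=
  μ[s.indicator (fun _ => (1 : ℝ)) | m]

/-- `S_N` obeys the Edgeworth expansion of order `r` in a conditionally stable way:
for every `ℓ`, the order `r` Edgeworth expansion holds for the conditional law of `S_N`
given `X_{j_1},…,X_{j_ℓ}`, with error term `o_ℓ(σ_N^{-r})` and polynomial coefficient
bounds depending only on `ℓ` (and `r`), uniformly over all choices of indices
`1 ≤ j_1,…,j_ℓ ≤ N`. -/
def CondStableEdgeworth (μ : Measure Ω) (X : ℕ → Ω → E) (f : ℕ → E → ℤ) (r : ℕ) : Prop :=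
  ∀ ℓ : ℕ, ∃ (D : ℕ) (Cb : ℝ), ∀ ε > 0, ∃ N₀, ∀ N ≥ N₀,
    ∀ j : Fin ℓ → ℕ, (∀ i, j i ∈ Finset.Icc 1 N) →
      ∃ P : ℕ → Ω → Polynomial ℝ,
        (∀ b ω, (P b ω).natDegree ≤ D) ∧
        (∀ b ω i, |(P b ω).coeff i| ≤ Cb) ∧
        ∀ᵐ ω ∂μ, ∀ k : ℤ,
          |condProb μ (sigmaOf X j) {ω' | S X f N ω' = k} ω -
              ∑ b ∈ Finset.Icc 1 r, (sigN μ X f N)⁻¹ ^ b *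
                (P b ω).eval (((k : ℝ) -
                    (μ[fun ω' => ((S X f N ω' : ℝ)) | sigmaOf X j]) ω) / sigN μ X f N) *
                gaussDensity (((k : ℝ) -
                    (μ[fun ω' => ((S X f N ω' : ℝ)) | sigmaOf X j]) ω) / sigN μ X f N)|
            ≤ ε * (sigN μ X f N)⁻¹ ^ r

/-- `t` is a resonant point: `t = 2πl/m` with `0 < m ≤ 2K`, `0 ≤ l < m`. -/
def IsResonant (K : ℕ) (t : ℝ) : Prop :=
  ∃ l m : ℕ, 0 < m ∧ m ≤ 2 * K ∧ l < m ∧ t = 2 * Real.pi * l / m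

/-- The conditional characteristic function `𝔼[e^{itS_N} | X_{j_1},…,X_{j_ℓ}]`. -/
def condChar (μ : Measure Ω) (X : ℕ → Ω → E) (f : ℕ → E → ℤ) (t : ℝ) (N : ℕ)
    {ℓ : ℕ} (j : Fin ℓ → ℕ) : Ω → ℂ :=
  μ[fun ω => Complex.exp (Complex.I * (t : ℂ) * ((S X f N ω : ℤ) : ℂ)) | sigmaOf X j]

end EdgeworthMC

namespace EdgeworthMC

variable {Ω E : Type*} [MeasurableSpace Ω] [MeasurableSpace E]

/-- A sequence of marginals and transition kernels with two-sided ellipticity bounds. -/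
structure EllSys (ν : ℕ → Measure E) (κ : ℕ → Kernel E E) (C : ℝ) : Prop where
  one_lt : 1 < C
  prob : ∀ n, IsProbabilityMeasure (ν n)
  markov : ∀ n, IsMarkovKernel (κ n)
  inv : ∀ n, (ν n).bind (κ n) = ν (n + 1)
  ell : ∀ n (A : Set E), MeasurableSet A → ∀ᵐ x ∂(ν n),
    κ n x A ≤ ENNReal.ofReal C * ν (n + 1) A ∧ ν (n + 1) A ≤ ENNReal.ofReal C * κ n x A

/-- Bounded measurable functions. -/
def BM (φ : E → ℂ) : Prop := Measurable φ ∧ ∃ b : ℝ, ∀ x, ‖φ x‖ ≤ b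

lemma BM.const (c : ℂ) : BM (fun _ : E => c) := ⟨measurable_const, ‖c‖, fun _ => le_rfl⟩

lemma BM.mul {φ ψ : E → ℂ} (h : BM φ) (h' : BM ψ) : BM (fun x => φ x * ψ x) := by
  obtain ⟨m, b, hb⟩ := h
  obtain ⟨m', b', hb'⟩ := h'
  refine ⟨m.mul m', b * b', fun x => ?_⟩
  rw [norm_mul]
  exact mul_le_mul (hb x) (hb' x) (norm_nonneg _) ((norm_nonneg _).trans (hb x))

lemma BM.sub {φ ψ : E → ℂ} (h : BM φ) (h' : BM ψ) : BM (fun x => φ x - ψ x) := by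
  obtain ⟨m, b, hb⟩ := h
  obtain ⟨m', b', hb'⟩ := h'
  exact ⟨m.sub m', b + b', fun x => (norm_sub_le _ _).trans (add_le_add (hb x) (hb' x))⟩

lemma BM.integrable {φ : E → ℂ} (h : BM φ) (μ : Measure E) [IsFiniteMeasure μ] :
    Integrable φ μ := by
  obtain ⟨m, b, hb⟩ := h
  exact Integrable.of_bound m.aestronglyMeasurable b (Eventually.of_forall hb)

lemma BM.kernel {φ : E → ℂ} (h : BM φ) (κ : Kernel E E) [IsMarkovKernel κ] :
    BM (fun x => ∫ y, φ y ∂(κ x)) := by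
  obtain ⟨m, b, hb⟩ := h
  refine ⟨?_, b, fun x => ?_⟩
  · exact (StronglyMeasurable.integral_kernel m.stronglyMeasurable).measurable
  · refine (norm_integral_le_of_norm_le_const (C := b) (Eventually.of_forall hb)).trans ?_
    simp

/-- A measurable function bounded a.e. agrees a.e. with a bounded one. -/
lemma exists_BM_ae_eq {φ : E → ℂ} (hφ : Measurable φ) {ν : Measure E} {s : ℝ}
    (h : ∀ᵐ x ∂ν, ‖φ x‖ ≤ s) : ∃ φ', BM φ' ∧ φ =ᵐ[ν] φ' := by
  classical
  refine ⟨{x | ‖φ x‖ ≤ s}.indicator φ, ⟨hφ.indicator (measurableSet_le hφ.norm measurable_const),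
    max s 0, fun x => ?_⟩, ?_⟩
  · by_cases hx : ‖φ x‖ ≤ s
    · rw [Set.indicator_of_mem (by exact hx)]; exact hx.trans (le_max_left _ _)
    · rw [Set.indicator_of_notMem (by exact hx)]; simp
  · filter_upwards [h] with x hx
    rw [Set.indicator_of_mem (by exact hx)]

namespace EllSys

variable {ν : ℕ → Measure E} {κ : ℕ → Kernel E E} {C : ℝ}

lemma ae_kernel (h : EllSys ν κ C) {n : ℕ} {P : E → Prop} (hP : ∀ᵐ y ∂(ν (n + 1)), P y) :
    ∀ᵐ x ∂(ν n), ∀ᵐ y ∂(κ n x), P y := by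
  rw [← h.inv n] at hP
  exact Measure.ae_ae_of_ae_bind (κ n).aemeasurable hP

lemma lintegral_ell (h : EllSys ν κ C) (n : ℕ) {φ : E → ℝ≥0∞} (hφ : Measurable φ) :
    ∀ᵐ x ∂(ν n), ∫⁻ y, φ y ∂(κ n x) ≤ ENNReal.ofReal C * ∫⁻ y, φ y ∂(ν (n + 1)) ∧
      ∫⁻ y, φ y ∂(ν (n + 1)) ≤ ENNReal.ofReal C * ∫⁻ y, φ y ∂(κ n x) := by
  refine Measurable.ennreal_induction (motive := fun φ => ∀ᵐ x ∂(ν n),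
    ∫⁻ y, φ y ∂(κ n x) ≤ ENNReal.ofReal C * ∫⁻ y, φ y ∂(ν (n + 1)) ∧
      ∫⁻ y, φ y ∂(ν (n + 1)) ≤ ENNReal.ofReal C * ∫⁻ y, φ y ∂(κ n x)) ?_ ?_ ?_ hφ
  · intro c s hs
    filter_upwards [h.ell n s hs] with x hx
    rw [lintegral_indicator_const hs, lintegral_indicator_const hs]
    constructor
    · calc c * κ n x s ≤ c * (ENNReal.ofReal C * ν (n + 1) s) := by gcongr; exact hx.1
        _ = _ := by ring
    · calc c * ν (n + 1) s ≤ c * (ENNReal.ofReal C * κ n x s) := by gcongr; exact hx.2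
        _ = _ := by ring
  · intro f g hd hf hg h1 h2
    filter_upwards [h1, h2] with x hx1 hx2
    simp only [Pi.add_apply]
    rw [lintegral_add_left hf, lintegral_add_left hf, mul_add, mul_add]
    exact ⟨add_le_add hx1.1 hx2.1, add_le_add hx1.2 hx2.2⟩
  · intro f hf hmono hi
    filter_upwards [ae_all_iff.2 hi] with x hx
    rw [lintegral_iSup hf hmono, lintegral_iSup hf hmono, ENNReal.mul_iSup, ENNReal.mul_iSup]
    exact ⟨iSup_mono fun i => (hx i).1, iSup_mono fun i => (hx i).2⟩

lemma integral_ell (h : EllSys ν κ C) (n : ℕ) {φ : E → ℝ} (hφ : Measurable φ)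
    (h0 : ∀ x, 0 ≤ φ x) {b : ℝ} (hb : ∀ x, φ x ≤ b) :
    ∀ᵐ x ∂(ν n), ∫ y, φ y ∂(κ n x) ≤ C * ∫ y, φ y ∂(ν (n + 1)) ∧
      C⁻¹ * ∫ y, φ y ∂(ν (n + 1)) ≤ ∫ y, φ y ∂(κ n x) := by
  have := h.prob
  have := h.markov
  have hC : 0 < C := by linarith [h.one_lt]
  filter_upwards [h.lintegral_ell n hφ.ennreal_ofReal] with x hx
  have e : ∀ (m : Measure E) [IsProbabilityMeasure m],
      ∫⁻ y, ENNReal.ofReal (φ y) ∂m = ENNReal.ofReal (∫ y, φ y ∂m) := fun m _ => by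
    rw [ofReal_integral_eq_lintegral_ofReal _ (Eventually.of_forall h0)]
    exact Integrable.of_bound hφ.aestronglyMeasurable b
      (Eventually.of_forall fun x => by rw [Real.norm_eq_abs, abs_of_nonneg (h0 x)]; exact hb x)
  have i0 : ∀ m : Measure E, 0 ≤ ∫ y, φ y ∂m := fun m => integral_nonneg h0
  rw [e, e, ← ENNReal.ofReal_mul hC.le, ← ENNReal.ofReal_mul hC.le] at hx
  rw [ENNReal.ofReal_le_ofReal_iff (mul_nonneg hC.le (i0 _)),
    ENNReal.ofReal_le_ofReal_iff (mul_nonneg hC.le (i0 _))] at hx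
  refine ⟨hx.1, ?_⟩
  rw [inv_mul_le_iff₀ hC]
  exact hx.2

lemma integral_inv (h : EllSys ν κ C) (n : ℕ) {φ : E → ℂ} (hφ : BM φ) :
    ∫ x, ∫ y, φ y ∂(κ n x) ∂(ν n) = ∫ y, φ y ∂(ν (n + 1)) := by
  have := h.prob
  have := h.markov
  have hs : (ν n ⊗ₘ κ n).snd = ν (n + 1) := by rw [Measure.snd_compProd, h.inv n]
  rw [← hs, Measure.snd, integral_map measurable_snd.aemeasurable hφ.1.aestronglyMeasurable,
    Measure.integral_compProd]
  obtain ⟨m, b, hb⟩ := hφ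
  exact Integrable.of_bound (m.comp measurable_snd).aestronglyMeasurable b
    (Eventually.of_forall fun x => hb _)

/-- Contraction of oscillation by an elliptic kernel. -/
lemma contract (h : EllSys ν κ C) (n : ℕ) {φ : E → ℂ} (hφ : Measurable φ) {c : ℂ} {o : ℝ}
    (ho : ∀ᵐ y ∂(ν (n + 1)), ‖φ y - c‖ ≤ o) :
    ∀ᵐ x ∂(ν n), ‖∫ y, φ y ∂(κ n x) -
      (C⁻¹ * ∫ y, φ y ∂(ν (n + 1)) + (1 - C⁻¹) * c)‖ ≤ (1 - C⁻¹) * o := by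
  have := h.prob
  have := h.markov
  have hC : 0 < C := by linarith [h.one_lt]
  have hC1 : C⁻¹ < 1 := inv_lt_one_of_one_lt₀ h.one_lt
  have o0 : 0 ≤ o := by
    obtain ⟨y, hy⟩ := ho.exists
    exact (norm_nonneg _).trans hy
  classical
  set S : Set E := {y | ‖φ y - c‖ ≤ o}
  have hS : MeasurableSet S := measurableSet_le (hφ.sub measurable_const).norm measurable_const
  set g : E → ℂ := S.indicator (fun y => φ y - c) with hg
  have gm : Measurable g := (hφ.sub measurable_const).indicator hS
  have gb : ∀ y, ‖g y‖ ≤ o := fun y => by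
    by_cases hy : y ∈ S
    · rw [hg, Set.indicator_of_mem hy]; exact hy
    · rw [hg, Set.indicator_of_notMem hy]; simpa using o0
  have gBM : BM g := ⟨gm, o, gb⟩
  have gae : ∀ᵐ y ∂(ν (n + 1)), φ y = g y + c := by
    filter_upwards [ho] with y hy
    rw [hg, Set.indicator_of_mem (by exact hy)]; ring
  have key : ∀ᵐ x ∂(ν n), ∀ k : ℕ,
      ((starRingEnd ℂ) (TopologicalSpace.denseSeq ℂ k) * (∫ y, g y ∂(κ n x) - C⁻¹ * ∫ y, g y ∂(ν (n + 1)))).re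
        ≤ (1 - C⁻¹) * (‖TopologicalSpace.denseSeq ℂ k‖ * o) := by
    rw [ae_all_iff]
    intro k
    set w := TopologicalSpace.denseSeq ℂ k
    set L : ℂ →L[ℝ] ℝ := Complex.reCLM.comp
      ((ContinuousLinearMap.mul ℝ ℂ) ((starRingEnd ℂ) w)) with hL
    have hLa : ∀ v, L v = ((starRingEnd ℂ) w * v).re := fun v => by simp [hL]
    have hLb : ∀ v, |L v| ≤ ‖w‖ * ‖v‖ := fun v => by
      rw [hLa]
      refine (Complex.abs_re_le_norm _).trans ?_
      rw [norm_mul, RCLike.norm_conj]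
    have hLg : ∀ y, |L (g y)| ≤ ‖w‖ * o := fun y =>
      (hLb _).trans (mul_le_mul_of_nonneg_left (gb y) (norm_nonneg _))
    have mm : Measurable fun y => ‖w‖ * o - L (g y) :=
      measurable_const.sub (L.continuous.measurable.comp gm)
    filter_upwards [h.integral_ell n mm (fun y => by linarith [abs_le.1 (hLg y)])
      (b := ‖w‖ * o + ‖w‖ * o) (fun y => by linarith [abs_le.1 (hLg y)])] with x hx
    have hi : ∀ (m : Measure E) [IsProbabilityMeasure m],
        ∫ y, (‖w‖ * o - L (g y)) ∂m = ‖w‖ * o - L (∫ y, g y ∂m) := fun m _ => by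
      rw [integral_sub (integrable_const _) (L.integrable_comp (gBM.integrable m)),
        L.integral_comp_comm (gBM.integrable m)]
      simp
    rw [hi, hi] at hx
    have := hx.2
    have e : ((starRingEnd ℂ) w * (∫ y, g y ∂(κ n x) - C⁻¹ * ∫ y, g y ∂(ν (n + 1)))).re
        = L (∫ y, g y ∂(κ n x)) - C⁻¹ * L (∫ y, g y ∂(ν (n + 1))) := by
      rw [hLa, hLa, mul_sub, Complex.sub_re]
      congr 1
      rw [mul_left_comm, Complex.re_ofReal_mul]
    rw [e]
    nlinarith
  have gint : ∫ y, φ y ∂(ν (n + 1)) = ∫ y, g y ∂(ν (n + 1)) + c := by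
    rw [integral_congr_ae gae, integral_add (gBM.integrable _) (integrable_const _)]; simp
  filter_upwards [key, h.ae_kernel gae] with x hx hx2
  have e1 : ∫ y, φ y ∂(κ n x) = ∫ y, g y ∂(κ n x) + c := by
    rw [integral_congr_ae hx2, integral_add (gBM.integrable _) (integrable_const _)]; simp
  rw [gint, e1]
  set v := ∫ y, g y ∂(κ n x) - C⁻¹ * ∫ y, g y ∂(ν (n + 1)) with hv
  have e2 : ∫ y, g y ∂(κ n x) + c - (C⁻¹ * (∫ y, g y ∂(ν (n + 1)) + c) + (1 - C⁻¹) * c) = v := by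
    rw [hv]; ring
  rw [e2]
  have all : ∀ w : ℂ, ((starRingEnd ℂ) w * v).re ≤ (1 - C⁻¹) * (‖w‖ * o) := by
    have cl : IsClosed {w : ℂ | ((starRingEnd ℂ) w * v).re ≤ (1 - C⁻¹) * (‖w‖ * o)} := by
      refine isClosed_le ?_ ?_
      · exact Complex.continuous_re.comp (Complex.continuous_conj.mul continuous_const)
      · fun_prop
    intro w
    have : w ∈ closure (Set.range (TopologicalSpace.denseSeq ℂ)) := TopologicalSpace.denseRange_denseSeq ℂ w
    exact (cl.closure_subset_iff.2 (by rintro _ ⟨k, rfl⟩; exact hx k)) this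
  have := all v
  rw [mul_comm, Complex.mul_conj, Complex.ofReal_re, Complex.normSq_eq_norm_sq] at this
  by_cases hv0 : ‖v‖ = 0
  · rw [hv0]; exact mul_nonneg (by linarith) o0
  · have : 0 < ‖v‖ := lt_of_le_of_ne (norm_nonneg _) (Ne.symm hv0)
    nlinarith

lemma norm_kernel_le (h : EllSys ν κ C) (n : ℕ) {φ : E → ℂ} {s : ℝ}
    (hs : ∀ᵐ y ∂(ν (n + 1)), ‖φ y‖ ≤ s) : ∀ᵐ x ∂(ν n), ‖∫ y, φ y ∂(κ n x)‖ ≤ s := by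
  have := h.markov
  filter_upwards [h.ae_kernel hs] with x hx
  refine (norm_integral_le_of_norm_le_const hx).trans ?_
  simp

lemma kernel_norm_le_integral (h : EllSys ν κ C) (n : ℕ) {φ : E → ℂ} (hφ : Measurable φ) {s : ℝ}
    (hs : ∀ᵐ y ∂(ν (n + 1)), ‖φ y‖ ≤ s) :
    ∀ᵐ x ∂(ν n), ∫ y, ‖φ y‖ ∂(κ n x) ≤ C * ∫ y, ‖φ y‖ ∂(ν (n + 1)) := by
  obtain ⟨φ', ⟨m, b, hb⟩, hae⟩ := exists_BM_ae_eq hφ hs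
  filter_upwards [h.integral_ell n m.norm (fun _ => norm_nonneg _) hb, h.ae_kernel hae] with x hx h2
  have e1 : ∫ y, ‖φ y‖ ∂(κ n x) = ∫ y, ‖φ' y‖ ∂(κ n x) :=
    integral_congr_ae (h2.mono fun y hy => by simp only [hy])
  have e2 : ∫ y, ‖φ y‖ ∂(ν (n + 1)) = ∫ y, ‖φ' y‖ ∂(ν (n + 1)) :=
    integral_congr_ae (hae.mono fun y hy => by simp only [hy])
  rw [e1, e2]; exact hx.1

lemma norm_kernel_le_integral (h : EllSys ν κ C) (n : ℕ) {φ : E → ℂ} (hφ : Measurable φ) {s : ℝ}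
    (hs : ∀ᵐ y ∂(ν (n + 1)), ‖φ y‖ ≤ s) :
    ∀ᵐ x ∂(ν n), ‖∫ y, φ y ∂(κ n x)‖ ≤ C * ∫ y, ‖φ y‖ ∂(ν (n + 1)) := by
  filter_upwards [h.kernel_norm_le_integral n hφ hs] with x hx
  exact (norm_integral_le_integral_norm _).trans hx

end EllSys

/-- Backward iterates `x ↦ 𝔼[∏_{n < i ≤ n + j} h_i(X_i) | X_n = x]`. -/
def back (κ : ℕ → Kernel E E) (h : ℕ → E → ℂ) : ℕ → ℕ → E → ℂ
  | 0, _, _ => 1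
  | j + 1, n, x => ∫ y, h (n + 1) y * back κ h j (n + 1) y ∂(κ n x)

lemma back_zero (κ : ℕ → Kernel E E) (h : ℕ → E → ℂ) (n : ℕ) : back κ h 0 n = fun _ => 1 := rfl

lemma back_succ (κ : ℕ → Kernel E E) (h : ℕ → E → ℂ) (j n : ℕ) (x : E) :
    back κ h (j + 1) n x = ∫ y, h (n + 1) y * back κ h j (n + 1) y ∂(κ n x) := rfl

lemma back_BM {κ : ℕ → Kernel E E} (hκ : ∀ n, IsMarkovKernel (κ n)) {h : ℕ → E → ℂ}
    (hh : ∀ n, BM (h n)) (j : ℕ) : ∀ n, BM (back κ h j n) := by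
  induction j with
  | zero => exact fun n => BM.const 1
  | succ j ih => exact fun n => ((hh (n + 1)).mul (ih (n + 1))).kernel (κ n)

lemma back_congr {κ : ℕ → Kernel E E} {h h' : ℕ → E → ℂ} (j : ℕ) : ∀ n,
    (∀ i ∈ Ioc n (n + j), h i = h' i) → back κ h j n = back κ h' j n := by
  induction j with
  | zero => intro n _; rfl
  | succ j ih =>
    intro n hn
    funext x
    rw [back_succ, back_succ, hn (n + 1) (by simp), ih (n + 1)]
    intro i hi
    exact hn i (by simp at hi ⊢; omega)

/-- The past `σ(X_0, …, X_n)`. -/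
abbrev past (X : ℕ → Ω → E) (n : ℕ) : MeasurableSpace Ω :=
  ⨆ i : Fin (n + 1), MeasurableSpace.comap (X i) (inferInstance : MeasurableSpace E)

/-- Marginal laws. -/
def marg (μ : Measure Ω) (X : ℕ → Ω → E) (n : ℕ) : Measure E := μ.map (X n)

lemma measurable_past (X : ℕ → Ω → E) {k n : ℕ} (hk : k ≤ n) : Measurable[past X n] (X k) := by
  have : MeasurableSpace.comap (X k) inferInstance ≤ past X n :=
    le_iSup (fun i : Fin (n + 1) => MeasurableSpace.comap (X i) inferInstance)
      ⟨k, Nat.lt_succ_of_le hk⟩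
  exact (comap_measurable (X k)).mono this le_rfl

section chain

variable {μ : Measure Ω} {X : ℕ → Ω → E} {κ : ℕ → Kernel E E} {C : ℝ}

lemma UEChain.past_le (h : UEChain μ X κ C) (n : ℕ) : past X n ≤ ‹MeasurableSpace Ω› :=
  iSup_le fun i => (h.2.1 i).comap_le

lemma past_mono (X : ℕ → Ω → E) (n : ℕ) : past X n ≤ past X (n + 1) :=
  iSup_le fun i => (measurable_past X (by omega : (i : ℕ) ≤ n + 1)).comap_le

lemma UEChain.setLIntegral (h : UEChain μ X κ C) (n : ℕ) {s : Set Ω}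
    (hs : MeasurableSet[past X n] s) {A : Set E} (hA : MeasurableSet A) :
    ∫⁻ ω in s, κ n (X n ω) A ∂μ = μ (s ∩ X (n + 1) ⁻¹' A) := by
  have hp := h.1
  have hm := h.2.2.1
  have hs' := h.past_le n s hs
  have hX := h.2.1 (n + 1)
  have e : ∫ ω in s, (κ n (X n ω) A).toReal ∂μ = (μ (s ∩ X (n + 1) ⁻¹' A)).toReal := by
    rw [← setIntegral_congr_ae hs' ((h.2.2.2.1 n A hA).mono fun ω hω _ => hω),
      setIntegral_condExp (h.past_le n)]
    · have : (fun ω => A.indicator (fun _ => (1 : ℝ)) (X (n + 1) ω)) =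
          (X (n + 1) ⁻¹' A).indicator fun _ => (1 : ℝ) := by
        rfl
      rw [this, integral_indicator (hX hA), Measure.restrict_restrict (hX hA)]
      simp [Measure.real, Set.inter_comm]
    · exact Integrable.of_bound ((measurable_const.indicator hA).comp hX).aestronglyMeasurable 1
        (Eventually.of_forall fun ω => by
          by_cases hω : X (n + 1) ω ∈ A <;> simp [hω])
    · exact hs
  have km : Measurable fun ω => κ n (X n ω) A := ((κ n).measurable_coe hA).comp (h.2.1 n)
  rw [integral_toReal km.aemeasurable
    (Eventually.of_forall fun ω => prob_le_one.trans_lt ENNReal.one_lt_top)] at e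
  refine (ENNReal.toReal_eq_toReal_iff' ?_ (measure_ne_top _ _)).1 e
  refine ne_top_of_le_ne_top (measure_ne_top (μ.restrict s) Set.univ) ?_
  calc ∫⁻ ω in s, κ n (X n ω) A ∂μ ≤ ∫⁻ ω in s, 1 ∂μ := lintegral_mono fun ω => prob_le_one
    _ = _ := by simp

lemma UEChain.ellSys (hC : 1 < C) (h : UEChain μ X κ C) : EllSys (marg μ X) κ C where
  one_lt := hC
  prob n := by
    have := h.1
    exact Measure.isProbabilityMeasure_map (h.2.1 n).aemeasurable
  markov := h.2.2.1
  inv n := by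
    ext A hA
    rw [Measure.bind_apply hA (κ n).aemeasurable, marg, marg,
      lintegral_map ((κ n).measurable_coe hA) (h.2.1 n), Measure.map_apply (h.2.1 _) hA]
    have := h.setLIntegral n (s := Set.univ) MeasurableSet.univ hA
    simpa using this
  ell n A hA := by
    rw [show marg μ X n = μ.map (X n) from rfl, ae_map_iff (h.2.1 n).aemeasurable]
    · exact h.2.2.2.2 n A hA
    · have km := (κ n).measurable_coe hA
      exact (measurableSet_le km measurable_const).inter
        (measurableSet_le measurable_const (km.const_mul _))

/-- Integrals of bounded functions of the state against the marginal. -/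
lemma integral_marg (hX : ∀ n, Measurable (X n)) (n : ℕ) {φ : E → ℂ} (hφ : Measurable φ) :
    ∫ x, φ x ∂(marg μ X n) = ∫ ω, φ (X n ω) ∂μ := by
  rw [marg, integral_map (hX n).aemeasurable hφ.aestronglyMeasurable]

lemma UEChain.condExp_eq (h : UEChain μ X κ C) (n : ℕ) {φ : E → ℂ} (hφ : BM φ) :
    (fun ω => ∫ y, φ y ∂(κ n (X n ω))) =ᵐ[μ] μ[fun ω => φ (X (n + 1) ω) | past X n] := by
  have hp := h.1
  have hm := h.2.2.1
  have hκ := hφ.kernel (κ n)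
  obtain ⟨b, hb⟩ := hφ.2
  obtain ⟨b', hb'⟩ := hκ.2
  have i1 : Integrable (fun ω => φ (X (n + 1) ω)) μ :=
    Integrable.of_bound (hφ.1.comp (h.2.1 _)).aestronglyMeasurable b
      (Eventually.of_forall fun _ => hb _)
  have i2 : Integrable (fun ω => ∫ y, φ y ∂(κ n (X n ω))) μ :=
    Integrable.of_bound (hκ.1.comp (h.2.1 _)).aestronglyMeasurable b'
      (Eventually.of_forall fun _ => hb' _)
  refine ae_eq_condExp_of_forall_setIntegral_eq (h.past_le n) i1
    (fun s _ _ => i2.integrableOn) ?_ ?_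
  · intro s hs _
    have hs' := h.past_le n s hs
    have e : κ n ∘ₘ ((μ.restrict s).map (X n)) = (μ.restrict s).map (X (n + 1)) := by
      ext A hA
      rw [Measure.bind_apply hA (κ n).aemeasurable,
        lintegral_map ((κ n).measurable_coe hA) (h.2.1 n), Measure.map_apply (h.2.1 _) hA,
        h.setLIntegral n hs hA, Measure.restrict_apply (h.2.1 _ hA), Set.inter_comm]
    have e2 : (((μ.restrict s).map (X n)) ⊗ₘ κ n).snd = (μ.restrict s).map (X (n + 1)) := by
      rw [Measure.snd_compProd, e]
    rw [← integral_map (h.2.1 (n + 1)).aemeasurable hφ.1.aestronglyMeasurable, ← e2, Measure.snd,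
      integral_map measurable_snd.aemeasurable hφ.1.aestronglyMeasurable,
      Measure.integral_compProd, integral_map (h.2.1 n).aemeasurable hκ.1.aestronglyMeasurable]
    exact Integrable.of_bound (hφ.1.comp measurable_snd).aestronglyMeasurable b
      (Eventually.of_forall fun _ => hb _)
  · exact (hκ.1.comp (measurable_past X le_rfl)).stronglyMeasurable.aestronglyMeasurable

lemma integral_mul_condExp {Ω : Type*} {m m₀ : MeasurableSpace Ω} {μ : Measure Ω}
    [IsProbabilityMeasure μ] (hm : m ≤ m₀) {G Z : Ω → ℂ}
    (hG : Measurable[m] G) {b : ℝ} (hb : ∀ ω, ‖G ω‖ ≤ b) (hZ : Integrable Z μ) :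
    ∫ ω, G ω * Z ω ∂μ = ∫ ω, G ω * μ[Z | m] ω ∂μ := by
  have i1 : Integrable (fun ω => G ω * Z ω) μ :=
    hZ.bdd_mul (hG.stronglyMeasurable.mono hm).aestronglyMeasurable (Eventually.of_forall hb)
  have := condExp_bilin_of_stronglyMeasurable_left (μ := μ) (m := m)
    (B := ContinuousLinearMap.mul ℝ ℂ) (f := G) (g := Z)
    hG.stronglyMeasurable (by simpa using i1) hZ
  simp only [ContinuousLinearMap.mul_apply'] at this
  rw [← integral_congr_ae this, integral_condExp hm]

lemma UEChain.integral_step (h : UEChain μ X κ C) (n : ℕ) {φ : E → ℂ} (hφ : BM φ) {G : Ω → ℂ}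
    (hG : Measurable[past X n] G) {b : ℝ} (hb : ∀ ω, ‖G ω‖ ≤ b) :
    ∫ ω, G ω * φ (X (n + 1) ω) ∂μ = ∫ ω, G ω * ∫ y, φ y ∂(κ n (X n ω)) ∂μ := by
  have hp := h.1
  obtain ⟨b', hb'⟩ := hφ.2
  rw [integral_mul_condExp (h.past_le n) hG hb (Z := fun ω => φ (X (n + 1) ω))
    (Integrable.of_bound (hφ.1.comp (h.2.1 _)).aestronglyMeasurable b'
      (Eventually.of_forall fun _ => hb' _))]
  refine integral_congr_ae ?_
  filter_upwards [h.condExp_eq n hφ] with ω hω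
  simp only [← hω]

lemma prod_Ioc_succ_left {M : Type*} [CommMonoid M] (F : ℕ → M) (n j : ℕ) :
    ∏ i ∈ Ioc n (n + (j + 1)), F i = F (n + 1) * ∏ i ∈ Ioc (n + 1) (n + 1 + j), F i := by
  rw [← Finset.prod_Ioc_consecutive F (m := n) (n := n + 1) (k := n + (j + 1))
    (by omega) (by omega)]
  congr 1
  · simp
  · congr 2; omega

lemma UEChain.integral_back (h : UEChain μ X κ C) {g : ℕ → E → ℂ} (hg : ∀ n, BM (g n)) (j : ℕ) :
    ∀ (n : ℕ) {G : Ω → ℂ}, Measurable[past X n] G → (∃ b : ℝ, ∀ ω, ‖G ω‖ ≤ b) →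
    ∫ ω, G ω * ∏ i ∈ Ioc n (n + j), g i (X i ω) ∂μ = ∫ ω, G ω * back κ g j n (X n ω) ∂μ := by
  induction j with
  | zero => intro n G _ _; simp [back_zero]
  | succ j ih =>
    intro n G hG ⟨b, hb⟩
    obtain ⟨m', b', hb'⟩ := hg (n + 1)
    have hb0 : ∀ ω : Ω, 0 ≤ b := fun ω => (norm_nonneg _).trans (hb ω)
    simp_rw [prod_Ioc_succ_left, ← mul_assoc]
    rw [ih (n + 1) (G := fun ω => G ω * g (n + 1) (X (n + 1) ω))]
    · simp_rw [mul_assoc]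
      rw [h.integral_step n ((hg (n + 1)).mul (back_BM h.2.2.1 hg j (n + 1))) hG hb]
      rfl
    · exact (hG.mono (past_mono X n) le_rfl).mul (m'.comp (measurable_past X le_rfl))
    · refine ⟨b * b', fun ω => ?_⟩
      rw [norm_mul]
      exact mul_le_mul (hb ω) (hb' _) (norm_nonneg _) (hb0 ω)

lemma measurable_prod_past {g : ℕ → E → ℂ} (hg : ∀ n, BM (g n)) (n : ℕ) :
    Measurable[past X n] fun ω => ∏ i ∈ Ioc 0 n, g i (X i ω) := by
  refine Finset.measurable_fun_prod (m := past X n) _ fun i hi => ?_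
  exact (hg i).1.comp (measurable_past X (by simp at hi; exact hi.2))

lemma bounded_prod {g : ℕ → E → ℂ} (hg : ∀ n, BM (g n)) (s : Finset ℕ) :
    ∃ b : ℝ, ∀ ω, ‖∏ i ∈ s, g i (X i ω)‖ ≤ b := by
  choose m b hb using hg
  refine ⟨∏ i ∈ s, b i, fun ω => ?_⟩
  rw [norm_prod]
  exact Finset.prod_le_prod (fun _ _ => norm_nonneg _) fun i _ => hb i _

lemma UEChain.integral_prod_Ioc (h : UEChain μ X κ C) {g : ℕ → E → ℂ}
    (hg : ∀ n, BM (g n)) (n j : ℕ) :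
    ∫ ω, ∏ i ∈ Ioc n (n + j), g i (X i ω) ∂μ = ∫ x, back κ g j n x ∂(marg μ X n) := by
  have := h.integral_back hg j n (G := fun _ => 1) measurable_const ⟨1, by simp⟩
  simp only [one_mul] at this
  rw [this, integral_marg h.2.1 n (back_BM h.2.2.1 hg j n).1]

lemma UEChain.integral_split (h : UEChain μ X κ C) {g : ℕ → E → ℂ}
    (hg : ∀ n, BM (g n)) {n N : ℕ} (hn : n ≤ N) :
    ∫ ω, ∏ i ∈ Ioc 0 N, g i (X i ω) ∂μ =
      ∫ ω, (∏ i ∈ Ioc 0 n, g i (X i ω)) * back κ g (N - n) n (X n ω) ∂μ := by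
  rw [← h.integral_back hg (N - n) n (measurable_prod_past hg n) (bounded_prod hg _)]
  congr 1
  funext ω
  rw [Finset.prod_Ioc_consecutive _ (by omega) (by omega)]
  congr 2
  omega

/-- Bounded functionals of the past act on functions of the present through a density. -/
lemma exists_density [IsProbabilityMeasure μ] (hX : ∀ n, Measurable (X n)) (n : ℕ) {G : Ω → ℂ}
    (hG : Measurable G) {b : ℝ} (hb : ∀ ω, ‖G ω‖ ≤ b) :
    ∃ F : E → ℂ, Measurable F ∧ Integrable F (marg μ X n) ∧ ∀ φ, BM φ →
      ∫ ω, G ω * φ (X n ω) ∂μ = ∫ x, F x * φ x ∂(marg μ X n) := by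
  have hm := (hX n).comap_le
  have iG : Integrable G μ := Integrable.of_bound hG.aestronglyMeasurable b (Eventually.of_forall hb)
  obtain ⟨F, hF, e⟩ := (stronglyMeasurable_condExp (f := G)
    (m := MeasurableSpace.comap (X n) inferInstance)
    (μ := μ)).exists_eq_measurable_comp
  refine ⟨F, hF.measurable, ?_, ?_⟩
  · rw [marg, integrable_map_measure hF.aestronglyMeasurable (hX n).aemeasurable, ← e]
    exact integrable_condExp
  · intro φ hφ
    obtain ⟨b', hb'⟩ := hφ.2
    have := integral_mul_condExp (μ := μ) hm (G := fun ω => φ (X n ω))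
      (hφ.1.comp (comap_measurable (X n))) (fun ω => hb' _) iG
    simp_rw [mul_comm (G _)]
    rw [this, integral_marg hX n (φ := fun x => F x * φ x) (hF.measurable.mul hφ.1)]
    refine integral_congr_ae (Eventually.of_forall fun ω => ?_)
    simp only [e, Function.comp, mul_comm]

end chain

/-- Potentials uniformly close to one, with `L¹` distance to one controlled by `α p_k`. -/
structure Tilt (ν : ℕ → Measure E) (e : ℕ → E → ℂ) (α : ℝ) (p : ℕ → ℝ) : Prop where
  bm : ∀ k, BM (e k)
  sup_le : ∀ k x, ‖e k x - 1‖ ≤ α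
  l1_le : ∀ k, ∫ x, ‖e k x - 1‖ ∂(ν k) ≤ α * p k
  p_le : ∀ k, p k ≤ 1

/-- Mean of the backward iterate. -/
def lam (ν : ℕ → Measure E) (κ : ℕ → Kernel E E) (e : ℕ → E → ℂ) (j n : ℕ) : ℂ :=
  ∫ x, back κ e j n x ∂(ν n)

section

variable {ν : ℕ → Measure E} {κ : ℕ → Kernel E E} {C α : ℝ} {e : ℕ → E → ℂ} {p : ℕ → ℝ}

lemma Tilt.nonneg (ht : Tilt ν e α p) (hE : EllSys ν κ C) : 0 ≤ α := by
  have := hE.prob 0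
  obtain ⟨x⟩ : Nonempty E := nonempty_of_isProbabilityMeasure (ν 0)
  exact (norm_nonneg _).trans (ht.sup_le 0 x)

lemma integral_norm_mul_le {m : Measure E} [IsProbabilityMeasure m] {φ ψ : E → ℂ} (hφ : BM φ)
    {s : ℝ} (hs : ∀ᵐ x ∂m, ‖ψ x‖ ≤ s) :
    ∫ x, ‖φ x * ψ x‖ ∂m ≤ (∫ x, ‖φ x‖ ∂m) * s := by
  rw [← integral_mul_const]
  refine integral_mono_of_nonneg (Eventually.of_forall fun x => norm_nonneg _)
    ((hφ.integrable m).norm.mul_const s) ?_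
  filter_upwards [hs] with x hx
  rw [norm_mul]
  exact mul_le_mul_of_nonneg_left hx (norm_nonneg _)

lemma lam_succ (hE : EllSys ν κ C) (he : ∀ k, BM (e k)) (j n : ℕ) :
    lam ν κ e (j + 1) n = ∫ x, e (n + 1) x * back κ e j (n + 1) x ∂(ν (n + 1)) :=
  hE.integral_inv n ((he (n + 1)).mul (back_BM hE.markov he j (n + 1)))

lemma norm_lam_succ_sub (ht : Tilt ν e α p) (hE : EllSys ν κ C) {j n : ℕ} {ε : ℝ} (hε : ε ≤ 1)
    (h : ∀ᵐ x ∂(ν (n + 1)), ‖back κ e j (n + 1) x - lam ν κ e j (n + 1)‖ ≤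
      ε * ‖lam ν κ e j (n + 1)‖) :
    ‖lam ν κ e (j + 1) n - lam ν κ e j (n + 1)‖ ≤ 2 * α * p (n + 1) * ‖lam ν κ e j (n + 1)‖ := by
  have := hE.prob
  have bu := back_BM hE.markov ht.bm j (n + 1)
  have be := (ht.bm (n + 1)).sub (BM.const 1)
  have e1 : lam ν κ e (j + 1) n - lam ν κ e j (n + 1) =
      ∫ x, (e (n + 1) x - 1) * back κ e j (n + 1) x ∂(ν (n + 1)) := by
    rw [lam_succ hE ht.bm, lam, ← integral_sub (((ht.bm _).mul bu).integrable _) (bu.integrable _)]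
    congr 1; funext x; ring
  rw [e1]
  refine (norm_integral_le_integral_norm _).trans ?_
  refine (integral_norm_mul_le be (s := 2 * ‖lam ν κ e j (n + 1)‖) ?_).trans ?_
  · filter_upwards [h] with x hx
    have := norm_sub_norm_le (back κ e j (n + 1) x) (lam ν κ e j (n + 1))
    nlinarith [norm_nonneg (lam ν κ e j (n + 1))]
  · nlinarith [ht.l1_le (n + 1), norm_nonneg (lam ν κ e j (n + 1))]

/-- Backward iterates of nearly constant potentials stay nearly constant. -/
lemma back_close (ht : Tilt ν e α p) (hE : EllSys ν κ C) (hα : α * (8 * C) ≤ 1) (j : ℕ) :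
    ∀ n, lam ν κ e j n ≠ 0 ∧ ∀ᵐ x ∂(ν n), ‖back κ e j n x - lam ν κ e j n‖ ≤
      8 * C * α * ‖lam ν κ e j n‖ := by
  have := hE.prob
  have hC := hE.one_lt
  have α0 := ht.nonneg hE
  induction j with
  | zero =>
    intro n
    have : lam ν κ e 0 n = 1 := by simp [lam, back_zero]
    rw [this, back_zero]
    refine ⟨one_ne_zero, Eventually.of_forall fun x => ?_⟩
    simp; positivity
  | succ j ih =>
    intro n
    obtain ⟨h0, h1⟩ := ih (n + 1)
    have hd := norm_lam_succ_sub ht hE (by linarith) h1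
    set c := lam ν κ e j (n + 1) with hc
    set c' := lam ν κ e (j + 1) n with hc'
    have cpos : 0 < ‖c‖ := norm_pos_iff.2 h0
    have hd' : ‖c' - c‖ ≤ 2 * α * ‖c‖ := hd.trans (by
      have := ht.p_le (n + 1)
      have : α * p (n + 1) ≤ α := by nlinarith
      nlinarith)
    have α1 : α * 8 ≤ 1 := by nlinarith
    have low : (1 - 2 * α) * ‖c‖ ≤ ‖c'‖ := by
      have := norm_sub_norm_le c c'
      rw [norm_sub_rev] at this
      linarith
    refine ⟨?_, ?_⟩
    · rw [← norm_pos_iff]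
      have : 0 < (1 - 2 * α) * ‖c‖ := mul_pos (by linarith) cpos
      linarith
    · have bu := back_BM hE.markov ht.bm j (n + 1)
      have hm := ((ht.bm (n + 1)).mul bu).1
      have key := hE.contract n hm (c := c') (o := (8 * C * α + 4 * α) * ‖c‖) (by
        filter_upwards [h1] with x hx
        have e1 : e (n + 1) x * back κ e j (n + 1) x - c' =
          (e (n + 1) x - 1) * back κ e j (n + 1) x + (back κ e j (n + 1) x - c) - (c' - c) := by
            ring
        rw [e1]
        refine (norm_sub_le _ _).trans ((add_le_add (norm_add_le _ _) le_rfl).trans ?_)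
        rw [norm_mul]
        have h2 : ‖back κ e j (n + 1) x‖ ≤ 2 * ‖c‖ := by
          have := norm_sub_norm_le (back κ e j (n + 1) x) c
          nlinarith
        have h3 : ‖e (n + 1) x - 1‖ * ‖back κ e j (n + 1) x‖ ≤ α * (2 * ‖c‖) :=
          mul_le_mul (ht.sup_le _ _) h2 (norm_nonneg _) α0
        nlinarith)
      filter_upwards [key] with x hx
      rw [← lam_succ hE ht.bm j n, ← hc'] at hx
      rw [back_succ]
      have e2 : ((C⁻¹ : ℝ) : ℂ) * c' + (1 - ((C⁻¹ : ℝ) : ℂ)) * c' = c' := by ring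
      rw [e2] at hx
      refine hx.trans ?_
      have e3 : (1 - C⁻¹) * ((8 * C * α + 4 * α) * ‖c‖) =
          (8 * C * α - 4 * α - 4 * α * C⁻¹) * ‖c‖ := by
        field_simp; ring
      rw [e3]
      have : 0 ≤ C⁻¹ := by positivity
      calc (8 * C * α - 4 * α - 4 * α * C⁻¹) * ‖c‖ ≤ (8 * C * α) * ((1 - 2 * α) * ‖c‖) := by
            rw [← mul_assoc]
            refine mul_le_mul_of_nonneg_right ?_ cpos.le
            nlinarith [mul_nonneg α0 this]
        _ ≤ _ := mul_le_mul_of_nonneg_left low (by positivity)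

/-- The tilted transition weights are close to one. -/
lemma weight_close (ht : Tilt ν e α p) (hE : EllSys ν κ C) (hα : α * (100 * C) ≤ 1) (j n : ℕ) :
    ∀ᵐ x ∂(ν n), back κ e (j + 1) n x ≠ 0 ∧ ∀ᵐ y ∂(κ n x),
      ‖e (n + 1) y * back κ e j (n + 1) y / back κ e (j + 1) n x - 1‖ ≤ 56 * C * α := by
  have := hE.prob
  have hC := hE.one_lt
  have α0 := ht.nonneg hE
  obtain ⟨h0, h1⟩ := back_close ht hE (by nlinarith) j (n + 1)
  obtain ⟨h0', h1'⟩ := back_close ht hE (by nlinarith) (j + 1) n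
  have hd := norm_lam_succ_sub ht hE (by nlinarith) h1
  set c := lam ν κ e j (n + 1) with hc
  set c' := lam ν κ e (j + 1) n with hc'
  have cpos : 0 < ‖c‖ := norm_pos_iff.2 h0
  have hd' : ‖c' - c‖ ≤ 2 * α * ‖c‖ := hd.trans (by
    have := ht.p_le (n + 1)
    have : α * p (n + 1) ≤ α := by nlinarith
    nlinarith)
  have aC : α ≤ C * α := by nlinarith
  have hc'c : ‖c'‖ ≤ (1 + 2 * α) * ‖c‖ := by
    have := norm_sub_norm_le c' c
    linarith
  filter_upwards [h1', hE.ae_kernel h1] with x hx hx2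
  have hux : ‖back κ e (j + 1) n x - c‖ ≤ 18 * C * α * ‖c‖ := by
    have e1 : back κ e (j + 1) n x - c = (back κ e (j + 1) n x - c') + (c' - c) := by ring
    rw [e1]
    refine (norm_add_le _ _).trans ((add_le_add hx hd').trans ?_)
    have : 8 * C * α * ‖c'‖ ≤ 8 * C * α * (2 * ‖c‖) :=
      mul_le_mul_of_nonneg_left (by nlinarith) (by positivity)
    nlinarith
  have hlow : 1 / 2 * ‖c‖ ≤ ‖back κ e (j + 1) n x‖ := by
    have := norm_sub_norm_le c (back κ e (j + 1) n x)
    rw [norm_sub_rev] at this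
    nlinarith
  have upos : 0 < ‖back κ e (j + 1) n x‖ := by linarith
  have hne : back κ e (j + 1) n x ≠ 0 := norm_pos_iff.1 upos
  refine ⟨hne, ?_⟩
  filter_upwards [hx2] with y hy
  rw [div_sub_one hne, norm_div, div_le_iff₀ upos]
  have e1 : e (n + 1) y * back κ e j (n + 1) y - back κ e (j + 1) n x =
    (e (n + 1) y - 1) * back κ e j (n + 1) y + (back κ e j (n + 1) y - c)
      - (back κ e (j + 1) n x - c) := by ring
  rw [e1]
  refine (norm_sub_le _ _).trans ((add_le_add (norm_add_le _ _) le_rfl).trans ?_)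
  rw [norm_mul]
  have h2 : ‖back κ e j (n + 1) y‖ ≤ 2 * ‖c‖ := by
    have := norm_sub_norm_le (back κ e j (n + 1) y) c
    nlinarith
  have h3 : ‖e (n + 1) y - 1‖ * ‖back κ e j (n + 1) y‖ ≤ α * (2 * ‖c‖) :=
    mul_le_mul (ht.sup_le _ _) h2 (norm_nonneg _) α0
  have h4 : 56 * C * α * (1 / 2 * ‖c‖) ≤ 56 * C * α * ‖back κ e (j + 1) n x‖ :=
    mul_le_mul_of_nonneg_left hlow (by positivity)
  nlinarith

/-- Lyapunov bound: modulating the potentials by factors of modulus at most one that are close to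
one in `L¹` only changes the size by factors `1 + O(α)`. -/
lemma back_modulated (ht : Tilt ν e α p) (hE : EllSys ν κ C) (hα : α * (200 * C ^ 2) ≤ 1)
    {χ : ℕ → E → ℂ} (hχ : ∀ k, BM (χ k)) (hχ1 : ∀ k x, ‖χ k x‖ ≤ 1) {m : ℕ → ℝ}
    (hm : ∀ k, 1 + 400 * C ^ 3 * α * ∫ x, ‖χ k x - 1‖ ∂(ν k) ≤ m k ∨
      4 * C * ∫ x, ‖χ k x‖ ∂(ν k) ≤ m k) (j : ℕ) :
    ∀ n, ∃ (s o : ℝ) (c : ℂ), 0 ≤ s ∧ 0 ≤ o ∧ s + 168 * C ^ 2 * α * o ≤ ∏ i ∈ Ioc n (n + j), m i ∧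
      (∀ᵐ x ∂(ν n), ‖back κ (fun k x => χ k x * e k x) j n x / back κ e j n x‖ ≤ s) ∧
      (∀ᵐ x ∂(ν n), ‖back κ (fun k x => χ k x * e k x) j n x / back κ e j n x - c‖ ≤ o) := by
  have := hE.prob
  have := hE.markov
  have hC := hE.one_lt
  have α0 := ht.nonneg hE
  have hCC : C ≤ C ^ 2 := by nlinarith
  have aC : α * (100 * C) ≤ 1 := by nlinarith [mul_le_mul_of_nonneg_left hCC α0]
  have hbm : ∀ k, BM (fun x => χ k x * e k x) := fun k => (hχ k).mul (ht.bm k)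
  induction j with
  | zero =>
    intro n
    refine ⟨1, 0, 1, zero_le_one, le_rfl, by simp, ?_, ?_⟩ <;>
      exact Eventually.of_forall fun x => by simp [back_zero]
  | succ j ih =>
    intro n
    obtain ⟨s, o, c, s0, o0, hso, hs, ho⟩ := ih (n + 1)
    obtain ⟨hcl0, hcl⟩ := back_close ht hE (by nlinarith) j (n + 1)
    rw [prod_Ioc_succ_left]
    set h : ℕ → E → ℂ := fun k x => χ k x * e k x with hh
    set u := back κ e j (n + 1) with hu
    set G := back κ h j (n + 1) with hG
    set W : E → ℂ := fun x => G x / u x with hW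
    have bu : BM u := back_BM hE.markov ht.bm j (n + 1)
    have bG : BM G := back_BM hE.markov hbm j (n + 1)
    have mW : Measurable W := bG.1.div bu.1
    have une : ∀ᵐ y ∂(ν (n + 1)), u y ≠ 0 := by
      filter_upwards [hcl] with y hy h0
      rw [h0, zero_sub, norm_neg] at hy
      have : 0 < ‖lam ν κ e j (n + 1)‖ := norm_pos_iff.2 hcl0
      nlinarith
    set Q := ∫ x, ‖χ (n + 1) x - 1‖ ∂(ν (n + 1)) with hQ
    set a := ∫ x, ‖χ (n + 1) x‖ ∂(ν (n + 1)) with ha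
    have Q0 : 0 ≤ Q := integral_nonneg fun x => norm_nonneg _
    have a0 : 0 ≤ a := integral_nonneg fun x => norm_nonneg _
    -- the representation of the new ratio through the tilted weights
    have rep : ∀ᵐ x ∂(ν n), back κ h (j + 1) n x / back κ e (j + 1) n x =
        ∫ y, χ (n + 1) y * W y * (e (n + 1) y * u y / back κ e (j + 1) n x) ∂(κ n x) := by
      filter_upwards [hE.ae_kernel une] with x hx
      rw [back_succ, ← integral_div]
      refine integral_congr_ae (hx.mono fun y hy => ?_)
      have hGy : G y = W y * u y := (div_mul_cancel₀ _ hy).symm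
      change χ (n + 1) y * e (n + 1) y * G y / _ = _
      rw [hGy]
      ring
    have rep1 : ∀ᵐ x ∂(ν n), ∫ y, (e (n + 1) y * u y / back κ e (j + 1) n x - 1) ∂(κ n x) = 0 := by
      filter_upwards [weight_close ht hE aC j n] with x hx
      have i1 : Integrable (fun y => e (n + 1) y * u y) (κ n x) :=
        ((ht.bm (n + 1)).mul bu).integrable _
      rw [integral_sub (i1.div_const _) (integrable_const _), integral_div]
      have hv : ∫ y, e (n + 1) y * u y ∂(κ n x) = back κ e (j + 1) n x := rfl
      rw [hv, div_self hx.1]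
      simp
    have mχ := (hχ (n + 1)).1
    have hWs : ∀ᵐ y ∂(ν (n + 1)), ‖χ (n + 1) y * W y‖ ≤ s := by
      filter_upwards [hs] with y hy
      rw [norm_mul]
      calc ‖χ (n + 1) y‖ * ‖W y‖ ≤ 1 * s := mul_le_mul (hχ1 _ _) hy (norm_nonneg _) zero_le_one
        _ = s := one_mul s
    have wc := weight_close ht hE aC j n
    rw [← hu] at wc
    rcases hm (n + 1) with hmk | hmk
    · -- factor close to one
      have hX1 : ∀ᵐ y ∂(ν (n + 1)), ‖(χ (n + 1) y - 1) * W y‖ ≤ 2 * s := by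
        filter_upwards [hs] with y hy
        rw [norm_mul]
        refine mul_le_mul ?_ hy (norm_nonneg _) (by norm_num)
        refine (norm_sub_le _ _).trans ?_
        have := hχ1 (n + 1) y
        simp; linarith
      have hmX : Measurable fun y => (χ (n + 1) y - 1) * W y := (mχ.sub measurable_const).mul mW
      have hXQ : ∫ y, ‖(χ (n + 1) y - 1) * W y‖ ∂(ν (n + 1)) ≤ Q * s :=
        integral_norm_mul_le ((hχ _).sub (BM.const 1)) hs
      set t := C * (Q * s) with ht'
      have t0 : 0 ≤ t := by positivity
      have hker : ∀ᵐ x ∂(ν n), ∫ y, ‖(χ (n + 1) y - 1) * W y‖ ∂(κ n x) ≤ t := by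
        filter_upwards [hE.kernel_norm_le_integral n hmX hX1] with x hx
        exact hx.trans (mul_le_mul_of_nonneg_left hXQ (by linarith))
      set c'' : ℂ := ((C⁻¹ : ℝ) : ℂ) * ∫ y, W y ∂(ν (n + 1)) + (1 - ((C⁻¹ : ℝ) : ℂ)) * c with hc''
      have hdiff : ∀ᵐ x ∂(ν n), ‖back κ h (j + 1) n x / back κ e (j + 1) n x -
          ∫ y, χ (n + 1) y * W y ∂(κ n x)‖ ≤ 56 * C * α * (o + t) := by
        filter_upwards [rep, rep1, wc, hE.ae_kernel hWs, hE.ae_kernel ho, hE.ae_kernel hX1, hker]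
          with x h1 h2 h3 h4 h5 h6 h7
        set v := back κ e (j + 1) n x with hv
        have mT : Measurable fun y => e (n + 1) y * u y / v :=
          (((ht.bm (n + 1)).mul bu).1).div_const v
        have bT : ∀ᵐ y ∂(κ n x), ‖e (n + 1) y * u y / v - 1‖ ≤ 56 * C * α := h3.2
        have i1 : Integrable (fun y => χ (n + 1) y * W y) (κ n x) :=
          Integrable.of_bound (mχ.mul mW).aestronglyMeasurable s h4
        have iT : Integrable (fun y => e (n + 1) y * u y / v - 1) (κ n x) :=
          Integrable.of_bound (mT.sub measurable_const).aestronglyMeasurable _ bT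
        have i2 : Integrable (fun y => (e (n + 1) y * u y / v - 1) * (χ (n + 1) y * W y))
            (κ n x) := iT.mul_bdd (mχ.mul mW).aestronglyMeasurable h4
        have e1 : back κ h (j + 1) n x / v - ∫ y, χ (n + 1) y * W y ∂(κ n x) =
            ∫ y, (e (n + 1) y * u y / v - 1) * (χ (n + 1) y * W y - c) ∂(κ n x) := by
          have e2 : ∀ y, (e (n + 1) y * u y / v - 1) * (χ (n + 1) y * W y - c) =
            (e (n + 1) y * u y / v - 1) * (χ (n + 1) y * W y) -
              (e (n + 1) y * u y / v - 1) * c := fun y => by ring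
          simp_rw [e2]
          rw [integral_sub i2 (iT.mul_const c), integral_mul_const, h2, zero_mul, sub_zero, h1,
            sub_eq_iff_eq_add, ← integral_add i2 i1]
          refine integral_congr_ae (Eventually.of_forall fun y => ?_)
          simp only
          ring
        rw [e1]
        refine (norm_integral_le_integral_norm _).trans ?_
        have i3 : Integrable (fun y => ‖(χ (n + 1) y - 1) * W y‖) (κ n x) :=
          (Integrable.of_bound hmX.aestronglyMeasurable _ h6).norm
        calc ∫ y, ‖(e (n + 1) y * u y / v - 1) * (χ (n + 1) y * W y - c)‖ ∂(κ n x)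
            ≤ ∫ y, 56 * C * α * (o + ‖(χ (n + 1) y - 1) * W y‖) ∂(κ n x) := by
              refine integral_mono_of_nonneg (Eventually.of_forall fun y => norm_nonneg _)
                (((integrable_const _).add i3).const_mul _) ?_
              filter_upwards [bT, h5] with y hy1 hy2
              rw [norm_mul]
              refine mul_le_mul hy1 ?_ (norm_nonneg _) (by positivity)
              have e3 : χ (n + 1) y * W y - c = (W y - c) + (χ (n + 1) y - 1) * W y := by ring
              rw [e3]
              exact (norm_add_le _ _).trans (add_le_add hy2 le_rfl)
          _ = 56 * C * α * (o + ∫ y, ‖(χ (n + 1) y - 1) * W y‖ ∂(κ n x)) := by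
              rw [integral_const_mul, integral_add (integrable_const _) i3]
              simp
          _ ≤ _ := mul_le_mul_of_nonneg_left (by linarith) (by positivity)
      refine ⟨s + 56 * C * α * (o + t), (1 - C⁻¹) * o + t + 56 * C * α * (o + t), c'', ?_, ?_, ?_,
        ?_, ?_⟩
      · positivity
      · have : C⁻¹ ≤ 1 := inv_le_one_of_one_le₀ hC.le
        have : 0 ≤ (1 - C⁻¹) * o := mul_nonneg (by linarith) o0
        positivity
      · refine le_trans ?_ (mul_le_mul hmk hso (by positivity) (le_trans (by positivity) hmk))
        set x := C ^ 2 * α with hx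
        have x0 : 0 ≤ x := by positivity
        have hx1 : 200 * x ≤ 1 := by rw [hx]; linarith
        have e1 : 56 * C * α = 56 * x * C⁻¹ := by rw [hx]; field_simp
        have e2 : 400 * C ^ 3 * α * Q * s = 400 * x * t := by rw [hx, ht']; ring
        set i := C⁻¹ with hi
        have i0 : 0 < i := by positivity
        have i1 : i ≤ 1 := inv_le_one_of_one_le₀ hC.le
        rw [e1]
        have e3 : 168 * C ^ 2 * α = 168 * x := by rw [hx]; ring
        rw [e3] at hso ⊢
        have e4 : (1 + 400 * C ^ 3 * α * Q) * (s + 168 * x * o) =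
          s + 168 * x * o + 400 * x * t + 400 * C ^ 3 * α * Q * (168 * x * o) := by
            rw [← e2]; ring
        rw [e4]
        have p1 : 0 ≤ 400 * C ^ 3 * α * Q * (168 * x * o) := by positivity
        have p2 : 0 ≤ x * i * o := by positivity
        have p3 : 0 ≤ x * t := by positivity
        have p4 : x * (x * i * o) ≤ 1 / 200 * (x * i * o) :=
          mul_le_mul_of_nonneg_right (by linarith) p2
        have p5 : x * t * i ≤ x * t * 1 := mul_le_mul_of_nonneg_left i1 p3
        have p6 : x * (x * t * i) ≤ 1 / 200 * (x * t * i) :=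
          mul_le_mul_of_nonneg_right (by linarith) (by positivity)
        nlinarith
      · filter_upwards [hdiff, hE.norm_kernel_le n hWs] with x h1 h2
        have := norm_sub_norm_le (back κ h (j + 1) n x / back κ e (j + 1) n x)
          (∫ y, χ (n + 1) y * W y ∂(κ n x))
        linarith
      · filter_upwards [hdiff, hE.contract n mW ho, hker, hE.ae_kernel hs, hE.ae_kernel hX1]
          with x h1 h2 h3 h4 h5
        have i1 : Integrable W (κ n x) := Integrable.of_bound mW.aestronglyMeasurable s h4
        have i2 : Integrable (fun y => (χ (n + 1) y - 1) * W y) (κ n x) :=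
          Integrable.of_bound hmX.aestronglyMeasurable _ h5
        have e1 : ∫ y, χ (n + 1) y * W y ∂(κ n x) =
            ∫ y, W y ∂(κ n x) + ∫ y, (χ (n + 1) y - 1) * W y ∂(κ n x) := by
          rw [← integral_add i1 i2]
          refine integral_congr_ae (Eventually.of_forall fun y => ?_)
          simp only
          ring
        have h6 := (norm_integral_le_integral_norm
          (fun y => (χ (n + 1) y - 1) * W y) (μ := κ n x)).trans h3
        have e2 : back κ h (j + 1) n x / back κ e (j + 1) n x - c'' =
          (back κ h (j + 1) n x / back κ e (j + 1) n x - ∫ y, χ (n + 1) y * W y ∂(κ n x)) +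
          ((∫ y, W y ∂(κ n x) - c'') + ∫ y, (χ (n + 1) y - 1) * W y ∂(κ n x)) := by
            rw [e1]; ring
        rw [e2]
        refine (norm_add_le _ _).trans ?_
        have := norm_add_le (∫ y, W y ∂(κ n x) - c'') (∫ y, (χ (n + 1) y - 1) * W y ∂(κ n x))
        linarith
    · -- arbitrary factor
      have hsmall : ∀ᵐ x ∂(ν n), ‖back κ h (j + 1) n x / back κ e (j + 1) n x‖ ≤
          2 * (C * (a * s)) := by
        have hXa : ∫ y, ‖χ (n + 1) y * W y‖ ∂(ν (n + 1)) ≤ a * s :=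
          integral_norm_mul_le (hχ _) hs
        filter_upwards [rep, wc, hE.ae_kernel hWs, hE.kernel_norm_le_integral n (mχ.mul mW) hWs]
          with x h1 h2 h3 h4
        rw [h1]
        refine (norm_integral_le_integral_norm _).trans ?_
        have i1 : Integrable (fun y => ‖χ (n + 1) y * W y‖) (κ n x) :=
          (Integrable.of_bound (mχ.mul mW).aestronglyMeasurable s h3).norm
        calc ∫ y, ‖χ (n + 1) y * W y * (e (n + 1) y * u y / back κ e (j + 1) n x)‖ ∂(κ n x)
            ≤ ∫ y, 2 * ‖χ (n + 1) y * W y‖ ∂(κ n x) := by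
              refine integral_mono_of_nonneg (Eventually.of_forall fun y => norm_nonneg _)
                (i1.const_mul _) ?_
              filter_upwards [h2.2] with y hy
              rw [norm_mul, mul_comm]
              refine mul_le_mul_of_nonneg_right ?_ (norm_nonneg _)
              have := norm_sub_norm_le (e (n + 1) y * u y / back κ e (j + 1) n x) 1
              rw [norm_one] at this
              nlinarith
          _ = 2 * ∫ y, ‖χ (n + 1) y * W y‖ ∂(κ n x) := integral_const_mul _ _
          _ ≤ _ := by
              refine mul_le_mul_of_nonneg_left (h4.trans ?_) (by norm_num)
              exact mul_le_mul_of_nonneg_left hXa (by linarith)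
      refine ⟨2 * (C * (a * s)), 2 * (C * (a * s)), 0, by positivity, by positivity, ?_, hsmall,
        by simpa using hsmall⟩
      refine le_trans ?_ (mul_le_mul hmk hso (by positivity) (le_trans (by positivity) hmk))
      have p1 : 0 ≤ C * (a * s) := by positivity
      have p2 : 0 ≤ 4 * C * a * (168 * C ^ 2 * α * o) := by positivity
      have p3 : 168 * C ^ 2 * α ≤ 1 := by linarith
      have p4 := mul_le_mul_of_nonneg_right p3 p1
      nlinarith

end

/-- Taylor coefficients at the origin. -/
def tay (f : ℂ → ℂ) (k : ℕ) : ℂ := (k.factorial : ℂ)⁻¹ * iteratedDeriv k f 0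

section taylor

variable {f : ℂ → ℂ} {R B : ℝ}

lemma norm_tay_le (hR : 0 < R) (hf : DifferentiableOn ℂ f (Metric.ball 0 (2 * R)))
    (hB : ∀ z ∈ Metric.ball (0 : ℂ) (2 * R), ‖f z‖ ≤ B) (k : ℕ) : ‖tay f k‖ ≤ B / R ^ k := by
  have hd : DiffContOnCl ℂ f (Metric.ball 0 R) :=
    hf.diffContOnCl_ball (Metric.closedBall_subset_ball (by linarith))
  have h := Complex.norm_iteratedDeriv_le_of_forall_mem_sphere_norm_le k hR hd
    (C := B) fun z hz => hB z (Metric.closedBall_subset_ball (by linarith)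
      (Metric.sphere_subset_closedBall hz))
  have hk : (0 : ℝ) < k.factorial := by positivity
  rw [tay, norm_mul, norm_inv, Complex.norm_natCast, inv_mul_le_iff₀ hk, ← mul_div_assoc]
  exact h

lemma norm_sub_taylor_le (hR : 0 < R) (hf : DifferentiableOn ℂ f (Metric.ball 0 (2 * R)))
    (hB : ∀ z ∈ Metric.ball (0 : ℂ) (2 * R), ‖f z‖ ≤ B) (D : ℕ) {z : ℂ} (hz : ‖z‖ ≤ R / 2) :
    ‖f z - ∑ k ∈ range D, tay f k * z ^ k‖ ≤ 2 * B * (‖z‖ / R) ^ D := by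
  have hz2 : z ∈ Metric.ball (0 : ℂ) (2 * R) := by
    rw [mem_ball_zero_iff]; linarith
  have hs : HasSum (fun k => tay f k * z ^ k) (f z) := by
    have := Complex.hasSum_taylorSeries_on_ball hf hz2
    have e : ∀ k, (k.factorial : ℂ)⁻¹ • (z - 0) ^ k • iteratedDeriv k f 0 = tay f k * z ^ k := by
      intro k
      rw [tay, sub_zero, smul_eq_mul, smul_eq_mul]
      ring
    simpa only [e] using this
  have hs' := (hasSum_nat_add_iff' D).2 hs
  have hB0 : 0 ≤ B := (norm_nonneg _).trans (hB 0 (Metric.mem_ball_self (by linarith)))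
  have hq : ‖z‖ / R ≤ 1 / 2 := by rw [div_le_iff₀ hR]; linarith
  have hq0 : 0 ≤ ‖z‖ / R := by positivity
  have hg : HasSum (fun k : ℕ => B * (‖z‖ / R) ^ D * (1 / 2 : ℝ) ^ k) (2 * B * (‖z‖ / R) ^ D) := by
    have := hasSum_geometric_two.mul_left (B * (‖z‖ / R) ^ D)
    rwa [show 2 * B * (‖z‖ / R) ^ D = B * (‖z‖ / R) ^ D * 2 by ring]
  rw [← hs'.tsum_eq, ← hg.tsum_eq]
  refine tsum_of_norm_bounded hg.summable.hasSum fun k => ?_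
  rw [norm_mul, norm_pow]
  calc ‖tay f (k + D)‖ * ‖z‖ ^ (k + D) ≤ B / R ^ (k + D) * ‖z‖ ^ (k + D) :=
        mul_le_mul_of_nonneg_right (norm_tay_le hR hf hB _) (by positivity)
    _ = B * (‖z‖ / R) ^ D * (‖z‖ / R) ^ k := by rw [div_pow, div_pow, pow_add, pow_add]; field_simp
    _ ≤ _ := by gcongr

end taylor

section expInt

variable {μ : Measure Ω} [IsProbabilityMeasure μ]

/-- Exponential moments with a bounded weight are entire. -/
lemma hasDerivAt_expInt {G : Ω → ℂ} {T : Ω → ℝ} {b B : ℝ} (hG : Measurable G)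
    (hb : ∀ ω, ‖G ω‖ ≤ b) (hT : Measurable T) (hB : ∀ ω, |T ω| ≤ B) (z : ℂ) :
    HasDerivAt (fun z : ℂ => ∫ ω, G ω * Complex.exp (z * T ω) ∂μ)
      (∫ ω, G ω * T ω * Complex.exp (z * T ω) ∂μ) z := by
  have hTc : Measurable fun ω => (T ω : ℂ) := Complex.measurable_ofReal.comp hT
  have hbd : ∀ w ∈ Metric.ball z 1, ∀ ω, ‖Complex.exp (w * T ω)‖ ≤ Real.exp ((‖z‖ + 1) * B) := by
    intro w hw ω
    refine (Complex.norm_exp_le_exp_norm _).trans (Real.exp_le_exp.2 ?_)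
    rw [norm_mul, Complex.norm_real, Real.norm_eq_abs]
    refine mul_le_mul ?_ (hB ω) (abs_nonneg _) (by positivity)
    have := norm_sub_norm_le w z
    rw [Metric.mem_ball, dist_eq_norm] at hw
    linarith
  have me : ∀ w : ℂ, Measurable fun ω => Complex.exp (w * T ω) := fun w =>
    Complex.measurable_exp.comp (hTc.const_mul w)
  refine (hasDerivAt_integral_of_dominated_loc_of_deriv_le (F := fun w ω => G ω * Complex.exp (w * T ω))
    (F' := fun w ω => G ω * T ω * Complex.exp (w * T ω)) (bound := fun _ => b * B * Real.exp ((‖z‖ + 1) * B)) (Metric.ball_mem_nhds z one_pos)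
    (Eventually.of_forall fun w => (hG.mul (me w)).aestronglyMeasurable) ?_
    ((hG.mul hTc).mul (me z)).aestronglyMeasurable ?_ (integrable_const _) ?_).2
  · refine Integrable.of_bound (hG.mul (me z)).aestronglyMeasurable (b * Real.exp ((‖z‖ + 1) * B))
      (Eventually.of_forall fun ω => ?_)
    rw [norm_mul]
    exact mul_le_mul (hb ω) (hbd z (Metric.mem_ball_self one_pos) ω) (norm_nonneg _)
      ((norm_nonneg _).trans (hb ω))
  · refine Eventually.of_forall fun ω w hw => ?_
    rw [norm_mul, norm_mul, Complex.norm_real, Real.norm_eq_abs]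
    have b0 := (norm_nonneg _).trans (hb ω)
    have B0 := (abs_nonneg _).trans (hB ω)
    gcongr
    · exact hb ω
    · exact hB ω
    · exact hbd w hw ω
  · refine Eventually.of_forall fun ω w _ => ?_
    have := (((hasDerivAt_id w).mul_const (T ω : ℂ)).cexp).const_mul (G ω)
    rw [show G ω * T ω * Complex.exp (w * T ω) = G ω * (Complex.exp (w * T ω) * (1 * T ω)) by ring]
    exact this

end expInt

/-- The standing assumptions, with additive functionals bounded everywhere and with a choice of
values `b n` taken with probability bounded from below. -/
structure Model (μ : Measure Ω) (X : ℕ → Ω → E) (κ : ℕ → Kernel E E) (f : ℕ → E → ℤ) (C : ℝ)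
    (K : ℕ) (b : ℕ → ℤ) : Prop where
  one_lt : 1 < C
  chain : UEChain μ X κ C
  meas : ∀ n, Measurable (f n)
  bound : ∀ n x, |f n x| ≤ (K : ℤ)
  one_le : 1 ≤ K
  mode_bound : ∀ n, |b n| ≤ (K : ℤ)
  mode : ∀ n, ((2 * K + 1 : ℝ))⁻¹ ≤ (marg μ X n).real {x | f n x = b n}

/-- Probability of not being at the mode. -/
def offp (μ : Measure Ω) (X : ℕ → Ω → E) (f : ℕ → E → ℤ) (b : ℕ → ℤ) (n : ℕ) : ℝ :=
  (marg μ X n).real {x | f n x ≠ b n}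

/-- Sum of the probabilities of not being at the mode. -/
def offP (μ : Measure Ω) (X : ℕ → Ω → E) (f : ℕ → E → ℤ) (b : ℕ → ℤ) (N : ℕ) : ℝ :=
  ∑ n ∈ Ioc 0 N, offp μ X f b n

/-- Sums recentred at the modes. -/
def Tsum (X : ℕ → Ω → E) (f : ℕ → E → ℤ) (b : ℕ → ℤ) (n m : ℕ) (ω : Ω) : ℝ :=
  ∑ i ∈ Ioc n m, ((f i (X i ω) - b i : ℤ) : ℝ)

/-- Exponential potential. -/
def expPot (f : ℕ → E → ℤ) (b : ℕ → ℤ) (z : ℂ) (n : ℕ) (x : E) : ℂ :=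
  Complex.exp (z * ((f n x - b n : ℤ) : ℂ))

/-- The radius on which exponential tilting is controlled. -/
def del (C : ℝ) (K : ℕ) : ℝ := (1600 * K * C ^ 2)⁻¹

section

variable {μ : Measure Ω} {X : ℕ → Ω → E} {κ : ℕ → Kernel E E} {f : ℕ → E → ℤ} {C : ℝ} {K : ℕ}
  {b : ℕ → ℤ}

namespace Model

lemma prob (h : Model μ X κ f C K b) : IsProbabilityMeasure μ := h.chain.1

lemma ellSys (h : Model μ X κ f C K b) : EllSys (marg μ X) κ C := h.chain.ellSys h.one_lt

lemma measX (h : Model μ X κ f C K b) (n : ℕ) : Measurable (X n) := h.chain.2.1 n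

lemma K_pos (h : Model μ X κ f C K b) : (1 : ℝ) ≤ K := by exact_mod_cast h.one_le

lemma del_pos (h : Model μ X κ f C K b) : 0 < del C K := by
  have := h.one_lt
  have := h.K_pos
  unfold del
  positivity

lemma del_mul (h : Model μ X κ f C K b) : 4 * K * del C K * (400 * C ^ 2) = 1 := by
  have := h.one_lt
  have := h.K_pos
  unfold del
  field_simp
  norm_num

lemma four_mul_del_le (h : Model μ X κ f C K b) : 4 * K * del C K ≤ 1 / 400 := by
  have h1 := h.del_mul
  have h2 := h.one_lt
  have h3 : 1 ≤ C ^ 2 := by nlinarith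
  have h4 : 0 ≤ 4 * K * del C K := by have := h.del_pos; positivity
  nlinarith

lemma abs_sub_le (h : Model μ X κ f C K b) (n : ℕ) (x : E) :
    |((f n x - b n : ℤ) : ℝ)| ≤ 2 * K := by
  have : |f n x - b n| ≤ 2 * (K : ℤ) :=
    (abs_sub _ _).trans (by linarith [h.bound n x, h.mode_bound n])
  exact_mod_cast this

lemma measurable_sub (h : Model μ X κ f C K b) (n : ℕ) :
    Measurable fun x => (f n x - b n : ℤ) := (h.meas n).sub measurable_const

lemma measurableSet_ne (h : Model μ X κ f C K b) (n : ℕ) : MeasurableSet {x | f n x ≠ b n} :=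
  (h.meas n) (measurableSet_singleton (b n)).compl

lemma measurable_expPot (h : Model μ X κ f C K b) (z : ℂ) (n : ℕ) :
    Measurable (expPot f b z n) :=
  Complex.measurable_exp.comp (measurable_const.mul
    ((measurable_of_countable (fun k : ℤ => (k : ℂ))).comp (h.measurable_sub n)))

lemma norm_arg_le (h : Model μ X κ f C K b) (z : ℂ) (n : ℕ) (x : E) :
    ‖z * ((f n x - b n : ℤ) : ℂ)‖ ≤ 2 * K * ‖z‖ := by
  have := h.abs_sub_le n x
  rw [norm_mul, Complex.norm_intCast, mul_comm]
  gcongr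

lemma expPot_BM (h : Model μ X κ f C K b) (z : ℂ) (n : ℕ) : BM (expPot f b z n) :=
  ⟨h.measurable_expPot z n, Real.exp (2 * K * ‖z‖), fun x =>
    (Complex.norm_exp_le_exp_norm _).trans (Real.exp_le_exp.2 (h.norm_arg_le z n x))⟩

lemma norm_expPot_sub_one_le (h : Model μ X κ f C K b) {z : ℂ} (hz : ‖z‖ ≤ del C K) (n : ℕ)
    (x : E) : ‖expPot f b z n x - 1‖ ≤ 4 * K * ‖z‖ := by
  have h1 := h.norm_arg_le z n x
  have h2 := h.four_mul_del_le
  have h3 := h.K_pos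
  refine (Complex.norm_exp_sub_one_le ?_).trans ?_
  · nlinarith [norm_nonneg z]
  · linarith

lemma offp_nonneg (n : ℕ) : 0 ≤ offp μ X f b n := measureReal_nonneg

lemma offp_le (h : Model μ X κ f C K b) (n : ℕ) : offp μ X f b n ≤ 1 := by
  have := h.ellSys.prob n
  exact measureReal_le_one

/-- A function that is one at the mode is close to one in `L¹`. -/
lemma integral_norm_sub_one_le (h : Model μ X κ f C K b) {n : ℕ} {φ : E → ℂ} {a : ℝ}
    (h1 : ∀ x, f n x = b n → φ x = 1) (ha : ∀ x, ‖φ x - 1‖ ≤ a) :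
    ∫ x, ‖φ x - 1‖ ∂(marg μ X n) ≤ a * offp μ X f b n := by
  have := h.ellSys.prob n
  have hs := h.measurableSet_ne n
  have e : ∫ x, {x | f n x ≠ b n}.indicator (fun _ => a) x ∂(marg μ X n) =
      a * offp μ X f b n := by
    rw [integral_indicator hs, setIntegral_const, smul_eq_mul, mul_comm, offp]
  rw [← e]
  refine integral_mono_of_nonneg (Eventually.of_forall fun _ => norm_nonneg _)
    ((integrable_const a).indicator hs) (Eventually.of_forall fun x => ?_)
  by_cases hx : f n x = b n
  · simp [h1 x hx, hx]
  · simpa [hx] using ha x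

lemma tilt (h : Model μ X κ f C K b) {z : ℂ} (hz : ‖z‖ ≤ del C K) :
    Tilt (marg μ X) (expPot f b z) (4 * K * ‖z‖) (offp μ X f b) where
  bm := h.expPot_BM z
  sup_le := h.norm_expPot_sub_one_le hz
  l1_le n := h.integral_norm_sub_one_le (fun x hx => by simp [expPot, hx])
    (h.norm_expPot_sub_one_le hz n)
  p_le := h.offp_le

lemma measurable_Tsum (h : Model μ X κ f C K b) (n m : ℕ) : Measurable (Tsum X f b n m) :=
  Finset.measurable_fun_sum _ fun i _ =>
    (measurable_of_countable (fun k : ℤ => (k : ℝ))).comp ((h.measurable_sub i).comp (h.measX i))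

lemma abs_Tsum_le (h : Model μ X κ f C K b) (n m : ℕ) (ω : Ω) :
    |Tsum X f b n m ω| ≤ (m - n : ℕ) * (2 * K) := by
  refine (Finset.abs_sum_le_sum_abs _ _).trans ?_
  refine (Finset.sum_le_sum fun i _ => h.abs_sub_le i _).trans ?_
  simp

lemma prod_expPot (z : ℂ) (n m : ℕ) (ω : Ω) :
    ∏ i ∈ Ioc n m, expPot f b z i (X i ω) = Complex.exp (z * Tsum X f b n m ω) := by
  rw [Tsum, Complex.ofReal_sum, Finset.mul_sum, Complex.exp_sum]
  exact Finset.prod_congr rfl fun i _ => by simp [expPot]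

lemma lam_eq (h : Model μ X κ f C K b) (z : ℂ) (j n : ℕ) :
    lam (marg μ X) κ (expPot f b z) j n = ∫ ω, Complex.exp (z * Tsum X f b n (n + j) ω) ∂μ := by
  rw [lam, ← h.chain.integral_prod_Ioc (h.expPot_BM z) n j]
  simp_rw [prod_expPot]

lemma differentiable_lam (h : Model μ X κ f C K b) (j n : ℕ) :
    Differentiable ℂ fun z => lam (marg μ X) κ (expPot f b z) j n := by
  have := h.prob
  intro z
  have := hasDerivAt_expInt (μ := μ) (G := fun _ => 1) (b := 1) measurable_const (by simp)
    (h.measurable_Tsum n (n + j)) (h.abs_Tsum_le n (n + j)) z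
  simp only [one_mul] at this
  simp_rw [h.lam_eq]
  exact this.differentiableAt

lemma alpha_sq_le (h : Model μ X κ f C K b) {z : ℂ} (hz : ‖z‖ ≤ del C K) :
    4 * K * ‖z‖ * (200 * C ^ 2) ≤ 1 := by
  have h1 := h.del_mul
  have h2 := h.one_lt
  have h3 := h.K_pos
  have : 4 * K * ‖z‖ * (200 * C ^ 2) ≤ 4 * K * del C K * (400 * C ^ 2) := by
    have := h.del_pos
    gcongr
    norm_num
  linarith

lemma alpha_le (h : Model μ X κ f C K b) {z : ℂ} (hz : ‖z‖ ≤ del C K) :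
    4 * K * ‖z‖ * (8 * C) ≤ 1 := by
  have h1 := h.alpha_sq_le hz
  have h2 := h.one_lt
  have h3 : 0 ≤ 4 * K * ‖z‖ := by positivity
  nlinarith [mul_le_mul_of_nonneg_left (show 8 * C ≤ 200 * C ^ 2 by nlinarith) h3]

lemma lam_ne_zero (h : Model μ X κ f C K b) {z : ℂ} (hz : ‖z‖ ≤ del C K) (j n : ℕ) :
    lam (marg μ X) κ (expPot f b z) j n ≠ 0 := by
  exact (back_close (h.tilt hz) h.ellSys (h.alpha_le hz) j n).1

lemma exists_log_lam (h : Model μ X κ f C K b) (j : ℕ) : ∀ n, ∃ g : ℂ → ℂ,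
    DifferentiableOn ℂ g (Metric.ball 0 (del C K)) ∧ g 0 = 0 ∧
    ∀ z ∈ Metric.ball (0 : ℂ) (del C K),
      Complex.exp (g z) = lam (marg μ X) κ (expPot f b z) j n ∧
      ‖g z‖ ≤ ∑ i ∈ Ioc n (n + j), offp μ X f b i := by
  have := h.ellSys.prob
  induction j with
  | zero =>
    refine fun n => ⟨fun _ => 0, differentiableOn_const 0, rfl, fun z hz => ?_⟩
    simp [lam, back_zero]
  | succ j ih =>
    intro n
    obtain ⟨g, gd, g0, hg⟩ := ih (n + 1)
    have hρ : ∀ z ∈ Metric.ball (0 : ℂ) (del C K),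
        ‖lam (marg μ X) κ (expPot f b z) (j + 1) n / lam (marg μ X) κ (expPot f b z) j (n + 1) - 1‖
          ≤ 1 / 2 * offp μ X f b (n + 1) := by
      intro z hz
      have hz' : ‖z‖ ≤ del C K := (mem_ball_zero_iff.1 hz).le
      have hne := h.lam_ne_zero hz' j (n + 1)
      have a1 := h.alpha_le hz'
      have h1 := norm_lam_succ_sub (h.tilt hz') h.ellSys (by linarith)
        (back_close (h.tilt hz') h.ellSys a1 j (n + 1)).2
      rw [div_sub_one hne, norm_div, div_le_iff₀ (norm_pos_iff.2 hne)]
      refine h1.trans (mul_le_mul_of_nonneg_right ?_ (norm_nonneg _))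
      refine mul_le_mul_of_nonneg_right ?_ (offp_nonneg _)
      have h3 := h.K_pos
      have : 4 * K * ‖z‖ ≤ 4 * K * del C K := by gcongr
      linarith [h.four_mul_del_le]
    set ρ : ℂ → ℂ := fun z => lam (marg μ X) κ (expPot f b z) (j + 1) n /
      lam (marg μ X) κ (expPot f b z) j (n + 1) with hρd
    have hρ' : ∀ z ∈ Metric.ball (0 : ℂ) (del C K), ‖ρ z - 1‖ ≤ 1 / 2 := fun z hz =>
      (hρ z hz).trans (by linarith [h.offp_le (n + 1)])
    have hsl : ∀ z ∈ Metric.ball (0 : ℂ) (del C K), ρ z ∈ Complex.slitPlane := fun z hz => by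
      have := Complex.mem_slitPlane_of_norm_lt_one (z := ρ z - 1) (by linarith [hρ' z hz])
      simpa using this
    refine ⟨fun z => g z + Complex.log (ρ z), ?_, ?_, fun z hz => ?_⟩
    · refine gd.add (DifferentiableOn.clog (fun z hz => ?_) hsl)
      exact ((h.differentiable_lam (j + 1) n z).div (h.differentiable_lam j (n + 1) z)
        (h.lam_ne_zero (mem_ball_zero_iff.1 hz).le j (n + 1))).differentiableWithinAt
    · have : ρ 0 = 1 := by
        have := h.prob
        simp [hρd, h.lam_eq]
      simp [g0, this]
    · obtain ⟨h1, h2⟩ := hg z hz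
      have hz' : ‖z‖ ≤ del C K := (mem_ball_zero_iff.1 hz).le
      have hne := h.lam_ne_zero hz' j (n + 1)
      constructor
      · rw [Complex.exp_add, h1, Complex.exp_log (Complex.slitPlane_ne_zero (hsl z hz)), hρd]
        exact mul_div_cancel₀ _ hne
      · have h3 := Complex.norm_log_one_add_half_le_self (hρ' z hz)
        rw [add_sub_cancel] at h3
        have h4 := hρ z hz
        have h5 : ∑ i ∈ Ioc n (n + (j + 1)), offp μ X f b i = offp μ X f b (n + 1) +
            ∑ i ∈ Ioc (n + 1) (n + 1 + j), offp μ X f b i := by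
          rw [← Finset.sum_Ioc_consecutive _ (Nat.le_succ n) (by omega : n + 1 ≤ n + (j + 1))]
          congr 1
          · simp
          · congr 2; omega
        rw [h5]
        have h6 : ‖ρ z - 1‖ ≤ 1 / 2 * offp μ X f b (n + 1) := h4
        have := offp_nonneg (μ := μ) (X := X) (f := f) (b := b) (n + 1)
        linarith [norm_add_le (g z) (Complex.log (ρ z))]

end Model

end

section

variable {μ : Measure Ω} {X : ℕ → Ω → E} {κ : ℕ → Kernel E E} {f : ℕ → E → ℤ} {C : ℝ} {K : ℕ}
  {b : ℕ → ℤ}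

lemma log_derivs {g L L' : ℂ → ℂ} {L'' : ℂ} {R : ℝ} (hR : 0 < R)
    (hg : DifferentiableOn ℂ g (Metric.ball 0 R)) (g0 : g 0 = 0)
    (he : ∀ z ∈ Metric.ball (0 : ℂ) R, Complex.exp (g z) = L z)
    (hL : ∀ z, HasDerivAt L (L' z) z) (hL' : HasDerivAt L' L'' 0) :
    deriv g 0 = L' 0 ∧ deriv (deriv g) 0 = L'' - L' 0 ^ 2 := by
  have h1 : ∀ z ∈ Metric.ball (0 : ℂ) R, deriv g z * L z = L' z := by
    intro z hz
    have hgz := (hg.differentiableAt (Metric.isOpen_ball.mem_nhds hz)).hasDerivAt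
    have h2 : HasDerivAt L (Complex.exp (g z) * deriv g z) z := by
      refine hgz.cexp.congr_of_eventuallyEq ?_
      filter_upwards [Metric.isOpen_ball.mem_nhds hz] with w hw
      exact (he w hw).symm
    rw [← (hL z).unique h2 |>.symm, ← he z hz, mul_comm]
  have h0 := Metric.mem_ball_self (x := (0 : ℂ)) hR
  have L0 : L 0 = 1 := by rw [← he 0 h0, g0, Complex.exp_zero]
  have e1 : deriv g 0 = L' 0 := by rw [← h1 0 h0, L0, mul_one]
  refine ⟨e1, ?_⟩
  have hg' : HasDerivAt (deriv g) (deriv (deriv g) 0) 0 :=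
    ((hg.deriv Metric.isOpen_ball).differentiableAt
      (Metric.isOpen_ball.mem_nhds h0)).hasDerivAt
  have h3 : HasDerivAt L' (deriv (deriv g) 0 * L 0 + deriv g 0 * L' 0) 0 := by
    refine (hg'.mul (hL 0)).congr_of_eventuallyEq ?_
    filter_upwards [Metric.isOpen_ball.mem_nhds h0] with w hw
    exact (h1 w hw).symm
  rw [hL'.unique h3, L0, e1]
  ring

namespace Model

lemma offP_nonneg (N : ℕ) : 0 ≤ offP μ X f b N := Finset.sum_nonneg fun _ _ => offp_nonneg _

lemma S_eq (h : Model μ X κ f C K b) (N : ℕ) (ω : Ω) :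
    (S X f N ω : ℝ) = Tsum X f b 0 N ω + ∑ i ∈ Ioc 0 N, (b i : ℝ) := by
  rw [S, Tsum, ← Finset.sum_add_distrib]
  push_cast
  exact Finset.sum_congr rfl fun i _ => by ring

lemma VN_eq (h : Model μ X κ f C K b) (N : ℕ) :
    VN μ X f N = ∫ ω, Tsum X f b 0 N ω ^ 2 ∂μ - (∫ ω, Tsum X f b 0 N ω ∂μ) ^ 2 := by
  have := h.prob
  have hm : MemLp (Tsum X f b 0 N) 2 μ :=
    MemLp.of_bound (h.measurable_Tsum 0 N).aestronglyMeasurable _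
      (Eventually.of_forall fun ω => by simpa only [Real.norm_eq_abs] using h.abs_Tsum_le 0 N ω)
  rw [VN]
  simp_rw [h.S_eq]
  rw [variance_add_const hm.aestronglyMeasurable, variance_eq_sub hm]
  rfl

/-- Quadratic approximation of the logarithm of the moment generating function. -/
lemma exists_quadratic (h : Model μ X κ f C K b) : ∃ A : ℝ, 0 < A ∧ ∀ N,
    VN μ X f N ≤ A * offP μ X f b N ∧ ∀ z : ℂ, ‖z‖ ≤ del C K / 4 → ∃ w : ℂ,
      ‖w‖ ≤ A * offP μ X f b N * ‖z‖ ^ 3 ∧ ∫ ω, Complex.exp (z * Tsum X f b 0 N ω) ∂μ =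
        Complex.exp (z * (∫ ω, Tsum X f b 0 N ω ∂μ : ℝ) + VN μ X f N * z ^ 2 / 2 + w) := by
  have := h.prob
  have hd := h.del_pos
  set R := del C K / 2 with hR
  have R0 : 0 < R := by positivity
  refine ⟨2 / R ^ 2 + 2 / R ^ 3, by positivity, fun N => ?_⟩
  set P := offP μ X f b N with hP
  have P0 : 0 ≤ P := offP_nonneg N
  obtain ⟨g, gd, g0, hg⟩ := h.exists_log_lam N 0
  have e2 : (2 : ℝ) * R = del C K := by rw [hR]; ring
  have hTm := h.measurable_Tsum 0 N
  have hTb := h.abs_Tsum_le 0 N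
  have hTc : Measurable fun ω => (Tsum X f b 0 N ω : ℂ) := Complex.measurable_ofReal.comp hTm
  set T := Tsum X f b 0 N with hT
  have hL : ∀ z : ℂ, HasDerivAt (fun z => ∫ ω, Complex.exp (z * T ω) ∂μ)
      (∫ ω, T ω * Complex.exp (z * T ω) ∂μ) z := fun z => by
    have := hasDerivAt_expInt (μ := μ) (G := fun _ => 1) (b := 1) measurable_const (by simp) hTm
      hTb z
    simpa only [one_mul] using this
  have hL' : HasDerivAt (fun z : ℂ => ∫ ω, T ω * Complex.exp (z * T ω) ∂μ)
      (∫ ω, (T ω : ℂ) ^ 2 ∂μ) 0 := by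
    have := hasDerivAt_expInt (μ := μ) hTc (fun ω => by
      rw [Complex.norm_real, Real.norm_eq_abs]; exact hTb ω) hTm hTb 0
    simpa only [zero_mul, Complex.exp_zero, mul_one, sq] using this
  have hgl : ∀ z ∈ Metric.ball (0 : ℂ) (del C K), Complex.exp (g z) =
      ∫ ω, Complex.exp (z * T ω) ∂μ := fun z hz => by
    rw [(hg z hz).1, h.lam_eq, zero_add]
  obtain ⟨d1, d2⟩ := log_derivs hd gd g0 hgl hL hL'
  have t1 : tay g 1 = (∫ ω, T ω ∂μ : ℝ) := by
    rw [tay, iteratedDeriv_one, d1]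
    simp [integral_complex_ofReal]
  have t2 : tay g 2 = VN μ X f N / 2 := by
    rw [tay, iteratedDeriv_succ, iteratedDeriv_one, d2, h.VN_eq]
    push_cast
    simp only [← integral_complex_ofReal]
    simp [← hT]
    ring
  have t0 : tay g 0 = 0 := by simp [tay, g0]
  rw [← e2] at gd hg hgl
  have gb : ∀ z ∈ Metric.ball (0 : ℂ) (2 * R), ‖g z‖ ≤ P := fun z hz => by
    have := (hg z hz).2
    rwa [zero_add] at this
  constructor
  · have := norm_tay_le R0 gd gb 2
    rw [t2] at this
    have h3 : VN μ X f N / 2 ≤ P / R ^ 2 := by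
      refine le_trans (le_abs_self _) ?_
      rw [← Real.norm_eq_abs, ← Complex.norm_real]
      push_cast
      exact this
    have h4 : 0 ≤ 2 / R ^ 3 * P := by positivity
    have h5 : 2 / R ^ 2 * P = 2 * (P / R ^ 2) := by ring
    rw [add_mul]
    linarith
  · intro z hz
    have hz2 : ‖z‖ ≤ R / 2 := by rw [hR]; linarith
    have h3 := norm_sub_taylor_le R0 gd gb 3 hz2
    simp only [Finset.sum_range_succ, Finset.sum_range_zero, t0, t1, t2] at h3
    refine ⟨g z - (z * (∫ ω, T ω ∂μ : ℝ) + VN μ X f N * z ^ 2 / 2), ?_, ?_⟩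
    · have e3 : g z - (z * (∫ ω, T ω ∂μ : ℝ) + VN μ X f N * z ^ 2 / 2) =
        g z - (0 + 0 * z ^ 0 + (∫ ω, T ω ∂μ : ℝ) * z ^ 1 + VN μ X f N / 2 * z ^ 2) := by ring
      rw [e3]
      refine h3.trans ?_
      have h4 : 0 ≤ 2 / R ^ 2 * P * ‖z‖ ^ 3 := by positivity
      have h5 : 2 * P * (‖z‖ / R) ^ 3 = 2 / R ^ 3 * P * ‖z‖ ^ 3 := by field_simp
      rw [h5, add_mul, add_mul]
      linarith
    · rw [add_sub_cancel, hgl z (by rw [mem_ball_zero_iff]; linarith)]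

end Model

end

/-- The indicator weights of a rectangle over the index set `J`. -/
def rectW (J : Finset ℕ) (A : ℕ → Set E) (i : ℕ) (x : E) : ℂ :=
  open Classical in if i ∈ J then (A i).indicator 1 x else 1

/-- A rectangle over the index set `J`. -/
def rect (X : ℕ → Ω → E) (J : Finset ℕ) (A : ℕ → Set E) : Set Ω := {ω | ∀ i ∈ J, X i ω ∈ A i}

section

variable {μ : Measure Ω} {X : ℕ → Ω → E} {κ : ℕ → Kernel E E} {f : ℕ → E → ℤ} {C : ℝ} {K : ℕ}
  {b : ℕ → ℤ} {J : Finset ℕ} {A : ℕ → Set E}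

lemma measurableSet_rect (hX : ∀ n, Measurable (X n)) (hA : ∀ i, MeasurableSet (A i)) :
    MeasurableSet (rect X J A) := by
  have : rect X J A = ⋂ i ∈ J, X i ⁻¹' A i := by ext; simp [rect]
  rw [this]
  exact Finset.measurableSet_biInter _ fun i _ => hX i (hA i)

lemma rectW_of_notMem {i : ℕ} (hi : i ∉ J) (x : E) : rectW J A i x = 1 := by simp [rectW, hi]

lemma rectW_of_mem {i : ℕ} (hi : i ∈ J) (x : E) : rectW J A i x = (A i).indicator 1 x := by
  simp [rectW, hi]

lemma norm_rectW_le (i : ℕ) (x : E) : ‖rectW J A i x‖ ≤ 1 := by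
  classical
  unfold rectW
  split_ifs with h
  · by_cases hx : x ∈ A i <;> simp [hx]
  · simp

lemma rectW_BM (hA : ∀ i, MeasurableSet (A i)) (i : ℕ) : BM (rectW J A i) := by
  refine ⟨?_, 1, norm_rectW_le i⟩
  by_cases hi : i ∈ J
  · have : rectW J A i = (A i).indicator 1 := funext fun x => rectW_of_mem hi x
    rw [this]
    exact measurable_one.indicator (hA i)
  · have : rectW J A i = fun _ => 1 := funext fun x => rectW_of_notMem hi x
    rw [this]
    exact measurable_const

lemma prod_rectW {N : ℕ} (hJ : J ⊆ Ioc 0 N) (ω : Ω) :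
    ∏ i ∈ Ioc 0 N, rectW J A i (X i ω) = (rect X J A).indicator 1 ω := by
  classical
  rw [← Finset.prod_subset hJ fun i _ hi => rectW_of_notMem hi _]
  by_cases h : ω ∈ rect X J A
  · rw [Set.indicator_of_mem h]
    refine Finset.prod_eq_one fun i hi => ?_
    rw [rectW_of_mem hi, Set.indicator_of_mem (h i hi)]
    rfl
  · rw [Set.indicator_of_notMem h]
    simp only [rect, Set.mem_ofPred_eq, not_forall] at h
    obtain ⟨i, hi, hx⟩ := h
    refine Finset.prod_eq_zero hi ?_
    rw [rectW_of_mem hi, Set.indicator_of_notMem hx]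

lemma integral_norm_rectW_mul_le {m : Measure E} [IsProbabilityMeasure m]
    (hA : ∀ i, MeasurableSet (A i)) {i : ℕ} (hi : i ∈ J) {φ : E → ℂ} (hφ : ∀ x, ‖φ x‖ ≤ 1) :
    ∫ x, ‖rectW J A i x * φ x‖ ∂m ≤ m.real (A i) := by
  have e : ∫ x, (A i).indicator (fun _ => (1 : ℝ)) x ∂m = m.real (A i) := by
    rw [integral_indicator (hA i), setIntegral_const, smul_eq_mul, mul_one]
  rw [← e]
  refine integral_mono_of_nonneg (Eventually.of_forall fun _ => norm_nonneg _)
    ((integrable_const 1).indicator (hA i)) (Eventually.of_forall fun x => ?_)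
  simp only [rectW_of_mem hi]
  by_cases hx : x ∈ A i
  · simpa [hx] using hφ x
  · simp [hx]

namespace Model

/-- Lower bound for the probability of a rectangle. -/
lemma le_re_back_rectW (h : Model μ X κ f C K b) (hA : ∀ i, MeasurableSet (A i)) (j : ℕ) : ∀ n,
    ∀ᵐ x ∂(marg μ X n),
      ∏ i ∈ Ioc n (n + j), (open Classical in if i ∈ J then C⁻¹ * (marg μ X i).real (A i) else 1) ≤
        (back κ (rectW J A) j n x).re := by
  classical
  have hE := h.ellSys
  have := hE.prob
  have := hE.markov
  have hC := h.one_lt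
  have hpos : ∀ i, 0 ≤ (if i ∈ J then C⁻¹ * (marg μ X i).real (A i) else (1 : ℝ)) := by
    intro i
    split_ifs
    · positivity
    · norm_num
  induction j with
  | zero => intro n; simp [back_zero]
  | succ j ih =>
    intro n
    rw [prod_Ioc_succ_left]
    set c := ∏ i ∈ Ioc (n + 1) (n + 1 + j),
      (if i ∈ J then C⁻¹ * (marg μ X i).real (A i) else (1 : ℝ)) with hc
    have c0 : 0 ≤ c := Finset.prod_nonneg fun i _ => hpos i
    have bW := rectW_BM (J := J) hA (n + 1)
    have bB := back_BM hE.markov (rectW_BM (J := J) hA) j (n + 1)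
    have key : ∀ᵐ x ∂(marg μ X n), (∫ y, (rectW J A (n + 1) y).re * c ∂(κ n x)) ≤
        (back κ (rectW J A) (j + 1) n x).re := by
      filter_upwards [hE.ae_kernel (ih (n + 1))] with x hx
      have i1 := (bW.mul bB).integrable (κ n x)
      rw [back_succ]
      have e : (∫ y, rectW J A (n + 1) y * back κ (rectW J A) j (n + 1) y ∂(κ n x)).re =
          ∫ y, (rectW J A (n + 1) y * back κ (rectW J A) j (n + 1) y).re ∂(κ n x) :=
        (integral_re i1).symm
      rw [e]
      refine integral_mono_ae (((bW.integrable _).re).mul_const c) i1.re ?_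
      filter_upwards [hx] with y hy
      have hy2 : rectW J A (n + 1) y = 0 ∨ rectW J A (n + 1) y = 1 := by
        unfold rectW
        split_ifs
        · by_cases h' : y ∈ A (n + 1) <;> simp [h']
        · simp
      rcases hy2 with h0 | h0 <;> simp [h0]
      exact hy
    by_cases hi : n + 1 ∈ J
    · have hr : ∀ y, (rectW J A (n + 1) y).re = (A (n + 1)).indicator (fun _ => (1 : ℝ)) y := by
        intro y
        rw [rectW_of_mem hi]
        by_cases h' : y ∈ A (n + 1) <;> simp [h']
      filter_upwards [key, hE.integral_ell n (φ := (A (n + 1)).indicator fun _ => (1 : ℝ)) (b := 1)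
        (measurable_const.indicator (hA _)) (fun y => Set.indicator_nonneg (by simp) y)
        (fun y => Set.indicator_le_self' (by simp) y)] with x h1 h2
      refine le_trans ?_ h1
      simp_rw [hr]
      rw [integral_mul_const, if_pos hi]
      refine mul_le_mul_of_nonneg_right ?_ c0
      refine le_trans (le_of_eq ?_) h2.2
      rw [integral_indicator (hA _), setIntegral_const, smul_eq_mul, mul_one]
    · filter_upwards [key] with x h1
      refine le_trans (le_of_eq ?_) h1
      simp [rectW_of_notMem hi, hi]

lemma integral_rect (h : Model μ X κ f C K b) (hA : ∀ i, MeasurableSet (A i)) {N : ℕ}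
    (hJ : J ⊆ Ioc 0 N) :
    ∫ x, back κ (rectW J A) N 0 x ∂(marg μ X 0) = ((μ.real (rect X J A) : ℝ) : ℂ) := by
  have := h.prob
  have := h.chain.integral_prod_Ioc (rectW_BM (J := J) hA) 0 N
  rw [zero_add] at this
  rw [← this]
  simp_rw [prod_rectW hJ]
  rw [integral_indicator (measurableSet_rect h.measX hA)]
  simp

lemma prod_le_rect (h : Model μ X κ f C K b) (hA : ∀ i, MeasurableSet (A i)) {N : ℕ}
    (hJ : J ⊆ Ioc 0 N) :
    ∏ i ∈ J, (marg μ X i).real (A i) ≤ C ^ J.card * μ.real (rect X J A) := by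
  classical
  have hE := h.ellSys
  have := hE.prob
  have hC := h.one_lt
  have h1 := h.le_re_back_rectW (J := J) hA N 0
  have h2 := integral_mono_ae (integrable_const _)
    ((back_BM hE.markov (rectW_BM (J := J) hA) N 0).integrable (marg μ X 0)).re h1
  have h3 := integral_re ((back_BM hE.markov (rectW_BM (J := J) hA) N 0).integrable (marg μ X 0))
  rw [h.integral_rect hA hJ] at h3
  rw [h3] at h2
  simp only [integral_const, probReal_univ, one_smul, zero_add, RCLike.re_to_complex,
    Complex.ofReal_re] at h2
  rw [← Finset.prod_subset hJ fun i _ hi => if_neg hi,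
    Finset.prod_congr rfl fun i hi => if_pos hi, Finset.prod_mul_distrib, Finset.prod_const] at h2
  have : (C⁻¹) ^ J.card * C ^ J.card = 1 := by
    rw [← mul_pow, inv_mul_cancel₀ (by positivity), one_pow]
  calc ∏ i ∈ J, (marg μ X i).real (A i)
      = C ^ J.card * (C⁻¹ ^ J.card * ∏ i ∈ J, (marg μ X i).real (A i)) := by
        rw [← mul_assoc, mul_comm (C ^ J.card), this, one_mul]
    _ ≤ _ := mul_le_mul_of_nonneg_left h2 (by positivity)

/-- Modulated exponential moments over rectangles are controlled by the unmodulated ones. -/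
lemma modulated_le (h : Model μ X κ f C K b) {z : ℂ} (hz : ‖z‖ ≤ del C K)
    (hA : ∀ i, MeasurableSet (A i)) {N : ℕ} (hJ : J ⊆ Ioc 0 N) {χ : ℕ → E → ℂ}
    (hχ : ∀ i, BM (χ i)) (hχ1 : ∀ i x, ‖χ i x‖ ≤ 1) :
    ‖∫ ω, ∏ i ∈ Ioc 0 N, (rectW J A i (X i ω) * χ i (X i ω) * expPot f b z i (X i ω)) ∂μ‖ ≤
      2 * (4 * C ^ 2) ^ J.card * Real.exp (1600 * C ^ 3 * K * ‖z‖ *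
        ∑ i ∈ Ioc 0 N, ∫ x, ‖χ i x - 1‖ ∂(marg μ X i)) * μ.real (rect X J A) *
        ‖∫ ω, Complex.exp (z * Tsum X f b 0 N ω) ∂μ‖ := by
  classical
  have hE := h.ellSys
  have := hE.prob
  have := h.prob
  have hC := h.one_lt
  have hKp := h.K_pos
  set q : ℕ → ℝ := fun i => ∫ x, ‖χ i x - 1‖ ∂(marg μ X i) with hq
  have q0 : ∀ i, 0 ≤ q i := fun i => integral_nonneg fun _ => norm_nonneg _
  set c := 1600 * C ^ 3 * K * ‖z‖ with hc
  have c0 : 0 ≤ c := by positivity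
  set m : ℕ → ℝ := fun i => if i ∈ J then 4 * C * (marg μ X i).real (A i) else 1 + c * q i with hm
  have hb' : ∀ i, BM (fun x => rectW J A i x * χ i x) := fun i => (rectW_BM hA i).mul (hχ i)
  obtain ⟨s, o, c', s0, o0, hso, hs, -⟩ := back_modulated (h.tilt hz) hE (h.alpha_sq_le hz)
    (χ := fun i x => rectW J A i x * χ i x) hb' (fun i x => by
      rw [norm_mul]; exact mul_le_one₀ (norm_rectW_le i x) (norm_nonneg _) (hχ1 i x))
    (m := m) (fun i => by
      by_cases hi : i ∈ J
      · right
        simp only [hm, if_pos hi]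
        exact mul_le_mul_of_nonneg_left (integral_norm_rectW_mul_le hA hi (hχ1 i)) (by positivity)
      · left
        simp only [hm, if_neg hi, rectW_of_notMem hi, one_mul, hq, hc]
        apply le_of_eq
        ring) N 0
  have hst : s ≤ (4 * C ^ 2) ^ J.card * Real.exp (c * ∑ i ∈ Ioc 0 N, q i) * μ.real (rect X J A) := by
    have h1 : s ≤ ∏ i ∈ Ioc 0 N, m i := by
      rw [zero_add] at hso
      have : 0 ≤ 168 * C ^ 2 * (4 * K * ‖z‖) * o := by positivity
      linarith
    have h2 : ∏ i ∈ Ioc 0 N, m i ≤ ∏ i ∈ Ioc 0 N,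
        ((if i ∈ J then 4 * C * (marg μ X i).real (A i) else 1) * Real.exp (c * q i)) := by
      refine Finset.prod_le_prod (fun i _ => ?_) fun i _ => ?_
      · simp only [hm]
        split_ifs
        · positivity
        · have := q0 i
          positivity
      · simp only [hm]
        have h3 := mul_nonneg c0 (q0 i)
        split_ifs
        · exact le_mul_of_one_le_right (by positivity) (Real.one_le_exp h3)
        · rw [one_mul]
          linarith [Real.add_one_le_exp (c * q i)]
    have h3 : ∏ i ∈ Ioc 0 N, (if i ∈ J then 4 * C * (marg μ X i).real (A i) else (1 : ℝ)) =
        (4 * C) ^ J.card * ∏ i ∈ J, (marg μ X i).real (A i) := by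
      rw [← Finset.prod_subset hJ fun i _ hi => if_neg hi,
        Finset.prod_congr rfl fun i hi => if_pos hi, Finset.prod_mul_distrib, Finset.prod_const]
    rw [Finset.prod_mul_distrib, h3, ← Real.exp_sum, ← Finset.mul_sum] at h2
    refine h1.trans (h2.trans ?_)
    have h4 := h.prod_le_rect hA hJ
    calc (4 * C) ^ J.card * (∏ i ∈ J, (marg μ X i).real (A i)) * Real.exp (c * ∑ i ∈ Ioc 0 N, q i)
        ≤ (4 * C) ^ J.card * (C ^ J.card * μ.real (rect X J A)) *
          Real.exp (c * ∑ i ∈ Ioc 0 N, q i) := by gcongr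
      _ = _ := by
        rw [show 4 * C ^ 2 = 4 * C * C by ring, mul_pow (4 * C)]
        ring
  obtain ⟨l0, hcl⟩ := back_close (h.tilt hz) hE (h.alpha_le hz) N 0
  have e1 : ∫ ω, ∏ i ∈ Ioc 0 N, (rectW J A i (X i ω) * χ i (X i ω) * expPot f b z i (X i ω)) ∂μ =
      ∫ x, back κ (fun i x => rectW J A i x * χ i x * expPot f b z i x) N 0 x ∂(marg μ X 0) := by
    rw [← h.chain.integral_prod_Ioc (fun i => (hb' i).mul (h.expPot_BM z i)), zero_add]
  have e2 := h.lam_eq z N 0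
  rw [zero_add] at e2
  rw [e1, ← e2]
  set lm := lam (marg μ X) κ (expPot f b z) N 0 with hlm
  have h5 : ∀ᵐ x ∂(marg μ X 0),
      ‖back κ (fun i x => rectW J A i x * χ i x * expPot f b z i x) N 0 x‖ ≤ s * (2 * ‖lm‖) := by
    filter_upwards [hs, hcl] with x h1 h2
    have h3 : ‖back κ (expPot f b z) N 0 x - lm‖ ≤ 1 / 2 * ‖lm‖ := by
      refine h2.trans (mul_le_mul_of_nonneg_right ?_ (norm_nonneg _))
      have := h.alpha_sq_le hz
      have h9 : 8 * C * (4 * K * ‖z‖) ≤ 8 * C ^ 2 * (4 * K * ‖z‖) := by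
        gcongr; nlinarith
      linarith
    have h4 : ‖back κ (expPot f b z) N 0 x‖ ≤ 2 * ‖lm‖ := by
      have := norm_sub_norm_le (back κ (expPot f b z) N 0 x) lm
      linarith [norm_nonneg lm]
    have h6 : back κ (expPot f b z) N 0 x ≠ 0 := by
      intro h0
      rw [h0, zero_sub, norm_neg] at h3
      have : 0 < ‖lm‖ := norm_pos_iff.2 l0
      linarith
    rw [norm_div, div_le_iff₀ (norm_pos_iff.2 h6)] at h1
    exact h1.trans (mul_le_mul_of_nonneg_left h4 s0)
  refine (norm_integral_le_of_norm_le_const h5).trans ?_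
  rw [probReal_univ, mul_one]
  calc s * (2 * ‖lm‖) ≤ ((4 * C ^ 2) ^ J.card * Real.exp (c * ∑ i ∈ Ioc 0 N, q i) *
        μ.real (rect X J A)) * (2 * ‖lm‖) := by gcongr
    _ = _ := by ring

end Model

end

section

variable {μ : Measure Ω} {X : ℕ → Ω → E} {κ : ℕ → Kernel E E} {f : ℕ → E → ℤ} {C : ℝ} {K : ℕ}
  {b : ℕ → ℤ} {J : Finset ℕ} {A : ℕ → Set E} {ν : ℕ → Measure E}

lemma EllSys.norm_kernel_le_mean (hE : EllSys ν κ C) (n : ℕ) {φ : E → ℂ} (hφ : Measurable φ) {o : ℝ}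
    (ho : ∀ᵐ y ∂(ν (n + 1)), ‖φ y‖ ≤ o) :
    ∀ᵐ x ∂(ν n), ‖∫ y, φ y ∂(κ n x) - ((C⁻¹ : ℝ) : ℂ) * ∫ y, φ y ∂(ν (n + 1))‖ ≤
      (1 - C⁻¹) * o := by
  have := hE.contract n hφ (c := 0) (o := o) (by simpa using ho)
  simpa using this

/-- Two consecutive steps contract by an amount governed by the mean of the potential. -/
lemma EllSys.two_step (hE : EllSys ν κ C) (n : ℕ) {ψ φ : E → ℂ} (hψ : BM ψ) (hψ1 : ∀ x, ‖ψ x‖ ≤ 1)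
    (hφ : BM φ) {o : ℝ} (ho : ∀ᵐ y ∂(ν (n + 2)), ‖φ y‖ ≤ o) :
    ∀ᵐ x ∂(ν n), ‖∫ y, ψ y * (∫ w, φ w ∂(κ (n + 1) y)) ∂(κ n x)‖ ≤
      Real.exp (-((C ^ 2)⁻¹ * (1 - ‖∫ y, ψ y ∂(ν (n + 1))‖))) * o := by
  have := hE.prob
  have := hE.markov
  have hC := hE.one_lt
  have hi0 : 0 < C⁻¹ := by positivity
  have hi1 : C⁻¹ ≤ 1 := inv_le_one_of_one_le₀ hC.le
  have o0 : 0 ≤ o := by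
    obtain ⟨y, hy⟩ := ho.exists
    exact (norm_nonneg _).trans hy
  set c : ℂ := ((C⁻¹ : ℝ) : ℂ) * ∫ y, φ y ∂(ν (n + 2)) with hc
  have hcn : ‖c‖ ≤ C⁻¹ * o := by
    rw [hc, norm_mul, Complex.norm_real, Real.norm_of_nonneg hi0.le]
    refine mul_le_mul_of_nonneg_left ?_ hi0.le
    refine (norm_integral_le_of_norm_le_const ho).trans ?_
    simp
  have h1 := hE.norm_kernel_le_mean (n + 1) hφ.1 ho
  have bU := hφ.kernel (κ (n + 1))
  set U : E → ℂ := fun y => ∫ w, φ w ∂(κ (n + 1) y) with hU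
  have h2 : ∀ᵐ y ∂(ν (n + 1)), ‖ψ y * (U y - c)‖ ≤ (1 - C⁻¹) * o := by
    filter_upwards [h1] with y hy
    rw [norm_mul]
    calc ‖ψ y‖ * ‖U y - c‖ ≤ 1 * ((1 - C⁻¹) * o) :=
          mul_le_mul (hψ1 y) hy (norm_nonneg _) zero_le_one
      _ = _ := one_mul _
  set d := ‖∫ y, ψ y ∂(ν (n + 1))‖ with hd
  have hk := hE.norm_kernel_le_mean n hψ.1 (o := 1) (Eventually.of_forall hψ1)
  filter_upwards [hE.norm_kernel_le n h2, hk] with x hx1 hx2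
  have e : ∫ y, ψ y * U y ∂(κ n x) =
      ∫ y, ψ y * (U y - c) ∂(κ n x) + (∫ y, ψ y ∂(κ n x)) * c := by
    rw [← integral_mul_const, ← integral_add ((hψ.mul (bU.sub (BM.const c))).integrable _)
      ((hψ.integrable _).mul_const c)]
    congr 1; funext y; ring
  have h3 : ‖∫ y, ψ y ∂(κ n x)‖ ≤ C⁻¹ * d + (1 - C⁻¹) := by
    have := norm_sub_norm_le (∫ y, ψ y ∂(κ n x)) (((C⁻¹ : ℝ) : ℂ) * ∫ y, ψ y ∂(ν (n + 1)))
    rw [norm_mul, Complex.norm_real, Real.norm_of_nonneg hi0.le] at this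
    linarith
  rw [e]
  have h4 : ‖∫ y, ψ y * (U y - c) ∂(κ n x) + (∫ y, ψ y ∂(κ n x)) * c‖ ≤
      (1 - C⁻¹) * o + (C⁻¹ * d + (1 - C⁻¹)) * (C⁻¹ * o) := by
    refine (norm_add_le _ _).trans (add_le_add hx1 ?_)
    rw [norm_mul]
    exact mul_le_mul h3 hcn (norm_nonneg _) ((norm_nonneg _).trans h3)
  refine h4.trans ?_
  have h5 := Real.add_one_le_exp (-((C ^ 2)⁻¹ * (1 - d)))
  calc (1 - C⁻¹) * o + (C⁻¹ * d + (1 - C⁻¹)) * (C⁻¹ * o)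
      = (-((C ^ 2)⁻¹ * (1 - d)) + 1) * o := by rw [← inv_pow]; ring
    _ ≤ _ := mul_le_mul_of_nonneg_right h5 o0

/-- Recursively defined bounds for backward iterates, gaining at every other site. -/
def altBound (a ε : ℕ → ℝ) : ℕ → ℕ → ℝ
  | 0, _ => 1
  | 1, n => a (n + 1) * ε (n + 1)
  | j + 2, n => ε (n + 1) * a (n + 1) * a (n + 2) * altBound a ε j (n + 2)

lemma altBound_nonneg {a ε : ℕ → ℝ} (ha : ∀ i, 0 ≤ a i) (hε : ∀ i, 0 ≤ ε i) (j n : ℕ) :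
    0 ≤ altBound a ε j n := by
  induction j, n using altBound.induct with
  | case1 n => exact zero_le_one
  | case2 n => exact mul_nonneg (ha _) (hε _)
  | case3 j n ih =>
    exact mul_nonneg (mul_nonneg (mul_nonneg (hε _) (ha _)) (ha _)) ih

lemma altBound_mul (a ε : ℕ → ℝ) (j : ℕ) : ∀ n,
    altBound a ε (j + 1) n * (a (n + 1) * altBound a ε j (n + 1)) =
      ∏ i ∈ Ioc n (n + (j + 1)), (a i ^ 2 * ε i) := by
  induction j with
  | zero =>
    intro n
    simp [altBound]
    ring
  | succ j ih =>
    intro n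
    rw [prod_Ioc_succ_left, ← ih (n + 1), altBound]
    ring

namespace Model

/-- One factor of the a priori bound over a rectangle. -/
def siteBound (μ : Measure Ω) (X : ℕ → Ω → E) (C : ℝ) (J : Finset ℕ) (A : ℕ → Set E) (i : ℕ) : ℝ :=
  open Classical in if i ∈ J then Real.exp 1 * C * (marg μ X i).real (A i) else 1

lemma siteBound_nonneg (hC : 1 < C) (i : ℕ) : 0 ≤ siteBound μ X C J A i := by
  unfold siteBound
  split_ifs <;> positivity

lemma one_step (h : Model μ X κ f C K b) (hA : ∀ i, MeasurableSet (A i)) {ψ : E → ℂ} (hψ : BM ψ)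
    (hψ1 : ∀ x, ‖ψ x‖ ≤ 1) {u : E → ℂ} (hu : BM u) {o : ℝ} {n : ℕ}
    (ho : ∀ᵐ y ∂(marg μ X (n + 1)), ‖u y‖ ≤ o) :
    ∀ᵐ x ∂(marg μ X n), ‖∫ y, rectW J A (n + 1) y * ψ y * u y ∂(κ n x)‖ ≤
      (open Classical in if n + 1 ∈ J then C * (marg μ X (n + 1)).real (A (n + 1)) else 1) * o := by
  have hE := h.ellSys
  have := hE.prob
  have hC := h.one_lt
  have o0 : 0 ≤ o := by
    obtain ⟨y, hy⟩ := ho.exists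
    exact (norm_nonneg _).trans hy
  have h1 : ∀ᵐ y ∂(marg μ X (n + 1)), ‖rectW J A (n + 1) y * ψ y * u y‖ ≤ o := by
    filter_upwards [ho] with y hy
    rw [norm_mul, norm_mul]
    calc _ ≤ 1 * 1 * o := by
          gcongr
          · exact norm_rectW_le _ _
          · exact hψ1 y
      _ = o := by ring
  by_cases hi : n + 1 ∈ J
  · filter_upwards [hE.norm_kernel_le_integral n
      ((((rectW_BM hA (n + 1)).mul hψ).mul hu).1) h1] with x hx
    refine hx.trans ?_
    rw [if_pos hi, mul_assoc]
    refine mul_le_mul_of_nonneg_left ?_ (by linarith)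
    refine (integral_norm_mul_le ((rectW_BM hA (n + 1)).mul hψ) ho).trans ?_
    exact mul_le_mul_of_nonneg_right (integral_norm_rectW_mul_le hA hi hψ1) o0
  · rw [if_neg hi, one_mul]
    exact hE.norm_kernel_le n h1

lemma norm_back_le_altBound (h : Model μ X κ f C K b) (hA : ∀ i, MeasurableSet (A i))
    {ψ : ℕ → E → ℂ} (hψ : ∀ i, BM (ψ i)) (hψ1 : ∀ i x, ‖ψ i x‖ ≤ 1) {ε : ℕ → ℝ}
    (hε : ∀ i, ε i = Real.exp (-((C ^ 2)⁻¹ * (1 - ‖∫ y, ψ i y ∂(marg μ X i)‖)))) (j n : ℕ) :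
    ∀ᵐ x ∂(marg μ X n), ‖back κ (fun i x => rectW J A i x * ψ i x) j n x‖ ≤
      altBound (siteBound μ X C J A) ε j n := by
  have hE := h.ellSys
  have := hE.prob
  have := hE.markov
  have hC := h.one_lt
  have hψm : ∀ i, ‖∫ y, ψ i y ∂(marg μ X i)‖ ≤ 1 := fun i => by
    refine (norm_integral_le_of_norm_le_const (Eventually.of_forall (hψ1 i))).trans ?_
    simp
  have hCi : (C ^ 2)⁻¹ ≤ 1 := inv_le_one_of_one_le₀ (by nlinarith)
  have hCi0 : 0 < (C ^ 2)⁻¹ := by positivity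
  have hεl : ∀ i, 1 ≤ Real.exp 1 * ε i := fun i => by
    rw [hε, ← Real.exp_add]
    apply Real.one_le_exp
    nlinarith [norm_nonneg (∫ y, ψ i y ∂(marg μ X i)), hψm i]
  have hε0 : ∀ i, 0 ≤ ε i := fun i => by rw [hε]; positivity
  have hεs : ∀ i, ε i ≤ 1 := fun i => by
    rw [hε]
    apply Real.exp_le_one_iff.2
    nlinarith [hψm i]
  have ha0 := siteBound_nonneg (μ := μ) (X := X) (J := J) (A := A) hC
  have hb := fun i => (rectW_BM (J := J) hA i).mul (hψ i)
  -- the gain may be inserted at the cost of the factor `e` on the sites of the rectangle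
  have hins : ∀ i, i ∈ J → C * (marg μ X i).real (A i) ≤ siteBound μ X C J A i * ε i := fun i hi => by
    rw [siteBound, if_pos hi]
    have h0 : 0 ≤ C * (marg μ X i).real (A i) := by positivity
    nlinarith [hεl i]
  have hbase : ∀ i, (open Classical in if i ∈ J then C * (marg μ X i).real (A i) else 1) ≤
      siteBound μ X C J A i := fun i => by
    unfold siteBound
    split_ifs
    · have h0 : 0 ≤ C * (marg μ X i).real (A i) := by positivity
      have := Real.add_one_le_exp 1
      nlinarith
    · exact le_rfl
  induction j, n using altBound.induct with
  | case1 n => simp [back_zero, altBound]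
  | case2 n =>
    by_cases hi : n + 1 ∈ J
    · filter_upwards [h.one_step (J := J) hA (hψ (n + 1)) (hψ1 (n + 1)) (BM.const 1) (o := 1)
        (n := n) (Eventually.of_forall fun _ => by simp)] with x hx
      rw [back_succ, back_zero]
      refine hx.trans ?_
      rw [if_pos hi, mul_one, altBound]
      exact hins _ hi
    · filter_upwards [hE.two_step n (hψ (n + 1)) (hψ1 (n + 1)) (BM.const 1) (o := 1)
        (Eventually.of_forall fun _ => by simp)] with x hx
      rw [back_succ, back_zero, altBound, siteBound, if_neg hi, one_mul, hε]
      simpa [rectW_of_notMem hi] using hx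
  | case3 j n ih =>
    have bu := back_BM hE.markov hb j (n + 2)
    have B0 := altBound_nonneg ha0 hε0 j (n + 2)
    have h1 := h.one_step (J := J) hA (hψ (n + 2)) (hψ1 (n + 2)) bu (n := n + 1) ih
    have bu1 := back_BM hE.markov hb (j + 1) (n + 1)
    by_cases hi : n + 1 ∈ J
    · filter_upwards [h.one_step (J := J) hA (hψ (n + 1)) (hψ1 (n + 1)) bu1 (n := n) h1] with x hx
      rw [back_succ]
      refine hx.trans ?_
      rw [if_pos hi, altBound]
      have h2 := mul_le_mul (hins _ hi) (mul_le_mul_of_nonneg_right (hbase (n + 2)) B0)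
        (mul_nonneg (by split_ifs <;> positivity) B0) (mul_nonneg (ha0 _) (hε0 _))
      refine h2.trans (le_of_eq (by ring))
    · by_cases hi2 : n + 2 ∈ J
      · filter_upwards [h.one_step (J := J) hA (hψ (n + 1)) (hψ1 (n + 1)) bu1 (n := n) h1] with x hx
        rw [back_succ]
        refine hx.trans ?_
        rw [if_neg hi, if_pos hi2, altBound, one_mul]
        have e1 : siteBound μ X C J A (n + 1) = 1 := by rw [siteBound, if_neg hi]
        rw [e1, mul_one]
        refine mul_le_mul_of_nonneg_right ?_ B0
        rw [siteBound, if_pos hi2]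
        have h0 : 0 ≤ C * (marg μ X (n + 2)).real (A (n + 2)) := by positivity
        nlinarith [hεl (n + 1)]
      · have e1 : siteBound μ X C J A (n + 1) = 1 := by rw [siteBound, if_neg hi]
        have e2 : siteBound μ X C J A (n + 2) = 1 := by rw [siteBound, if_neg hi2]
        have ho : ∀ᵐ y ∂(marg μ X (n + 2)), ‖rectW J A (n + 2) y * ψ (n + 2) y *
            back κ (fun i x => rectW J A i x * ψ i x) j (n + 2) y‖ ≤
            altBound (siteBound μ X C J A) ε j (n + 2) := by
          filter_upwards [ih] with y hy
          rw [rectW_of_notMem hi2, one_mul, norm_mul]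
          calc _ ≤ 1 * altBound (siteBound μ X C J A) ε j (n + 2) :=
                mul_le_mul (hψ1 _ _) hy (norm_nonneg _) zero_le_one
            _ = _ := one_mul _
        filter_upwards [hE.two_step n (hψ (n + 1)) (hψ1 (n + 1)) ((hb (n + 2)).mul bu) ho] with x hx
        rw [back_succ, altBound, e1, e2, mul_one, mul_one, hε]
        simp only [rectW_of_notMem hi, one_mul]
        exact hx

/-- Decay of characteristic functions over rectangles. -/
lemma norm_sq_le_decay (h : Model μ X κ f C K b) (hA : ∀ i, MeasurableSet (A i)) {N : ℕ}
    (hJ : J ⊆ Ioc 0 N) {ψ : ℕ → E → ℂ} (hψ : ∀ i, BM (ψ i)) (hψ1 : ∀ i x, ‖ψ i x‖ ≤ 1) :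
    ‖∫ ω, ∏ i ∈ Ioc 0 N, (rectW J A i (X i ω) * ψ i (X i ω)) ∂μ‖ ^ 2 ≤
      ((3 * C ^ 2) ^ J.card * μ.real (rect X J A)) ^ 2 *
        Real.exp (-((C ^ 2)⁻¹ * ∑ i ∈ Ioc 0 N, (1 - ‖∫ y, ψ i y ∂(marg μ X i)‖))) := by
  classical
  have hE := h.ellSys
  have := hE.prob
  have := h.prob
  have hC := h.one_lt
  have hb := fun i => (rectW_BM (J := J) hA i).mul (hψ i)
  rcases N with _ | N
  · have hJ0 : J = ∅ := by simpa using hJ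
    subst hJ0
    simp [rect]
  set ε : ℕ → ℝ := fun i => Real.exp (-((C ^ 2)⁻¹ * (1 - ‖∫ y, ψ i y ∂(marg μ X i)‖))) with hε
  have hε0 : ∀ i, 0 ≤ ε i := fun i => by positivity
  have h1 := h.norm_back_le_altBound (J := J) hA hψ hψ1 (ε := ε) (fun i => rfl) (N + 1) 0
  have h2 := h.norm_back_le_altBound (J := J) hA hψ hψ1 (ε := ε) (fun i => rfl) N 1
  have h3 := h.one_step (J := J) hA (hψ 1) (hψ1 1) (back_BM hE.markov hb N 1) (n := 0) h2
  have ha0 := siteBound_nonneg (μ := μ) (X := X) (J := J) (A := A) hC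
  have B0 := altBound_nonneg ha0 hε0 N 1
  have h3' : ∀ᵐ x ∂(marg μ X 0), ‖back κ (fun i x => rectW J A i x * ψ i x) (N + 1) 0 x‖ ≤
      siteBound μ X C J A 1 * altBound (siteBound μ X C J A) ε N 1 := by
    filter_upwards [h3] with x hx
    refine hx.trans (mul_le_mul_of_nonneg_right ?_ B0)
    unfold siteBound
    split_ifs
    · have h0 : 0 ≤ C * (marg μ X 1).real (A 1) := by positivity
      have := Real.add_one_le_exp 1
      nlinarith
    · exact le_rfl
  have e1 : ∫ ω, ∏ i ∈ Ioc 0 (N + 1), (rectW J A i (X i ω) * ψ i (X i ω)) ∂μ =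
      ∫ x, back κ (fun i x => rectW J A i x * ψ i x) (N + 1) 0 x ∂(marg μ X 0) := by
    rw [← h.chain.integral_prod_Ioc hb, zero_add]
  rw [e1]
  have b1 := norm_integral_le_of_norm_le_const h1
  have b2 := norm_integral_le_of_norm_le_const h3'
  rw [probReal_univ, mul_one] at b1 b2
  have b3 := mul_le_mul b1 b2 (norm_nonneg _) (altBound_nonneg ha0 hε0 _ _)
  rw [altBound_mul, ← sq, zero_add, Finset.prod_mul_distrib, ← Real.exp_sum, Finset.sum_neg_distrib,
    ← Finset.mul_sum, Finset.prod_pow] at b3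
  refine b3.trans (mul_le_mul_of_nonneg_right ?_ (Real.exp_pos _).le)
  have e2 : ∏ i ∈ Ioc 0 (N + 1), siteBound μ X C J A i =
      (Real.exp 1 * C) ^ J.card * ∏ i ∈ J, (marg μ X i).real (A i) := by
    unfold siteBound
    rw [← Finset.prod_subset hJ fun i _ hi => if_neg hi,
      Finset.prod_congr rfl fun i hi => if_pos hi, Finset.prod_mul_distrib, Finset.prod_const]
  rw [e2]
  have he3 : Real.exp 1 ≤ 3 := by linarith [Real.exp_one_lt_d9]
  have hp0 : 0 ≤ ∏ i ∈ J, (marg μ X i).real (A i) := Finset.prod_nonneg fun _ _ => measureReal_nonneg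
  refine pow_le_pow_left₀ (by positivity) ?_ 2
  calc (Real.exp 1 * C) ^ J.card * ∏ i ∈ J, (marg μ X i).real (A i)
      ≤ (3 * C) ^ J.card * (C ^ J.card * μ.real (rect X J A)) := by
        gcongr
        exact h.prod_le_rect hA hJ
    _ = _ := by
      rw [show 3 * C ^ 2 = 3 * C * C by ring, mul_pow (3 * C)]
      ring

end Model

end

section

variable {μ : Measure Ω} {X : ℕ → Ω → E} {κ : ℕ → Kernel E E} {f : ℕ → E → ℤ} {C : ℝ} {K : ℕ}
  {b : ℕ → ℤ} {J : Finset ℕ} {A : ℕ → Set E}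

lemma expPot_I (t : ℝ) (n : ℕ) (x : E) : expPot f b (Complex.I * t) n x =
    Complex.exp ((t * ((f n x - b n : ℤ) : ℝ) : ℝ) * Complex.I) := by
  rw [expPot]
  congr 1
  push_cast
  ring

lemma norm_expPot_I (t : ℝ) (n : ℕ) (x : E) : ‖expPot f b (Complex.I * t) n x‖ = 1 := by
  rw [expPot_I, Complex.norm_exp_ofReal_mul_I]

/-- Mass of the set where the recentred value lies in `Q`. -/
def massOf (μ : Measure Ω) (X : ℕ → Ω → E) (f : ℕ → E → ℤ) (b : ℕ → ℤ) (Q : Set ℤ) (n : ℕ) : ℝ :=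
  (marg μ X n).real {x | f n x - b n ∈ Q}

namespace Model

lemma norm_mean_le (h : Model μ X κ f C K b) (t : ℝ) {Q : Set ℤ} {η : ℝ} (hη : 0 ≤ η)
    (hQ : ∀ y ∈ Q, |y| ≤ 2 * K → η ≤ 1 - Real.cos (t * y)) (n : ℕ) :
    ‖∫ x, expPot f b (Complex.I * t) n x ∂(marg μ X n)‖ ≤
      1 - η * massOf μ X f b Q n / (2 * K + 1) := by
  have := h.ellSys.prob n
  have hKp := h.K_pos
  have hms : MeasurableSet {x | f n x = b n} := (h.meas n) (measurableSet_singleton (b n))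
  have hmQ : MeasurableSet {x | f n x - b n ∈ Q} := (h.measurable_sub n) (Set.to_countable Q).measurableSet
  have bm := h.expPot_BM (Complex.I * t) n
  have iE := bm.integrable (marg μ X n)
  set m := (marg μ X n).real {x | f n x = b n} with hm
  have hm1 := h.mode n
  have m0 : 0 ≤ m := measureReal_nonneg
  have hmle : m ≤ 1 := measureReal_le_one
  set w := ∫ x in {x | f n x = b n}ᶜ, expPot f b (Complex.I * t) n x ∂(marg μ X n) with hw
  have e1 : ∫ x, expPot f b (Complex.I * t) n x ∂(marg μ X n) = m + w := by
    rw [← integral_add_compl hms iE]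
    congr 1
    rw [setIntegral_congr_fun hms (g := fun _ => (1 : ℂ)) fun x hx => by
      simp [expPot, show f n x = b n from hx]]
    rw [setIntegral_const]
    simp [hm]
  have hwn : ‖w‖ ≤ 1 - m := by
    have h1 := norm_setIntegral_le_of_norm_le_const (μ := marg μ X n) (C := 1)
      (s := {x | f n x = b n}ᶜ) (f := expPot f b (Complex.I * t) n) (measure_lt_top _ _)
      (fun x _ => (norm_expPot_I t n x).le)
    rw [one_mul, probReal_compl_eq_one_sub hms] at h1
    exact h1
  set D := ∫ x, (1 - Real.cos (t * ((f n x - b n : ℤ) : ℝ))) ∂(marg μ X n) with hD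
  have hre : ∀ x, (expPot f b (Complex.I * t) n x).re = Real.cos (t * ((f n x - b n : ℤ) : ℝ)) :=
    fun x => by rw [expPot_I, Complex.exp_ofReal_mul_I_re]
  have hDi : m + w.re = 1 - D := by
    have h2 := integral_re iE
    rw [e1] at h2
    simp only [RCLike.re_to_complex, hre, Complex.add_re, Complex.ofReal_re] at h2
    rw [hD, integral_sub (integrable_const _), h2]
    · simp
    · have := iE.re
      simpa only [RCLike.re_to_complex, hre] using this
  have hDQ : η * massOf μ X f b Q n ≤ D := by
    have h3 : ∫ x, {x | f n x - b n ∈ Q}.indicator (fun _ => η) x ∂(marg μ X n) =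
        η * massOf μ X f b Q n := by
      rw [integral_indicator hmQ, setIntegral_const, smul_eq_mul, mul_comm, massOf]
    rw [← h3]
    refine integral_mono_of_nonneg (Eventually.of_forall fun x => Set.indicator_nonneg (by simp [hη]) x)
      ?_ (Eventually.of_forall fun x => ?_)
    · have hcos := iE.re
      simp only [RCLike.re_to_complex, hre] at hcos
      exact (integrable_const (1 : ℝ)).sub hcos
    · by_cases hx : f n x - b n ∈ Q
      · simp only [Set.indicator, Set.mem_ofPred_eq, hx, if_true]
        refine hQ _ hx ?_
        have := h.abs_sub_le n x
        exact_mod_cast this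
      · simp only [Set.indicator, Set.mem_ofPred_eq, hx, if_false]
        linarith [Real.cos_le_one (t * ((f n x - b n : ℤ) : ℝ))]
  have D0 : 0 ≤ D := le_trans (mul_nonneg hη measureReal_nonneg) hDQ
  have D1 : m * D ≤ 1 := by
    have h4 : |w.re| ≤ 1 - m := (Complex.abs_re_le_norm w).trans hwn
    have := abs_le.1 h4
    nlinarith
  have hsq : ‖(m + w : ℂ)‖ ^ 2 ≤ (1 - m * D) ^ 2 := by
    have h4 : ‖w‖ ^ 2 ≤ (1 - m) ^ 2 := by gcongr
    rw [Complex.sq_norm, Complex.normSq_apply] at h4 ⊢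
    simp only [Complex.add_re, Complex.add_im, Complex.ofReal_re, Complex.ofReal_im, zero_add]
    nlinarith [sq_nonneg (m * D)]
  rw [e1]
  have h5 := abs_le_of_sq_le_sq' hsq (by linarith)
  have h6 : η * massOf μ X f b Q n / (2 * K + 1) ≤ m * D := by
    rw [div_eq_mul_inv, mul_comm]
    exact mul_le_mul hm1 hDQ (mul_nonneg hη measureReal_nonneg) m0
  linarith [h5.2]

/-- Decay of the characteristic function over rectangles, in terms of the mass of a set of values
on which the phase is bounded away from zero. -/
lemma norm_char_le_decay (h : Model μ X κ f C K b) (hA : ∀ i, MeasurableSet (A i)) {N : ℕ}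
    (hJ : J ⊆ Ioc 0 N) (t : ℝ) {Q : Set ℤ} {η : ℝ} (hη : 0 ≤ η)
    (hQ : ∀ y ∈ Q, |y| ≤ 2 * K → η ≤ 1 - Real.cos (t * y)) :
    ‖∫ ω, ∏ i ∈ Ioc 0 N, (rectW J A i (X i ω) * expPot f b (Complex.I * t) i (X i ω)) ∂μ‖ ≤
      (3 * C ^ 2) ^ J.card * μ.real (rect X J A) *
        Real.exp (-(η / (2 * (2 * K + 1) * C ^ 2) * ∑ i ∈ Ioc 0 N, massOf μ X f b Q i)) := by
  have hC := h.one_lt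
  have hKp := h.K_pos
  have h1 := h.norm_sq_le_decay hA hJ (fun i => h.expPot_BM (Complex.I * t) i)
    (fun i x => (norm_expPot_I (f := f) (b := b) t i x).le)
  refine le_of_sq_le_sq ?_ (by positivity)
  refine h1.trans ?_
  rw [mul_pow _ (Real.exp _)]
  refine mul_le_mul_of_nonneg_left ?_ (by positivity)
  rw [← Real.exp_nat_mul]
  apply Real.exp_le_exp.2
  have h2 : ∑ i ∈ Ioc 0 N, η * massOf μ X f b Q i / (2 * K + 1) ≤
      ∑ i ∈ Ioc 0 N, (1 - ‖∫ y, expPot f b (Complex.I * t) i y ∂(marg μ X i)‖) :=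
    Finset.sum_le_sum fun i _ => by linarith [h.norm_mean_le t hη hQ i]
  rw [← Finset.sum_div, ← Finset.mul_sum] at h2
  have h3 := mul_le_mul_of_nonneg_left h2 (show 0 ≤ (C ^ 2)⁻¹ by positivity)
  have e : (((2 : ℕ) : ℝ)) * -(η / (2 * (2 * K + 1) * C ^ 2) * ∑ i ∈ Ioc 0 N, massOf μ X f b Q i) =
      -((C ^ 2)⁻¹ * (η * ∑ i ∈ Ioc 0 N, massOf μ X f b Q i / (2 * K + 1))) := by
    rw [← Finset.sum_div]
    push_cast
    field_simp
  rw [e]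
  rw [← Finset.sum_div, ← mul_div_assoc]
  linarith

end Model

end

/-- A unimodular number rotating `w` to `‖w‖`. -/
def unphase (w : ℂ) : ℂ := if w = 0 then 1 else (starRingEnd ℂ) w / ‖w‖

lemma mul_unphase (w : ℂ) : w * unphase w = ‖w‖ := by
  unfold unphase
  split_ifs with h
  · simp [h]
  · have : (‖w‖ : ℂ) ≠ 0 := by simpa using h
    field_simp
    rw [Complex.mul_conj, Complex.normSq_eq_norm_sq]
    push_cast; ring

lemma norm_unphase (w : ℂ) : ‖unphase w‖ = 1 := by
  unfold unphase
  split_ifs with h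
  · simp
  · simp [h]

lemma unphase_one : unphase 1 = 1 := by simp [unphase]

lemma measurable_unphase : Measurable unphase := by
  unfold unphase
  refine Measurable.ite (measurableSet_singleton (0 : ℂ)) measurable_const ?_
  exact (Complex.continuous_conj.measurable).div (Complex.measurable_ofReal.comp measurable_norm)

lemma BM_unphase {F : E → ℂ} (hF : Measurable F) : BM fun x => unphase (F x) :=
  ⟨measurable_unphase.comp hF, 1, fun _ => (norm_unphase _).le⟩

lemma EllSys.re_back_ge {ν : ℕ → Measure E} {κ : ℕ → Kernel E E} {C : ℝ} (h : EllSys ν κ C)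
    {w : ℕ → E → ℂ} (hw : ∀ n, BM (w n)) (hw1 : ∀ n x, ‖w n x‖ ≤ 1) {m : ℝ} (hm : 0 ≤ m) {i j : ℕ}
    (base : ∀ᵐ x ∂(ν i), ‖back κ w j i x‖ ≤ C * m ∧ C⁻¹ * m ≤ (back κ w j i x).re) :
    ∀ d n, n + d = i → ∀ᵐ x ∂(ν n), ‖back κ w (j + d) n x‖ ≤ C * m ∧
      C⁻¹ * m - C ^ 2 * m * ∑ l ∈ Ioc n i, ∫ y, ‖w l y - 1‖ ∂(ν l) ≤
        (back κ w (j + d) n x).re := by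
  have := h.prob
  have := h.markov
  have hC : 0 < C := by linarith [h.one_lt]
  intro d
  induction d with
  | zero =>
    intro n hn
    obtain rfl : n = i := by omega
    simpa using base
  | succ d ih =>
    intro n hn
    have ih' := ih (n + 1) (by omega)
    set g := back κ w (j + d) (n + 1) with hg
    have gB : BM g := back_BM h.markov hw _ _
    have hub : ∀ᵐ y ∂(ν (n + 1)), ‖w (n + 1) y * g y‖ ≤ C * m := by
      filter_upwards [ih'] with y hy
      rw [norm_mul]
      exact (mul_le_of_le_one_left (norm_nonneg _) (hw1 _ _)).trans hy.1
    have hsum : ∑ l ∈ Ioc n i, ∫ y, ‖w l y - 1‖ ∂(ν l) =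
        ∫ y, ‖w (n + 1) y - 1‖ ∂(ν (n + 1)) + ∑ l ∈ Ioc (n + 1) i, ∫ y, ‖w l y - 1‖ ∂(ν l) := by
      rw [← Finset.sum_Ioc_consecutive _ (show n ≤ n + 1 by omega) (show n + 1 ≤ i by omega)]
      simp
    have w1B : BM fun y => w (n + 1) y - 1 := (hw _).sub (BM.const 1)
    filter_upwards [h.norm_kernel_le n hub, h.ae_kernel ih', h.kernel_norm_le_integral n w1B.1
      (s := 2) (Eventually.of_forall fun y => (norm_sub_le _ _).trans (by
        have := hw1 (n + 1) y; simp; linarith))] with x h1 h2 h3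
    have e : back κ w (j + (d + 1)) n x = ∫ y, w (n + 1) y * g y ∂(κ n x) := by
      rw [← add_assoc, back_succ]
    rw [e]
    refine ⟨h1, ?_⟩
    have iw : Integrable (fun y => w (n + 1) y * g y) (κ n x) := ((hw _).mul gB).integrable _
    have iwre : Integrable (fun y => (w (n + 1) y * g y).re) (κ n x) := iw.re
    have e2 : (∫ y, w (n + 1) y * g y ∂(κ n x)).re = ∫ y, (w (n + 1) y * g y).re ∂(κ n x) :=
      (integral_re iw).symm
    set a := ∑ l ∈ Ioc (n + 1) i, ∫ y, ‖w l y - 1‖ ∂(ν l) with ha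
    have i1 : Integrable (fun y => ‖w (n + 1) y - 1‖) (κ n x) := (w1B.integrable _).norm
    have h4 : ∫ y, ((C⁻¹ * m - C ^ 2 * m * a) - C * m * ‖w (n + 1) y - 1‖) ∂(κ n x) ≤
        ∫ y, (w (n + 1) y * g y).re ∂(κ n x) := by
      refine integral_mono_ae ((integrable_const _).sub (i1.const_mul _)) iwre ?_
      filter_upwards [h2] with y hy
      have e3 : w (n + 1) y * g y = g y + (w (n + 1) y - 1) * g y := by ring
      have h5 : -(‖w (n + 1) y - 1‖ * ‖g y‖) ≤ ((w (n + 1) y - 1) * g y).re := by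
        rw [← norm_mul]; exact (abs_le.1 (Complex.abs_re_le_norm _)).1
      have h6 : ‖w (n + 1) y - 1‖ * ‖g y‖ ≤ ‖w (n + 1) y - 1‖ * (C * m) :=
        mul_le_mul_of_nonneg_left hy.1 (norm_nonneg _)
      simp only [e3, Complex.add_re]
      linarith [hy.2]
    rw [integral_sub (integrable_const _) (i1.const_mul _), integral_const_mul] at h4
    simp only [integral_const, probReal_univ, one_smul] at h4
    have h7 := mul_le_mul_of_nonneg_left h3 (mul_nonneg hC.le hm)
    rw [e2, hsum]
    calc _ = (C⁻¹ * m - C ^ 2 * m * a) - C * m * (C * ∫ y, ‖w (n + 1) y - 1‖ ∂(ν (n + 1))) := by ring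
      _ ≤ _ := by linarith

/-- The mass of the future beyond site `i`. -/
def tailMass (ν : ℕ → Measure E) (κ : ℕ → Kernel E E) (w : ℕ → E → ℂ) (N i : ℕ) : ℝ :=
  if i < N then ∫ x, ‖w (i + 1) x * back κ w (N - (i + 1)) (i + 1) x‖ ∂(ν (i + 1)) else 1

lemma tailMass_nonneg (ν : ℕ → Measure E) (κ : ℕ → Kernel E E) (w : ℕ → E → ℂ) (N i : ℕ) :
    0 ≤ tailMass ν κ w N i := by
  unfold tailMass
  split_ifs
  · positivity
  · exact zero_le_one

lemma EllSys.norm_back_le_tailMass {ν : ℕ → Measure E} {κ : ℕ → Kernel E E} {C : ℝ}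
    (h : EllSys ν κ C) {w : ℕ → E → ℂ} (hw : ∀ n, BM (w n)) {N i : ℕ} (hi : i ≤ N) :
    ∀ᵐ x ∂(ν i), ‖back κ w (N - i) i x‖ ≤ C * tailMass ν κ w N i := by
  unfold tailMass
  split_ifs with hiN
  · obtain ⟨m, b, hb⟩ := (hw (i + 1)).mul (back_BM h.markov hw (N - (i + 1)) (i + 1))
    filter_upwards [h.norm_kernel_le_integral i m (Eventually.of_forall hb)] with x hx
    rw [show N - i = N - (i + 1) + 1 by omega, back_succ]
    exact hx
  · obtain rfl : i = N := by omega
    refine Eventually.of_forall fun x => ?_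
    simp [back_zero, h.one_lt.le]

/-- A density of the past product `∏_{0<i≤k} w_i` with respect to the law of the `k`-th state. -/
structure PastDensity (μ : Measure Ω) (X : ℕ → Ω → E) (w : ℕ → E → ℂ) (k : ℕ) (F : E → ℂ) :
    Prop where
  meas : Measurable F
  int : Integrable F (marg μ X k)
  rep : ∀ φ, BM φ → ∫ ω, (∏ i ∈ Ioc 0 k, w i (X i ω)) * φ (X k ω) ∂μ =
    ∫ x, F x * φ x ∂(marg μ X k)
  zero : k = 0 → F = fun _ => 1

section chain

variable {μ : Measure Ω} {X : ℕ → Ω → E} {κ : ℕ → Kernel E E} {C : ℝ}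

lemma UEChain.exists_pastDensity (h : UEChain μ X κ C) {w : ℕ → E → ℂ} (hw : ∀ n, BM (w n))
    (k : ℕ) : ∃ F, PastDensity μ X w k F := by
  have := h.1
  rcases Nat.eq_zero_or_pos k with rfl | hk
  · have : IsProbabilityMeasure (marg μ X 0) :=
      Measure.isProbabilityMeasure_map (h.2.1 0).aemeasurable
    refine ⟨fun _ => 1, measurable_const, integrable_const _, fun φ hφ => ?_, fun _ => rfl⟩
    simp [integral_marg h.2.1 0 hφ.1]
  · obtain ⟨b, hb⟩ := bounded_prod (X := X) hw (Ioc 0 k)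
    obtain ⟨F, h1, h2, h3⟩ := exists_density (μ := μ) h.2.1 k
      ((measurable_prod_past (X := X) hw k).mono (h.past_le k) le_rfl) hb
    exact ⟨F, h1, h2, h3, fun e => by omega⟩

lemma UEChain.gap (hC : 1 < C) (h : UEChain μ X κ C) {w : ℕ → E → ℂ} (hw : ∀ n, BM (w n))
    (hw1 : ∀ n x, ‖w n x‖ ≤ 1) {k i N : ℕ} (hki : k < i) (hiN : i ≤ N)
    (hmid : ∑ l ∈ Ioo k i, ∫ y, ‖w l y - 1‖ ∂(marg μ X l) ≤ (2 * C ^ 4)⁻¹) {F : E → ℂ}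
    (hF : PastDensity μ X w k F) :
    ∃ w' : ℕ → E → ℂ, (∀ n, BM (w' n)) ∧ (∀ n x, n ≠ i → ‖w' n x‖ ≤ ‖w n x‖) ∧
      (∀ x, w' i x = 1) ∧ (∀ n, n ≠ k → n ≠ i → n ≠ i + 1 → w' n = w n) ∧
      (∫ x, ‖F x‖ ∂(marg μ X k)) * tailMass (marg μ X) κ w N i ≤
        2 * C * ‖∫ ω, ∏ n ∈ Ioc 0 N, w' n (X n ω) ∂μ‖ := by
  have hS := h.ellSys hC
  have := hS.prob
  have := hS.markov
  have hC0 : 0 < C := by linarith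
  set g := back κ w (N - (i + 1)) (i + 1) with hg
  have gB : BM g := back_BM hS.markov hw _ _
  set w' : ℕ → E → ℂ := fun n => if n = k then fun x => w k x * unphase (F x) else
    if n = i then fun _ => 1 else
    if n = i + 1 then fun x => w (i + 1) x * unphase (w (i + 1) x * g x) else w n with hw'
  have wB : ∀ n, BM (w' n) := by
    intro n
    simp only [hw']
    split_ifs
    · exact (hw k).mul (BM_unphase hF.meas)
    · exact BM.const 1
    · exact (hw _).mul (BM_unphase ((hw _).mul gB).1)
    · exact hw n
  have wi : w' i = fun _ => 1 := by simp [hw', hki.ne']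
  have wle : ∀ n x, n ≠ i → ‖w' n x‖ ≤ ‖w n x‖ := by
    intro n x hn
    simp only [hw', hn, if_false]
    split_ifs with h1 h2
    · subst h1; simp [norm_unphase]
    · subst h2; simp [norm_unphase]
    · rfl
  have wk : ∀ n, n ≠ k → n ≠ i → n ≠ i + 1 → w' n = w n := by
    intro n h1 h2 h3; simp [hw', h1, h2, h3]
  have w'1 : ∀ n x, ‖w' n x‖ ≤ 1 := by
    intro n x
    by_cases hn : n = i
    · subst hn; simp [wi]
    · exact (wle n x hn).trans (hw1 n x)
  refine ⟨w', wB, wle, fun x => by rw [wi], wk, ?_⟩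
  set m := tailMass (marg μ X) κ w N i with hm
  have m0 : 0 ≤ m := tailMass_nonneg _ _ _ _ _
  have base : ∀ᵐ x ∂(marg μ X i), ‖back κ w' (N - i) i x‖ ≤ C * m ∧
      C⁻¹ * m ≤ (back κ w' (N - i) i x).re := by
    rw [hm, tailMass]
    split_ifs with hlt
    · obtain ⟨mm, b, hb⟩ := (hw (i + 1)).mul gB
      filter_upwards [hS.integral_ell i mm.norm (fun _ => norm_nonneg _) hb] with x hx
      have e : back κ w' (N - i) i x = ((∫ y, ‖w (i + 1) y * g y‖ ∂(κ i x) : ℝ) : ℂ) := by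
        rw [show N - i = N - (i + 1) + 1 by omega, back_succ, ← integral_complex_ofReal,
          back_congr (h' := w)]
        · refine integral_congr_ae (Eventually.of_forall fun y => ?_)
          have : w' (i + 1) = fun x => w (i + 1) x * unphase (w (i + 1) x * g x) := by
            simp [hw', show i + 1 ≠ k by omega]
          simp only [this]
          rw [← mul_unphase, ← hg]; ring
        · intro l hl
          simp only [Finset.mem_Ioc] at hl
          exact wk l (by omega) (by omega) (by omega)
      rw [e, Complex.norm_real, Complex.ofReal_re, Real.norm_of_nonneg (by positivity)]
      exact hx
    · obtain rfl : i = N := by omega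
      refine Eventually.of_forall fun x => ?_
      simp only [Nat.sub_self, back_zero, norm_one, mul_one, Complex.one_re]
      exact ⟨hC.le, inv_le_one_of_one_le₀ hC.le⟩
  have key := hS.re_back_ge wB w'1 m0 base (i - k) k (by omega)
  rw [show N - i + (i - k) = N - k by omega] at key
  have hsum : ∑ l ∈ Ioc k i, ∫ y, ‖w' l y - 1‖ ∂(marg μ X l) ≤ (2 * C ^ 4)⁻¹ := by
    rw [show Ioc k i = insert i (Ioo k i) by ext; simp; omega, Finset.sum_insert (by simp), wi]
    simp only [sub_self, norm_zero, integral_zero, zero_add]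
    refine le_trans (le_of_eq (Finset.sum_congr rfl fun l hl => ?_)) hmid
    simp only [Finset.mem_Ioo] at hl
    rw [wk l (by omega) (by omega) (by omega)]
  rw [h.integral_split wB (show k ≤ N by omega)]
  set Φ := back κ w' (N - k) k with hΦ
  have ΦB : BM Φ := back_BM hS.markov wB _ _
  have e1 : ∀ ω, (∏ n ∈ Ioc 0 k, w' n (X n ω)) * Φ (X k ω) =
      (∏ n ∈ Ioc 0 k, w n (X n ω)) * (unphase (F (X k ω)) * Φ (X k ω)) := by
    intro ω
    rw [← mul_assoc]
    congr 1
    rcases Nat.eq_zero_or_pos k with h0 | h0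
    · rw [hF.zero h0, h0]; simp [unphase_one]
    · rw [show Ioc 0 k = insert k (Ioo 0 k) by ext; simp; omega, Finset.prod_insert (by simp),
        Finset.prod_insert (by simp)]
      have : ∏ n ∈ Ioo 0 k, w' n (X n ω) = ∏ n ∈ Ioo 0 k, w n (X n ω) :=
        Finset.prod_congr rfl fun l hl => by
          simp only [Finset.mem_Ioo] at hl
          rw [wk l (by omega) (by omega) (by omega)]
      rw [this]
      simp only [hw', if_true]
      ring
  simp_rw [e1]
  rw [hF.rep _ ((BM_unphase hF.meas).mul ΦB)]
  have e2 : ∀ x, F x * (unphase (F x) * Φ x) = ‖F x‖ * Φ x := fun x => by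
    rw [← mul_assoc, mul_unphase]
  simp_rw [e2]
  have iFΦ : Integrable (fun x => (‖F x‖ : ℂ) * Φ x) (marg μ X k) := by
    obtain ⟨mm, b, hb⟩ := ΦB
    exact hF.int.norm.ofReal.mul_bdd (c := b) mm.aestronglyMeasurable (Eventually.of_forall hb)
  have h8 : ∫ x, ‖F x‖ * (m / (2 * C)) ∂(marg μ X k) ≤
      (∫ x, (‖F x‖ : ℂ) * Φ x ∂(marg μ X k)).re := by
    have e3 : (∫ x, (‖F x‖ : ℂ) * Φ x ∂(marg μ X k)).re =
      ∫ x, ((‖F x‖ : ℂ) * Φ x).re ∂(marg μ X k) := (integral_re iFΦ).symm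
    rw [e3]
    refine integral_mono_ae (hF.int.norm.mul_const _) iFΦ.re ?_
    filter_upwards [key] with x hx
    show ‖F x‖ * (m / (2 * C)) ≤ ((‖F x‖ : ℂ) * Φ x).re
    rw [Complex.re_ofReal_mul]
    refine mul_le_mul_of_nonneg_left ?_ (norm_nonneg _)
    refine le_trans ?_ hx.2
    have h9 := mul_le_mul_of_nonneg_left hsum (show 0 ≤ C ^ 2 * m by positivity)
    have h10 : C ^ 2 * m * (2 * C ^ 4)⁻¹ ≤ m / (2 * C) := by
      rw [← div_eq_mul_inv, div_le_div_iff₀ (by positivity) (by positivity)]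
      have : C ^ 3 ≤ C ^ 4 := pow_le_pow_right₀ hC.le (by norm_num)
      nlinarith
    have h11 : C⁻¹ * m = m / (2 * C) + m / (2 * C) := by field_simp; norm_num
    linarith
  rw [integral_mul_const] at h8
  have h12 := h8.trans (Complex.re_le_norm _)
  have := mul_le_mul_of_nonneg_left h12 (show 0 ≤ 2 * C by positivity)
  refine le_trans (le_of_eq ?_) this
  field_simp

end chain

/-- Sequences of weights agreeing with `base` off the finite set `J`, bounded by one. -/
structure Cls (base : ℕ → E → ℂ) (J : Finset ℕ) (w : ℕ → E → ℂ) : Prop where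
  bm : ∀ n, BM (w n)
  le_one : ∀ n x, ‖w n x‖ ≤ 1
  eq : ∀ n, n ∉ J → w n = base n

section chain

variable {μ : Measure Ω} {X : ℕ → Ω → E} {κ : ℕ → Kernel E E} {C : ℝ}

lemma norm_integral_mul_le_of_ae {ν : Measure E} {F Ψ : E → ℂ} (hF : Integrable F ν) {s : ℝ}
    (hs : ∀ᵐ x ∂ν, ‖Ψ x‖ ≤ s) : ‖∫ x, F x * Ψ x ∂ν‖ ≤ (∫ x, ‖F x‖ ∂ν) * s := by
  rw [← integral_mul_const]
  refine norm_integral_le_of_norm_le (hF.norm.mul_const _) ?_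
  filter_upwards [hs] with x hx
  rw [norm_mul]
  exact mul_le_mul_of_nonneg_left hx (norm_nonneg _)

/-- The form of the gap estimate used with classes of weights. -/
lemma UEChain.gap_cls (hC : 1 < C) (h : UEChain μ X κ C) {base w : ℕ → E → ℂ} {J : Finset ℕ}
    (hw : Cls base J w) {k i N : ℕ} (hki : k < i) (hiN : i ≤ N)
    (hmid : ∑ l ∈ Ioo k i, ∫ y, ‖w l y - 1‖ ∂(marg μ X l) ≤ (2 * C ^ 4)⁻¹) {F : E → ℂ}
    (hF : PastDensity μ X w k F) {a : ℝ} {ℓ : ℕ} (hJ : J.card ≤ ℓ)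
    (ha : ∀ J' : Finset ℕ, J'.card ≤ ℓ + 3 → ∀ w', Cls base J' w' →
      ‖∫ ω, ∏ n ∈ Ioc 0 N, w' n (X n ω) ∂μ‖ ≤ a) :
    (∫ x, ‖F x‖ ∂(marg μ X k)) * tailMass (marg μ X) κ w N i ≤ 2 * C * a := by
  obtain ⟨w', wB, wle, wi, wk, hle⟩ := h.gap hC hw.bm hw.le_one hki hiN hmid hF
  refine hle.trans (mul_le_mul_of_nonneg_left ?_ (by linarith))
  refine ha (J ∪ {k, i, i + 1}) ((Finset.card_union_le _ _).trans
    (add_le_add hJ Finset.card_le_three)) w' ⟨wB, fun n x => ?_, fun n hn => ?_⟩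
  · by_cases hn : n = i
    · subst hn; simp [wi]
    · exact (wle n x hn).trans (hw.le_one n x)
  · simp only [Finset.mem_union, Finset.mem_insert, Finset.mem_singleton, not_or] at hn
    rw [wk n hn.2.1 hn.2.2.1 hn.2.2.2, hw.eq n hn.1]

/-- Weights supported on sets of small measure can be traded for unimodular weights at
neighbouring sites. -/
lemma UEChain.rect_reduce (hC : 1 < C) (h : UEChain μ X κ C) {base : ℕ → E → ℂ} {N L : ℕ} {a : ℝ}
    (ha : ∀ J : Finset ℕ, J.card ≤ L → ∀ w, Cls base J w →
      ‖∫ ω, ∏ n ∈ Ioc 0 N, w n (X n ω) ∂μ‖ ≤ a) {A : ℕ → Set E} (hA : ∀ i, MeasurableSet (A i))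
    (I : Finset ℕ) : ∀ (J : Finset ℕ) (w : ℕ → E → ℂ), Cls base J w → J.card + 3 * I.card ≤ L →
      I ⊆ Ioc 0 N → (∀ i ∈ I, ∀ x, x ∉ A i → w i x = 0) →
      ‖∫ ω, ∏ n ∈ Ioc 0 N, w n (X n ω) ∂μ‖ ≤
        (2 * C ^ 3) ^ I.card * (∏ i ∈ I, (marg μ X i).real (A i)) * a := by
  have hS := h.ellSys hC
  have := hS.prob
  have := hS.markov
  have hC0 : 0 < C := by linarith
  induction I using Finset.induction_on with
  | empty =>
    intro J w hw hcard _ _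
    simpa using ha J (by simpa using hcard) w hw
  | insert i I hi ih =>
    intro J w hw hcard hI hsupp
    have hiN := hI (Finset.mem_insert_self i I)
    simp only [Finset.mem_Ioc] at hiN
    rw [Finset.card_insert_of_notMem hi] at hcard
    obtain ⟨k, rfl⟩ : ∃ k, i = k + 1 := ⟨i - 1, by omega⟩
    obtain ⟨F, hF⟩ := h.exists_pastDensity hw.bm k
    obtain ⟨w', wB, wle, wi, wk, hle⟩ := h.gap hC hw.bm hw.le_one (show k < k + 1 by omega) hiN.2
      (by
        rw [show Ioo k (k + 1) = ∅ from Finset.ext fun x => by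
          simp only [Finset.mem_Ioo, Finset.notMem_empty, iff_false]; omega, Finset.sum_empty]
        positivity) hF
    have hw' : Cls base (J ∪ {k, k + 1, k + 1 + 1}) w' := by
      refine ⟨wB, fun n x => ?_, fun n hn => ?_⟩
      · by_cases hn : n = k + 1
        · subst hn; simp [wi]
        · exact (wle n x hn).trans (hw.le_one n x)
      · simp only [Finset.mem_union, Finset.mem_insert, Finset.mem_singleton, not_or] at hn
        rw [wk n hn.2.1 hn.2.2.1 hn.2.2.2, hw.eq n hn.1]
    have hc : (J ∪ {k, k + 1, k + 1 + 1}).card ≤ J.card + 3 :=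
      (Finset.card_union_le _ _).trans (Nat.add_le_add_left Finset.card_le_three _)
    have h1 := ih _ w' hw' (by omega) ((Finset.subset_insert _ _).trans hI) (by
      intro l hl x hx
      have hne : l ≠ k + 1 := fun e => hi (e ▸ hl)
      have := wle l x hne
      rw [hsupp l (Finset.mem_insert_of_mem hl) x hx, norm_zero] at this
      exact norm_le_zero_iff.1 this)
    set m := tailMass (marg μ X) κ w N (k + 1) with hm
    have hb := hS.norm_back_le_tailMass hw.bm hiN.2
    have h2 : ‖∫ ω, ∏ n ∈ Ioc 0 N, w n (X n ω) ∂μ‖ ≤ (∫ x, ‖F x‖ ∂(marg μ X k)) *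
        (C * ((marg μ X (k + 1)).real (A (k + 1)) * (C * m))) := by
      rw [h.integral_split hw.bm (show k ≤ N by omega), hF.rep _ (back_BM hS.markov hw.bm _ _)]
      refine norm_integral_mul_le_of_ae hF.int ?_
      obtain ⟨mm, b, hbb⟩ := (hw.bm (k + 1)).mul (back_BM hS.markov hw.bm (N - (k + 1)) (k + 1))
      filter_upwards [hS.norm_kernel_le_integral k mm (Eventually.of_forall hbb)] with x hx
      rw [show N - k = N - (k + 1) + 1 by omega, back_succ]
      refine hx.trans (mul_le_mul_of_nonneg_left ?_ hC0.le)
      rw [← smul_eq_mul, ← setIntegral_const, ← integral_indicator (hA _)]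
      refine integral_mono_ae (Integrable.of_bound mm.norm.aestronglyMeasurable b
        (Eventually.of_forall fun x => by simpa using hbb x))
        ((integrable_const _).indicator (hA _)) ?_
      filter_upwards [hb] with y hy
      by_cases hyA : y ∈ A (k + 1)
      · rw [Set.indicator_of_mem hyA, norm_mul]
        exact (mul_le_of_le_one_left (norm_nonneg _) (hw.le_one _ _)).trans hy
      · rw [Set.indicator_of_notMem hyA, hsupp _ (Finset.mem_insert_self _ _) y hyA]
        simp
    rw [Finset.card_insert_of_notMem hi, Finset.prod_insert hi, pow_succ]
    set p := (marg μ X (k + 1)).real (A (k + 1)) with hp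
    have p0 : 0 ≤ p := measureReal_nonneg
    calc _ ≤ (∫ x, ‖F x‖ ∂(marg μ X k)) * (C * (p * (C * m))) := h2
      _ = C ^ 2 * p * ((∫ x, ‖F x‖ ∂(marg μ X k)) * m) := by ring
      _ ≤ C ^ 2 * p * (2 * C * ((2 * C ^ 3) ^ I.card *
          (∏ i ∈ I, (marg μ X i).real (A i)) * a)) := by
        refine mul_le_mul_of_nonneg_left (hle.trans ?_) (by positivity)
        exact mul_le_mul_of_nonneg_left h1 (by positivity)
      _ = _ := by ring

end chain

section chain

variable {μ : Measure Ω} {X : ℕ → Ω → E} {κ : ℕ → Kernel E E} {C : ℝ}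

/-- Conditional expectations of products of weights close to one vary little. -/
lemma EllSys.exists_back_near {ν : ℕ → Measure E} (h : EllSys ν κ C)
    {e : ℕ → E → ℂ} (he : ∀ n, BM (e n)) (he1 : ∀ n x, ‖e n x‖ ≤ 1) {β : ℝ} (hβ : 0 ≤ β)
    (hed : ∀ n x, ‖e n x - 1‖ ≤ β) (j : ℕ) : ∀ n, ∃ c : ℂ,
      ∀ᵐ x ∂(ν n), ‖back κ e j n x - c‖ ≤ (C - 1) * β := by
  have hC := h.one_lt
  have hC0 : 0 < C := by linarith
  have hb : ∀ j n x, ‖back κ e j n x‖ ≤ 1 := by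
    intro j
    induction j with
    | zero => intro n x; simp [back_zero]
    | succ j ih =>
      intro n x
      have := h.markov n
      rw [back_succ]
      refine (norm_integral_le_of_norm_le_const (C := 1) (Eventually.of_forall fun y => ?_)).trans
        (by simp)
      rw [norm_mul]
      exact mul_le_one₀ (he1 _ _) (norm_nonneg _) (ih _ _)
  induction j with
  | zero =>
    intro n
    refine ⟨1, Eventually.of_forall fun x => ?_⟩
    simp only [back_zero, sub_self, norm_zero]
    exact mul_nonneg (by linarith) hβ
  | succ j ih =>
    intro n
    obtain ⟨c, hc⟩ := ih (n + 1)
    have hφ := ((he (n + 1)).mul (back_BM h.markov he j (n + 1))).1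
    have := h.contract n hφ (c := c) (o := C * β) (by
      filter_upwards [hc] with y hy
      have e1 : e (n + 1) y * back κ e j (n + 1) y - c =
        (e (n + 1) y - 1) * back κ e j (n + 1) y + (back κ e j (n + 1) y - c) := by ring
      rw [e1]
      refine (norm_add_le _ _).trans ?_
      rw [norm_mul]
      have := mul_le_mul (hed (n + 1) y) (hb j (n + 1) y) (norm_nonneg _) hβ
      linarith)
    refine ⟨C⁻¹ * ∫ y, e (n + 1) y * back κ e j (n + 1) y ∂(ν (n + 1)) + (1 - C⁻¹) * c, ?_⟩
    filter_upwards [this] with x hx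
    refine le_trans (le_of_eq ?_) (hx.trans (le_of_eq ?_))
    · rw [back_succ]
    field_simp

/-- One step of backward propagation of the oscillation. -/
lemma EllSys.exists_back_osc {ν : ℕ → Measure E} (h : EllSys ν κ C)
    {w : ℕ → E → ℂ} (hw : ∀ n, BM (w n)) {i N : ℕ} (hi : i < N) {c : ℂ}
    {D G q : ℝ} (hG0 : 0 ≤ G)
    (hG : ∀ᵐ x ∂(ν (i + 1)), ‖back κ w (N - (i + 1)) (i + 1) x‖ ≤ G)
    (hD : ∀ᵐ x ∂(ν (i + 1)), ‖back κ w (N - (i + 1)) (i + 1) x - c‖ ≤ D)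
    (hq : ∫ y, ‖w (i + 1) y - 1‖ ∂(ν (i + 1)) ≤ q) :
    ∃ c' : ℂ, ∀ᵐ x ∂(ν i), ‖back κ w (N - i) i x - c'‖ ≤ (1 - C⁻¹) * D + C * (q * G) := by
  have := h.prob
  have := h.markov
  have hC0 : 0 < C := by linarith [h.one_lt]
  set g := back κ w (N - (i + 1)) (i + 1) with hg
  have gB : BM g := back_BM h.markov hw _ _
  have w1B : BM fun y => w (i + 1) y - 1 := (hw _).sub (BM.const 1)
  obtain ⟨mm, b, hb⟩ := w1B.mul gB
  refine ⟨C⁻¹ * ∫ y, g y ∂(ν (i + 1)) + (1 - C⁻¹) * c, ?_⟩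
  filter_upwards [h.contract i gB.1 hD, h.norm_kernel_le_integral i mm (Eventually.of_forall hb)]
    with x h1 h2
  rw [show N - i = N - (i + 1) + 1 by omega, back_succ]
  have e1 : ∫ y, w (i + 1) y * g y ∂(κ i x) =
      ∫ y, g y ∂(κ i x) + ∫ y, (w (i + 1) y - 1) * g y ∂(κ i x) := by
    rw [← integral_add (gB.integrable _) ((w1B.mul gB).integrable _)]
    congr 1; funext y; ring
  rw [← hg, e1, add_sub_right_comm]
  refine (norm_add_le _ _).trans (add_le_add (by simpa using h1)
    (h2.trans (mul_le_mul_of_nonneg_left ?_ hC0.le)))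
  calc ∫ y, ‖(w (i + 1) y - 1) * g y‖ ∂(ν (i + 1))
      ≤ ∫ y, ‖w (i + 1) y - 1‖ * G ∂(ν (i + 1)) := by
        refine integral_mono_ae ((w1B.mul gB).integrable _).norm
          ((w1B.integrable _).norm.mul_const _) ?_
        filter_upwards [hG] with y hy
        rw [norm_mul]
        exact mul_le_mul_of_nonneg_left hy (norm_nonneg _)
    _ ≤ q * G := by
      rw [integral_mul_const]
      exact mul_le_mul_of_nonneg_right hq hG0

/-- The product of the size of the past with the oscillation of the future is controlled by
products of weights with a bounded number of free sites. -/
lemma UEChain.past_mul_osc (hC : 1 < C) (h : UEChain μ X κ C) {base w : ℕ → E → ℂ} {J : Finset ℕ}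
    (hw : Cls base J w) {k N : ℕ} {F : E → ℂ}
    (hF : PastDensity μ X w k F) {a : ℝ} (ha0 : 0 ≤ a) {ℓ : ℕ} (hJ : J.card ≤ ℓ)
    (ha : ∀ J' : Finset ℕ, J'.card ≤ ℓ + 3 → ∀ w', Cls base J' w' →
      ‖∫ ω, ∏ n ∈ Ioc 0 N, w' n (X n ω) ∂μ‖ ≤ a)
    {q : ℕ → ℝ} (hq : ∀ i, k < i → ∫ y, ‖w i y - 1‖ ∂(marg μ X i) ≤ q i) (d : ℕ) :
    ∀ i, i + d = N → k < i → ∑ l ∈ Ioo k i, q l ≤ (2 * C ^ 4)⁻¹ →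
      ∃ (D : ℝ) (c : ℂ), 0 ≤ D ∧ (∀ᵐ x ∂(marg μ X i), ‖back κ w (N - i) i x - c‖ ≤ D) ∧
        (∫ x, ‖F x‖ ∂(marg μ X k)) * D ≤
          4 * C ^ 6 * a * ∑ l ∈ Ioc k N, (1 - (2 * C)⁻¹) ^ ((l : ℤ) - (i : ℤ)) * q l := by
  have hS := h.ellSys hC
  have := hS.prob
  have := hS.markov
  have hC0 : 0 < C := by linarith
  have hCi : C⁻¹ < 1 := inv_lt_one_of_one_lt₀ hC
  set θ := 1 - (2 * C)⁻¹ with hθ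
  have hCi2 : (2 * C)⁻¹ = C⁻¹ / 2 := by field_simp
  have θ0 : 0 < θ := by rw [hθ, hCi2]; linarith
  have θ1 : θ < 1 := by rw [hθ]; have : 0 < (2 * C)⁻¹ := by positivity
                        linarith
  have q0 : ∀ i, k < i → 0 ≤ q i := fun i hi => le_trans (by positivity) (hq i hi)
  set R := ∫ x, ‖F x‖ ∂(marg μ X k) with hR
  have R0 : 0 ≤ R := by positivity
  have hgap : ∀ i, k < i → i ≤ N → ∑ l ∈ Ioo k i, q l ≤ (2 * C ^ 4)⁻¹ →
      R * tailMass (marg μ X) κ w N i ≤ 2 * C * a := fun i hi hiN hmid =>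
    h.gap_cls hC hw hi hiN (le_trans (Finset.sum_le_sum fun l hl => hq l (by simp at hl; omega))
      hmid) hF hJ ha
  have W0 : ∀ i : ℕ, ∀ l ∈ Ioc k N, 0 ≤ θ ^ ((l : ℤ) - (i : ℤ)) * q l := fun i l hl =>
    mul_nonneg (zpow_nonneg θ0.le _) (q0 l (by simp at hl; omega))
  induction d with
  | zero =>
    intro i hi hki _
    obtain rfl : i = N := by omega
    refine ⟨0, 1, le_rfl, Eventually.of_forall fun x => by simp [back_zero], ?_⟩
    rw [mul_zero]
    exact mul_nonneg (by positivity) (Finset.sum_nonneg (W0 i))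
  | succ d ih =>
    intro i hi hki hmid
    by_cases hmid' : ∑ l ∈ Ioo k (i + 1), q l ≤ (2 * C ^ 4)⁻¹
    · obtain ⟨D, c, D0, hD, hle⟩ := ih (i + 1) (by omega) (by omega) hmid'
      set G := C * tailMass (marg μ X) κ w N (i + 1) with hG
      have G0 : 0 ≤ G := mul_nonneg hC0.le (tailMass_nonneg _ _ _ _ _)
      have hGb := hS.norm_back_le_tailMass hw.bm (show i + 1 ≤ N by omega)
      obtain ⟨c', hc'⟩ := hS.exists_back_osc hw.bm (show i < N by omega) G0 hGb hD
        (hq (i + 1) (by omega))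
      refine ⟨_, c', ?_, hc', ?_⟩
      · have := q0 (i + 1) (by omega)
        exact add_nonneg (mul_nonneg (by linarith) D0) (by positivity)
      set W := ∑ l ∈ Ioc k N, θ ^ ((l : ℤ) - ((i + 1 : ℕ) : ℤ)) * q l with hW
      have eW : ∑ l ∈ Ioc k N, θ ^ ((l : ℤ) - (i : ℤ)) * q l = θ * W := by
        rw [hW, Finset.mul_sum]
        refine Finset.sum_congr rfl fun l _ => ?_
        rw [← mul_assoc, ← zpow_one_add₀ θ0.ne']
        congr 2; push_cast; ring
      have hqW : q (i + 1) ≤ W := by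
        have := Finset.single_le_sum (W0 (i + 1)) (show i + 1 ∈ Ioc k N by simp; omega)
        rw [hW]
        simpa using this
      have hRG := hgap (i + 1) (by omega) (by omega) hmid'
      rw [eW]
      have s1 : R * ((1 - C⁻¹) * D) ≤ (1 - C⁻¹) * (4 * C ^ 6 * a * W) := by
        calc _ = (1 - C⁻¹) * (R * D) := by ring
          _ ≤ _ := mul_le_mul_of_nonneg_left hle (by linarith)
      have s2 : R * (C * (q (i + 1) * G)) ≤ 2 * C ^ 3 * a * W := by
        calc _ = C ^ 2 * q (i + 1) * (R * tailMass (marg μ X) κ w N (i + 1)) := by rw [hG]; ring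
          _ ≤ C ^ 2 * q (i + 1) * (2 * C * a) :=
            mul_le_mul_of_nonneg_left hRG (by have := q0 (i + 1) (by omega); positivity)
          _ = 2 * C ^ 3 * a * q (i + 1) := by ring
          _ ≤ _ := mul_le_mul_of_nonneg_left hqW (by positivity)
      have W0' : 0 ≤ W := Finset.sum_nonneg (W0 (i + 1))
      have s3 : 2 * C ^ 3 * a * W ≤ (2 * C)⁻¹ * (4 * C ^ 6 * a * W) := by
        have e : (2 * C)⁻¹ * (4 * C ^ 6 * a * W) = 2 * C ^ 5 * a * W := by field_simp; norm_num
        rw [e]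
        have : C ^ 3 ≤ C ^ 5 := pow_le_pow_right₀ hC.le (by norm_num)
        gcongr
      have e4 : 4 * C ^ 6 * a * (θ * W) =
          (1 - C⁻¹) * (4 * C ^ 6 * a * W) + (2 * C)⁻¹ * (4 * C ^ 6 * a * W) := by
        rw [hθ, hCi2]; ring
      rw [e4, mul_add]
      linarith
    · push Not at hmid'
      refine ⟨C * tailMass (marg μ X) κ w N i, 0,
        mul_nonneg hC0.le (tailMass_nonneg _ _ _ _ _), ?_, ?_⟩
      · simpa using hS.norm_back_le_tailMass hw.bm (show i ≤ N by omega)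
      have hRG := hgap i hki (by omega) hmid
      have hW : (2 * C ^ 4)⁻¹ ≤ ∑ l ∈ Ioc k N, θ ^ ((l : ℤ) - (i : ℤ)) * q l := by
        refine hmid'.le.trans ?_
        refine (Finset.sum_le_sum fun l hl => ?_).trans
          (Finset.sum_le_sum_of_subset_of_nonneg (s := Ioo k (i + 1)) ?_ fun l hl _ => W0 i l hl)
        · simp only [Finset.mem_Ioo] at hl
          refine le_mul_of_one_le_left (q0 l hl.1) ?_
          exact one_le_zpow_of_nonpos₀ θ0 θ1.le (by omega)
        · intro l hl; simp at hl ⊢; omega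
      calc R * (C * tailMass (marg μ X) κ w N i) = C * (R * tailMass (marg μ X) κ w N i) := by ring
        _ ≤ C * (2 * C * a) := mul_le_mul_of_nonneg_left hRG hC0.le
        _ = 4 * C ^ 6 * a * (2 * C ^ 4)⁻¹ := by field_simp; ring
        _ ≤ _ := mul_le_mul_of_nonneg_left hW (by positivity)

end chain

section chain

variable {μ : Measure Ω} {X : ℕ → Ω → E} {κ : ℕ → Kernel E E} {C : ℝ}

lemma sum_geom_shift_le {θ : ℝ} (h0 : 0 < θ) (h1 : θ < 1) {q : ℕ → ℝ} (hq : ∀ i, 0 ≤ q i)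
    (n N : ℕ) :
    ∑ k ∈ range n, ∑ l ∈ Ioc k N, θ ^ ((l : ℤ) - ((k + 1 : ℕ) : ℤ)) * q l ≤
      (1 - θ)⁻¹ * ∑ l ∈ Ioc 0 N, q l := by
  have e : ∑ k ∈ range n, ∑ l ∈ Ioc k N, θ ^ ((l : ℤ) - ((k + 1 : ℕ) : ℤ)) * q l =
      ∑ l ∈ Ioc 0 N, (∑ k ∈ range (min n l), θ ^ ((l : ℤ) - ((k + 1 : ℕ) : ℤ))) * q l := by
    simp_rw [Finset.sum_mul]
    refine Finset.sum_comm' fun k l => ?_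
    simp only [Finset.mem_range, Finset.mem_Ioc, lt_min_iff]
    omega
  rw [e, Finset.mul_sum]
  refine Finset.sum_le_sum fun l hl => mul_le_mul_of_nonneg_right ?_ (hq l)
  have : ∑ k ∈ range (min n l), θ ^ ((l : ℤ) - ((k + 1 : ℕ) : ℤ)) ≤ ∑ k ∈ range l, θ ^ k := by
    refine (Finset.sum_le_sum_of_subset_of_nonneg
      (Finset.range_subset_range.2 (min_le_right n l)) fun k _ _ => zpow_nonneg h0.le _).trans ?_
    rw [← Finset.sum_range_reflect]
    refine le_of_eq (Finset.sum_congr rfl fun k hk => ?_)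
    rw [Finset.mem_range] at hk
    rw [← zpow_natCast]
    congr 1
    omega
  refine this.trans ?_
  rw [← tsum_geometric_of_lt_one h0.le h1]
  exact (summable_geometric_of_lt_one h0.le h1).sum_le_tsum _ fun k _ => by positivity

/-- The weights `χ` tilted by `e` at the sites up to `n`. -/
def tilted (χ e : ℕ → E → ℂ) (n i : ℕ) (x : E) : ℂ := if i ≤ n then χ i x * e i x else χ i x

/-- Removing a small tilt, at the cost of a few additional free sites. -/
lemma UEChain.remove_tilt (hC : 1 < C) (h : UEChain μ X κ C) {χ e : ℕ → E → ℂ}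
    (he : ∀ n, BM (e n))
    (he1 : ∀ n x, ‖e n x‖ = 1) {β : ℝ} (hβ : 0 ≤ β) (hed : ∀ n x, ‖e n x - 1‖ ≤ β)
    {N ℓ : ℕ} (hN : 1 ≤ N) {a a₀ : ℝ}
    (ha : ∀ n ≤ N, ∀ J : Finset ℕ, J.card ≤ ℓ + 3 → ∀ w, Cls (tilted χ e n) J w →
      ‖∫ ω, ∏ i ∈ Ioc 0 N, w i (X i ω) ∂μ‖ ≤ a)
    (ha₀ : ∀ J : Finset ℕ, J.card ≤ ℓ + 3 → ∀ w, Cls χ J w →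
      ‖∫ ω, ∏ i ∈ Ioc 0 N, w i (X i ω) ∂μ‖ ≤ a₀)
    {n : ℕ} (hn : n ≤ N) {J : Finset ℕ} (hJ : J.card ≤ ℓ) {w : ℕ → E → ℂ}
    (hw : Cls (tilted χ e n) J w) :
    ‖∫ ω, ∏ i ∈ Ioc 0 N, w i (X i ω) ∂μ‖ ≤
      2 * C ^ 2 * a₀ + 20 * C ^ 9 * β * a *
        (2 * ℓ + ∑ i ∈ Ioc 0 N, ∫ y, ‖χ i y - 1‖ ∂(marg μ X i)) := by
  classical
  have hS := h.ellSys hC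
  have := h.1
  have := hS.prob
  have := hS.markov
  have hC0 : 0 < C := by linarith
  have a0 : 0 ≤ a := (norm_nonneg _).trans
    (ha n hn J (by omega) w hw)
  set v : ℕ → E → ℂ := fun i x => if i ≤ n then w i x * (starRingEnd ℂ) (e i x) else w i x with hv
  have hconj : ∀ i x, (starRingEnd ℂ) (e i x) * e i x = 1 := fun i x => by
    rw [mul_comm, Complex.mul_conj, Complex.normSq_eq_norm_sq, he1]; simp
  have vB : ∀ i, BM (v i) := by
    intro i
    by_cases hi : i ≤ n
    · simp only [hv, hi, if_true]
      exact (hw.bm i).mul ⟨Complex.continuous_conj.measurable.comp (he i).1, 1, fun x => by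
        simp [he1]⟩
    · simp only [hv, hi, if_false]
      exact hw.bm i
  have vn : ∀ i x, ‖v i x‖ = ‖w i x‖ := by
    intro i x
    simp only [hv]
    split_ifs <;> simp [he1]
  have v1 : ∀ i x, ‖v i x‖ ≤ 1 := fun i x => (vn i x).le.trans (hw.le_one i x)
  have vJ : ∀ i, i ∉ J → v i = χ i := by
    intro i hi
    funext x
    simp only [hv, hw.eq i hi, tilted]
    split_ifs
    · rw [mul_assoc, mul_comm (e i x), hconj, mul_one]
    · rfl
  have vw : ∀ i ≤ n, ∀ x, w i x = v i x * e i x := by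
    intro i hi x
    simp only [hv, hi, if_true]
    rw [mul_assoc, hconj, mul_one]
  have vC : Cls χ J v := ⟨vB, v1, vJ⟩
  set q : ℕ → ℝ := fun i => if i ∈ J then 2 else ∫ y, ‖χ i y - 1‖ ∂(marg μ X i) with hq
  have q0 : ∀ i, 0 ≤ q i := fun i => by simp only [hq]; split_ifs <;> positivity
  have vq : ∀ i, ∫ y, ‖v i y - 1‖ ∂(marg μ X i) ≤ q i := by
    intro i
    by_cases hi : i ∈ J
    · simp only [hq, hi, if_true]
      have : ∫ y, ‖v i y - 1‖ ∂(marg μ X i) ≤ ∫ y, (2 : ℝ) ∂(marg μ X i) := by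
        refine integral_mono (((vB i).sub (BM.const 1)).integrable _).norm (integrable_const _)
          fun y => (norm_sub_le _ _).trans ?_
        have := v1 i y
        simp; linarith
      simpa using this
    · simp only [hq, hi, if_false, vJ i hi]; exact le_rfl
  have hqs : ∑ i ∈ Ioc 0 N, q i ≤ 2 * ℓ + ∑ i ∈ Ioc 0 N, ∫ y, ‖χ i y - 1‖ ∂(marg μ X i) := by
    have h1 : ∀ i, q i ≤ (if i ∈ J then 2 else 0) + ∫ y, ‖χ i y - 1‖ ∂(marg μ X i) := fun i => by
      simp only [hq]
      split_ifs
      · have : 0 ≤ ∫ y, ‖χ i y - 1‖ ∂(marg μ X i) := by positivity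
        linarith
      · simp
    refine (Finset.sum_le_sum fun i _ => h1 i).trans ?_
    rw [Finset.sum_add_distrib]
    gcongr
    rw [← Finset.sum_filter, Finset.sum_const, nsmul_eq_mul, mul_comm]
    have h2 : ((Ioc 0 N).filter (· ∈ J)).card ≤ ℓ :=
      (Finset.card_le_card fun i hi => (Finset.mem_filter.1 hi).2).trans hJ
    have : (((Ioc 0 N).filter (· ∈ J)).card : ℝ) ≤ ℓ := by exact_mod_cast h2
    linarith
  set u : ℕ → E → ℂ := fun k => back κ e (n - k) k with hu
  set g : ℕ → E → ℂ := fun k => back κ v (N - k) k with hg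
  have uB : ∀ k, BM (u k) := fun k => back_BM hS.markov he _ _
  have gB : ∀ k, BM (g k) := fun k => back_BM hS.markov vB _ _
  have u1 : ∀ k x, ‖u k x‖ ≤ 1 := by
    have : ∀ j k x, ‖back κ e j k x‖ ≤ 1 := by
      intro j
      induction j with
      | zero => intro k x; simp [back_zero]
      | succ j ih =>
        intro k x
        rw [back_succ]
        refine (norm_integral_le_of_norm_le_const (C := 1)
          (Eventually.of_forall fun y => ?_)).trans (by simp)
        rw [norm_mul, he1, one_mul]
        exact ih _ _
    exact fun k x => this _ _ _
  set I : ℕ → ℂ := fun k => ∫ ω, (∏ i ∈ Ioc 0 k, w i (X i ω)) * (u k (X k ω) * g k (X k ω)) ∂μ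
    with hI
  have hIn : I n = ∫ ω, ∏ i ∈ Ioc 0 N, w i (X i ω) ∂μ := by
    rw [h.integral_split hw.bm hn]
    simp only [hI, hu, hg, Nat.sub_self, back_zero, one_mul]
    rw [back_congr (h' := w)]
    intro i hi
    simp only [Finset.mem_Ioc] at hi
    funext x
    simp [hv, show ¬ i ≤ n by omega]
  have mix : ∀ k ≤ n, Cls (tilted χ e k) J (fun i => if i ≤ k then w i else v i) := by
    intro k hk
    refine ⟨fun i => ?_, fun i x => ?_, fun i hi => ?_⟩
    · split_ifs
      · exact hw.bm i
      · exact vB i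
    · split_ifs
      · exact hw.le_one i x
      · exact v1 i x
    · funext x
      simp only [tilted]
      split_ifs with hik
      · simp [hw.eq i hi, tilted, hik.trans hk]
      · simp [vJ i hi]
  have hI0 : ‖I 0‖ ≤ 2 * C ^ 2 * a₀ := by
    obtain ⟨F, hF⟩ := h.exists_pastDensity vB 0
    have h1 := h.gap_cls hC vC (show 0 < 1 by omega) hN (by
      rw [show Ioo 0 1 = ∅ from Finset.ext fun x => by
          simp only [Finset.mem_Ioo, Finset.notMem_empty, iff_false]; omega, Finset.sum_empty]
      positivity) hF hJ ha₀
    rw [hF.zero rfl] at h1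
    simp only [norm_one, integral_const, probReal_univ, one_smul, one_mul] at h1
    have h2 := hS.norm_back_le_tailMass vB hN
    have h3 : ∀ᵐ x ∂(marg μ X 0), ‖g 0 x‖ ≤ 2 * C ^ 2 * a₀ := by
      have h4 : ∀ᵐ y ∂(marg μ X 1), ‖v 1 y * g 1 y‖ ≤ 2 * C ^ 2 * a₀ := by
        filter_upwards [h2] with y hy
        rw [norm_mul]
        refine (mul_le_of_le_one_left (norm_nonneg _) (v1 1 y)).trans (hy.trans ?_)
        calc _ ≤ C * (2 * C * a₀) := mul_le_mul_of_nonneg_left h1 hC0.le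
          _ = _ := by ring
      filter_upwards [hS.norm_kernel_le 0 h4] with x hx
      simp only [hg]
      rw [show N - 0 = N - 1 + 1 by omega, back_succ]
      exact hx
    have h5 := norm_integral_mul_le_of_ae (ν := marg μ X 0) (F := fun _ => 1)
      (Ψ := fun x => u 0 x * g 0 x) (integrable_const _) (s := 2 * C ^ 2 * a₀) (by
        filter_upwards [h3] with x hx
        rw [norm_mul]
        exact (mul_le_of_le_one_left (norm_nonneg _) (u1 0 x)).trans hx)
    simp only [one_mul, norm_one, integral_const, probReal_univ, one_smul] at h5
    rw [integral_marg h.2.1 0 ((uB 0).mul (gB 0)).1] at h5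
    simpa [hI] using h5
  have hstep : ∀ k < n, ‖I (k + 1) - I k‖ ≤ 2 * C ^ 2 * β * a * (2 * C ^ 2 * q (k + 1) +
      4 * C ^ 6 * ∑ l ∈ Ioc k N, (1 - (2 * C)⁻¹) ^ ((l : ℤ) - ((k + 1 : ℕ) : ℤ)) * q l) := by
    intro k hk
    set z : ℕ → E → ℂ := fun i => if i ≤ k then w i else v i with hz
    have zC := mix k hk.le
    have zpast : ∀ ω, ∏ i ∈ Ioc 0 k, z i (X i ω) = ∏ i ∈ Ioc 0 k, w i (X i ω) := fun ω =>
      Finset.prod_congr rfl fun i hi => by simp [hz, (Finset.mem_Ioc.1 hi).2]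
    have zg : ∀ i, k < i → back κ z (N - i) i = g i := by
      intro i hi
      simp only [hg]
      refine back_congr _ _ fun l hl => ?_
      have := (Finset.mem_Ioc.1 hl).1
      simp [hz, show ¬ l ≤ k by omega]
    obtain ⟨F, hF⟩ := h.exists_pastDensity zC.bm k
    have zq : ∀ i, k < i → ∫ y, ‖z i y - 1‖ ∂(marg μ X i) ≤ q i := fun i hi => by
      simp only [hz, show ¬ i ≤ k by omega, if_false]; exact vq i
    have hempty : Ioo k (k + 1) = ∅ := Finset.ext fun x => by
      simp only [Finset.mem_Ioo, Finset.notMem_empty, iff_false]; omega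
    obtain ⟨D, c, D0, hD, hRD⟩ := h.past_mul_osc hC zC hF a0 hJ (ha k (by omega)) zq
      (N - (k + 1)) (k + 1) (by omega) (by omega) (by rw [hempty, Finset.sum_empty]; positivity)
    have hRG := h.gap_cls hC zC (show k < k + 1 by omega) (show k + 1 ≤ N by omega)
      (by rw [hempty, Finset.sum_empty]; positivity) hF hJ (ha k (by omega))
    have hGb := hS.norm_back_le_tailMass zC.bm (show k + 1 ≤ N by omega)
    rw [zg (k + 1) (by omega)] at hD hGb
    set R := ∫ x, ‖F x‖ ∂(marg μ X k) with hR
    set G := tailMass (marg μ X) κ z N (k + 1) with hG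
    have G0 : 0 ≤ G := tailMass_nonneg _ _ _ _ _
    set Ψ : E → ℂ := fun x => (∫ y, w (k + 1) y * (u (k + 1) y * g (k + 1) y) ∂(κ k x)) -
      u k x * g k x with hΨ
    have ΨB : BM Ψ := (((hw.bm _).mul ((uB _).mul (gB _))).kernel _).sub ((uB k).mul (gB k))
    have hdiff : I (k + 1) - I k = ∫ x, F x * Ψ x ∂(marg μ X k) := by
      rw [← hF.rep _ ΨB]
      rw [show (fun ω => (∏ i ∈ Ioc 0 k, z i (X i ω)) * Ψ (X k ω)) =
        fun ω => (∏ i ∈ Ioc 0 k, w i (X i ω)) * Ψ (X k ω) from funext fun ω => by rw [zpast]]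
      have hm := measurable_prod_past (X := X) hw.bm k
      obtain ⟨b, hb⟩ := bounded_prod (X := X) hw.bm (Ioc 0 k)
      have e1 : I (k + 1) = ∫ ω, (∏ i ∈ Ioc 0 k, w i (X i ω)) *
          ∫ y, w (k + 1) y * (u (k + 1) y * g (k + 1) y) ∂(κ k (X k ω)) ∂μ := by
        rw [← h.integral_step k ((hw.bm (k + 1)).mul ((uB (k + 1)).mul (gB (k + 1)))) hm hb]
        simp only [hI]
        congr 1; funext ω
        rw [Finset.prod_Ioc_succ_top (by omega)]
        ring
      have hinterp : ∀ φ : E → ℂ, BM φ →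
          Integrable (fun ω => (∏ i ∈ Ioc 0 k, w i (X i ω)) * φ (X k ω)) μ := by
        intro φ ⟨mφ, bφ, hbφ⟩
        refine Integrable.mul_bdd (c := bφ) ?_ (mφ.comp (h.2.1 k)).aestronglyMeasurable
          (Eventually.of_forall fun ω => hbφ _)
        exact Integrable.of_bound (hm.mono (h.past_le k) le_rfl).aestronglyMeasurable b
          (Eventually.of_forall hb)
      rw [e1]
      simp only [hI, hΨ, mul_sub]
      rw [integral_sub (hinterp _ (((hw.bm _).mul ((uB _).mul (gB _))).kernel _))
        (hinterp _ ((uB k).mul (gB k)))]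
    have hus : ∀ x, u k x = ∫ y, e (k + 1) y * u (k + 1) y ∂(κ k x) := fun x => by
      simp only [hu]
      rw [show n - k = n - (k + 1) + 1 by omega, back_succ]
    have hgs : ∀ x, g k x = ∫ y, v (k + 1) y * g (k + 1) y ∂(κ k x) := fun x => by
      simp only [hg]
      rw [show N - k = N - (k + 1) + 1 by omega, back_succ]
    obtain ⟨cu, hcu⟩ := hS.exists_back_near he (fun n x => (he1 n x).le) hβ hed (n - (k + 1)) (k + 1)
    have hcu' : ∀ᵐ y ∂(marg μ X (k + 1)), ‖e (k + 1) y * u (k + 1) y - cu‖ ≤ C * β := by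
      filter_upwards [hcu] with y hy
      have e1 : e (k + 1) y * u (k + 1) y - cu =
        (e (k + 1) y - 1) * u (k + 1) y + (u (k + 1) y - cu) := by ring
      rw [e1]
      refine (norm_add_le _ _).trans ?_
      rw [norm_mul]
      have := mul_le_mul (hed (k + 1) y) (u1 (k + 1) y) (norm_nonneg _) hβ
      simp only [hu] at this hy ⊢
      linarith
    have vgB : BM fun y => v (k + 1) y * g (k + 1) y - c := ((vB _).mul (gB _)).sub (BM.const c)
    have hvg : ∫ y, ‖v (k + 1) y * g (k + 1) y - c‖ ∂(marg μ X (k + 1)) ≤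
        q (k + 1) * (C * G) + D := by
      have i1 : Integrable (fun y => ‖v (k + 1) y - 1‖) (marg μ X (k + 1)) :=
        (((vB (k + 1)).sub (BM.const 1)).integrable _).norm
      calc _ ≤ ∫ y, (‖v (k + 1) y - 1‖ * (C * G) + D) ∂(marg μ X (k + 1)) := by
            refine integral_mono_ae (vgB.integrable _).norm
              ((i1.mul_const _).add (integrable_const _)) ?_
            filter_upwards [hGb, hD] with y h1 h2
            have e1 : v (k + 1) y * g (k + 1) y - c =
              (v (k + 1) y - 1) * g (k + 1) y + (g (k + 1) y - c) := by ring
            simp only [e1]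
            refine (norm_add_le _ _).trans (add_le_add ?_ h2)
            rw [norm_mul]
            exact mul_le_mul_of_nonneg_left h1 (norm_nonneg _)
        _ = (∫ y, ‖v (k + 1) y - 1‖ ∂(marg μ X (k + 1))) * (C * G) + D := by
            rw [integral_add (i1.mul_const _) (integrable_const _), integral_mul_const]
            simp
        _ ≤ _ := by
            gcongr
            exact vq (k + 1)
    obtain ⟨bv, hbv⟩ := vgB.2
    have hΨs : ∀ᵐ x ∂(marg μ X k), ‖Ψ x‖ ≤ 2 * C * β * (C * (q (k + 1) * (C * G) + D)) := by
      filter_upwards [hS.ae_kernel hcu', hS.norm_kernel_le k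
        (φ := fun y => e (k + 1) y * u (k + 1) y - cu) hcu',
        hS.kernel_norm_le_integral k vgB.1 (Eventually.of_forall hbv)] with x h1 h2 h3
      have ieu : Integrable (fun y => e (k + 1) y * u (k + 1) y) (κ k x) :=
        ((he _).mul (uB _)).integrable _
      have h4 : ‖u k x - cu‖ ≤ C * β := by
        rw [integral_sub ieu (integrable_const _)] at h2
        simpa [hus] using h2
      have e1 : Ψ x = ∫ y, (e (k + 1) y * u (k + 1) y - u k x) *
          (v (k + 1) y * g (k + 1) y - c) ∂(κ k x) := by
        have e2 : ∀ y, (e (k + 1) y * u (k + 1) y - u k x) * (v (k + 1) y * g (k + 1) y - c) =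
            (w (k + 1) y * (u (k + 1) y * g (k + 1) y) - u k x * (v (k + 1) y * g (k + 1) y)) -
            (e (k + 1) y * u (k + 1) y - u k x) * c := fun y => by
          rw [vw (k + 1) (by omega)]; ring
        simp_rw [e2]
        have i1 := ((hw.bm (k + 1)).mul ((uB (k + 1)).mul (gB (k + 1)))).integrable (κ k x)
        have i2 := (((vB (k + 1)).mul (gB (k + 1))).integrable (κ k x)).const_mul (u k x)
        have i3 := (ieu.sub (integrable_const (u k x))).mul_const c
        simp only [Pi.sub_apply] at i3
        have i12 : Integrable (fun y => w (k + 1) y * (u (k + 1) y * g (k + 1) y) -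
            u k x * (v (k + 1) y * g (k + 1) y)) (κ k x) := i1.sub i2
        rw [integral_sub i12 i3, integral_sub i1 i2, integral_const_mul, integral_mul_const,
          integral_sub ieu (integrable_const _), ← hus, ← hgs]
        simp [hΨ]
      rw [e1]
      refine (norm_integral_le_of_norm_le (((vgB.integrable (κ k x)).norm).const_mul (2 * C * β))
        ?_).trans ?_
      · filter_upwards [h1] with y hy
        rw [norm_mul]
        refine mul_le_mul_of_nonneg_right ?_ (norm_nonneg _)
        have e3 : e (k + 1) y * u (k + 1) y - u k x =
          (e (k + 1) y * u (k + 1) y - cu) - (u k x - cu) := by ring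
        rw [e3]
        refine (norm_sub_le _ _).trans ?_
        linarith
      · rw [integral_const_mul]
        refine mul_le_mul_of_nonneg_left ?_ (by positivity)
        exact h3.trans (mul_le_mul_of_nonneg_left hvg hC0.le)
    rw [hdiff]
    refine (norm_integral_mul_le_of_ae hF.int hΨs).trans ?_
    calc R * (2 * C * β * (C * (q (k + 1) * (C * G) + D)))
        = 2 * C ^ 2 * β * (q (k + 1) * C * (R * G) + R * D) := by ring
      _ ≤ 2 * C ^ 2 * β * (q (k + 1) * C * (2 * C * a) + 4 * C ^ 6 * a *
          ∑ l ∈ Ioc k N, (1 - (2 * C)⁻¹) ^ ((l : ℤ) - ((k + 1 : ℕ) : ℤ)) * q l) := by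
        have := q0 (k + 1)
        gcongr
      _ = _ := by ring
  have htel : I n = I 0 + ∑ k ∈ range n, (I (k + 1) - I k) := by
    rw [Finset.sum_range_sub]; ring
  rw [← hIn, htel]
  refine (norm_add_le _ _).trans (add_le_add hI0 ?_)
  refine (norm_sum_le _ _).trans ((Finset.sum_le_sum fun k hk =>
    hstep k (Finset.mem_range.1 hk)).trans ?_)
  have hCi : (2 * C)⁻¹ < 1 := inv_lt_one_of_one_lt₀ (by linarith)
  have hCi0 : 0 < (2 * C)⁻¹ := by positivity
  have hW := sum_geom_shift_le (θ := 1 - (2 * C)⁻¹) (by linarith) (by linarith) q0 n N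
  rw [sub_sub_cancel, inv_inv] at hW
  have hqn : ∑ k ∈ range n, q (k + 1) ≤ ∑ l ∈ Ioc 0 N, q l := by
    have : ∑ k ∈ range n, q (k + 1) = ∑ l ∈ Ioc 0 n, q l := by
      rw [Finset.range_eq_Ico, Finset.sum_Ico_add' q 0 n 1]
      congr 1
    rw [this]
    refine Finset.sum_le_sum_of_subset_of_nonneg (fun i hi => ?_) fun i _ _ => q0 i
    simp at hi ⊢; omega
  rw [← Finset.mul_sum, Finset.sum_add_distrib, ← Finset.mul_sum, ← Finset.mul_sum]
  set Q := ∑ l ∈ Ioc 0 N, q l with hQ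
  have Q0 : 0 ≤ Q := Finset.sum_nonneg fun i _ => q0 i
  calc _ ≤ 2 * C ^ 2 * β * a * (2 * C ^ 2 * Q + 4 * C ^ 6 * (2 * C * Q)) := by gcongr
    _ = (4 * C ^ 4 + 16 * C ^ 9) * β * a * Q := by ring
    _ ≤ 20 * C ^ 9 * β * a * Q := by
      have : C ^ 4 ≤ C ^ 9 := pow_le_pow_right₀ hC.le (by norm_num)
      gcongr
      linarith
    _ ≤ _ := by gcongr

end chain

section

variable {μ : Measure Ω} {X : ℕ → Ω → E} {κ : ℕ → Kernel E E} {f : ℕ → E → ℤ} {C : ℝ} {K : ℕ}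
  {b : ℕ → ℤ} {J : Finset ℕ} {A : ℕ → Set E}

/-- All products of weights in `Cls base` with at most `L` free sites have mean at most `a`. -/
def ClsBd (μ : Measure Ω) (X : ℕ → Ω → E) (N : ℕ) (base : ℕ → E → ℂ) (L : ℕ) (a : ℝ) : Prop :=
  ∀ J : Finset ℕ, J.card ≤ L → ∀ w, Cls base J w → ‖∫ ω, ∏ i ∈ Ioc 0 N, w i (X i ω) ∂μ‖ ≤ a

lemma ClsBd.one [IsProbabilityMeasure μ] (N : ℕ) (base : ℕ → E → ℂ) (L : ℕ) :
    ClsBd μ X N base L 1 := by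
  intro J _ w hw
  refine (norm_integral_le_of_norm_le_const (C := 1) (Eventually.of_forall fun ω => ?_)).trans
    (by simp)
  rw [norm_prod]
  exact Finset.prod_le_one (fun _ _ => norm_nonneg _) fun i _ => hw.le_one _ _

lemma ClsBd.mono_level {N : ℕ} {base : ℕ → E → ℂ} {L L' : ℕ} {a : ℝ} (h : ClsBd μ X N base L a)
    (hL : L' ≤ L) : ClsBd μ X N base L' a := fun J hJ => h J (hJ.trans hL)

/-- Iterated removal of a small tilt. -/
lemma UEChain.clsBd_tilted (hC : 1 < C) (h : UEChain μ X κ C) {χ e : ℕ → E → ℂ}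
    (he : ∀ n, BM (e n)) (he1 : ∀ n x, ‖e n x‖ = 1) {β : ℝ} (hβ : 0 ≤ β)
    (hed : ∀ n x, ‖e n x - 1‖ ≤ β) {N : ℕ} (hN : 1 ≤ N) {L : ℕ} {a₀ q : ℝ}
    (a00 : 0 ≤ a₀) (ha₀ : ClsBd μ X N χ L a₀) (hq1 : q ≤ 1)
    (hq : 20 * C ^ 9 * β * (2 * L + ∑ i ∈ Ioc 0 N, ∫ y, ‖χ i y - 1‖ ∂(marg μ X i)) ≤ q) (m : ℕ) :
    ∀ ℓ, ℓ + 3 * m ≤ L → ∀ n ≤ N, ClsBd μ X N (tilted χ e n) ℓ (2 * C ^ 2 * m * a₀ + q ^ m) := by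
  have := h.1
  have hs0 : 0 ≤ ∑ i ∈ Ioc 0 N, ∫ y, ‖χ i y - 1‖ ∂(marg μ X i) :=
    Finset.sum_nonneg fun i _ => by positivity
  have hq0 : 0 ≤ q := le_trans (by positivity) hq
  induction m with
  | zero => intro ℓ _ n _; simpa using ClsBd.one N _ ℓ
  | succ m ih =>
    intro ℓ hℓ n hn J hJ w hw
    have h1 := h.remove_tilt hC he he1 hβ hed hN (ℓ := ℓ)
      (a := 2 * C ^ 2 * m * a₀ + q ^ m) (a₀ := a₀)
      (fun n' hn' => ih (ℓ + 3) (by omega) n' hn') (ha₀.mono_level (by omega)) hn hJ hw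
    refine h1.trans ?_
    have a0 : 0 ≤ 2 * C ^ 2 * m * a₀ + q ^ m :=
      (norm_nonneg _).trans (ih ℓ (by omega) n hn J hJ w hw)
    have hLℓ : (ℓ : ℝ) ≤ L := by exact_mod_cast (by omega : ℓ ≤ L)
    have h2 : 20 * C ^ 9 * β * (2 * C ^ 2 * m * a₀ + q ^ m) *
        (2 * ℓ + ∑ i ∈ Ioc 0 N, ∫ y, ‖χ i y - 1‖ ∂(marg μ X i)) ≤
        q * (2 * C ^ 2 * m * a₀ + q ^ m) := by
      refine le_trans ?_ (mul_le_mul_of_nonneg_right hq a0)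
      calc _ = 20 * C ^ 9 * β * (2 * ℓ + ∑ i ∈ Ioc 0 N, ∫ y, ‖χ i y - 1‖ ∂(marg μ X i)) *
            (2 * C ^ 2 * m * a₀ + q ^ m) := by ring
        _ ≤ _ := by gcongr
    have h3 : q * (2 * C ^ 2 * m * a₀) ≤ 2 * C ^ 2 * m * a₀ :=
      mul_le_of_le_one_left (by positivity) hq1
    push_cast
    rw [pow_succ q m]
    linarith

/-- Conditional exponential moments of the recentred sum given a rectangle. -/
def chr (μ : Measure Ω) (X : ℕ → Ω → E) (f : ℕ → E → ℤ) (b : ℕ → ℤ) (J : Finset ℕ)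
    (A : ℕ → Set E) (N : ℕ) (z : ℂ) : ℂ :=
  ∫ ω, Complex.exp (z * Tsum X f b 0 N ω) ∂(μ[|rect X J A])

lemma integral_cond_smul [IsFiniteMeasure μ] {s : Set Ω} (hpos : 0 < μ.real s) (g : Ω → ℂ) :
    ∫ ω in s, g ω ∂μ = μ.real s * ∫ ω, g ω ∂(μ[|s]) := by
  rw [ProbabilityTheory.cond, integral_smul_measure, ENNReal.toReal_inv, Complex.real_smul,
    Complex.ofReal_inv, ← mul_assoc, ← measureReal_def, mul_inv_cancel₀, one_mul]
  exact_mod_cast hpos.ne'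

namespace Model

lemma integral_prod_rect (h : Model μ X κ f C K b) (hA : ∀ i, MeasurableSet (A i)) {N : ℕ}
    (hJ : J ⊆ Ioc 0 N) (hpos : 0 < μ.real (rect X J A)) (z : ℂ) :
    ∫ ω, ∏ i ∈ Ioc 0 N, (rectW J A i (X i ω) * expPot f b z i (X i ω)) ∂μ =
      μ.real (rect X J A) * chr μ X f b J A N z := by
  have := h.prob
  simp_rw [Finset.prod_mul_distrib, prod_rectW hJ, prod_expPot]
  rw [chr, ← integral_cond_smul hpos, ← integral_indicator (measurableSet_rect h.measX hA)]
  congr 1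
  funext ω
  by_cases hω : ω ∈ rect X J A <;> simp [hω]

lemma norm_expPot_I_sub_one_le (h : Model μ X κ f C K b) (s : ℝ) (n : ℕ) (x : E) :
    ‖expPot f b (Complex.I * s) n x - 1‖ ≤ 2 * K * |s| := by
  rw [expPot_I, mul_comm _ Complex.I]
  refine (Real.norm_exp_I_mul_ofReal_sub_one_le).trans ?_
  rw [Real.norm_eq_abs, abs_mul, mul_comm]
  refine mul_le_mul_of_nonneg_right ?_ (abs_nonneg _)
  have := h.abs_sub_le n x
  exact this

lemma integral_expPot_I_sub_one_le (h : Model μ X κ f C K b) (t : ℝ) {Q : Set ℤ}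
    (hQ : ∀ y : ℤ, y ∉ Q → Complex.exp ((t * y : ℝ) * Complex.I) = 1) (n : ℕ) :
    ∫ x, ‖expPot f b (Complex.I * t) n x - 1‖ ∂(marg μ X n) ≤ 2 * massOf μ X f b Q n := by
  have := h.ellSys.prob n
  have hmQ : MeasurableSet {x | f n x - b n ∈ Q} :=
    (h.measurable_sub n) (Set.to_countable Q).measurableSet
  calc _ ≤ ∫ x, {x | f n x - b n ∈ Q}.indicator (fun _ => (2 : ℝ)) x ∂(marg μ X n) := by
        refine integral_mono (((h.expPot_BM _ n).sub (BM.const 1)).integrable _).norm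
          ((integrable_const _).indicator hmQ) fun x => ?_
        by_cases hx : f n x - b n ∈ Q
        · rw [Set.indicator_of_mem (by exact hx)]
          refine (norm_sub_le _ _).trans ?_
          rw [norm_expPot_I]; norm_num
        · rw [Set.indicator_of_notMem (by exact hx)]
          have := hQ _ hx
          simp only [expPot_I, this, sub_self, norm_zero, le_refl]
    _ = _ := by
        rw [integral_indicator hmQ, setIntegral_const, smul_eq_mul, mul_comm, massOf]

/-- Decay of conditional characteristic functions. -/
lemma norm_chr_le_decay (h : Model μ X κ f C K b) (hA : ∀ i, MeasurableSet (A i)) {N : ℕ}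
    (hJ : J ⊆ Ioc 0 N) (hpos : 0 < μ.real (rect X J A)) (t : ℝ) {Q : Set ℤ} {η : ℝ} (hη : 0 ≤ η)
    (hQ : ∀ y ∈ Q, |y| ≤ 2 * K → η ≤ 1 - Real.cos (t * y)) :
    ‖chr μ X f b J A N (Complex.I * t)‖ ≤ (3 * C ^ 2) ^ J.card *
      Real.exp (-(η / (2 * (2 * K + 1) * C ^ 2) * ∑ i ∈ Ioc 0 N, massOf μ X f b Q i)) := by
  have h1 := h.norm_char_le_decay hA hJ t hη hQ
  rw [h.integral_prod_rect hA hJ hpos, norm_mul, Complex.norm_real, Real.norm_eq_abs,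
    abs_of_pos hpos] at h1
  refine le_of_mul_le_mul_left (h1.trans (le_of_eq ?_)) hpos
  ring

/-- Conditional exponential moments near a resonance are controlled by the moments at zero. -/
lemma norm_chr_le_modulated (h : Model μ X κ f C K b) (hA : ∀ i, MeasurableSet (A i)) {N : ℕ}
    (hJ : J ⊆ Ioc 0 N) (hpos : 0 < μ.real (rect X J A)) (t : ℝ) {Q : Set ℤ}
    (hQ : ∀ y : ℤ, y ∉ Q → Complex.exp ((t * y : ℝ) * Complex.I) = 1) {z : ℂ}
    (hz : ‖z‖ ≤ del C K) :
    ‖chr μ X f b J A N (Complex.I * t + z)‖ ≤ 2 * (4 * C ^ 2) ^ J.card *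
      Real.exp (3200 * C ^ 3 * K * ‖z‖ * ∑ i ∈ Ioc 0 N, massOf μ X f b Q i) *
        ‖∫ ω, Complex.exp (z * Tsum X f b 0 N ω) ∂μ‖ := by
  have hC := h.one_lt
  have h1 := h.modulated_le hz hA hJ (χ := expPot f b (Complex.I * t)) (h.expPot_BM _)
    (fun i x => (norm_expPot_I t i x).le)
  have h2 : ∀ ω i, rectW J A i (X i ω) * expPot f b (Complex.I * t) i (X i ω) *
      expPot f b z i (X i ω) = rectW J A i (X i ω) * expPot f b (Complex.I * t + z) i (X i ω) := by
    intro ω i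
    rw [mul_assoc, expPot, expPot, expPot, ← Complex.exp_add, add_mul]
  simp_rw [h2] at h1
  rw [h.integral_prod_rect hA hJ hpos, norm_mul, Complex.norm_real, Real.norm_eq_abs,
    abs_of_pos hpos] at h1
  refine le_of_mul_le_mul_left (h1.trans ?_) hpos
  have h3 : ∑ i ∈ Ioc 0 N, ∫ x, ‖expPot f b (Complex.I * t) i x - 1‖ ∂(marg μ X i) ≤
      2 * ∑ i ∈ Ioc 0 N, massOf μ X f b Q i := by
    rw [Finset.mul_sum]
    exact Finset.sum_le_sum fun i _ => h.integral_expPot_I_sub_one_le t hQ i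
  calc _ ≤ 2 * (4 * C ^ 2) ^ J.card * Real.exp (1600 * C ^ 3 * K * ‖z‖ *
        (2 * ∑ i ∈ Ioc 0 N, massOf μ X f b Q i)) * μ.real (rect X J A) *
        ‖∫ ω, Complex.exp (z * Tsum X f b 0 N ω) ∂μ‖ := by gcongr
    _ = _ := by ring_nf

/-- Smallness near a resonance from smallness, with free sites, at the resonance. -/
lemma norm_chr_le_clsBd (h : Model μ X κ f C K b) (hA : ∀ i, MeasurableSet (A i)) {N : ℕ}
    (hN : 1 ≤ N) (hJ : J ⊆ Ioc 0 N) (hpos : 0 < μ.real (rect X J A)) (t : ℝ) {Q : Set ℤ}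
    (hQ : ∀ y : ℤ, y ∉ Q → Complex.exp ((t * y : ℝ) * Complex.I) = 1) {m L : ℕ} {a₀ q s : ℝ}
    (hL : 4 * J.card + 3 * m ≤ L) (a00 : 0 ≤ a₀)
    (ha₀ : ClsBd μ X N (expPot f b (Complex.I * t)) L a₀) (hq1 : q ≤ 1)
    (hq : 20 * C ^ 9 * (2 * K * |s|) * (2 * L + 2 * ∑ i ∈ Ioc 0 N, massOf μ X f b Q i) ≤ q) :
    ‖chr μ X f b J A N (Complex.I * t + Complex.I * s)‖ ≤
      (2 * C ^ 4) ^ J.card * (2 * C ^ 2 * m * a₀ + q ^ m) := by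
  have hC := h.one_lt
  have hKp := h.K_pos
  set χ := expPot f b (Complex.I * t) with hχ
  set e := expPot f b (Complex.I * s) with he
  have h3 : ∑ i ∈ Ioc 0 N, ∫ x, ‖χ i x - 1‖ ∂(marg μ X i) ≤
      2 * ∑ i ∈ Ioc 0 N, massOf μ X f b Q i := by
    rw [Finset.mul_sum]
    exact Finset.sum_le_sum fun i _ => h.integral_expPot_I_sub_one_le t hQ i
  have hb := h.chain.clsBd_tilted hC (χ := χ) (e := e) (h.expPot_BM _) (norm_expPot_I s)
    (β := 2 * K * |s|) (by positivity) (h.norm_expPot_I_sub_one_le s) hN a00 ha₀ hq1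
    (le_trans (by gcongr) hq) m (4 * J.card) hL N le_rfl
  have tB : ∀ i, BM (tilted χ e N i) := by
    intro i
    by_cases hi : i ≤ N
    · have : tilted χ e N i = fun x => χ i x * e i x := funext fun x => by simp [tilted, hi]
      rw [this]
      exact (h.expPot_BM _ i).mul (h.expPot_BM _ i)
    · have : tilted χ e N i = χ i := funext fun x => by simp [tilted, hi]
      rw [this]
      exact h.expPot_BM _ i
  have t1 : ∀ i x, ‖tilted χ e N i x‖ = 1 := fun i x => by
    rw [tilted]
    split_ifs
    · rw [norm_mul, norm_expPot_I, norm_expPot_I, one_mul]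
    · rw [norm_expPot_I]
  have hr := h.chain.rect_reduce hC hb hA J J (fun i x => rectW J A i x * tilted χ e N i x)
    ⟨fun i => (rectW_BM hA i).mul (tB i), fun i x => by
      rw [norm_mul, t1, mul_one]; exact norm_rectW_le i x, fun i hi => by
      funext x; rw [rectW_of_notMem hi, one_mul]⟩ (by omega) hJ
    (fun i hi x hx => by rw [rectW_of_mem hi, Set.indicator_of_notMem hx, zero_mul])
  have h4 : ∀ ω, ∏ i ∈ Ioc 0 N, (rectW J A i (X i ω) * tilted χ e N i (X i ω)) =
      ∏ i ∈ Ioc 0 N, (rectW J A i (X i ω) *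
        expPot f b (Complex.I * t + Complex.I * s) i (X i ω)) := by
    intro ω
    refine Finset.prod_congr rfl fun i hi => ?_
    rw [tilted, if_pos (Finset.mem_Ioc.1 hi).2, hχ, he, expPot, expPot, expPot, ← Complex.exp_add,
      add_mul]
  simp only [h4] at hr
  rw [h.integral_prod_rect hA hJ hpos, norm_mul, Complex.norm_real, Real.norm_eq_abs,
    abs_of_pos hpos] at hr
  have hq0 : 0 ≤ q := le_trans (by
    have : 0 ≤ ∑ i ∈ Ioc 0 N, massOf μ X f b Q i :=
      Finset.sum_nonneg fun i _ => measureReal_nonneg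
    positivity) hq
  refine le_of_mul_le_mul_left (hr.trans ?_) hpos
  calc _ ≤ (2 * C ^ 3) ^ J.card * (C ^ J.card * μ.real (rect X J A)) *
        (2 * C ^ 2 * m * a₀ + q ^ m) := by
        gcongr
        exact h.prod_le_rect hA hJ
    _ = _ := by
        rw [show 2 * C ^ 4 = 2 * C ^ 3 * C by ring, mul_pow _ C]; ring

/-- Products with free sites are controlled by conditional characteristic functions. -/
lemma clsBd_of_condChar (h : Model μ X κ f C K b) {N : ℕ} (hN : 1 ≤ N) (t : ℝ) {L : ℕ} {a : ℝ}
    (ha : ∀ j : Fin L → ℕ, (∀ i, j i ∈ Finset.Icc 1 N) →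
      (∫ ω, ‖condChar μ X f t N j ω‖ ∂μ) ≤ a) :
    ClsBd μ X N (expPot f b (Complex.I * t)) L a := by
  classical
  have := h.prob
  intro J' hJ' w hw
  set χ := expPot f b (Complex.I * t) with hχ
  set J := J' ∩ Ioc 0 N with hJ
  set l := J.toList with hl
  have hlen : l.length ≤ L := by
    rw [hl, Finset.length_toList]
    exact (Finset.card_le_card Finset.inter_subset_left).trans hJ'
  set j : Fin L → ℕ := fun i => l.getD i 1 with hj
  have hjm : ∀ i, j i ∈ Finset.Icc 1 N := by
    intro i
    simp only [hj]
    by_cases hi : (i : ℕ) < l.length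
    · rw [List.getD_eq_getElem _ _ hi]
      have : l[(i : ℕ)] ∈ J := by rw [← Finset.mem_toList]; exact List.getElem_mem hi
      have := (Finset.mem_inter.1 this).2
      simp only [Finset.mem_Ioc] at this
      exact Finset.mem_Icc.2 ⟨by omega, this.2⟩
    · rw [List.getD_eq_default _ _ (by omega)]
      exact Finset.mem_Icc.2 ⟨le_rfl, hN⟩
  have hjs : ∀ n ∈ J, ∃ i, j i = n := by
    intro n hn
    rw [← Finset.mem_toList, List.mem_iff_getElem] at hn
    obtain ⟨i, hi, hn⟩ := hn
    exact ⟨⟨i, hi.trans_le hlen⟩, by simp only [hj]; rw [List.getD_eq_getElem _ _ hi]; exact hn⟩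
  refine le_trans ?_ (ha j hjm)
  have hle : sigmaOf X j ≤ ‹MeasurableSpace Ω› :=
    iSup_le fun i => (h.measX (j i)).comap_le
  set c : ℂ := Complex.exp (-(Complex.I * t * ∑ i ∈ Ioc 0 N, (b i : ℂ))) with hc
  have hc1 : ‖c‖ = 1 := by
    rw [hc, show -(Complex.I * t * ∑ i ∈ Ioc 0 N, (b i : ℂ)) =
      ((-(t * ∑ i ∈ Ioc 0 N, (b i : ℝ)) : ℝ) : ℂ) * Complex.I by push_cast; ring]
    exact Complex.norm_exp_ofReal_mul_I _
  set G : Ω → ℂ := fun ω => c * ∏ i ∈ J, (w i (X i ω) * (starRingEnd ℂ) (χ i (X i ω))) with hG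
  set Z : Ω → ℂ := fun ω => Complex.exp (Complex.I * (t : ℂ) * ((S X f N ω : ℤ) : ℂ)) with hZ
  have χ1 : ∀ i x, ‖χ i x‖ = 1 := norm_expPot_I t
  have hprod : ∀ ω, ∏ i ∈ Ioc 0 N, w i (X i ω) = G ω * Z ω := by
    intro ω
    have e1 : ∏ i ∈ Ioc 0 N, χ i (X i ω) = c * Z ω := by
      rw [hχ, prod_expPot, hc, hZ, ← Complex.exp_add]
      congr 1
      have := h.S_eq N ω
      have h2 : ((S X f N ω : ℤ) : ℂ) = Tsum X f b 0 N ω + ∑ i ∈ Ioc 0 N, (b i : ℂ) := by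
        exact_mod_cast congrArg (fun r : ℝ => (r : ℂ)) this
      rw [h2]; ring
    have e2 : ∏ i ∈ Ioc 0 N, w i (X i ω) =
        (∏ i ∈ Ioc 0 N, (w i (X i ω) * (starRingEnd ℂ) (χ i (X i ω)))) *
          ∏ i ∈ Ioc 0 N, χ i (X i ω) := by
      rw [← Finset.prod_mul_distrib]
      refine Finset.prod_congr rfl fun i _ => ?_
      rw [mul_assoc, mul_comm ((starRingEnd ℂ) _), Complex.mul_conj, Complex.normSq_eq_norm_sq, χ1]
      simp
    rw [e2, e1, ← Finset.prod_subset (s₁ := J) Finset.inter_subset_right]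
    · simp only [hG]; ring
    · intro i hi hiJ
      have : i ∉ J' := fun hh => hiJ (Finset.mem_inter.2 ⟨hh, hi⟩)
      rw [hw.eq i this, Complex.mul_conj, Complex.normSq_eq_norm_sq, χ1]
      simp
  have G1 : ∀ ω, ‖G ω‖ ≤ 1 := by
    intro ω
    simp only [hG]
    rw [norm_mul, hc1, one_mul, norm_prod]
    refine Finset.prod_le_one (fun _ _ => norm_nonneg _) fun i _ => ?_
    rw [norm_mul, RCLike.norm_conj, χ1, mul_one]
    exact hw.le_one _ _
  have GM : Measurable[sigmaOf X j] G := by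
    refine Measurable.const_mul (m := sigmaOf X j) ?_ c
    refine Finset.measurable_fun_prod (m := sigmaOf X j) _ fun i hi => ?_
    obtain ⟨k, rfl⟩ := hjs i hi
    have hX : Measurable[sigmaOf X j] (X (j k)) :=
      Measurable.of_comap_le (le_iSup (fun i => MeasurableSpace.comap (X (j i)) _) k)
    exact ((hw.bm _).1.comp hX).mul
      (Complex.continuous_conj.measurable.comp ((h.expPot_BM _ _).1.comp hX))
  have Zm : Measurable Z := by
    have : Measurable fun ω => S X f N ω := by
      unfold S
      exact Finset.measurable_fun_sum _ fun i _ => (h.meas i).comp (h.measX i)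
    refine Complex.measurable_exp.comp (Measurable.const_mul ?_ _)
    exact (measurable_of_countable (fun k : ℤ => (k : ℂ))).comp this
  have Z1 : ∀ ω, ‖Z ω‖ ≤ 1 := by
    intro ω
    simp only [hZ]
    rw [show Complex.I * (t : ℂ) * ((S X f N ω : ℤ) : ℂ) =
      ((t * (S X f N ω : ℝ) : ℝ) : ℂ) * Complex.I by push_cast; ring]
    exact (Complex.norm_exp_ofReal_mul_I _).le
  have Zi : Integrable Z μ := Integrable.of_bound Zm.aestronglyMeasurable 1 (Eventually.of_forall Z1)
  simp_rw [hprod]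
  rw [integral_mul_condExp hle GM G1 Zi]
  refine norm_integral_le_of_norm_le integrable_condExp.norm (Eventually.of_forall fun ω => ?_)
  rw [norm_mul]
  exact mul_le_of_le_one_left (norm_nonneg _) (G1 ω)

end Model

end

/-- Distance to `2πℤ` bounds `1 - cos` from below. -/
lemma one_sub_cos_ge {θ d : ℝ} (hd : 0 ≤ d) (h : ∀ l : ℤ, d ≤ |θ - 2 * Real.pi * l|) :
    2 / Real.pi ^ 2 * d ^ 2 ≤ 1 - Real.cos θ := by
  have hpi := Real.pi_pos
  set l := round (θ / (2 * Real.pi))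
  have h1 := abs_sub_round (θ / (2 * Real.pi))
  have h2 : |θ - 2 * Real.pi * l| ≤ Real.pi := by
    have : θ - 2 * Real.pi * l = (2 * Real.pi) * (θ / (2 * Real.pi) - l) := by field_simp
    rw [this, abs_mul, abs_of_pos (by positivity)]
    nlinarith
  have h3 := Real.cos_le_one_sub_mul_cos_sq h2
  have h4 : Real.cos (θ - 2 * Real.pi * l) = Real.cos θ := by
    have := Real.cos_sub_int_mul_two_pi θ l
    rwa [mul_comm] at this
  rw [h4] at h3
  have h5 : d ^ 2 ≤ (θ - 2 * Real.pi * l) ^ 2 := by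
    rw [← sq_abs (θ - 2 * Real.pi * l)]
    exact pow_le_pow_left₀ hd (h l) 2
  have h6 : 0 ≤ 2 / Real.pi ^ 2 := by positivity
  nlinarith

/-- Number of points of the grid containing the resonant points. -/
def gridSize (K : ℕ) : ℕ := (2 * K).factorial

/-- Points of the grid containing the resonant points. -/
def gridPt (K a : ℕ) : ℝ := 2 * Real.pi * a / gridSize K

lemma gridSize_pos (K : ℕ) : 0 < gridSize K := Nat.factorial_pos _

lemma one_le_gridSize (K : ℕ) : (1 : ℝ) ≤ gridSize K := by
  exact_mod_cast gridSize_pos K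

lemma int_dvd_gridSize {K : ℕ} {y : ℤ} (hy : y ≠ 0) (hyK : |y| ≤ 2 * K) :
    y ∣ (gridSize K : ℤ) := by
  rw [← Int.natAbs_dvd, Int.natCast_dvd_natCast]
  apply Nat.dvd_factorial (Int.natAbs_pos.mpr hy)
  zify
  exact hyK

lemma grid_cos_ge {K a : ℕ} {s : ℝ} (hs : |s| ≤ Real.pi / gridSize K) {y : ℤ} (hy : y ≠ 0)
    (hyK : |y| ≤ 2 * K) : 2 / Real.pi ^ 2 * s ^ 2 ≤ 1 - Real.cos ((gridPt K a + s) * y) := by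
  rw [← sq_abs s]
  refine one_sub_cos_ge (abs_nonneg s) fun l => ?_
  obtain ⟨d, hd⟩ := int_dvd_gridSize hy hyK
  have hL : (gridSize K : ℝ) = y * d := by exact_mod_cast hd
  have hL1 := one_le_gridSize K
  have hy1 : (1 : ℝ) ≤ |(y : ℝ)| := by exact_mod_cast Int.one_le_abs hy
  have hpi := Real.pi_pos
  have hy0 : (y : ℝ) ≠ 0 := by exact_mod_cast hy
  set n : ℤ := a - l * d with hn
  have key : (gridPt K a + s) * y - 2 * Real.pi * l = y * (s + 2 * Real.pi * n / gridSize K) := by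
    have : (gridSize K : ℝ) * l = y * (l * d : ℝ) := by rw [hL]; ring
    unfold gridPt
    rw [hn]
    push_cast
    field_simp
    linear_combination (-2 * Real.pi) * this
  rw [key, abs_mul]
  suffices |s| ≤ |s + 2 * Real.pi * n / gridSize K| by
    nlinarith [abs_nonneg (s + 2 * Real.pi * n / gridSize K)]
  rcases eq_or_ne n 0 with h0 | h0
  · simp [h0]
  · have hn1 : (1 : ℝ) ≤ |(n : ℝ)| := by exact_mod_cast Int.one_le_abs h0
    have h2 : |2 * Real.pi * n / gridSize K| = 2 * (Real.pi / gridSize K) * |(n : ℝ)| := by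
      rw [abs_div, abs_mul, abs_of_pos (by positivity : 0 < 2 * Real.pi),
        abs_of_pos (by linarith : (0 : ℝ) < gridSize K)]
      ring
    have h3 : |2 * Real.pi * n / gridSize K| - |s| ≤ |s + 2 * Real.pi * n / gridSize K| := by
      have := abs_sub_abs_le_abs_sub (2 * Real.pi * n / gridSize K) (-s)
      rwa [abs_neg, sub_neg_eq_add, add_comm (2 * Real.pi * n / gridSize K) s] at this
    have h4 : 0 ≤ Real.pi / gridSize K := by positivity
    nlinarith

lemma exp_gridPt_eq_one_iff {K a : ℕ} {y : ℤ} :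
    Complex.exp ((gridPt K a * y : ℝ) * Complex.I) = 1 ↔ (gridSize K : ℤ) ∣ a * y := by
  have hL := one_le_gridSize K
  have hpi := Real.pi_pos
  rw [Complex.exp_eq_one_iff]
  refine exists_congr fun n => ?_
  have : (gridPt K a * y : ℝ) = 2 * Real.pi * (a * y) / gridSize K := by unfold gridPt; ring
  constructor
  · intro h
    have h1 : ((gridPt K a * y : ℝ) : ℂ) = ((n * (2 * Real.pi) : ℝ) : ℂ) := by
      apply mul_right_cancel₀ Complex.I_ne_zero
      rw [h]; push_cast; ring
    have h2 := Complex.ofReal_injective h1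
    rw [this] at h2
    have h3 : (a * y : ℝ) = gridSize K * n := by
      field_simp at h2
      linarith
    exact_mod_cast h3
  · intro h
    have h3 : (a * y : ℝ) = gridSize K * n := by exact_mod_cast h
    have h2 : (gridPt K a * y : ℝ) = n * (2 * Real.pi) := by
      rw [this, h3]; field_simp
    rw [h2]; push_cast; ring

lemma grid_cos_ge_of_ne_one {K a : ℕ} (hK : 1 ≤ K) {s : ℝ}
    (hs : |s| ≤ Real.pi / (2 * K * gridSize K)) {y : ℤ} (hyK : |y| ≤ 2 * K)
    (hne : Complex.exp ((gridPt K a * y : ℝ) * Complex.I) ≠ 1) :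
    2 / (gridSize K : ℝ) ^ 2 ≤ 1 - Real.cos ((gridPt K a + s) * y) := by
  have hL := one_le_gridSize K
  have hpi := Real.pi_pos
  have hK' : (1 : ℝ) ≤ K := by exact_mod_cast hK
  have := one_sub_cos_ge (θ := (gridPt K a + s) * y) (d := Real.pi / gridSize K) (by positivity) ?_
  · refine le_trans (le_of_eq ?_) this
    field_simp
  intro l
  set n : ℤ := a * y - gridSize K * l with hn
  have hn0 : n ≠ 0 := by
    intro h0
    exact hne (exp_gridPt_eq_one_iff.mpr ⟨l, by linarith⟩)
  have hn1 : (1 : ℝ) ≤ |(n : ℝ)| := by exact_mod_cast Int.one_le_abs hn0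
  have key : (gridPt K a + s) * y - 2 * Real.pi * l = 2 * Real.pi * n / gridSize K + s * y := by
    unfold gridPt
    rw [hn]
    push_cast
    field_simp
    ring
  have h2 : |2 * Real.pi * n / gridSize K| = 2 * (Real.pi / gridSize K) * |(n : ℝ)| := by
    rw [abs_div, abs_mul, abs_of_pos (by positivity : 0 < 2 * Real.pi),
      abs_of_pos (by linarith : (0 : ℝ) < gridSize K)]
    ring
  have h3 : |s * y| ≤ Real.pi / gridSize K := by
    rw [abs_mul]
    have : |(y : ℝ)| ≤ 2 * K := by exact_mod_cast hyK
    calc |s| * |(y : ℝ)| ≤ Real.pi / (2 * K * gridSize K) * (2 * K) := by gcongr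
      _ = _ := by field_simp
  have h4 := abs_sub_abs_le_abs_sub (2 * Real.pi * n / gridSize K) (-(s * y))
  rw [abs_neg, sub_neg_eq_add] at h4
  rw [key]
  have h5 : 0 ≤ Real.pi / gridSize K := by positivity
  nlinarith

lemma isResonant_gridPt {K a : ℕ} (ha : a < gridSize K) {y : ℤ} (hy : y ≠ 0)
    (hyK : |y| ≤ 2 * K) (h : Complex.exp ((gridPt K a * y : ℝ) * Complex.I) = 1) :
    IsResonant K (gridPt K a) := by
  obtain ⟨l, hl⟩ := exp_gridPt_eq_one_iff.mp h
  have hL := gridSize_pos K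
  have h1 : a * y.natAbs = gridSize K * l.natAbs := by
    have := congrArg Int.natAbs hl
    simpa [Int.natAbs_mul] using this
  have hy' : 0 < y.natAbs := Int.natAbs_pos.mpr hy
  refine ⟨l.natAbs, y.natAbs, hy', by zify; exact hyK, ?_, ?_⟩
  · by_contra hcon
    push Not at hcon
    have : gridSize K * y.natAbs ≤ gridSize K * l.natAbs := Nat.mul_le_mul_left _ hcon
    have : a * y.natAbs < gridSize K * y.natAbs := Nat.mul_lt_mul_of_pos_right ha hy'
    omega
  · unfold gridPt
    have h2 : (a : ℝ) * y.natAbs = gridSize K * l.natAbs := by exact_mod_cast h1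
    have h3 : (0 : ℝ) < y.natAbs := by exact_mod_cast hy'
    have h4 : (0 : ℝ) < gridSize K := by exact_mod_cast hL
    rw [div_eq_div_iff h4.ne' h3.ne']
    linear_combination 2 * Real.pi * h2

lemma IsResonant.exists_gridPt {K : ℕ} {t : ℝ} (h : IsResonant K t) :
    ∃ a < gridSize K, t = gridPt K a := by
  obtain ⟨l, m, hm, hmK, hlm, rfl⟩ := h
  obtain ⟨d, hd⟩ : m ∣ gridSize K := Nat.dvd_factorial hm hmK
  have hL := gridSize_pos K
  have hd0 : 0 < d := by
    rcases Nat.eq_zero_or_pos d with h | h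
    · subst h; omega
    · exact h
  refine ⟨l * d, ?_, ?_⟩
  · rw [hd]; exact Nat.mul_lt_mul_of_pos_right hlm hd0
  · unfold gridPt
    rw [hd]
    push_cast
    have : (d : ℝ) ≠ 0 := by exact_mod_cast hd0.ne'
    have : (m : ℝ) ≠ 0 := by exact_mod_cast hm.ne'
    field_simp

lemma gridPt_zero (K : ℕ) : gridPt K 0 = 0 := by simp [gridPt]

/-- The Gaussian Fourier transform of monomials. -/
def gaussFour (k : ℕ) (x : ℝ) : ℂ :=
  ∫ h : ℝ, (Complex.I * h) ^ k * Complex.exp (-(h : ℂ) ^ 2 / 2) * Complex.exp (-(Complex.I * h * x))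

lemma norm_gaussFour_integrand (k : ℕ) (x h : ℝ) :
    ‖(Complex.I * h) ^ k * Complex.exp (-(h : ℂ) ^ 2 / 2) * Complex.exp (-(Complex.I * h * x))‖
      = |h| ^ k * Real.exp (-(1 / 2) * h ^ 2) := by
  have h1 : (-(h : ℂ) ^ 2 / 2) = ((-(1 / 2) * h ^ 2 : ℝ) : ℂ) := by push_cast; ring
  have h2 : -(Complex.I * h * x) = ((-(h * x) : ℝ) : ℂ) * Complex.I := by push_cast; ring
  rw [norm_mul, norm_mul, norm_pow, norm_mul, Complex.norm_I, h1, h2, Complex.norm_exp_ofReal_mul_I,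
    Complex.norm_exp_ofReal]
  simp

lemma integrable_pow_mul_gauss (k : ℕ) :
    Integrable fun h : ℝ => |h| ^ k * Real.exp (-(1 / 2) * h ^ 2) := by
  have := (integrable_rpow_mul_exp_neg_mul_sq (b := 1 / 2) (by norm_num)
    (s := k) (by have : (0 : ℝ) ≤ k := Nat.cast_nonneg k; linarith)).norm
  simpa using this

lemma integrable_gaussFour (k : ℕ) (x : ℝ) :
    Integrable fun h : ℝ => (Complex.I * h) ^ k * Complex.exp (-(h : ℂ) ^ 2 / 2) *
      Complex.exp (-(Complex.I * h * x)) := by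
  refine (integrable_pow_mul_gauss k).mono' (by fun_prop) (Eventually.of_forall fun h => ?_)
  rw [norm_gaussFour_integrand]

lemma hasDerivAt_gaussFour (k : ℕ) (x : ℝ) :
    HasDerivAt (gaussFour k) (-gaussFour (k + 1) x) x := by
  have := (hasDerivAt_integral_of_dominated_loc_of_deriv_le (μ := volume) (𝕜 := ℝ) (s := Set.univ)
    (F := fun (x h : ℝ) => (Complex.I * h) ^ k * Complex.exp (-(h : ℂ) ^ 2 / 2) *
      Complex.exp (-(Complex.I * h * x)))
    (F' := fun (x h : ℝ) => -((Complex.I * h) ^ (k + 1) * Complex.exp (-(h : ℂ) ^ 2 / 2) *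
      Complex.exp (-(Complex.I * h * x))))
    (bound := fun h : ℝ => |h| ^ (k + 1) * Real.exp (-(1 / 2) * h ^ 2)) (x₀ := x)
    Filter.univ_mem (Eventually.of_forall fun y => (integrable_gaussFour k y).1)
    (integrable_gaussFour k x) (integrable_gaussFour (k + 1) x).neg.1
    (Eventually.of_forall fun h y _ => by rw [norm_neg, norm_gaussFour_integrand])
    (integrable_pow_mul_gauss (k + 1)) (Eventually.of_forall fun h y _ => ?_)).2
  · rw [integral_neg] at this
    exact this
  · have h1 : HasDerivAt (fun y : ℝ => -(Complex.I * h * (y : ℂ))) (-(Complex.I * h)) y := by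
      have := ((hasDerivAt_id y).ofReal_comp.const_mul (Complex.I * h)).fun_neg
      simpa using this
    have h2 := (h1.cexp.const_mul ((Complex.I * h) ^ k * Complex.exp (-(h : ℂ) ^ 2 / 2)))
    refine h2.congr_deriv ?_
    ring

lemma gaussFour_zero (x : ℝ) :
    gaussFour 0 x = ((√(2 * Real.pi) * Real.exp (-(x ^ 2 / 2)) : ℝ) : ℂ) := by
  have h := fourierIntegral_gaussian (b := 1 / 2) (by norm_num) (-x : ℂ)
  have h1 : gaussFour 0 x = ∫ h : ℝ, Complex.exp (Complex.I * (-x : ℂ) * h) *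
      Complex.exp (-(1 / 2) * (h : ℂ) ^ 2) := by
    unfold gaussFour
    congr 1 with h
    rw [pow_zero, one_mul, mul_comm]
    congr 1 <;> congr 1 <;> ring
  rw [h1, h]
  push_cast
  congr 1
  · have : ((Real.pi : ℂ) / (1 / 2)) = ((2 * Real.pi : ℝ) : ℂ) := by push_cast; ring
    rw [this, Real.sqrt_eq_rpow, Complex.ofReal_cpow (by positivity)]
    norm_num
  · congr 1; ring

/-- Hermite polynomials over the reals. -/
def herm (k : ℕ) : Polynomial ℝ := (Polynomial.hermite k).map (Int.castRingHom ℝ)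

lemma herm_monic (k : ℕ) : (herm k).Monic := (Polynomial.hermite_monic k).map _

lemma natDegree_herm (k : ℕ) : (herm k).natDegree = k := by
  unfold herm
  rw [(Polynomial.hermite_monic k).natDegree_map, Polynomial.natDegree_hermite]

lemma deriv_iter_gaussFour (k : ℕ) :
    (fun x => gaussFour k x) = fun x => (-1) ^ k * deriv^[k] (gaussFour 0) x := by
  induction k with
  | zero => simp
  | succ k ih =>
    funext x
    rw [Function.iterate_succ_apply']
    have h1 : deriv^[k] (gaussFour 0) = fun x => (-1) ^ k * gaussFour k x := by
      funext y
      rw [congrFun ih y, ← mul_assoc, ← pow_add, ← two_mul]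
      simp
    rw [h1, deriv_const_mul _ (hasDerivAt_gaussFour k x).differentiableAt,
      (hasDerivAt_gaussFour k x).deriv, pow_succ]
    have : ((-1 : ℂ) ^ k) * (-1) ^ k = 1 := by rw [← pow_add, ← two_mul]; simp
    linear_combination (-gaussFour (k + 1) x) * this

lemma gaussFour_eq (k : ℕ) (x : ℝ) :
    gaussFour k x = ((2 * Real.pi * ((herm k).eval x * gaussDensity x) : ℝ) : ℂ) := by
  have h0 : ∀ k, deriv^[k] (gaussFour 0) = fun x =>
      ((√(2 * Real.pi) * deriv^[k] (fun y => Real.exp (-(y ^ 2 / 2))) x : ℝ) : ℂ) := by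
    intro k
    induction k with
    | zero => funext x; simp [gaussFour_zero]
    | succ k ih =>
      rw [Function.iterate_succ_apply', ih]
      funext x
      rw [Function.iterate_succ_apply']
      have hd : DifferentiableAt ℝ (deriv^[k] (fun y => Real.exp (-(y ^ 2 / 2)))) x := by
        have hc : ContDiff ℝ (k + 1 : ℕ) (fun y : ℝ => Real.exp (-(y ^ 2 / 2))) := by fun_prop
        rw [← iteratedDeriv_eq_iterate]
        exact (hc.differentiable_iteratedDeriv k (by exact_mod_cast Nat.lt_succ_self k)) x
      exact (hd.hasDerivAt.const_mul √(2 * Real.pi)).ofReal_comp.deriv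
  have h1 := congrFun (deriv_iter_gaussFour k) x
  rw [h1, h0]
  beta_reduce
  rw [Polynomial.deriv_gaussian_eq_hermite_mul_gaussian]
  have h2 : Polynomial.aeval x (Polynomial.hermite k) = (herm k).eval x := by
    unfold herm
    rw [Polynomial.aeval_def, Polynomial.eval_map]
    rfl
  rw [h2]
  unfold gaussDensity
  have h3 : (√(2 * Real.pi)) ^ 2 = 2 * Real.pi := Real.sq_sqrt (by positivity)
  have h4 : √(2 * Real.pi) ≠ 0 := by positivity
  have h5 : ((-1 : ℝ) ^ k) * (-1) ^ k = 1 := by rw [← pow_add, ← two_mul]; simp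
  have h6 : -x ^ 2 / 2 = -(x ^ 2 / 2) := by ring
  rw [h6]
  have : ((2 * Real.pi * ((herm k).eval x * ((√(2 * Real.pi))⁻¹ * Real.exp (-(x ^ 2 / 2)))) : ℝ))
      = (-1) ^ k * (√(2 * Real.pi) * ((-1) ^ k * (herm k).eval x * Real.exp (-(x ^ 2 / 2)))) := by
    nth_rw 1 [← h3]
    field_simp
    linear_combination (-(herm k).eval x) * h5
  rw [this]
  push_cast
  ring

/-- Coefficients in a basis of monic polynomials are controlled by values at nodes. -/
lemma exists_interpolation (p : ℕ → Polynomial ℝ) (hp : ∀ k, (p k).Monic)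
    (hd : ∀ k, (p k).natDegree = k) {y : ℕ → ℝ} (hy : Function.Injective y) (n : ℕ) :
    ∃ A : ℝ, 0 ≤ A ∧ ∀ (c : ℕ → ℂ) (δ : ℝ), 0 ≤ δ →
      (∀ j < n, ‖∑ k ∈ range n, c k * (((p k).eval (y j) : ℝ) : ℂ)‖ ≤ δ) →
      ∀ k < n, ‖c k‖ ≤ A * δ := by
  set M : Matrix (Fin n) (Fin n) ℝ := Matrix.of fun i j => (p j).eval (y i) with hM
  have hdet : M.det ≠ 0 := by
    have := Matrix.det_eval_matrixOfPolynomials_eq_det_vandermonde (fun i : Fin n => y i)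
      (fun i : Fin n => p i) (fun i => hd i) (fun i => hp i)
    rw [hM, ← this, Matrix.det_vandermonde_ne_zero_iff]
    exact fun i j hij => Fin.ext (hy hij)
  have hinv : M⁻¹ * M = 1 := Matrix.nonsing_inv_mul _ (Ne.isUnit hdet)
  refine ⟨∑ i, ∑ j, |M⁻¹ i j|, by positivity, fun c δ hδ hc k hk => ?_⟩
  have key : c k = ∑ j : Fin n, (M⁻¹ ⟨k, hk⟩ j : ℂ) *
      ∑ i ∈ range n, c i * (((p i).eval (y j) : ℝ) : ℂ) := by
    have h1 : ∀ i : Fin n, ∑ j : Fin n, (M⁻¹ ⟨k, hk⟩ j : ℂ) * ((M j i : ℝ) : ℂ) =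
        if (⟨k, hk⟩ : Fin n) = i then 1 else 0 := by
      intro i
      have := congrFun (congrFun hinv ⟨k, hk⟩) i
      rw [Matrix.mul_apply, Matrix.one_apply] at this
      have h2 := congrArg (fun x : ℝ => (x : ℂ)) this
      push_cast at h2
      rw [h2]
      split_ifs <;> simp
    calc c k = ∑ i : Fin n, (if (⟨k, hk⟩ : Fin n) = i then 1 else 0) * c i := by simp
      _ = ∑ i : Fin n, (∑ j : Fin n, (M⁻¹ ⟨k, hk⟩ j : ℂ) * ((M j i : ℝ) : ℂ)) * c i := by
        simp_rw [h1]
      _ = _ := by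
        simp_rw [← Fin.sum_univ_eq_sum_range (fun i => c i * (((p i).eval (y _) : ℝ) : ℂ)) n,
          Finset.sum_mul, Finset.mul_sum]
        rw [Finset.sum_comm]
        refine Finset.sum_congr rfl fun j _ => Finset.sum_congr rfl fun i _ => ?_
        simp only [hM, Matrix.of_apply]
        ring
  rw [key]
  calc _ ≤ ∑ j : Fin n, |M⁻¹ ⟨k, hk⟩ j| * δ := by
        refine norm_sum_le_of_le _ fun j _ => ?_
        rw [norm_mul, Complex.norm_real, Real.norm_eq_abs]
        exact mul_le_mul_of_nonneg_left (hc j j.2) (abs_nonneg _)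
    _ = (∑ j : Fin n, |M⁻¹ ⟨k, hk⟩ j|) * δ := by rw [Finset.sum_mul]
    _ ≤ _ := by
        refine mul_le_mul_of_nonneg_right ?_ hδ
        exact Finset.single_le_sum (f := fun i => ∑ j, |M⁻¹ i j|)
          (fun i _ => Finset.sum_nonneg fun j _ => abs_nonneg _) (Finset.mem_univ _)

section law

variable {ι : Type*} [Fintype ι]

/-- Fourier transform of a finite signed measure on `ℤ`. -/
def lawChar (val : ι → ℤ) (v : ι → ℝ) (u : ℝ) : ℂ :=
  ∑ i, (v i : ℂ) * Complex.exp (Complex.I * u * val i)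

/-- Mean of a finite signed measure on `ℤ`. -/
def lawMean (val : ι → ℤ) (v : ι → ℝ) : ℝ := ∑ i, v i * val i

/-- Point masses of a finite signed measure on `ℤ`. -/
def lawMass (val : ι → ℤ) (v : ι → ℝ) (κ : ℤ) : ℝ := ∑ i, if val i = κ then v i else 0

lemma continuous_lawChar (val : ι → ℤ) (v : ι → ℝ) : Continuous (lawChar val v) := by
  unfold lawChar; fun_prop

lemma sum_integral_grid (K : ℕ) {g : ℝ → ℂ} (hg : Continuous g) :
    ∑ a ∈ range (gridSize K), ∫ s in (-(Real.pi / gridSize K))..(Real.pi / gridSize K),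
      g (gridPt K a + s) = ∫ u in (-(Real.pi / gridSize K))..(-(Real.pi / gridSize K) + 2 * Real.pi),
        g u := by
  have hL := one_le_gridSize K
  have h1 : ∀ a : ℕ, ∫ s in (-(Real.pi / gridSize K))..(Real.pi / gridSize K), g (gridPt K a + s)
      = ∫ u in (gridPt K a - Real.pi / gridSize K)..(gridPt K (a + 1) - Real.pi / gridSize K),
        g u := by
    intro a
    rw [intervalIntegral.integral_comp_add_left]
    congr 1
    unfold gridPt
    push_cast
    field_simp
    ring
  simp_rw [h1]
  rw [intervalIntegral.sum_integral_adjacent_intervals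
    (a := fun a => gridPt K a - Real.pi / gridSize K) (fun k _ => hg.intervalIntegrable _ _)]
  congr 1
  · simp [gridPt_zero]
  · unfold gridPt; field_simp; ring

lemma integral_exp_int (x : ℝ) (y : ℤ) :
    ∫ u in x..(x + 2 * Real.pi), Complex.exp (Complex.I * u * y) =
      if y = 0 then ((2 * Real.pi : ℝ) : ℂ) else 0 := by
  split_ifs with hy
  · subst hy; simp
  · have hc : Complex.I * y ≠ 0 := mul_ne_zero Complex.I_ne_zero (by exact_mod_cast hy)
    have h1 : ∀ u : ℝ, Complex.exp (Complex.I * u * y) = Complex.exp (Complex.I * y * u) :=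
      fun u => by congr 1; ring
    simp_rw [h1]
    rw [integral_exp_mul_complex hc]
    have h2 : Complex.I * y * ((x + 2 * Real.pi : ℝ) : ℂ) =
        Complex.I * y * x + y * (2 * Real.pi * Complex.I) := by push_cast; ring
    rw [h2, Complex.exp_add, Complex.exp_int_mul_two_pi_mul_I]
    simp

lemma lawMass_inversion (K : ℕ) (val : ι → ℤ) (v : ι → ℝ) (κ : ℤ) :
    ∑ a ∈ range (gridSize K), ∫ s in (-(Real.pi / gridSize K))..(Real.pi / gridSize K),
      lawChar val v (gridPt K a + s) * Complex.exp (-(Complex.I * ((gridPt K a + s : ℝ) : ℂ) * κ))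
      = ((2 * Real.pi * lawMass val v κ : ℝ) : ℂ) := by
  rw [sum_integral_grid K (g := fun u => lawChar val v u * Complex.exp (-(Complex.I * (u : ℂ) * κ)))
    ((continuous_lawChar val v).mul (by fun_prop))]
  have h1 : ∀ u : ℝ, lawChar val v u * Complex.exp (-(Complex.I * (u : ℂ) * κ)) =
      ∑ i, (v i : ℂ) * Complex.exp (Complex.I * u * ((val i - κ : ℤ) : ℂ)) := by
    intro u
    unfold lawChar
    rw [Finset.sum_mul]
    refine Finset.sum_congr rfl fun i _ => ?_
    rw [mul_assoc, ← Complex.exp_add]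
    congr 2
    push_cast
    ring
  simp_rw [h1]
  rw [intervalIntegral.integral_finsetSum
    (fun i _ => Continuous.intervalIntegrable (by fun_prop) _ _)]
  simp_rw [intervalIntegral.integral_const_mul, integral_exp_int, lawMass, sub_eq_zero]
  push_cast
  rw [Finset.mul_sum]
  refine Finset.sum_congr rfl fun i _ => ?_
  split_ifs <;> push_cast <;> ring

end law

/-- The oscillating Gaussian approximation of point masses. -/
def mainTerm (K D : ℕ) (c : ℕ → ℕ → ℂ) (x : ℝ) (κ : ℤ) : ℂ :=
  ∑ a ∈ range (gridSize K), Complex.exp (-(Complex.I * gridPt K a * κ)) *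
    ∑ k ∈ range D, c a k * (((herm k).eval x * gaussDensity x : ℝ) : ℂ)

/-- The local approximation of characteristic functions near a grid point. -/
def localApprox (D : ℕ) (c : ℕ → ℂ) (σ s : ℝ) : ℂ :=
  Complex.exp (-((σ * s : ℝ) : ℂ) ^ 2 / 2) *
    ∑ k ∈ range D, c k * (Complex.I * ((σ * s : ℝ) : ℂ)) ^ k

lemma integrable_localApprox_mul (D : ℕ) (c : ℕ → ℂ) {σ : ℝ} (hσ : 0 < σ) (w : ℝ) :
    Integrable (fun s : ℝ => localApprox D c σ s * Complex.exp (-(Complex.I * s * w))) ∧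
    ∫ s : ℝ, localApprox D c σ s * Complex.exp (-(Complex.I * s * w)) =
      ((σ⁻¹ * (2 * Real.pi) : ℝ) : ℂ) *
        ∑ k ∈ range D, c k * (((herm k).eval (w / σ) * gaussDensity (w / σ) : ℝ) : ℂ) := by
  set G : ℕ → ℝ → ℂ := fun k h => (Complex.I * h) ^ k * Complex.exp (-(h : ℂ) ^ 2 / 2) *
    Complex.exp (-(Complex.I * h * ((w / σ : ℝ) : ℂ))) with hG
  have h1 : (fun s : ℝ => localApprox D c σ s * Complex.exp (-(Complex.I * s * w))) =
      fun s => ∑ k ∈ range D, c k * G k (σ * s) := by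
    funext s
    unfold localApprox
    rw [Finset.mul_sum, Finset.sum_mul]
    refine Finset.sum_congr rfl fun k _ => ?_
    have : Complex.I * ((σ * s : ℝ) : ℂ) * ((w / σ : ℝ) : ℂ) = Complex.I * s * w := by
      have : (σ : ℂ) ≠ 0 := by exact_mod_cast hσ.ne'
      push_cast
      field_simp
    simp only [hG]
    rw [this]
    ring
  have hinterp : ∀ k ∈ range D, Integrable fun s : ℝ => c k * G k (σ * s) := fun k _ =>
    ((integrable_gaussFour k (w / σ)).comp_mul_left' hσ.ne').const_mul _
  rw [h1]
  refine ⟨integrable_finsetSum _ hinterp, ?_⟩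
  rw [integral_finsetSum _ hinterp, Finset.mul_sum]
  refine Finset.sum_congr rfl fun k _ => ?_
  rw [integral_const_mul, Measure.integral_comp_mul_left (G k)]
  have h2 : ∫ h, G k h = gaussFour k (w / σ) := rfl
  rw [h2, gaussFour_eq, abs_of_pos (by positivity)]
  rw [Complex.real_smul]
  push_cast
  ring

lemma norm_localApprox_le (D : ℕ) {c : ℕ → ℂ} {B : ℝ} (hc : ∀ k < D, ‖c k‖ ≤ B) (σ s : ℝ) :
    ‖localApprox D c σ s‖ ≤
      B * (∑ k ∈ range D, (k.factorial : ℝ)) * Real.exp 1 * Real.exp (-(σ * s) ^ 2 / 4) := by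
  set h := σ * s with hh
  unfold localApprox
  rw [norm_mul, ← hh]
  have h1 : (-(h : ℂ) ^ 2 / 2) = ((-h ^ 2 / 2 : ℝ) : ℂ) := by push_cast; ring
  rw [h1, Complex.norm_exp_ofReal]
  have h2 : ‖∑ k ∈ range D, c k * (Complex.I * (h : ℂ)) ^ k‖ ≤
      ∑ k ∈ range D, B * ((k.factorial : ℝ) * Real.exp |h|) := by
    refine norm_sum_le_of_le _ fun k hk => ?_
    rw [norm_mul, norm_pow, norm_mul, Complex.norm_I, one_mul, Complex.norm_real, Real.norm_eq_abs]
    have h3 := Real.pow_div_factorial_le_exp |h| (abs_nonneg _) k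
    have h4 : |h| ^ k ≤ k.factorial * Real.exp |h| := by
      rw [div_le_iff₀ (by positivity)] at h3
      linarith
    have hB := hc k (Finset.mem_range.mp hk)
    exact mul_le_mul hB h4 (by positivity) ((norm_nonneg _).trans hB)
  have h3 : Real.exp (-h ^ 2 / 2) * Real.exp |h| ≤ Real.exp 1 * Real.exp (-h ^ 2 / 4) := by
    rw [← Real.exp_add, ← Real.exp_add]
    apply Real.exp_le_exp.mpr
    nlinarith [sq_abs h, sq_nonneg (|h| - 2)]
  rcases Nat.eq_zero_or_pos D with hD | hD
  · subst hD; simp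
  have hB : 0 ≤ B := (norm_nonneg _).trans (hc 0 hD)
  calc _ ≤ Real.exp (-h ^ 2 / 2) * ∑ k ∈ range D, B * ((k.factorial : ℝ) * Real.exp |h|) := by
        gcongr
    _ = B * (∑ k ∈ range D, (k.factorial : ℝ)) * (Real.exp (-h ^ 2 / 2) * Real.exp |h|) := by
        rw [← Finset.mul_sum, ← Finset.sum_mul]; ring
    _ ≤ B * (∑ k ∈ range D, (k.factorial : ℝ)) * (Real.exp 1 * Real.exp (-h ^ 2 / 4)) := by
        gcongr
    _ = _ := by ring

/-- Fourier inversion of local approximations. -/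
lemma exists_fourier_inversion (K D : ℕ) : ∃ A : ℝ, 0 < A ∧
    ∀ {ι : Type} [Fintype ι] (val : ι → ℤ) (v : ι → ℝ) (c : ℕ → ℕ → ℂ) (B σ ρ η e : ℝ),
      (∀ a < gridSize K, ∀ k < D, ‖c a k‖ ≤ B) → 0 ≤ B → 1 ≤ σ → 0 ≤ ρ → ρ < Real.pi / gridSize K →
      (∀ a < gridSize K, ∀ s : ℝ, |s| ≤ ρ →
        ‖lawChar val v (gridPt K a + s) * Complex.exp (-(Complex.I * s * e))
          - localApprox D (c a) σ s‖ ≤ η) →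
      (∀ a < gridSize K, ∀ s : ℝ, ρ ≤ |s| → |s| ≤ Real.pi / gridSize K →
        ‖lawChar val v (gridPt K a + s)‖ ≤ η) →
      ∀ κ : ℤ, ‖(lawMass val v κ : ℂ) - ((σ⁻¹ : ℝ) : ℂ) * mainTerm K D c ((κ - e) / σ) κ‖
        ≤ A * (η + B * Real.exp (-(ρ * σ) ^ 2 / 8)) := by
  set L := gridSize K with hLdef
  have hL : (1 : ℝ) ≤ L := one_le_gridSize K
  have hpi := Real.pi_pos
  set A₁ : ℝ := (∑ k ∈ range D, (k.factorial : ℝ)) * Real.exp 1 with hA₁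
  have hA₁0 : 0 ≤ A₁ := by positivity
  set A₂ : ℝ := ∫ s : ℝ, Real.exp (-(1 / 8) * s ^ 2) with hA₂
  have hA₂0 : 0 ≤ A₂ := by positivity
  refine ⟨L * (2 * (Real.pi / L) + A₁ * A₂) + 1, by positivity, ?_⟩
  intro ι _ val v c B σ ρ η e hcB hB hσ hρ hρL hnear hfar κ
  set p : ℝ := Real.pi / L with hp
  have hp0 : 0 < p := by positivity
  have hη : 0 ≤ η := (norm_nonneg _).trans (hnear 0 (gridSize_pos K) 0 (by simpa using hρ))
  set x : ℝ := κ - e with hx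
  set F : ℕ → ℝ → ℂ := fun a s => (Set.Ioc (-p) p).indicator
    (fun s => lawChar val v (gridPt K a + s) * Complex.exp (-(Complex.I * s * κ))) s with hF
  set G : ℕ → ℝ → ℂ := fun a s => localApprox D (c a) σ s * Complex.exp (-(Complex.I * s * x))
    with hG
  have hcont : ∀ a, Continuous fun s : ℝ => lawChar val v (gridPt K a + s) *
      Complex.exp (-(Complex.I * s * κ)) := fun a =>
    ((continuous_lawChar val v).comp (by fun_prop)).mul (by fun_prop)
  have hFint : ∀ a, Integrable (F a) := fun a => by
    rw [hF, integrable_indicator_iff measurableSet_Ioc]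
    exact (hcont a).integrableOn_Ioc
  have hFval : ∀ a, ∫ s, F a s = ∫ s in (-p)..p, lawChar val v (gridPt K a + s) *
      Complex.exp (-(Complex.I * s * κ)) := fun a => by
    rw [hF, integral_indicator measurableSet_Ioc, intervalIntegral.integral_of_le (by linarith)]
  have hGint : ∀ a, Integrable (G a) := fun a =>
    (integrable_localApprox_mul D (c a) (by linarith) x).1
  set T : ℝ := B * Real.exp (-(ρ * σ) ^ 2 / 8) with hT
  have hT0 : 0 ≤ T := by positivity
  have htail : ∀ a < L, ∀ s : ℝ, ρ ≤ |s| → ‖G a s‖ ≤ A₁ * T * Real.exp (-(1 / 8) * s ^ 2) := by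
    intro a ha s hs
    have h1 : ‖Complex.exp (-(Complex.I * s * x))‖ = 1 := by
      have : -(Complex.I * s * x) = ((-(s * x) : ℝ) : ℂ) * Complex.I := by push_cast; ring
      rw [this, Complex.norm_exp_ofReal_mul_I]
    simp only [hG]
    rw [norm_mul, h1, mul_one]
    refine (norm_localApprox_le D (hcB a ha) σ s).trans ?_
    have h2 : Real.exp (-(σ * s) ^ 2 / 4) ≤
        Real.exp (-(ρ * σ) ^ 2 / 8) * Real.exp (-(1 / 8) * s ^ 2) := by
      rw [← Real.exp_add]
      apply Real.exp_le_exp.mpr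
      have h3 : ρ ^ 2 ≤ s ^ 2 := by rw [← sq_abs s]; exact pow_le_pow_left₀ hρ hs 2
      have h4 : 1 ≤ σ ^ 2 := one_le_pow₀ hσ
      nlinarith [mul_le_mul_of_nonneg_left h3 (sq_nonneg σ),
        mul_le_mul_of_nonneg_right h4 (sq_nonneg s)]
    calc _ = B * A₁ * Real.exp (-(σ * s) ^ 2 / 4) := by rw [hA₁]; ring
      _ ≤ B * A₁ * (Real.exp (-(ρ * σ) ^ 2 / 8) * Real.exp (-(1 / 8) * s ^ 2)) := by gcongr
      _ = _ := by rw [hT]; ring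
  have hbd : ∀ a < L, ∀ s : ℝ, ‖F a s - G a s‖ ≤
      (Set.Icc (-p) p).indicator (fun _ => η) s + A₁ * T * Real.exp (-(1 / 8) * s ^ 2) := by
    intro a ha s
    have hex : 0 ≤ A₁ * T * Real.exp (-(1 / 8) * s ^ 2) := by positivity
    have hn1 : ‖Complex.exp (-(Complex.I * s * κ))‖ = 1 := by
      have : -(Complex.I * s * κ) = ((-(s * κ) : ℝ) : ℂ) * Complex.I := by push_cast; ring
      rw [this, Complex.norm_exp_ofReal_mul_I]
    have hn2 : ‖Complex.exp (-(Complex.I * s * x))‖ = 1 := by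
      have : -(Complex.I * s * x) = ((-(s * x) : ℝ) : ℂ) * Complex.I := by push_cast; ring
      rw [this, Complex.norm_exp_ofReal_mul_I]
    rcases le_or_gt |s| ρ with hs | hs
    · have hsp := abs_lt.mp (hs.trans_lt hρL)
      have h1 : s ∈ Set.Ioc (-p) p := ⟨hsp.1, hsp.2.le⟩
      have h2 : s ∈ Set.Icc (-p) p := ⟨hsp.1.le, hsp.2.le⟩
      simp only [hF, hG, Set.indicator_of_mem h1, Set.indicator_of_mem h2]
      have h3 : Complex.exp (-(Complex.I * s * κ)) =
          Complex.exp (-(Complex.I * s * e)) * Complex.exp (-(Complex.I * s * x)) := by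
        rw [← Complex.exp_add]
        congr 1
        rw [hx]; push_cast; ring
      rw [h3, ← mul_assoc, ← sub_mul, norm_mul, hn2, mul_one]
      exact (hnear a ha s hs).trans (by linarith)
    · have hFb : ‖F a s‖ ≤ (Set.Icc (-p) p).indicator (fun _ => η) s := by
        by_cases h1 : s ∈ Set.Ioc (-p) p
        · have h2 : s ∈ Set.Icc (-p) p := ⟨h1.1.le, h1.2⟩
          simp only [hF, Set.indicator_of_mem h1, Set.indicator_of_mem h2]
          rw [norm_mul, hn1, mul_one]
          exact hfar a ha s hs.le (abs_le.mpr h2)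
        · simp only [hF, Set.indicator_of_notMem h1, norm_zero]
          exact Set.indicator_nonneg (fun _ _ => hη) _
      exact (norm_sub_le _ _).trans (add_le_add hFb (htail a ha s hs.le))
  have hI : ∀ a < L, ‖(∫ s, F a s) - ∫ s, G a s‖ ≤ 2 * p * η + A₁ * T * A₂ := by
    intro a ha
    rw [← integral_sub (hFint a) (hGint a)]
    have hi1 : Integrable ((Set.Icc (-p) p).indicator (fun _ : ℝ => η)) := by
      rw [integrable_indicator_iff measurableSet_Icc]
      exact continuous_const.integrableOn_Icc
    have hi2 : Integrable fun s : ℝ => A₁ * T * Real.exp (-(1 / 8) * s ^ 2) :=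
      (integrable_exp_neg_mul_sq (by norm_num)).const_mul _
    refine (norm_integral_le_of_norm_le (hi1.add hi2) (Eventually.of_forall (hbd a ha))).trans ?_
    simp only [Pi.add_apply]
    rw [integral_add hi1 hi2, integral_indicator measurableSet_Icc, integral_const_mul]
    simp only [integral_const, MeasurableSet.univ, measureReal_restrict_apply, Set.univ_inter,
      Real.volume_real_Icc, smul_eq_mul]
    rw [max_eq_left (by linarith)]
    apply le_of_eq
    ring
  have hfin : ((2 * Real.pi : ℝ) : ℂ) * ((lawMass val v κ : ℂ) -
      ((σ⁻¹ : ℝ) : ℂ) * mainTerm K D c (x / σ) κ) =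
      ∑ a ∈ range L, Complex.exp (-(Complex.I * gridPt K a * κ)) *
        ((∫ s, F a s) - ∫ s, G a s) := by
    have h1 : ((2 * Real.pi : ℝ) : ℂ) * (lawMass val v κ : ℂ) =
        ∑ a ∈ range L, Complex.exp (-(Complex.I * gridPt K a * κ)) * ∫ s, F a s := by
      rw [← Complex.ofReal_mul, ← lawMass_inversion K]
      refine Finset.sum_congr rfl fun a _ => ?_
      rw [hFval, ← intervalIntegral.integral_const_mul]
      congr 1
      funext s
      rw [mul_left_comm, ← Complex.exp_add]
      congr 2
      push_cast
      ring
    have h2 : ((2 * Real.pi : ℝ) : ℂ) * (((σ⁻¹ : ℝ) : ℂ) * mainTerm K D c (x / σ) κ) =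
        ∑ a ∈ range L, Complex.exp (-(Complex.I * gridPt K a * κ)) * ∫ s, G a s := by
      unfold mainTerm
      rw [Finset.mul_sum, Finset.mul_sum]
      refine Finset.sum_congr rfl fun a _ => ?_
      rw [(integrable_localApprox_mul D (c a) (by linarith : 0 < σ) x).2]
      push_cast
      ring
    rw [mul_sub, h1, h2, ← Finset.sum_sub_distrib]
    exact Finset.sum_congr rfl fun a _ => by ring
  have hn : ‖((2 * Real.pi : ℝ) : ℂ) * ((lawMass val v κ : ℂ) -
      ((σ⁻¹ : ℝ) : ℂ) * mainTerm K D c (x / σ) κ)‖ ≤ L * (2 * p * η + A₁ * T * A₂) := by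
    rw [hfin]
    refine (norm_sum_le_of_le (range L) (fun a ha => ?_)).trans
      (le_of_eq (by rw [Finset.sum_const, Finset.card_range, nsmul_eq_mul]))
    have : -(Complex.I * gridPt K a * κ) = ((-(gridPt K a * κ) : ℝ) : ℂ) * Complex.I := by
      push_cast; ring
    rw [norm_mul, this, Complex.norm_exp_ofReal_mul_I, one_mul]
    exact hI a (Finset.mem_range.mp ha)
  rw [norm_mul, Complex.norm_real, Real.norm_eq_abs, abs_of_pos (by positivity)] at hn
  have hpi1 : 1 ≤ 2 * Real.pi := by linarith [Real.pi_gt_three]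
  have hn' := (le_mul_of_one_le_left (norm_nonneg _) hpi1).trans hn
  refine hn'.trans ?_
  have e1 : 2 * p * η ≤ 2 * p * (η + T) := by gcongr; linarith
  have e2 : A₁ * T * A₂ ≤ A₁ * A₂ * (η + T) := by nlinarith [mul_nonneg (mul_nonneg hA₁0 hA₂0) hη]
  calc L * (2 * p * η + A₁ * T * A₂) ≤ L * (2 * p * (η + T) + A₁ * A₂ * (η + T)) := by gcongr
    _ = L * (2 * p + A₁ * A₂) * (η + T) := by ring
    _ ≤ _ := by nlinarith

section

variable {μ : Measure Ω} {X : ℕ → Ω → E} {κ : ℕ → Kernel E E} {f : ℕ → E → ℤ} {C : ℝ} {K : ℕ}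
  {b : ℕ → ℤ} {J : Finset ℕ} {A : ℕ → Set E}

lemma sum_massOf_compl_zero (N : ℕ) :
    ∑ i ∈ Ioc 0 N, massOf μ X f b {0}ᶜ i = offP μ X f b N := by
  refine Finset.sum_congr rfl fun i _ => ?_
  simp [massOf, offp, sub_eq_zero]

/-- The increments that are visible at a grid point. -/
def visible (K a : ℕ) : Set ℤ := {y | Complex.exp ((gridPt K a * y : ℝ) * Complex.I) ≠ 1}

/-- Expected number of visible increments. -/
def visMass (μ : Measure Ω) (X : ℕ → Ω → E) (f : ℕ → E → ℤ) (b : ℕ → ℤ) (K a N : ℕ) : ℝ :=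
  ∑ i ∈ Ioc 0 N, massOf μ X f b (visible K a) i

namespace Model

lemma chr_univ (h : Model μ X κ f C K b) (N : ℕ) (z : ℂ) :
    chr μ X f b ∅ (fun _ => Set.univ) N z = ∫ ω, Complex.exp (z * Tsum X f b 0 N ω) ∂μ := by
  have := h.prob
  simp [chr, rect]

lemma exists_offP_le (h : Model μ X κ f C K b) : ∃ A : ℝ, 0 < A ∧ ∀ N,
    offP μ X f b N ≤ A * VN μ X f N := by
  have := h.prob
  obtain ⟨A, hA, hq⟩ := h.exists_quadratic
  have hC := h.one_lt
  have hK := h.K_pos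
  have hpi := Real.pi_pos
  have hL := one_le_gridSize K
  set c₁ : ℝ := 2 / Real.pi ^ 2 / (2 * (2 * K + 1) * C ^ 2) with hc₁
  have hc₁0 : 0 < c₁ := by positivity
  set s : ℝ := min (Real.pi / gridSize K) (min (del C K / 4) (c₁ / (2 * A))) with hs
  have hs0 : 0 < s := by
    have := h.del_pos
    refine lt_min (by positivity) (lt_min (by positivity) (by positivity))
  have hs1 : s ≤ Real.pi / gridSize K := min_le_left _ _
  have hs2 : s ≤ del C K / 4 := (min_le_right _ _).trans (min_le_left _ _)
  have hs3 : A * s ≤ c₁ / 2 := by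
    have : s ≤ c₁ / (2 * A) := (min_le_right _ _).trans (min_le_right _ _)
    calc A * s ≤ A * (c₁ / (2 * A)) := by gcongr
      _ = _ := by field_simp
  refine ⟨c₁⁻¹, by positivity, fun N => ?_⟩
  set P := offP μ X f b N with hP
  have hP0 : 0 ≤ P := offP_nonneg N
  obtain ⟨w, hw, he⟩ := (hq N).2 (Complex.I * s) (by
    rw [norm_mul, Complex.norm_I, Complex.norm_real, Real.norm_eq_abs, abs_of_pos hs0]; linarith)
  have h1 := h.norm_chr_le_decay (J := ∅) (A := fun _ => Set.univ) (fun _ => MeasurableSet.univ)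
    (N := N) (by simp) (by simp [rect]) s (Q := {0}ᶜ) (η := 2 / Real.pi ^ 2 * s ^ 2)
    (by positivity) (fun y hy hyK => by
      have := grid_cos_ge (K := K) (a := 0) (s := s) (by rwa [abs_of_pos hs0]) (y := y) hy hyK
      rwa [gridPt_zero, zero_add] at this)
  rw [h.chr_univ, he, Complex.norm_exp, sum_massOf_compl_zero, Finset.card_empty, pow_zero, one_mul,
    Real.exp_le_exp] at h1
  have h2 : (Complex.I * s * ((∫ ω, Tsum X f b 0 N ω ∂μ : ℝ) : ℂ) +
      VN μ X f N * (Complex.I * s) ^ 2 / 2 + w).re = -(VN μ X f N * s ^ 2 / 2) + w.re := by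
    have e1 : Complex.I * s * ((∫ ω, Tsum X f b 0 N ω ∂μ : ℝ) : ℂ) =
        ((s * ∫ ω, Tsum X f b 0 N ω ∂μ : ℝ) : ℂ) * Complex.I := by push_cast; ring
    have e2 : (VN μ X f N : ℂ) * (Complex.I * s) ^ 2 / 2 =
        ((-(VN μ X f N * s ^ 2 / 2) : ℝ) : ℂ) := by
      rw [mul_pow, Complex.I_sq]; push_cast; ring
    rw [e1, e2, Complex.add_re, Complex.add_re, Complex.re_ofReal_mul, Complex.I_re,
      Complex.ofReal_re]
    ring
  rw [h2] at h1
  have h3 : -‖w‖ ≤ w.re := (abs_le.mp (Complex.abs_re_le_norm w)).1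
  rw [norm_mul, Complex.norm_I, one_mul, Complex.norm_real, Real.norm_eq_abs, abs_of_pos hs0] at hw
  have h4 : A * P * s ^ 3 ≤ c₁ / 2 * (P * s ^ 2) := by
    calc A * P * s ^ 3 = (A * s) * (P * s ^ 2) := by ring
      _ ≤ _ := by gcongr
  have h5 : 2 / Real.pi ^ 2 * s ^ 2 / (2 * (2 * K + 1) * C ^ 2) * P = c₁ * (P * s ^ 2) := by
    rw [hc₁]; ring
  rw [h5] at h1
  have h6 : c₁ * P * s ^ 2 ≤ VN μ X f N * s ^ 2 := by nlinarith
  have h7 : c₁ * P ≤ VN μ X f N := le_of_mul_le_mul_right h6 (by positivity)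
  rw [inv_mul_eq_div, le_div_iff₀ hc₁0]
  linarith

lemma hasDerivAt_chr (h : Model μ X κ f C K b) (hpos : 0 < μ.real (rect X J A)) (N : ℕ) (z : ℂ) :
    HasDerivAt (chr μ X f b J A N)
      (∫ ω, (Tsum X f b 0 N ω : ℂ) * Complex.exp (z * Tsum X f b 0 N ω) ∂(μ[|rect X J A])) z := by
  have := h.prob
  have : IsProbabilityMeasure (μ[|rect X J A]) := cond_isProbabilityMeasure (by
    intro h0; rw [measureReal_def, h0] at hpos; simp at hpos)
  have := hasDerivAt_expInt (μ := μ[|rect X J A]) (G := fun _ => 1) (b := 1) measurable_const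
    (by simp) (h.measurable_Tsum 0 N) (h.abs_Tsum_le 0 N) z
  simp only [one_mul] at this
  exact this

lemma exists_mean_close (h : Model μ X κ f C K b) (ℓ : ℕ) : ∃ B : ℝ, 0 ≤ B ∧
    ∀ (N : ℕ) (J : Finset ℕ) (A : ℕ → Set E), J.card ≤ ℓ → J ⊆ Ioc 0 N →
      (∀ i, MeasurableSet (A i)) → 0 < μ.real (rect X J A) →
      |(∫ ω, Tsum X f b 0 N ω ∂μ) - ∫ ω, Tsum X f b 0 N ω ∂(μ[|rect X J A])| ≤ B := by
  have := h.prob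
  have hC := h.one_lt
  have hd := h.del_pos
  set B₁ : ℝ := 2 * (4 * C ^ 2) ^ ℓ with hB₁
  have hB₁0 : 0 ≤ B₁ := by positivity
  refine ⟨B₁ / (del C K / 2), by positivity, fun N J A hJ hJN hA hpos => ?_⟩
  have hprob : IsProbabilityMeasure (μ[|rect X J A]) := cond_isProbabilityMeasure (by
    intro h0; rw [measureReal_def, h0] at hpos; simp at hpos)
  have hu := h.hasDerivAt_chr (J := ∅) (A := fun _ => Set.univ) (by simp [rect]) N
  have hc := h.hasDerivAt_chr hpos N
  set Λ := chr μ X f b ∅ (fun _ => Set.univ) N with hΛ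
  set φ := chr μ X f b J A N with hφ
  have hne : ∀ z : ℂ, ‖z‖ ≤ del C K → Λ z ≠ 0 := by
    intro z hz
    have := h.lam_ne_zero hz N 0
    rwa [h.lam_eq, zero_add, ← h.chr_univ] at this
  have hC1 : 1 ≤ 4 * C ^ 2 := by nlinarith
  have hbd : ∀ z : ℂ, ‖z‖ ≤ del C K → ‖φ z / Λ z‖ ≤ B₁ := by
    intro z hz
    have h1 := h.norm_chr_le_modulated hA hJN hpos 0 (Q := ∅) (by simp) hz
    simp only [Complex.ofReal_zero, mul_zero, zero_add] at h1
    have h2 : ∑ i ∈ Ioc 0 N, massOf μ X f b ∅ i = 0 := by simp [massOf]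
    rw [h2, mul_zero, Real.exp_zero, mul_one, ← h.chr_univ] at h1
    rw [norm_div, div_le_iff₀ (norm_pos_iff.mpr (hne z hz))]
    refine h1.trans ?_
    refine mul_le_mul_of_nonneg_right ?_ (norm_nonneg _)
    rw [hB₁]
    gcongr
  have hdiff : ∀ z : ℂ, ‖z‖ ≤ del C K → DifferentiableAt ℂ (fun z => φ z / Λ z) z := fun z hz =>
    (hc z).differentiableAt.div (hu z).differentiableAt (hne z hz)
  have hder := Complex.norm_deriv_le_of_forall_mem_sphere_norm_le (f := fun z => φ z / Λ z) (c := 0)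
    (R := del C K / 2) (C := B₁) (by positivity)
    (DifferentiableOn.diffContOnCl (s := Metric.ball 0 (del C K / 2)) (by
      intro z hz
      have := Metric.closure_ball_subset_closedBall hz
      rw [mem_closedBall_zero_iff] at this
      exact (hdiff z (by linarith)).differentiableWithinAt))
    (fun z hz => hbd z (by rw [mem_sphere_zero_iff_norm.mp hz]; linarith))
  have hΛ0 : Λ 0 = 1 := by simp [hΛ, h.chr_univ]
  have hφ0 : φ 0 = 1 := by simp [hφ, chr]
  have hd0 := ((hc 0).div (hu 0) (by simp [hΛ0])).deriv
  have e2 : (fun z => φ z / Λ z) = φ / Λ := rfl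
  rw [e2, hd0, hΛ0, hφ0] at hder
  simp only [zero_mul, Complex.exp_zero, mul_one, one_pow, div_one, one_mul] at hder
  rw [integral_complex_ofReal, integral_complex_ofReal, ← Complex.ofReal_sub, Complex.norm_real,
    Real.norm_eq_abs, abs_sub_comm] at hder
  simpa [rect] using hder

end Model

end

section

variable {μ : Measure Ω} {X : ℕ → Ω → E} {κ : ℕ → Kernel E E} {f : ℕ → E → ℤ} {C : ℝ} {K : ℕ}
  {b : ℕ → ℤ}

namespace Model

/-- Taylor approximation near grid points with few visible increments. -/
lemma exists_taylor (h : Model μ X κ f C K b) (ℓ D : ℕ) {R : ℝ} (hR : 0 ≤ R) :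
    ∃ B τ₀ : ℝ, 0 ≤ B ∧ 4 ≤ τ₀ ∧ ∀ (N : ℕ) (τ : ℝ), τ₀ ≤ τ → τ ^ 12 = VN μ X f N →
      ∀ (J : Finset ℕ) (A : ℕ → Set E), J.card ≤ ℓ → J ⊆ Ioc 0 N →
      (∀ i, MeasurableSet (A i)) → 0 < μ.real (rect X J A) →
      ∀ a : ℕ, visMass μ X f b K a N ≤ R * Real.log τ →
      ∃ c : ℕ → ℂ, (∀ k, ‖c k‖ ≤ B) ∧ ∀ s : ℝ, |s| ≤ (τ ^ 5)⁻¹ →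
        ‖chr μ X f b J A N (Complex.I * gridPt K a + Complex.I * s) *
          Complex.exp (-(Complex.I * s * (∫ ω, Tsum X f b 0 N ω ∂(μ[|rect X J A]) : ℝ))) -
          localApprox D c (τ ^ 6) s‖ ≤ B * (τ ^ D)⁻¹ := by
  have := h.prob
  have hC := h.one_lt
  have hK := h.K_pos
  have hd := h.del_pos
  obtain ⟨A₁, hA₁, hq⟩ := h.exists_quadratic
  obtain ⟨A₂, hA₂, hP⟩ := h.exists_offP_le
  obtain ⟨B₂, hB₂, hmean⟩ := h.exists_mean_close ℓ
  have hC1 : 1 ≤ 4 * C ^ 2 := by nlinarith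
  set B₁ : ℝ := 2 * (4 * C ^ 2) ^ ℓ * Real.exp (3200 * C ^ 3 * K * R) *
    Real.exp (B₂ + A₁ * A₂) with hB₁
  have hB₁0 : 0 ≤ B₁ := by positivity
  refine ⟨2 * B₁ * 2 ^ D, max 4 (4 / del C K), by positivity, le_max_left _ _, ?_⟩
  intro N τ hτ hV J A hJ hJN hA hpos a hM
  have hτ4 : 4 ≤ τ := (le_max_left _ _).trans hτ
  have hτ1 : 1 ≤ τ := by linarith
  have hτ0 : 0 < τ := by linarith
  have hτd : (τ ^ 4)⁻¹ ≤ del C K / 4 := by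
    have h1 : 4 / del C K ≤ τ := (le_max_right _ _).trans hτ
    have h2 : τ ≤ τ ^ 4 := le_self_pow₀ hτ1 (by norm_num)
    rw [inv_le_comm₀ (by positivity) (by positivity), inv_div]
    linarith
  set eT : ℝ := ∫ ω, Tsum X f b 0 N ω ∂(μ[|rect X J A]) with heT
  set H : ℂ → ℂ := fun z => chr μ X f b J A N (Complex.I * gridPt K a + z) *
    Complex.exp (-(z * eT) - VN μ X f N * z ^ 2 / 2) with hH
  set ρ : ℝ := (τ ^ 4)⁻¹ / 2 with hρ
  have hρ0 : 0 < ρ := by positivity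
  have hdiff : Differentiable ℂ H := by
    have h1 : Differentiable ℂ (chr μ X f b J A N) := fun z =>
      (h.hasDerivAt_chr hpos N z).differentiableAt
    have h2 : Differentiable ℂ fun z => chr μ X f b J A N (Complex.I * gridPt K a + z) :=
      h1.comp (by fun_prop)
    exact h2.mul (by fun_prop)
  have hbd : ∀ z ∈ Metric.ball (0 : ℂ) (2 * ρ), ‖H z‖ ≤ B₁ := by
    intro z hz
    rw [mem_ball_zero_iff] at hz
    have hz1 : ‖z‖ ≤ (τ ^ 4)⁻¹ := by rw [hρ] at hz; linarith
    have hz2 : ‖z‖ ≤ del C K / 4 := hz1.trans hτd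
    have h1 := h.norm_chr_le_modulated hA hJN hpos (gridPt K a) (Q := visible K a)
      (fun y hy => by simpa [visible] using hy) (z := z) (by linarith)
    obtain ⟨w, hw, he⟩ := (hq N).2 z hz2
    rw [he] at h1
    simp only [hH]
    rw [norm_mul]
    have hinv1 : (τ ^ 4)⁻¹ ≤ 1 := inv_le_one_of_one_le₀ (one_le_pow₀ hτ1)
    have hz3 : ‖z‖ ≤ 1 := hz1.trans hinv1
    have e1 : ‖z‖ * visMass μ X f b K a N ≤ R := by
      have hl : Real.log τ ≤ τ ^ 4 :=
        (Real.log_le_self hτ0.le).trans (le_self_pow₀ hτ1 (by norm_num))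
      have hl0 : 0 ≤ Real.log τ := Real.log_nonneg hτ1
      calc ‖z‖ * visMass μ X f b K a N ≤ ‖z‖ * (R * Real.log τ) := by gcongr
        _ ≤ (τ ^ 4)⁻¹ * (R * τ ^ 4) := by gcongr
        _ = R := by field_simp
    have e2 : ‖w‖ ≤ A₁ * A₂ := by
      refine hw.trans ?_
      calc A₁ * offP μ X f b N * ‖z‖ ^ 3 ≤ A₁ * (A₂ * τ ^ 12) * ((τ ^ 4)⁻¹) ^ 3 := by
            have := hP N
            rw [← hV] at this
            gcongr
        _ = _ := by field_simp
    have e3 : ‖Complex.exp (z * (∫ ω, Tsum X f b 0 N ω ∂μ : ℝ) + VN μ X f N * z ^ 2 / 2 + w)‖ *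
        ‖Complex.exp (-(z * eT) - VN μ X f N * z ^ 2 / 2)‖ ≤ Real.exp (B₂ + A₁ * A₂) := by
      rw [← norm_mul, ← Complex.exp_add]
      have : z * (∫ ω, Tsum X f b 0 N ω ∂μ : ℝ) + VN μ X f N * z ^ 2 / 2 + w +
          (-(z * eT) - VN μ X f N * z ^ 2 / 2) =
          z * (((∫ ω, Tsum X f b 0 N ω ∂μ) - eT : ℝ) : ℂ) + w := by push_cast; ring
      rw [this]
      refine (Complex.norm_exp_le_exp_norm _).trans (Real.exp_le_exp.mpr ?_)
      refine (norm_add_le _ _).trans (add_le_add ?_ e2)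
      rw [norm_mul, Complex.norm_real, Real.norm_eq_abs]
      have := hmean N J A hJ hJN hA hpos
      calc ‖z‖ * |(∫ ω, Tsum X f b 0 N ω ∂μ) - eT| ≤ 1 * B₂ := by gcongr
        _ = B₂ := one_mul _
    have e4 : Real.exp (3200 * C ^ 3 * K * ‖z‖ * ∑ i ∈ Ioc 0 N, massOf μ X f b (visible K a) i) ≤
        Real.exp (3200 * C ^ 3 * K * R) := by
      apply Real.exp_le_exp.mpr
      have : 3200 * C ^ 3 * K * ‖z‖ * ∑ i ∈ Ioc 0 N, massOf μ X f b (visible K a) i =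
        3200 * C ^ 3 * K * (‖z‖ * visMass μ X f b K a N) := by rw [visMass]; ring
      rw [this]
      gcongr
    calc _ ≤ 2 * (4 * C ^ 2) ^ J.card * Real.exp (3200 * C ^ 3 * K * ‖z‖ *
          ∑ i ∈ Ioc 0 N, massOf μ X f b (visible K a) i) * ‖Complex.exp (z *
          (∫ ω, Tsum X f b 0 N ω ∂μ : ℝ) + VN μ X f N * z ^ 2 / 2 + w)‖ *
          ‖Complex.exp (-(z * eT) - VN μ X f N * z ^ 2 / 2)‖ := by gcongr
      _ ≤ 2 * (4 * C ^ 2) ^ ℓ * Real.exp (3200 * C ^ 3 * K * R) * Real.exp (B₂ + A₁ * A₂) := by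
          rw [mul_assoc]
          gcongr
      _ = B₁ := rfl
  have hσ0 : (0 : ℝ) < τ ^ 6 := by positivity
  have hσc : ((τ ^ 6 : ℝ) : ℂ) ≠ 0 := by exact_mod_cast hσ0.ne'
  refine ⟨fun k => if k < D then tay H k / ((τ ^ 6 : ℝ) : ℂ) ^ k else 0, fun k => ?_,
    fun s hs => ?_⟩
  · simp only
    split_ifs with hk
    · have h1 := norm_tay_le hρ0 hdiff.differentiableOn hbd k
      rw [norm_div, norm_pow, Complex.norm_real, Real.norm_eq_abs, abs_of_pos hσ0]
      have h2 : B₁ / ρ ^ k = B₁ * 2 ^ k * (τ ^ 4) ^ k := by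
        rw [hρ, div_pow, inv_pow]; field_simp
      rw [h2] at h1
      have h3 : (2 : ℝ) ^ k ≤ 2 ^ D := pow_le_pow_right₀ (by norm_num) hk.le
      have h4 : (τ ^ 4) ^ k ≤ (τ ^ 6) ^ k := by
        gcongr
        norm_num
      rw [div_le_iff₀ (by positivity)]
      calc ‖tay H k‖ ≤ B₁ * 2 ^ k * (τ ^ 4) ^ k := h1
        _ ≤ B₁ * 2 ^ D * (τ ^ 6) ^ k := by gcongr
        _ ≤ _ := by
          have : 0 ≤ B₁ * 2 ^ D * (τ ^ 6) ^ k := by positivity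
          nlinarith
    · simp only [norm_zero]; positivity
  · have hz : ‖Complex.I * (s : ℂ)‖ = |s| := by
      rw [norm_mul, Complex.norm_I, one_mul, Complex.norm_real, Real.norm_eq_abs]
    have hsr : |s| ≤ ρ / 2 := by
      refine hs.trans ?_
      have : (τ ^ 5)⁻¹ = (τ ^ 4)⁻¹ * τ⁻¹ := by rw [← mul_inv, ← pow_succ]
      rw [this, hρ]
      have h1 : τ⁻¹ ≤ 1 / 4 := by rw [inv_le_comm₀ hτ0 (by norm_num)]; norm_num; exact hτ4
      have h2 : 0 < (τ ^ 4)⁻¹ := by positivity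
      nlinarith
    have ht := norm_sub_taylor_le hρ0 hdiff.differentiableOn hbd D (z := Complex.I * s)
      (by rw [hz]; exact hsr)
    rw [hz] at ht
    set G : ℂ := Complex.exp (-((τ ^ 6 * s : ℝ) : ℂ) ^ 2 / 2) with hG
    have hGn : ‖G‖ ≤ 1 := by
      have : (-((τ ^ 6 * s : ℝ) : ℂ) ^ 2 / 2) = ((-(τ ^ 6 * s) ^ 2 / 2 : ℝ) : ℂ) := by
        push_cast; ring
      rw [hG, this, Complex.norm_exp_ofReal, Real.exp_le_one_iff]
      nlinarith [sq_nonneg (τ ^ 6 * s)]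
    have e1 : chr μ X f b J A N (Complex.I * gridPt K a + Complex.I * s) *
        Complex.exp (-(Complex.I * s * eT)) = G * H (Complex.I * s) := by
      simp only [hH, hG]
      rw [mul_left_comm, ← Complex.exp_add]
      congr 2
      rw [← hV]
      push_cast
      rw [mul_pow, mul_pow, Complex.I_sq]
      ring
    have e2 : localApprox D (fun k => if k < D then tay H k / ((τ ^ 6 : ℝ) : ℂ) ^ k else 0) (τ ^ 6) s
        = G * ∑ k ∈ range D, tay H k * (Complex.I * s) ^ k := by
      unfold localApprox
      congr 1
      refine Finset.sum_congr rfl fun k hk => ?_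
      beta_reduce
      rw [if_pos (Finset.mem_range.mp hk), Complex.ofReal_mul, mul_left_comm, mul_pow]
      field_simp
    rw [e1, e2, ← mul_sub, norm_mul]
    have h5 : |s| / ρ ≤ 2 * τ⁻¹ := by
      rw [div_le_iff₀ hρ0, hρ]
      refine hs.trans (le_of_eq ?_)
      field_simp
    calc ‖G‖ * ‖H (Complex.I * s) - ∑ k ∈ range D, tay H k * (Complex.I * s) ^ k‖
        ≤ 1 * (2 * B₁ * (|s| / ρ) ^ D) := by gcongr
      _ ≤ 1 * (2 * B₁ * (2 * τ⁻¹) ^ D) := by gcongr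
      _ = _ := by rw [mul_pow, inv_pow]; ring

lemma exists_near_decay (h : Model μ X κ f C K b) (ℓ D : ℕ) :
    ∃ R B : ℝ, 0 ≤ R ∧ 0 ≤ B ∧ ∀ (N : ℕ) (τ : ℝ), 1 ≤ τ →
      ∀ (J : Finset ℕ) (A : ℕ → Set E), J.card ≤ ℓ → J ⊆ Ioc 0 N →
      (∀ i, MeasurableSet (A i)) → 0 < μ.real (rect X J A) →
      ∀ a : ℕ, R * Real.log τ < visMass μ X f b K a N →
      ∀ s : ℝ, |s| ≤ Real.pi / (2 * K * gridSize K) →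
        ‖chr μ X f b J A N (Complex.I * gridPt K a + Complex.I * s)‖ ≤ B * (τ ^ D)⁻¹ := by
  have hC := h.one_lt
  have hK := h.K_pos
  have hL := one_le_gridSize K
  set c₁ : ℝ := 2 / (gridSize K : ℝ) ^ 2 / (2 * (2 * K + 1) * C ^ 2) with hc₁
  have hc₁0 : 0 < c₁ := by positivity
  refine ⟨D / c₁, (3 * C ^ 2) ^ ℓ, by positivity, by positivity, ?_⟩
  intro N τ hτ J A hJ hJN hA hpos a hM s hs
  have h1 := h.norm_chr_le_decay hA hJN hpos (gridPt K a + s) (Q := visible K a)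
    (η := 2 / (gridSize K : ℝ) ^ 2) (by positivity)
    (fun y hy hyK => grid_cos_ge_of_ne_one h.one_le hs hyK hy)
  rw [Complex.ofReal_add, mul_add] at h1
  refine h1.trans ?_
  have hC1 : 1 ≤ 3 * C ^ 2 := by nlinarith
  have h2 : Real.exp (-(c₁ * visMass μ X f b K a N)) ≤ (τ ^ D)⁻¹ := by
    have h3 : D * Real.log τ ≤ c₁ * visMass μ X f b K a N := by
      have : c₁ * (D / c₁ * Real.log τ) ≤ c₁ * visMass μ X f b K a N := by gcongr
      calc _ = c₁ * (D / c₁ * Real.log τ) := by field_simp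
        _ ≤ _ := this
    rw [Real.exp_neg]
    refine inv_anti₀ (by positivity) ?_
    rw [← Real.exp_log (by linarith : 0 < τ), ← Real.exp_nat_mul]
    exact Real.exp_le_exp.mpr h3
  gcongr
  exact h2

lemma exists_far_decay (h : Model μ X κ f C K b) (ℓ D : ℕ) :
    ∃ B : ℝ, 0 ≤ B ∧ ∀ (N : ℕ) (τ : ℝ), 1 ≤ τ → τ ^ 12 = VN μ X f N →
      ∀ (J : Finset ℕ) (A : ℕ → Set E), J.card ≤ ℓ → J ⊆ Ioc 0 N →
      (∀ i, MeasurableSet (A i)) → 0 < μ.real (rect X J A) →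
      ∀ (a : ℕ) (s : ℝ), (τ ^ 5)⁻¹ ≤ |s| → |s| ≤ Real.pi / gridSize K →
        ‖chr μ X f b J A N (Complex.I * gridPt K a + Complex.I * s)‖ ≤ B * (τ ^ D)⁻¹ := by
  have hC := h.one_lt
  have hK := h.K_pos
  have hpi := Real.pi_pos
  obtain ⟨A₁, hA₁, hq⟩ := h.exists_quadratic
  set c₁ : ℝ := 2 / Real.pi ^ 2 / (2 * (2 * K + 1) * C ^ 2) / A₁ with hc₁
  have hc₁0 : 0 < c₁ := by positivity
  refine ⟨(3 * C ^ 2) ^ ℓ * (D.factorial / c₁ ^ D), by positivity, ?_⟩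
  intro N τ hτ hV J A hJ hJN hA hpos a s hs1 hs2
  have hτ0 : 0 < τ := by linarith
  have h1 := h.norm_chr_le_decay hA hJN hpos (gridPt K a + s) (Q := {0}ᶜ)
    (η := 2 / Real.pi ^ 2 * s ^ 2) (by positivity)
    (fun y hy hyK => grid_cos_ge hs2 hy hyK)
  rw [Complex.ofReal_add, mul_add, sum_massOf_compl_zero] at h1
  refine h1.trans ?_
  have hC1 : 1 ≤ 3 * C ^ 2 := by nlinarith
  have h3 : c₁ * τ ≤ 2 / Real.pi ^ 2 * s ^ 2 / (2 * (2 * K + 1) * C ^ 2) * offP μ X f b N := by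
    have h4 : τ ^ 12 ≤ A₁ * offP μ X f b N := by rw [hV]; exact (hq N).1
    have h5 : ((τ ^ 5)⁻¹) ^ 2 ≤ s ^ 2 := by
      rw [← sq_abs s]; exact pow_le_pow_left₀ (by positivity) hs1 2
    have h6 : τ ≤ s ^ 2 * (A₁ * offP μ X f b N) := by
      calc τ ≤ τ ^ 2 := le_self_pow₀ hτ (by norm_num)
        _ = ((τ ^ 5)⁻¹) ^ 2 * τ ^ 12 := by field_simp
        _ ≤ _ := by gcongr
    calc c₁ * τ ≤ c₁ * (s ^ 2 * (A₁ * offP μ X f b N)) := by gcongr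
      _ = _ := by rw [hc₁]; field_simp
  have h2 : Real.exp (-(2 / Real.pi ^ 2 * s ^ 2 / (2 * (2 * K + 1) * C ^ 2) * offP μ X f b N)) ≤
      D.factorial / c₁ ^ D * (τ ^ D)⁻¹ := by
    have h7 := Real.pow_div_factorial_le_exp (c₁ * τ) (by positivity) D
    have h8 : (D.factorial / c₁ ^ D * (τ ^ D)⁻¹) = ((c₁ * τ) ^ D / D.factorial)⁻¹ := by
      rw [mul_pow]; field_simp
    rw [h8, Real.exp_neg]
    exact inv_anti₀ (by positivity) (h7.trans (Real.exp_le_exp.mpr h3))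
  calc _ ≤ (3 * C ^ 2) ^ ℓ * (D.factorial / c₁ ^ D * (τ ^ D)⁻¹) := by gcongr
    _ = _ := by ring

lemma exists_isResonant (h : Model μ X κ f C K b) {R : ℝ} (hR : 0 ≤ R) :
    ∃ τ₀ : ℝ, 1 ≤ τ₀ ∧ ∀ (N : ℕ) (τ : ℝ), τ₀ ≤ τ → τ ^ 12 = VN μ X f N → ∀ a < gridSize K,
      visMass μ X f b K a N ≤ R * Real.log τ → IsResonant K (gridPt K a) := by
  obtain ⟨A₁, hA₁, hq⟩ := h.exists_quadratic
  refine ⟨A₁ * R + 1, by nlinarith, fun N τ hτ hV a ha hM => ?_⟩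
  by_contra hcon
  have hτ1 : 1 ≤ τ := by nlinarith
  have h1 : ∀ i, massOf μ X f b (visible K a) i = massOf μ X f b {0}ᶜ i := by
    intro i
    unfold massOf
    congr 1
    ext x
    have hyK : |f i x - b i| ≤ 2 * (K : ℤ) := by exact_mod_cast h.abs_sub_le i x
    simp only [Set.mem_ofPred_eq, visible, Set.mem_compl_iff, Set.mem_singleton_iff]
    constructor
    · intro hne h0
      rw [h0] at hne
      simp at hne
    · intro h0 h2
      exact hcon (isResonant_gridPt ha h0 hyK h2)
  have h2 : visMass μ X f b K a N = offP μ X f b N := by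
    unfold visMass
    simp_rw [h1]
    exact sum_massOf_compl_zero N
  rw [h2] at hM
  have h3 : τ ^ 12 ≤ A₁ * offP μ X f b N := by rw [hV]; exact (hq N).1
  have h4 : Real.log τ ≤ τ := Real.log_le_self (by linarith)
  have h5 : τ ^ 2 ≤ τ ^ 12 := pow_le_pow_right₀ hτ1 (by norm_num)
  have h6 : A₁ * offP μ X f b N ≤ A₁ * R * τ := by
    calc A₁ * offP μ X f b N ≤ A₁ * (R * Real.log τ) := by gcongr
      _ ≤ A₁ * (R * τ) := by gcongr
      _ = _ := by ring
  nlinarith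

end Model

end

/-- The possible values of `S_N`. -/
abbrev Vals (K N : ℕ) : Type := {y : ℤ // y ∈ Finset.Icc (-(N * K : ℤ)) (N * K)}

/-- A finite law is approximated near grid points and small away from them. -/
def Approx (K D : ℕ) {ι : Type*} [Fintype ι] (val : ι → ℤ) (σ ρ η : ℝ) (c : ℕ → ℕ → ℂ)
    (v : ι → ℝ) : Prop :=
  (∀ a < gridSize K, ∀ s : ℝ, |s| ≤ ρ →
    ‖lawChar val v (gridPt K a + s) * Complex.exp (-(Complex.I * s * (lawMean val v : ℝ)))
      - localApprox D (c a) σ s‖ ≤ η) ∧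
  ∀ a < gridSize K, ∀ s : ℝ, ρ ≤ |s| → |s| ≤ Real.pi / gridSize K →
    ‖lawChar val v (gridPt K a + s)‖ ≤ η

section

variable {μ : Measure Ω} {X : ℕ → Ω → E} {κ : ℕ → Kernel E E} {f : ℕ → E → ℤ} {C : ℝ} {K : ℕ}
  {b : ℕ → ℤ}

/-- The law of `S_N` under a measure, as a finite vector. -/
def lawS (ν : Measure Ω) (X : ℕ → Ω → E) (f : ℕ → E → ℤ) (K N : ℕ) (i : Vals K N) : ℝ :=
  ν.real {ω | S X f N ω = i}

namespace Model

lemma measurable_S (h : Model μ X κ f C K b) (N : ℕ) : Measurable (S X f N) :=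
  Finset.measurable_fun_sum _ fun i _ => (h.meas i).comp (h.measX i)

lemma S_mem (h : Model μ X κ f C K b) (N : ℕ) (ω : Ω) :
    S X f N ω ∈ Finset.Icc (-(N * K : ℤ)) (N * K) := by
  have : |S X f N ω| ≤ N * K := by
    refine (Finset.abs_sum_le_sum_abs _ _).trans ?_
    refine (Finset.sum_le_sum fun i _ => h.bound i _).trans ?_
    simp
  rw [Finset.mem_Icc]
  exact abs_le.mp this

lemma comp_S_eq_sum (h : Model μ X κ f C K b) {F : Type*} [AddCommMonoid F] (N : ℕ) (g : ℤ → F)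
    (ω : Ω) : g (S X f N ω) =
      ∑ i : Vals K N, ({ω | S X f N ω = i} : Set Ω).indicator (fun _ => g i) ω := by
  rw [Finset.sum_eq_single (⟨S X f N ω, h.S_mem N ω⟩ : Vals K N)]
  · simp
  · intro i _ hi
    rw [Set.indicator_of_notMem]
    intro hcon
    exact hi (Subtype.ext (Set.mem_ofPred_eq ▸ hcon).symm)
  · simp

lemma measurableSet_S (h : Model μ X κ f C K b) (N : ℕ) (k : ℤ) :
    MeasurableSet {ω | S X f N ω = k} := h.measurable_S N (measurableSet_singleton k)

lemma integral_comp_S (h : Model μ X κ f C K b) {F : Type*} [NormedAddCommGroup F]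
    [NormedSpace ℝ F] [CompleteSpace F] (ν : Measure Ω) [IsFiniteMeasure ν] (N : ℕ) (g : ℤ → F) :
    ∫ ω, g (S X f N ω) ∂ν = ∑ i : Vals K N, lawS ν X f K N i • g i := by
  rw [integral_congr_ae (Eventually.of_forall (h.comp_S_eq_sum N g))]
  refine (integral_finsetSum (f := fun (i : Vals K N) ω =>
    ({ω | S X f N ω = i} : Set Ω).indicator (fun _ => g i) ω) _
    fun i _ => (integrable_const (g i)).indicator (h.measurableSet_S N i)).trans ?_
  refine Finset.sum_congr rfl fun i _ => ?_
  rw [integral_indicator_const _ (h.measurableSet_S N i), lawS]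

lemma lawChar_lawS (h : Model μ X κ f C K b) (ν : Measure Ω) [IsFiniteMeasure ν] (N : ℕ) (u : ℝ) :
    lawChar (fun i : Vals K N => (i : ℤ)) (lawS ν X f K N) u =
      Complex.exp (Complex.I * u * ((∑ i ∈ Ioc 0 N, b i : ℤ) : ℂ)) *
        ∫ ω, Complex.exp (Complex.I * u * Tsum X f b 0 N ω) ∂ν := by
  rw [lawChar, ← integral_const_mul]
  have := h.integral_comp_S ν N (fun k => Complex.exp (Complex.I * u * (k : ℂ)))
  simp_rw [Complex.real_smul] at this
  rw [← this]
  congr 1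
  funext ω
  rw [← Complex.exp_add, ← mul_add]
  congr 2
  have := h.S_eq N ω
  have h2 := congrArg (fun x : ℝ => (x : ℂ)) this
  push_cast at h2 ⊢
  rw [h2]
  ring

lemma lawMean_lawS (h : Model μ X κ f C K b) (ν : Measure Ω) [IsProbabilityMeasure ν] (N : ℕ) :
    lawMean (fun i : Vals K N => (i : ℤ)) (lawS ν X f K N) =
      (∫ ω, Tsum X f b 0 N ω ∂ν) + ((∑ i ∈ Ioc 0 N, b i : ℤ) : ℝ) := by
  have := h.integral_comp_S ν N (fun k => (k : ℝ))
  simp_rw [smul_eq_mul] at this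
  rw [lawMean, ← this]
  simp_rw [h.S_eq]
  rw [integral_add ?_ (integrable_const _)]
  · simp
  · exact Integrable.of_bound (h.measurable_Tsum 0 N).aestronglyMeasurable _
      (Eventually.of_forall fun ω => by simpa only [Real.norm_eq_abs] using h.abs_Tsum_le 0 N ω)

/-- Approximation of the conditional laws given rectangles. -/
lemma exists_approx (h : Model μ X κ f C K b) (ℓ D : ℕ) :
    ∃ B τ₀ R : ℝ, 0 ≤ B ∧ 1 ≤ τ₀ ∧ 0 ≤ R ∧ ∀ (N : ℕ) (τ : ℝ), τ₀ ≤ τ → τ ^ 12 = VN μ X f N →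
      ∀ (J : Finset ℕ) (A : ℕ → Set E), J.card ≤ ℓ → J ⊆ Ioc 0 N →
      (∀ i, MeasurableSet (A i)) → 0 < μ.real (rect X J A) →
      ∃ c : ℕ → ℕ → ℂ, (∀ a k, ‖c a k‖ ≤ B) ∧
        Approx K D (fun i : Vals K N => (i : ℤ)) (τ ^ 6) (τ ^ 5)⁻¹ (B * (τ ^ D)⁻¹) c
          (lawS (μ[|rect X J A]) X f K N) ∧
        ∀ a < gridSize K, (∀ k, c a k = 0) ∨
          (IsResonant K (gridPt K a) ∧ visMass μ X f b K a N ≤ R * Real.log τ) := by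
  have := h.prob
  have hK := h.K_pos
  have hpi := Real.pi_pos
  have hL := one_le_gridSize K
  obtain ⟨R, B₁, hR, hB₁, hnear⟩ := h.exists_near_decay ℓ D
  obtain ⟨B₂, hB₂, hfar⟩ := h.exists_far_decay ℓ D
  obtain ⟨B₃, τ₃, hB₃, hτ₃, htay⟩ := h.exists_taylor ℓ D hR
  obtain ⟨τ₄, hτ₄, hres⟩ := h.exists_isResonant hR
  set p : ℝ := Real.pi / (2 * K * gridSize K) with hp
  have hp0 : 0 < p := by positivity
  refine ⟨B₁ + B₂ + B₃, τ₃ + τ₄ + p⁻¹, R, by positivity, ?_, hR, ?_⟩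
  · have : 0 < p⁻¹ := by positivity
    linarith
  intro N τ hτ hV J A hJ hJN hA hpos
  have hpinv : 0 < p⁻¹ := by positivity
  have hτ1 : 1 ≤ τ := by linarith
  have hτ0 : 0 < τ := by linarith
  have hprob : IsProbabilityMeasure (μ[|rect X J A]) := cond_isProbabilityMeasure (by
    intro h0; rw [measureReal_def, h0] at hpos; simp at hpos)
  set β : ℤ := ∑ i ∈ Ioc 0 N, b i with hβ
  set ν := μ[|rect X J A] with hν
  have hrho : (τ ^ 5)⁻¹ ≤ p := by
    rw [inv_le_comm₀ (by positivity) hp0]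
    have : τ ≤ τ ^ 5 := le_self_pow₀ hτ1 (by norm_num)
    linarith
  have hchr : ∀ (a : ℕ) (s : ℝ), lawChar (fun i : Vals K N => (i : ℤ)) (lawS ν X f K N)
      (gridPt K a + s) = Complex.exp (Complex.I * (gridPt K a + s) * β) *
        chr μ X f b J A N (Complex.I * gridPt K a + Complex.I * s) := by
    intro a s
    rw [h.lawChar_lawS, chr, ← hβ, Complex.ofReal_add, mul_add]
  have hunit : ∀ x : ℝ, ‖Complex.exp (Complex.I * x * β)‖ = 1 := by
    intro x
    have : Complex.I * x * β = ((x * β : ℝ) : ℂ) * Complex.I := by push_cast; ring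
    rw [this, Complex.norm_exp_ofReal_mul_I]
  have hchrn : ∀ (a : ℕ) (s : ℝ), ‖lawChar (fun i : Vals K N => (i : ℤ)) (lawS ν X f K N)
      (gridPt K a + s)‖ = ‖chr μ X f b J A N (Complex.I * gridPt K a + Complex.I * s)‖ := by
    intro a s
    rw [hchr, norm_mul, ← Complex.ofReal_add, hunit, one_mul]
  have hlocal : ∀ a < gridSize K, ∃ c : ℕ → ℂ, (∀ k, ‖c k‖ ≤ B₁ + B₂ + B₃) ∧
      (∀ s : ℝ, |s| ≤ (τ ^ 5)⁻¹ →
        ‖lawChar (fun i : Vals K N => (i : ℤ)) (lawS ν X f K N) (gridPt K a + s) *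
          Complex.exp (-(Complex.I * s * (lawMean (fun i : Vals K N => (i : ℤ))
            (lawS ν X f K N) : ℝ))) - localApprox D c (τ ^ 6) s‖
          ≤ (B₁ + B₂ + B₃) * (τ ^ D)⁻¹) ∧ ((∀ k, c k = 0) ∨
          (IsResonant K (gridPt K a) ∧ visMass μ X f b K a N ≤ R * Real.log τ)) := by
    intro a ha
    rcases le_or_gt (visMass μ X f b K a N) (R * Real.log τ) with hM | hM
    · obtain ⟨c, hc, hcs⟩ := htay N τ (by linarith) hV J A hJ hJN hA hpos a hM
      refine ⟨fun k => Complex.exp (Complex.I * gridPt K a * β) * c k, fun k => ?_, fun s hs => ?_,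
        Or.inr ⟨hres N τ (by linarith) hV a ha hM, hM⟩⟩
      · rw [norm_mul, hunit, one_mul]
        exact (hc k).trans (by linarith)
      · have e1 : localApprox D (fun k => Complex.exp (Complex.I * gridPt K a * β) * c k) (τ ^ 6) s
            = Complex.exp (Complex.I * gridPt K a * β) * localApprox D c (τ ^ 6) s := by
          unfold localApprox
          rw [Finset.mul_sum, Finset.mul_sum, Finset.mul_sum]
          exact Finset.sum_congr rfl fun k _ => by ring
        have e2 : Complex.exp (Complex.I * (gridPt K a + s) * β) *
            Complex.exp (-(Complex.I * s * (lawMean (fun i : Vals K N => (i : ℤ))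
              (lawS ν X f K N) : ℝ))) = Complex.exp (Complex.I * gridPt K a * β) *
              Complex.exp (-(Complex.I * s * (∫ ω, Tsum X f b 0 N ω ∂ν : ℝ))) := by
          rw [← Complex.exp_add, ← Complex.exp_add, h.lawMean_lawS, ← hβ, Complex.ofReal_add,
            Complex.ofReal_intCast]
          congr 1
          ring
        rw [hchr, e1, mul_right_comm, e2, mul_assoc, mul_comm (Complex.exp (-_)), ← mul_sub,
          norm_mul, hunit, one_mul]
        refine (hcs s hs).trans ?_
        have : 0 ≤ (τ ^ D)⁻¹ := by positivity
        nlinarith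
    · refine ⟨fun _ => 0, fun k => by simp only [norm_zero]; positivity, fun s hs => ?_,
        Or.inl fun _ => rfl⟩
      have e1 : localApprox D (fun _ => 0) (τ ^ 6) s = 0 := by simp [localApprox]
      have e2 : ‖Complex.exp (-(Complex.I * s * (lawMean (fun i : Vals K N => (i : ℤ))
              (lawS ν X f K N) : ℝ)))‖ = 1 := by
        have : -(Complex.I * s * (lawMean (fun i : Vals K N => (i : ℤ)) (lawS ν X f K N) : ℝ)) =
            ((-(s * lawMean (fun i : Vals K N => (i : ℤ)) (lawS ν X f K N)) : ℝ) : ℂ) *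
              Complex.I := by push_cast; ring
        rw [this, Complex.norm_exp_ofReal_mul_I]
      rw [e1, sub_zero, norm_mul, e2, mul_one, hchrn]
      refine (hnear N τ hτ1 J A hJ hJN hA hpos a hM s (hs.trans hrho)).trans ?_
      have : 0 ≤ (τ ^ D)⁻¹ := by positivity
      nlinarith
  choose! c hc using hlocal
  refine ⟨fun a => if a < gridSize K then c a else fun _ => 0, fun a k => ?_,
    ⟨fun a ha s hs => ?_, fun a ha s hs hs2 => ?_⟩, fun a ha => ?_⟩
  · simp only
    split_ifs with ha
    · exact (hc a ha).1 k
    · simp only [norm_zero]; positivity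
  · simp only [if_pos ha]
    exact (hc a ha).2.1 s hs
  · rw [hchrn]
    refine (hfar N τ hτ1 hV J A hJ hJN hA hpos a s hs hs2).trans ?_
    have : 0 ≤ (τ ^ D)⁻¹ := by positivity
    nlinarith
  · simp only [if_pos ha]
    exact (hc a ha).2.2

set_option maxHeartbeats 1000000 in
/-- Smallness at the resonances forces the oscillating coefficients to be small. -/
lemma exists_coeff_small (h : Model μ X κ f C K b) (ℓ r D : ℕ) {B R : ℝ} (hB : 0 ≤ B) (hR : 0 ≤ R)
    (hr : 1 ≤ r) (hD : 6 * r ≤ D)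
    (hsmall : ∀ t : ℝ, IsResonant K t → t ≠ 0 → ∀ ℓ : ℕ, ∀ ε > 0, ∃ N₀, ∀ N ≥ N₀,
      ∀ j : Fin ℓ → ℕ, (∀ i, j i ∈ Finset.Icc 1 N) →
        (∫ ω, ‖condChar μ X f t N j ω‖ ∂μ) ≤ ε * (sigN μ X f N)⁻¹ ^ (r - 1)) {ε : ℝ} (hε : 0 < ε) :
    ∃ (τ₁ : ℝ) (N₀ : ℕ), ∀ N ≥ N₀, ∀ τ : ℝ, τ₁ ≤ τ → τ ^ 12 = VN μ X f N →
      ∀ (J : Finset ℕ) (A : ℕ → Set E), J.card ≤ ℓ → J ⊆ Ioc 0 N →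
      (∀ i, MeasurableSet (A i)) → 0 < μ.real (rect X J A) →
      ∀ c : ℕ → ℕ → ℂ, Approx K D (fun i : Vals K N => (i : ℤ)) (τ ^ 6) (τ ^ 5)⁻¹
          (B * (τ ^ D)⁻¹) c (lawS (μ[|rect X J A]) X f K N) →
      ∀ a < gridSize K, a ≠ 0 → IsResonant K (gridPt K a) →
        visMass μ X f b K a N ≤ R * Real.log τ →
      ∀ k < D, ‖c a k‖ ≤ ε * ((τ ^ 6)⁻¹) ^ (r - 1) := by
  have := h.prob
  have hC := h.one_lt
  have hK := h.K_pos
  have hpi := Real.pi_pos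
  have hL := one_le_gridSize K
  obtain ⟨A₁, hA₁, hinterp⟩ := exists_interpolation (fun k => (Polynomial.X : Polynomial ℝ) ^ k)
    (fun k => Polynomial.monic_X_pow k) (fun k => Polynomial.natDegree_X_pow k)
    (y := fun j : ℕ => (j : ℝ) / (D + 1)) (fun i j hij => by
      have : (0 : ℝ) < D + 1 := by positivity
      have h2 : (i : ℝ) / (D + 1) = j / (D + 1) := hij
      rw [div_left_inj' this.ne'] at h2
      exact_mod_cast h2) D
  set m : ℕ := 2 * r with hm
  set L' : ℕ := 4 * ℓ + 3 * m with hL'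
  set Q : ℝ := 20 * C ^ 9 * (2 * K) * (2 * L' + 2 * R) with hQ
  have hQ0 : 0 ≤ Q := by positivity
  set U : ℝ := (2 * C ^ 4) ^ ℓ with hU
  have hU0 : 0 < U := by positivity
  set W : ℝ := A₁ * Real.exp 1 with hW
  have hW0 : 0 ≤ W := by positivity
  have hC2 : 1 ≤ 2 * C ^ 4 := by nlinarith [one_le_pow₀ (n := 4) hC.le]
  set ε₁ : ℝ := ε / (2 * (W * (U * (2 * C ^ 2 * m)) + 1)) with hε₁
  have hε₁0 : 0 < ε₁ := by positivity
  have hsm : ∀ a : ℕ, ∃ N₀ : ℕ, IsResonant K (gridPt K a) → gridPt K a ≠ 0 → ∀ N ≥ N₀,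
      ∀ j : Fin L' → ℕ, (∀ i, j i ∈ Finset.Icc 1 N) →
        (∫ ω, ‖condChar μ X f (gridPt K a) N j ω‖ ∂μ) ≤ ε₁ * (sigN μ X f N)⁻¹ ^ (r - 1) := by
    intro a
    by_cases h1 : IsResonant K (gridPt K a) ∧ gridPt K a ≠ 0
    · obtain ⟨N₀, hN₀⟩ := hsmall _ h1.1 h1.2 L' ε₁ hε₁0
      exact ⟨N₀, fun _ _ => hN₀⟩
    · exact ⟨0, fun h2 h3 => absurd ⟨h2, h3⟩ h1⟩
  choose N₀ hN₀ using hsm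
  refine ⟨1 + Q + 2 * W * (U * Q ^ m + B) / ε, (∑ a ∈ range (gridSize K), N₀ a) + 1, ?_⟩
  intro N hN τ hτ hV J A hJ hJN hA hpos c hc a ha ha0 hresa hM k hk
  have hfr : 0 ≤ 2 * W * (U * Q ^ m + B) / ε := by positivity
  have hτ1 : 1 ≤ τ := by linarith
  have hτ0 : 0 < τ := by linarith
  have hprob : IsProbabilityMeasure (μ[|rect X J A]) := cond_isProbabilityMeasure (by
    intro h0; rw [measureReal_def, h0] at hpos; simp at hpos)
  have hNa : N₀ a ≤ N := by
    have := Finset.single_le_sum (f := N₀) (fun _ _ => Nat.zero_le _) (Finset.mem_range.mpr ha)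
    omega
  have hN1 : 1 ≤ N := by omega
  have hgp : gridPt K a ≠ 0 := by
    unfold gridPt
    have : (a : ℝ) ≠ 0 := by exact_mod_cast ha0
    positivity
  have hσ : sigN μ X f N = τ ^ 6 := by
    rw [sigN, ← hV]
    rw [show τ ^ 12 = (τ ^ 6) ^ 2 by ring]
    exact Real.sqrt_sq (by positivity)
  set a₀ : ℝ := ε₁ * ((τ ^ 6)⁻¹) ^ (r - 1) with ha₀
  have hcls : ClsBd μ X N (expPot f b (Complex.I * gridPt K a)) L' a₀ := by
    refine h.clsBd_of_condChar hN1 (gridPt K a) fun j hj => ?_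
    have := hN₀ a hresa hgp N hNa j hj
    rwa [hσ] at this
  have hsig : ((τ ^ 6)⁻¹) ^ (r - 1) * (τ ^ 6)⁻¹ = ((τ ^ 6)⁻¹) ^ r := by
    rw [← pow_succ]; congr 1; omega
  set q : ℝ := Q * (τ ^ 5)⁻¹ with hq
  have hq1 : q ≤ 1 := by
    rw [hq, ← div_eq_mul_inv, div_le_one (by positivity)]
    have : τ ≤ τ ^ 5 := le_self_pow₀ hτ1 (by norm_num)
    linarith
  have hlog : Real.log τ ≤ τ := Real.log_le_self hτ0.le
  have hchr : ∀ s : ℝ, |s| ≤ (τ ^ 6)⁻¹ → ‖lawChar (fun i : Vals K N => (i : ℤ))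
      (lawS (μ[|rect X J A]) X f K N) (gridPt K a + s)‖ ≤ U * (2 * C ^ 2 * m * a₀ + q ^ m) := by
    intro s hs
    have e1 : ‖lawChar (fun i : Vals K N => (i : ℤ)) (lawS (μ[|rect X J A]) X f K N)
        (gridPt K a + s)‖ = ‖chr μ X f b J A N (Complex.I * gridPt K a + Complex.I * s)‖ := by
      rw [h.lawChar_lawS, norm_mul]
      have : Complex.I * ((gridPt K a + s : ℝ) : ℂ) * ((∑ i ∈ Ioc 0 N, b i : ℤ) : ℂ) =
          (((gridPt K a + s) * ((∑ i ∈ Ioc 0 N, b i : ℤ) : ℝ) : ℝ) : ℂ) * Complex.I := by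
        push_cast; ring
      rw [this, Complex.norm_exp_ofReal_mul_I, one_mul, chr, Complex.ofReal_add, mul_add]
    rw [e1]
    have hq' : 20 * C ^ 9 * (2 * K * |s|) * (2 * L' + 2 * ∑ i ∈ Ioc 0 N,
        massOf μ X f b (visible K a) i) ≤ q := by
      have e2 : (2 * L' + 2 * ∑ i ∈ Ioc 0 N, massOf μ X f b (visible K a) i : ℝ) ≤
          (2 * L' + 2 * R) * τ := by
        have h1 : (∑ i ∈ Ioc 0 N, massOf μ X f b (visible K a) i) ≤ R * τ :=
          hM.trans (by gcongr)
        have h2 : (L' : ℝ) ≤ L' * τ := le_mul_of_one_le_right (by positivity) hτ1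
        linarith
      have e3 : (0 : ℝ) ≤ 2 * L' + 2 * ∑ i ∈ Ioc 0 N, massOf μ X f b (visible K a) i := by
        have : 0 ≤ ∑ i ∈ Ioc 0 N, massOf μ X f b (visible K a) i :=
          Finset.sum_nonneg fun _ _ => measureReal_nonneg
        positivity
      calc _ ≤ 20 * C ^ 9 * (2 * K * (τ ^ 6)⁻¹) * ((2 * L' + 2 * R) * τ) := by gcongr
        _ = q := by rw [hq, hQ]; field_simp
    have h1 := h.norm_chr_le_clsBd hA hN1 hJN hpos (gridPt K a) (Q := visible K a)
      (fun y hy => by simpa [visible] using hy) (m := m) (L := L') (a₀ := a₀) (q := q) (s := s)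
      (by omega) (by positivity) hcls hq1 hq'
    refine h1.trans ?_
    rw [hU]
    have : 0 ≤ q := by positivity
    gcongr
  have hexp1 : ∀ s : ℝ, |s| ≤ (τ ^ 6)⁻¹ →
      ‖∑ k ∈ range D, c a k * (Complex.I * ((τ ^ 6 * s : ℝ) : ℂ)) ^ k‖ ≤
        Real.exp 1 * (U * (2 * C ^ 2 * m * a₀ + q ^ m) + B * (τ ^ D)⁻¹) := by
    intro s hs
    have hs5 : |s| ≤ (τ ^ 5)⁻¹ := hs.trans (inv_anti₀ (by positivity)
      (pow_le_pow_right₀ hτ1 (by norm_num)))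
    have h1 := hc.1 a ha s hs5
    have h2 := hchr s hs
    have e2 : ‖Complex.exp (-(Complex.I * s * (lawMean (fun i : Vals K N => (i : ℤ))
        (lawS (μ[|rect X J A]) X f K N) : ℝ)))‖ = 1 := by
      have : -(Complex.I * s * (lawMean (fun i : Vals K N => (i : ℤ))
          (lawS (μ[|rect X J A]) X f K N) : ℝ)) =
          ((-(s * lawMean (fun i : Vals K N => (i : ℤ)) (lawS (μ[|rect X J A]) X f K N)) : ℝ) : ℂ)
            * Complex.I := by push_cast; ring
      rw [this, Complex.norm_exp_ofReal_mul_I]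
    have h3 : ‖localApprox D (c a) (τ ^ 6) s‖ ≤
        U * (2 * C ^ 2 * m * a₀ + q ^ m) + B * (τ ^ D)⁻¹ := by
      have := norm_le_norm_add_norm_sub' (localApprox D (c a) (τ ^ 6) s)
        (lawChar (fun i : Vals K N => (i : ℤ)) (lawS (μ[|rect X J A]) X f K N) (gridPt K a + s) *
          Complex.exp (-(Complex.I * s * (lawMean (fun i : Vals K N => (i : ℤ))
            (lawS (μ[|rect X J A]) X f K N) : ℝ))))
      rw [norm_mul, e2, mul_one, norm_sub_rev] at this
      linarith
    unfold localApprox at h3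
    rw [norm_mul] at h3
    have e3 : (-((τ ^ 6 * s : ℝ) : ℂ) ^ 2 / 2) = ((-(τ ^ 6 * s) ^ 2 / 2 : ℝ) : ℂ) := by
      push_cast; ring
    rw [e3, Complex.norm_exp_ofReal] at h3
    have h4 : Real.exp (-1) ≤ Real.exp (-(τ ^ 6 * s) ^ 2 / 2) := by
      apply Real.exp_le_exp.mpr
      have h5 : |τ ^ 6 * s| ≤ 1 := by
        rw [abs_mul, abs_of_pos (by positivity)]
        calc τ ^ 6 * |s| ≤ τ ^ 6 * (τ ^ 6)⁻¹ := by gcongr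
          _ = 1 := by field_simp
      have := (sq_le_one_iff_abs_le_one _).mpr h5
      linarith
    have h6 : Real.exp 1 * Real.exp (-1) = 1 := by rw [← Real.exp_add]; simp
    set n := ‖∑ k ∈ range D, c a k * (Complex.I * ((τ ^ 6 * s : ℝ) : ℂ)) ^ k‖
    have hn : 0 ≤ n := norm_nonneg _
    calc n = Real.exp 1 * (Real.exp (-1) * n) := by rw [← mul_assoc, h6, one_mul]
      _ ≤ Real.exp 1 * (Real.exp (-(τ ^ 6 * s) ^ 2 / 2) * n) := by gcongr
      _ ≤ _ := by gcongr
  set Z : ℝ := U * (2 * C ^ 2 * m * a₀ + q ^ m) + B * (τ ^ D)⁻¹ with hZ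
  have hZ0 : 0 ≤ Z := by positivity
  have hfin := hinterp (fun k => c a k * Complex.I ^ k) (Real.exp 1 * Z) (by positivity) (by
    intro j hj
    have hD0 : (0 : ℝ) < D + 1 := by positivity
    have := hexp1 ((τ ^ 6)⁻¹ * ((j : ℝ) / (D + 1))) (by
      rw [abs_mul, abs_of_pos (by positivity : (0 : ℝ) < (τ ^ 6)⁻¹), abs_of_nonneg (by positivity)]
      refine mul_le_of_le_one_right (by positivity) ?_
      rw [div_le_one hD0]
      have : (j : ℝ) ≤ D := by exact_mod_cast hj.le
      linarith)
    have e5 : τ ^ 6 * ((τ ^ 6)⁻¹ * ((j : ℝ) / (D + 1))) = (j : ℝ) / (D + 1) := by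
      field_simp
    rw [e5] at this
    refine le_trans (le_of_eq ?_) this
    congr 1
    refine Finset.sum_congr rfl fun k _ => ?_
    rw [Polynomial.eval_pow, Polynomial.eval_X, mul_pow]
    push_cast
    ring) k hk
  rw [norm_mul, norm_pow, Complex.norm_I, one_pow, mul_one] at hfin
  refine hfin.trans ?_
  set y : ℝ := ((τ ^ 6)⁻¹) ^ (r - 1) with hy
  have hy0 : 0 < y := by positivity
  have b1 : q ^ m ≤ Q ^ m * (y * τ⁻¹) := by
    rw [hq, mul_pow]
    refine mul_le_mul_of_nonneg_left ?_ (by positivity)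
    rw [hy, inv_pow, inv_pow, ← pow_mul, ← pow_mul, ← mul_inv, ← pow_succ]
    exact inv_anti₀ (by positivity) (pow_le_pow_right₀ hτ1 (by omega))
  have b2 : (τ ^ D)⁻¹ ≤ y * τ⁻¹ := by
    rw [hy, inv_pow, ← pow_mul, ← mul_inv, ← pow_succ]
    exact inv_anti₀ (by positivity) (pow_le_pow_right₀ hτ1 (by omega))
  have b3 : Z ≤ U * (2 * C ^ 2 * m) * ε₁ * y + (U * Q ^ m + B) * τ⁻¹ * y := by
    calc Z ≤ U * (2 * C ^ 2 * m * a₀ + Q ^ m * (y * τ⁻¹)) + B * (y * τ⁻¹) := by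
          rw [hZ]; gcongr
      _ = _ := by rw [ha₀]; ring
  have b4 : W * (U * (2 * C ^ 2 * m)) * ε₁ ≤ ε / 2 := by
    rw [hε₁]
    have h0 : 0 ≤ W * (U * (2 * C ^ 2 * m)) := by positivity
    generalize W * (U * (2 * C ^ 2 * m)) = w at h0
    rw [mul_div_assoc', div_le_div_iff₀ (by positivity) (by norm_num)]
    linarith
  have b5 : W * (U * Q ^ m + B) * τ⁻¹ ≤ ε / 2 := by
    rw [← div_eq_mul_inv, div_le_iff₀ hτ0]
    have : 2 * W * (U * Q ^ m + B) / ε ≤ τ := by linarith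
    rw [div_le_iff₀ hε] at this
    linarith
  calc A₁ * (Real.exp 1 * Z) = W * Z := by rw [hW]; ring
    _ ≤ W * (U * (2 * C ^ 2 * m) * ε₁ * y + (U * Q ^ m + B) * τ⁻¹ * y) := by gcongr
    _ = (W * (U * (2 * C ^ 2 * m)) * ε₁ + W * (U * Q ^ m + B) * τ⁻¹) * y := by ring
    _ ≤ (ε / 2 + ε / 2) * y := by gcongr
    _ = ε * y := by ring

end Model

end

section

variable {μ : Measure Ω} {X : ℕ → Ω → E} {ℓ : ℕ}

/-- Events determined by a countable discretisation of `X_{j_1}, …, X_{j_ℓ}`. -/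
def cylAlg (X : ℕ → Ω → E) (j : Fin ℓ → ℕ) : Set (Set Ω) :=
  {s | ∃ g : E → ℕ, Measurable g ∧ ∃ U : Set (Fin ℓ → ℕ), s = {ω | (fun i => g (X (j i) ω)) ∈ U}}

lemma isSetAlgebra_cylAlg (X : ℕ → Ω → E) (j : Fin ℓ → ℕ) : IsSetAlgebra (cylAlg X j) where
  empty_mem := ⟨fun _ => 0, measurable_const, ∅, by simp⟩
  compl_mem := by
    rintro s ⟨g, hg, U, rfl⟩
    exact ⟨g, hg, Uᶜ, rfl⟩
  union_mem := by
    rintro s t ⟨g, hg, U, rfl⟩ ⟨g', hg', U', rfl⟩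
    refine ⟨fun x => Nat.pair (g x) (g' x), (Measurable.of_discrete
      (f := fun p : ℕ × ℕ => Nat.pair p.1 p.2)).comp (hg.prodMk hg'),
      {u | (fun i => (Nat.unpair (u i)).1) ∈ U ∨ (fun i => (Nat.unpair (u i)).2) ∈ U'}, ?_⟩
    ext ω
    simp

lemma sigmaOf_eq_generateFrom (X : ℕ → Ω → E) (j : Fin ℓ → ℕ) :
    sigmaOf X j = MeasurableSpace.generateFrom (cylAlg X j) := by
  apply le_antisymm
  · refine iSup_le fun i => ?_
    rintro s ⟨A, hA, rfl⟩
    refine MeasurableSpace.measurableSet_generateFrom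
      ⟨A.indicator fun _ => 1, measurable_const.indicator hA, {u | u i = 1}, ?_⟩
    ext ω
    simp [Set.indicator_apply]
  · refine MeasurableSpace.generateFrom_le ?_
    rintro s ⟨g, hg, U, rfl⟩
    have h1 : Measurable[sigmaOf X j] fun ω => (fun i => g (X (j i) ω)) := by
      refine @measurable_pi_lambda _ _ _ (sigmaOf X j) _ _ fun i => ?_
      have : Measurable[MeasurableSpace.comap (X (j i)) inferInstance] (X (j i)) :=
        comap_measurable _
      exact hg.comp (this.mono (le_iSup (fun i : Fin ℓ => MeasurableSpace.comap (X (j i))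
        (inferInstance : MeasurableSpace E)) i) le_rfl)
    exact h1 (Set.to_countable U).measurableSet

lemma sigmaOf_le (hX : ∀ n, Measurable (X n)) (j : Fin ℓ → ℕ) :
    sigmaOf X j ≤ (inferInstance : MeasurableSpace Ω) :=
  iSup_le fun i => (hX (j i)).comap_le

lemma measurableSet_rect_sigmaOf (X : ℕ → Ω → E) (j : Fin ℓ → ℕ) {A : ℕ → Set E}
    (hA : ∀ i, MeasurableSet (A i)) :
    MeasurableSet[sigmaOf X j] (rect X (univ.image j) A) := by
  have : rect X (univ.image j) A = ⋂ i : Fin ℓ, X (j i) ⁻¹' A (j i) := by ext; simp [rect]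
  rw [this]
  refine @MeasurableSet.iInter _ _ (sigmaOf X j) _ _ fun i => ?_
  exact le_iSup (fun i : Fin ℓ => MeasurableSpace.comap (X (j i))
    (inferInstance : MeasurableSpace E)) i _ ⟨_, hA _, rfl⟩

lemma lintegral_cylAlg_ge (hX : ∀ n, Measurable (X n)) (j : Fin ℓ → ℕ) {Φ : Ω → ℝ≥0∞} {q : ℝ≥0∞}
    (hrect : ∀ A : ℕ → Set E, (∀ i, MeasurableSet (A i)) →
      q * μ (rect X (univ.image j) A) ≤ ∫⁻ ω in rect X (univ.image j) A, Φ ω ∂μ)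
    {s : Set Ω} (hs : s ∈ cylAlg X j) : q * μ s ≤ ∫⁻ ω in s, Φ ω ∂μ := by
  obtain ⟨g, hg, U, rfl⟩ := hs
  set A : (Fin ℓ → ℕ) → ℕ → Set E := fun u n => {x | ∀ i, j i = n → g x = u i} with hA
  have hAm : ∀ u n, MeasurableSet (A u n) := by
    intro u n
    have : A u n = ⋂ i : Fin ℓ, ⋂ _ : j i = n, g ⁻¹' {u i} := by ext; simp [hA]
    rw [this]
    exact MeasurableSet.iInter fun i => MeasurableSet.iInter fun _ => hg (measurableSet_singleton _)
  have hR : ∀ u, rect X (univ.image j) (A u) = {ω | (fun i => g (X (j i) ω)) = u} := by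
    intro u
    ext ω
    simp only [rect, hA, Finset.mem_image, Finset.mem_univ, true_and, Set.mem_ofPred_eq,
      forall_exists_index, forall_apply_eq_imp_iff, funext_iff]
    constructor
    · intro h i
      exact h i i rfl
    · intro h i i' hi
      rw [← hi]
      exact h i'
  have hU : {ω | (fun i => g (X (j i) ω)) ∈ U} = ⋃ u : U, rect X (univ.image j) (A u) := by
    ext ω
    simp [hR]
  have hdis : Pairwise (Function.onFun Disjoint fun u : U => rect X (univ.image j) (A u)) := by
    intro u v huv
    refine Set.disjoint_left.mpr fun ω hω hω' => huv ?_
    simp only [hR] at hω hω'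
    exact Subtype.ext (hω.symm.trans hω')
  have hm : ∀ u : U, MeasurableSet (rect X (univ.image j) (A u)) :=
    fun u => measurableSet_rect hX (hAm u)
  rw [hU, measure_iUnion hdis hm, lintegral_iUnion hm hdis, ← ENNReal.tsum_mul_left]
  exact ENNReal.tsum_le_tsum fun u => hrect _ (hAm u)

/-- If averages of `Z` over all rectangles lie in a closed set then so do almost surely the
conditional expectations. -/
theorem ae_condExp_mem_of_rect [IsProbabilityMeasure μ] (hX : ∀ n, Measurable (X n))
    (j : Fin ℓ → ℕ) {ι : Type*} [Fintype ι] {Z : ι → Ω → ℝ} (hZ : ∀ i, Integrable (Z i) μ)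
    {F : Set (ι → ℝ)} (hF : IsClosed F)
    (hrect : ∀ A : ℕ → Set E, (∀ i, MeasurableSet (A i)) → 0 < μ.real (rect X (univ.image j) A) →
      (fun i => ∫ ω, Z i ω ∂(μ[|rect X (univ.image j) A])) ∈ F) :
    ∀ᵐ ω ∂μ, (fun i => (μ[Z i | sigmaOf X j]) ω) ∈ F := by
  have hm := sigmaOf_le hX j
  set V : Ω → ι → ℝ := fun ω i => (μ[Z i | sigmaOf X j]) ω with hV
  have hVm : Measurable[sigmaOf X j] V :=
    @measurable_pi_lambda _ _ _ (sigmaOf X j) _ _ fun i => stronglyMeasurable_condExp.measurable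
  have hVm' : Measurable V := hVm.mono hm le_rfl
  by_contra hcon
  have hpos : μ.map V Fᶜ ≠ 0 := by
    rw [Measure.map_apply hVm' hF.isOpen_compl.measurableSet]
    exact hcon
  obtain ⟨p, hp, hball⟩ := exists_mem_forall_mem_nhdsWithin_pos_measure hpos
  rw [hF.isOpen_compl.nhdsWithin_eq hp] at hball
  obtain ⟨η, hη, hsub⟩ := Metric.isOpen_iff.mp hF.isOpen_compl p hp
  set B : Set Ω := V ⁻¹' Metric.ball p (η / 3) with hB
  have hBm : MeasurableSet[sigmaOf X j] B := hVm Metric.isOpen_ball.measurableSet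
  have hBpos : 0 < μ B := by
    have := hball (Metric.ball p (η / 3)) (Metric.ball_mem_nhds _ (by positivity))
    rwa [Measure.map_apply hVm' Metric.isOpen_ball.measurableSet] at this
  set Φ : Ω → ℝ≥0∞ := fun ω => ‖V ω - p‖ₑ with hΦ
  have hVint : ∀ i, Integrable (fun ω => V ω i) μ := fun i => integrable_condExp
  have hΦint : ∫⁻ ω, Φ ω ∂μ ≠ ∞ := by
    have h1 : Integrable V μ := Integrable.of_eval hVint
    exact (h1.sub (integrable_const p)).hasFiniteIntegral.ne
  have hge : ∀ A : ℕ → Set E, (∀ i, MeasurableSet (A i)) →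
      ENNReal.ofReal η * μ (rect X (univ.image j) A) ≤
        ∫⁻ ω in rect X (univ.image j) A, Φ ω ∂μ := by
    intro A hA
    set R := rect X (univ.image j) A with hR
    have hRm : MeasurableSet[sigmaOf X j] R := measurableSet_rect_sigmaOf X j hA
    rcases eq_or_lt_of_le (measureReal_nonneg (μ := μ) (s := R)) with h0 | h0
    · have : μ R = 0 := (measureReal_eq_zero_iff).mp h0.symm
      rw [this, mul_zero]
      exact zero_le
    have hmem := hrect A hA h0
    have hdist : ¬ dist (fun i => ∫ ω, Z i ω ∂(μ[|R])) p < η := fun hlt => hsub hlt hmem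
    rw [dist_pi_lt_iff hη] at hdist
    push Not at hdist
    obtain ⟨i, hi⟩ := hdist
    have e1 : ∫ ω in R, (V ω i - p i) ∂μ = μ.real R * (∫ ω, Z i ω ∂(μ[|R]) - p i) := by
      rw [integral_sub (hVint i).integrableOn (integrable_const _).integrableOn,
        setIntegral_condExp hm (hZ i) hRm, setIntegral_const, ProbabilityTheory.cond,
        integral_smul_measure, ENNReal.toReal_inv, ← measureReal_def, smul_eq_mul, smul_eq_mul]
      field_simp
    have e2 : η * μ.real R ≤ ‖∫ ω in R, (V ω i - p i) ∂μ‖ := by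
      rw [e1, norm_mul, Real.norm_of_nonneg h0.le, mul_comm]
      rw [Real.dist_eq] at hi
      rw [Real.norm_eq_abs]
      gcongr
    calc ENNReal.ofReal η * μ R = ENNReal.ofReal (η * μ.real R) := by
          rw [ENNReal.ofReal_mul hη.le, ofReal_measureReal]
      _ ≤ ENNReal.ofReal ‖∫ ω in R, (V ω i - p i) ∂μ‖ := ENNReal.ofReal_le_ofReal e2
      _ = ‖∫ ω in R, (V ω i - p i) ∂μ‖ₑ := ofReal_norm _
      _ ≤ ∫⁻ ω in R, ‖V ω i - p i‖ₑ ∂μ := enorm_integral_le_lintegral_enorm _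
      _ ≤ ∫⁻ ω in R, Φ ω ∂μ := lintegral_mono fun ω => by
          rw [hΦ, enorm_le_iff_norm_le]
          exact norm_le_pi_norm (V ω - p) i
  set β : ℝ := μ.real B with hβ
  have hβ0 : 0 < β := ENNReal.toReal_pos hBpos.ne' (measure_ne_top _ _)
  obtain ⟨δ, hδ, hδs⟩ := exists_pos_setLIntegral_lt_of_measure_lt hΦint
    (ε := ENNReal.ofReal (η * β / 4)) (by
      simp only [ne_eq, ENNReal.ofReal_eq_zero, not_le]; positivity)
  have hδ' : 0 < (min δ 1).toReal :=
    ENNReal.toReal_pos (by simp [hδ.ne']) (by simp)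
  have hdense : @Measure.MeasureDense Ω (sigmaOf X j) (μ.trim hm) (cylAlg X j) :=
    @Measure.MeasureDense.of_generateFrom_isSetAlgebra_finite Ω (sigmaOf X j) (μ.trim hm)
      (cylAlg X j) (isFiniteMeasure_trim hm) (isSetAlgebra_cylAlg X j) (sigmaOf_eq_generateFrom X j)
  obtain ⟨D, hD, hDs⟩ := @Measure.MeasureDense.approx Ω (sigmaOf X j) (μ.trim hm) _ hdense B hBm
    (by rw [trim_measurableSet_eq hm hBm]; exact measure_ne_top _ _)
    (min (min δ 1).toReal (β / 4)) (by positivity)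
  have hDm : MeasurableSet[sigmaOf X j] D := by
    rw [sigmaOf_eq_generateFrom]
    exact MeasurableSpace.measurableSet_generateFrom hD
  rw [trim_measurableSet_eq hm (hBm.symmDiff hDm)] at hDs
  have hDB : μ (D \ B) < δ := by
    calc μ (D \ B) ≤ μ (symmDiff B D) := measure_mono fun x hx => Or.inr hx
      _ < _ := hDs
      _ ≤ ENNReal.ofReal (min δ 1).toReal := ENNReal.ofReal_le_ofReal (min_le_left _ _)
      _ = min δ 1 := ENNReal.ofReal_toReal (by simp)
      _ ≤ δ := min_le_left _ _
  have hBD : μ.real (B \ D) ≤ β / 4 := by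
    have : μ (B \ D) ≤ ENNReal.ofReal (β / 4) := by
      calc μ (B \ D) ≤ μ (symmDiff B D) := measure_mono fun x hx => Or.inl hx
        _ ≤ _ := hDs.le
        _ ≤ _ := ENNReal.ofReal_le_ofReal (min_le_right _ _)
    exact ENNReal.toReal_le_of_le_ofReal (by positivity) this
  have hBD2 : 3 / 4 * β ≤ μ.real D := by
    have : β ≤ μ.real (B \ D) + μ.real D := by
      rw [hβ]
      refine (measureReal_mono (s₂ := (B \ D) ∪ D) (by rw [Set.sdiff_union_self]
                                                       exact Set.subset_union_left)).trans ?_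
      exact measureReal_union_le _ _
    linarith
  have hlow := lintegral_cylAlg_ge hX j hge hD
  have hup : ∫⁻ ω in D, Φ ω ∂μ ≤ ENNReal.ofReal (η / 3 * β) + ENNReal.ofReal (η * β / 4) := by
    calc ∫⁻ ω in D, Φ ω ∂μ ≤ ∫⁻ ω in B ∪ (D \ B), Φ ω ∂μ :=
          lintegral_mono_set (by rw [Set.union_sdiff_self]; exact Set.subset_union_right)
      _ ≤ ∫⁻ ω in B, Φ ω ∂μ + ∫⁻ ω in D \ B, Φ ω ∂μ := lintegral_union_le _ _ _
      _ ≤ _ := by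
          refine add_le_add ?_ (hδs _ hDB).le
          calc ∫⁻ ω in B, Φ ω ∂μ ≤ ∫⁻ ω in B, ENNReal.ofReal (η / 3) ∂μ :=
                setLIntegral_mono' (hm _ hBm) fun ω hω => by
                  rw [hΦ]
                  simp only
                  rw [← ofReal_norm, ← dist_eq_norm]
                  exact ENNReal.ofReal_le_ofReal (Metric.mem_ball.mp hω).le
            _ = ENNReal.ofReal (η / 3) * μ B := by simp
            _ = _ := by rw [ENNReal.ofReal_mul (by positivity), hβ, ofReal_measureReal]
  rw [← ENNReal.ofReal_add (by positivity) (by positivity)] at hup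
  have hfin := hlow.trans hup
  rw [← ofReal_measureReal, ← ENNReal.ofReal_mul hη.le,
    ENNReal.ofReal_le_ofReal_iff (by positivity)] at hfin
  nlinarith

end

section

variable {K D : ℕ} {ι : Type*} [Fintype ι]

/-- Laws admitting an approximation with controlled coefficients. -/
def approxSet (K D : ℕ) (val : ι → ℤ) (σ ρ η B δ : ℝ) : Set (ι → ℝ) :=
  {v | ∃ c : ℕ → ℕ → ℂ, (∀ a k, ‖c a k‖ ≤ B) ∧
    (∀ a < gridSize K, a ≠ 0 → ∀ k < D, ‖c a k‖ ≤ δ) ∧ Approx K D val σ ρ η c v}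

lemma isClosed_approxSet (K D : ℕ) (val : ι → ℤ) (σ ρ η B δ : ℝ) :
    IsClosed (approxSet K D val σ ρ η B δ) := by
  set Q : Set (ℕ → ℕ → ℂ) := Set.univ.pi fun _ => Set.univ.pi fun _ => Metric.closedBall 0 B
  have hQ : IsCompact Q :=
    isCompact_univ_pi fun _ => isCompact_univ_pi fun _ => isCompact_closedBall 0 B
  have : CompactSpace Q := isCompact_iff_compactSpace.mp hQ
  set G : Set (Q × (ι → ℝ)) := {p | (∀ a < gridSize K, a ≠ 0 → ∀ k < D, ‖p.1.1 a k‖ ≤ δ) ∧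
    Approx K D val σ ρ η p.1.1 p.2}
  have hcoef : ∀ a k, Continuous fun p : Q × (ι → ℝ) => p.1.1 a k := fun a k =>
    (continuous_apply k).comp ((continuous_apply a).comp (continuous_subtype_val.comp
      continuous_fst))
  have hv : ∀ i, Continuous fun p : Q × (ι → ℝ) => p.2 i := fun i =>
    (continuous_apply i).comp continuous_snd
  have hchar : ∀ u, Continuous fun p : Q × (ι → ℝ) => lawChar val p.2 u := by
    intro u
    unfold lawChar
    refine continuous_finsetSum _ fun i _ => ?_
    have := hv i
    fun_prop
  have hmean : Continuous fun p : Q × (ι → ℝ) => lawMean val p.2 := by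
    unfold lawMean
    refine continuous_finsetSum _ fun i _ => ?_
    have := hv i
    fun_prop
  have hloc : ∀ a s, Continuous fun p : Q × (ι → ℝ) => localApprox D (p.1.1 a) σ s := by
    intro a s
    unfold localApprox
    refine continuous_const.mul (continuous_finsetSum _ fun k _ => ?_)
    exact (hcoef a k).mul continuous_const
  have hG : IsClosed G := by
    have hGe : G = (⋂ a, ⋂ (_ : a < gridSize K), ⋂ (_ : a ≠ 0), ⋂ k, ⋂ (_ : k < D),
        {p | ‖p.1.1 a k‖ ≤ δ}) ∩
        ((⋂ a, ⋂ (_ : a < gridSize K), ⋂ s : ℝ, ⋂ (_ : |s| ≤ ρ),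
          {p | ‖lawChar val p.2 (gridPt K a + s) *
            Complex.exp (-(Complex.I * s * (lawMean val p.2 : ℝ)))
            - localApprox D (p.1.1 a) σ s‖ ≤ η}) ∩
        (⋂ a, ⋂ (_ : a < gridSize K), ⋂ s : ℝ, ⋂ (_ : ρ ≤ |s|), ⋂ (_ : |s| ≤ Real.pi / gridSize K),
          {p | ‖lawChar val p.2 (gridPt K a + s)‖ ≤ η})) := by
      ext p
      simp only [G, Approx, Set.mem_inter_iff, Set.mem_iInter, Set.mem_ofPred_eq]
    rw [hGe]
    refine IsClosed.inter ?_ (IsClosed.inter ?_ ?_)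
    · exact isClosed_iInter fun a => isClosed_iInter fun _ => isClosed_iInter fun _ =>
        isClosed_iInter fun k => isClosed_iInter fun _ =>
          isClosed_le (hcoef a k).norm continuous_const
    · refine isClosed_iInter fun a => isClosed_iInter fun _ => isClosed_iInter fun s =>
        isClosed_iInter fun _ => isClosed_le ?_ continuous_const
      have h1 := hchar (gridPt K a + s)
      have h2 := hloc a s
      fun_prop
    · exact isClosed_iInter fun a => isClosed_iInter fun _ => isClosed_iInter fun s =>
        isClosed_iInter fun _ => isClosed_iInter fun _ => isClosed_le (hchar _).norm continuous_const
  have himg : approxSet K D val σ ρ η B δ = Prod.snd '' G := by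
    ext v
    constructor
    · rintro ⟨c, hc, hc2, hc3⟩
      refine ⟨(⟨c, fun a _ k _ => ?_⟩, v), ⟨hc2, hc3⟩, rfl⟩
      simpa using hc a k
    · rintro ⟨⟨⟨c, hc⟩, v'⟩, ⟨h1, h2⟩, rfl⟩
      exact ⟨c, fun a k => by simpa using hc a trivial k trivial, h1, h2⟩
  rw [himg]
  exact isClosedMap_snd_of_compactSpace _ hG

end

section

variable {μ : Measure Ω} {X : ℕ → Ω → E} {κ : ℕ → Kernel E E} {f : ℕ → E → ℤ} {C : ℝ} {K : ℕ}
  {b : ℕ → ℤ}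

/-- The conditional law of `S_N` as a finite vector. -/
def condLaw (μ : Measure Ω) (X : ℕ → Ω → E) (f : ℕ → E → ℤ) (K N : ℕ) {ℓ : ℕ} (j : Fin ℓ → ℕ)
    (ω : Ω) (i : Vals K N) : ℝ :=
  condProb μ (sigmaOf X j) {ω' | S X f N ω' = i} ω

namespace Model

lemma condExp_comp_S (h : Model μ X κ f C K b) {F : Type*} [NormedAddCommGroup F]
    [NormedSpace ℝ F] [CompleteSpace F] (N : ℕ) {ℓ : ℕ} (j : Fin ℓ → ℕ) (g : ℤ → F) :
    μ[fun ω => g (S X f N ω) | sigmaOf X j] =ᵐ[μ]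
      fun ω => ∑ i : Vals K N, condLaw μ X f K N j ω i • g i := by
  have := h.prob
  have hm := sigmaOf_le h.measX j
  have hcl : ∀ i, Integrable (fun ω => condLaw μ X f K N j ω i) μ := fun i => integrable_condExp
  have hgint : Integrable (fun ω => g (S X f N ω)) μ := by
    rw [integrable_congr (Eventually.of_forall (h.comp_S_eq_sum N g))]
    exact integrable_finsetSum _ fun i _ =>
      (integrable_const (g i)).indicator (h.measurableSet_S N i)
  symm
  refine ae_eq_condExp_of_forall_setIntegral_eq hm hgint ?_ ?_ ?_
  · intro s _ _
    exact (integrable_finsetSum _ fun i _ => (hcl i).smul_const (g i)).integrableOn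
  · intro s hs _
    rw [h.integral_comp_S (μ.restrict s) N g,
      integral_finsetSum _ fun i _ => ((hcl i).smul_const (g i)).integrableOn]
    refine Finset.sum_congr rfl fun i _ => ?_
    rw [integral_smul_const]
    congr 1
    unfold condLaw condProb
    rw [setIntegral_condExp hm ((integrable_const _).indicator (h.measurableSet_S N i)) hs, lawS]
    exact integral_indicator_one (h.measurableSet_S N i)
  · refine StronglyMeasurable.aestronglyMeasurable ?_
    refine Finset.stronglyMeasurable_fun_sum _ fun i _ => ?_
    exact StronglyMeasurable.smul_const stronglyMeasurable_condExp _

/-- Conditional probabilities, means and characteristic functions in terms of the conditional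
law. -/
lemma ae_condLaw (h : Model μ X κ f C K b) (N : ℕ) {ℓ : ℕ} (j : Fin ℓ → ℕ) :
    ∀ᵐ ω ∂μ,
      (μ[fun ω' => ((S X f N ω' : ℝ)) | sigmaOf X j]) ω =
        lawMean (fun i : Vals K N => (i : ℤ)) (condLaw μ X f K N j ω) ∧
      (∀ a : ℕ, condChar μ X f (gridPt K a) N j ω =
        lawChar (fun i : Vals K N => (i : ℤ)) (condLaw μ X f K N j ω) (gridPt K a)) ∧
      ∀ k : ℤ, condProb μ (sigmaOf X j) {ω' | S X f N ω' = k} ω =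
        lawMass (fun i : Vals K N => (i : ℤ)) (condLaw μ X f K N j ω) k := by
  have h1 := h.condExp_comp_S N j (fun k => (k : ℝ))
  have h2 := fun a : ℕ => h.condExp_comp_S N j
    (fun k => Complex.exp (Complex.I * (gridPt K a : ℂ) * (k : ℂ)))
  have h3 := fun k : ℤ => h.condExp_comp_S N j (fun n => if n = k then (1 : ℝ) else 0)
  filter_upwards [h1, ae_all_iff.mpr h2, ae_all_iff.mpr h3] with ω h1 h2 h3
  refine ⟨?_, fun a => ?_, fun k => ?_⟩
  · rw [h1, lawMean]
    simp only [smul_eq_mul]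
  · unfold condChar
    rw [h2 a, lawChar]
    simp only [Complex.real_smul]
  · unfold condProb lawMass
    have : ({ω' | S X f N ω' = k} : Set Ω).indicator (fun _ => (1 : ℝ)) =
        fun ω => if S X f N ω = k then (1 : ℝ) else 0 := by
      funext ω
      simp [Set.indicator_apply]
    rw [this, h3 k]
    simp

lemma ae_condLaw_mem (h : Model μ X κ f C K b) {N ℓ : ℕ} {j : Fin ℓ → ℕ} {F : Set (Vals K N → ℝ)}
    (hF : IsClosed F) (hj : ∀ i, j i ∈ Finset.Icc 1 N)
    (hrect : ∀ (J : Finset ℕ) (A : ℕ → Set E), J.card ≤ ℓ → J ⊆ Ioc 0 N →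
      (∀ i, MeasurableSet (A i)) → 0 < μ.real (rect X J A) →
      lawS (μ[|rect X J A]) X f K N ∈ F) :
    ∀ᵐ ω ∂μ, condLaw μ X f K N j ω ∈ F := by
  classical
  have := h.prob
  refine ae_condExp_mem_of_rect h.measX j
    (fun i : Vals K N => (integrable_const (1 : ℝ)).indicator (h.measurableSet_S N i)) hF fun A hA hpos => ?_
  have h1 := hrect (univ.image j) A (Finset.card_image_le.trans (by simp)) (by
    intro n hn
    obtain ⟨i, -, rfl⟩ := Finset.mem_image.mp hn
    have := Finset.mem_Icc.mp (hj i)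
    exact Finset.mem_Ioc.mpr ⟨by omega, this.2⟩) hA hpos
  convert h1 using 1
  funext i
  rw [lawS, ← integral_indicator_one (h.measurableSet_S N i)]
  rfl

end Model

end

lemma exists_herm_bound (D : ℕ) : ∃ G : ℝ, 0 ≤ G ∧ ∀ k < D, ∀ x : ℝ,
    |(herm k).eval x * gaussDensity x| ≤ G := by
  set g : ℕ → ℝ := fun k => ∫ h : ℝ, |h| ^ k * Real.exp (-(1 / 2) * h ^ 2)
  have hg : ∀ k, 0 ≤ g k := fun k => integral_nonneg fun h => by positivity
  refine ⟨∑ k ∈ range D, g k, Finset.sum_nonneg fun k _ => hg k, fun k hk x => ?_⟩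
  refine le_trans ?_ (Finset.single_le_sum (f := g) (fun k _ => hg k) (Finset.mem_range.mpr hk))
  have h1 : ‖gaussFour k x‖ ≤ g k := by
    refine (norm_integral_le_integral_norm _).trans (le_of_eq ?_)
    simp_rw [norm_gaussFour_integrand]
    rfl
  rw [gaussFour_eq, Complex.norm_real, Real.norm_eq_abs, abs_mul,
    abs_of_pos (by positivity : (0 : ℝ) < 2 * Real.pi)] at h1
  refine le_trans ?_ h1
  refine le_mul_of_one_le_left (abs_nonneg _) ?_
  linarith [Real.pi_gt_three]

lemma exp_neg_sq_le (D : ℕ) {τ : ℝ} (hτ : 1 ≤ τ) :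
    Real.exp (-τ ^ 2 / 8) ≤ 8 ^ D * D.factorial * (τ ^ D)⁻¹ := by
  have hτ0 : 0 < τ := by linarith
  have h1 := Real.pow_div_factorial_le_exp (τ ^ 2 / 8) (by positivity) D
  have h2 : (τ ^ D / (8 ^ D * D.factorial) : ℝ) ≤ Real.exp (τ ^ 2 / 8) := by
    refine le_trans ?_ h1
    rw [div_pow, div_div, ← pow_mul]
    gcongr
    omega
  rw [neg_div, Real.exp_neg]
  calc (Real.exp (τ ^ 2 / 8))⁻¹ ≤ (τ ^ D / (8 ^ D * D.factorial) : ℝ)⁻¹ :=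
        inv_anti₀ (by positivity) h2
    _ = _ := by rw [inv_div, div_eq_mul_inv]

/-- Local expansion of point masses. -/
lemma exists_lawMass_approx (K D : ℕ) : ∃ A : ℝ, 0 < A ∧
    ∀ {ι : Type} [Fintype ι] (val : ι → ℤ) (v : ι → ℝ) (c : ℕ → ℕ → ℂ) (B τ : ℝ),
      (∀ a k, ‖c a k‖ ≤ B) → 0 ≤ B → 1 ≤ τ → (gridSize K : ℝ) ≤ τ →
      Approx K D val (τ ^ 6) (τ ^ 5)⁻¹ (B * (τ ^ D)⁻¹) c v → ∀ κ : ℤ,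
      ‖(lawMass val v κ : ℂ) - (((τ ^ 6)⁻¹ : ℝ) : ℂ) *
        mainTerm K D c ((κ - lawMean val v) / τ ^ 6) κ‖ ≤ A * B * (τ ^ D)⁻¹ := by
  obtain ⟨A, hA, hinv⟩ := exists_fourier_inversion K D
  refine ⟨A * (1 + 8 ^ D * D.factorial), by positivity, ?_⟩
  intro ι _ val v c B τ hc hB hτ hτL happ κ
  have hτ0 : 0 < τ := by linarith
  have hL := one_le_gridSize K
  have hrho : (τ ^ 5)⁻¹ < Real.pi / gridSize K := by
    rw [inv_lt_comm₀ (by positivity) (by have := Real.pi_pos; positivity), inv_div]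
    have h1 : τ ≤ τ ^ 5 := le_self_pow₀ hτ (by norm_num)
    have h2 : (gridSize K : ℝ) / Real.pi < gridSize K :=
      div_lt_self (by linarith) (by linarith [Real.pi_gt_three])
    linarith
  have h1 := hinv val v c B (τ ^ 6) (τ ^ 5)⁻¹ (B * (τ ^ D)⁻¹) (lawMean val v)
    (fun a _ k _ => hc a k) hB (one_le_pow₀ hτ) (by positivity) hrho happ.1 happ.2 κ
  refine h1.trans ?_
  have e1 : (τ ^ 5)⁻¹ * τ ^ 6 = τ := by field_simp
  rw [e1]
  have h2 := exp_neg_sq_le D hτ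
  calc A * (B * (τ ^ D)⁻¹ + B * Real.exp (-τ ^ 2 / 8))
      ≤ A * (B * (τ ^ D)⁻¹ + B * (8 ^ D * D.factorial * (τ ^ D)⁻¹)) := by gcongr
    _ = _ := by ring

section

variable {μ : Measure Ω} {X : ℕ → Ω → E} {κ : ℕ → Kernel E E} {f : ℕ → E → ℤ} {C : ℝ} {K : ℕ}
  {b : ℕ → ℤ}

lemma exists_scale (hV : Tendsto (fun N => VN μ X f N) atTop atTop) (T : ℝ) :
    ∃ N₀ : ℕ, ∀ N ≥ N₀, ∃ τ : ℝ, T ≤ τ ∧ 1 ≤ τ ∧ τ ^ 12 = VN μ X f N ∧ sigN μ X f N = τ ^ 6 := by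
  obtain ⟨N₀, hN₀⟩ := eventually_atTop.mp (tendsto_atTop.mp hV ((max T 1) ^ 12))
  refine ⟨N₀, fun N hN => ?_⟩
  have hm : 1 ≤ max T 1 := le_max_right _ _
  have hv := hN₀ N hN
  have hv1 : 1 ≤ VN μ X f N := (one_le_pow₀ hm).trans hv
  have hpow : (VN μ X f N ^ ((12 : ℝ)⁻¹)) ^ 12 = VN μ X f N := by
    have := Real.rpow_inv_natCast_pow (x := VN μ X f N) (by linarith) (n := 12) (by norm_num)
    exact_mod_cast this
  have hτ0 : 0 ≤ VN μ X f N ^ ((12 : ℝ)⁻¹) := Real.rpow_nonneg (by linarith) _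
  set τ := VN μ X f N ^ ((12 : ℝ)⁻¹)
  have hle : max T 1 ≤ τ := by
    rw [← hpow] at hv
    exact le_of_pow_le_pow_left₀ (by norm_num) hτ0 hv
  refine ⟨τ, (le_max_left _ _).trans hle, hm.trans hle, hpow, ?_⟩
  rw [sigN, ← hpow, show τ ^ 12 = (τ ^ 6) ^ 2 by ring]
  exact Real.sqrt_sq (by positivity)

/-- The polynomial in the nonoscillating part of the expansion. -/
def mainPoly (D : ℕ) (c : ℕ → ℂ) : Polynomial ℝ :=
  ∑ k ∈ range D, Polynomial.C (c k).re * herm k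

lemma natDegree_mainPoly_le (D : ℕ) (c : ℕ → ℂ) : (mainPoly D c).natDegree ≤ D := by
  refine Polynomial.natDegree_sum_le_of_forall_le _ _ fun k hk => ?_
  refine (Polynomial.natDegree_C_mul_le _ _).trans ?_
  rw [natDegree_herm]
  exact (Finset.mem_range.mp hk).le

lemma abs_coeff_mainPoly_le {D : ℕ} {c : ℕ → ℂ} {B : ℝ} (hB : 0 ≤ B) (hc : ∀ k, ‖c k‖ ≤ B) (i : ℕ) :
    |(mainPoly D c).coeff i| ≤ B * ∑ k ∈ range D, ∑ i ∈ range D, |(herm k).coeff i| := by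
  unfold mainPoly
  rw [Polynomial.finsetSum_coeff, Finset.mul_sum]
  refine (Finset.abs_sum_le_sum_abs _ _).trans (Finset.sum_le_sum fun k hk => ?_)
  rw [Polynomial.coeff_C_mul, abs_mul]
  refine mul_le_mul ((Complex.abs_re_le_norm _).trans (hc k)) ?_ (abs_nonneg _) hB
  by_cases hi : i < D
  · exact Finset.single_le_sum (f := fun i => |(herm k).coeff i|) (fun _ _ => abs_nonneg _)
      (Finset.mem_range.mpr hi)
  · rw [Polynomial.coeff_eq_zero_of_natDegree_lt, abs_zero]
    · exact Finset.sum_nonneg fun _ _ => abs_nonneg _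
    · rw [natDegree_herm]
      have := Finset.mem_range.mp hk
      omega

lemma re_sum_eq_mainPoly (D : ℕ) (c : ℕ → ℂ) (x : ℝ) :
    (∑ k ∈ range D, c k * (((herm k).eval x * gaussDensity x : ℝ) : ℂ)).re =
      (mainPoly D c).eval x * gaussDensity x := by
  rw [Complex.re_sum, mainPoly, Polynomial.eval_finsetSum, Finset.sum_mul]
  refine Finset.sum_congr rfl fun k _ => ?_
  rw [Complex.re_mul_ofReal, Polynomial.eval_mul, Polynomial.eval_C]
  ring

lemma abs_re_mainTerm_sub_le {D : ℕ} {c : ℕ → ℕ → ℂ} {δ G x : ℝ} (hδ : 0 ≤ δ)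
    (hG : ∀ k < D, |(herm k).eval x * gaussDensity x| ≤ G)
    (hc : ∀ a < gridSize K, a ≠ 0 → ∀ k < D, ‖c a k‖ ≤ δ) (n : ℤ) :
    |(mainTerm K D c x n).re - (mainPoly D (c 0)).eval x * gaussDensity x| ≤
      gridSize K * (D * (δ * G)) := by
  have hG0 : ∀ k < D, 0 ≤ G := fun k hk => (abs_nonneg _).trans (hG k hk)
  set T : ℕ → ℂ := fun a => Complex.exp (-(Complex.I * gridPt K a * n)) *
    ∑ k ∈ range D, c a k * (((herm k).eval x * gaussDensity x : ℝ) : ℂ) with hT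
  have h0 : T 0 = ∑ k ∈ range D, c 0 k * (((herm k).eval x * gaussDensity x : ℝ) : ℂ) := by
    simp [hT, gridPt_zero]
  have hsplit : mainTerm K D c x n = T 0 + ∑ a ∈ (range (gridSize K)).erase 0, T a := by
    rw [mainTerm, Finset.add_sum_erase _ T (Finset.mem_range.mpr (gridSize_pos K))]
  rw [← re_sum_eq_mainPoly, ← h0, hsplit, Complex.add_re, add_sub_cancel_left]
  refine (Complex.abs_re_le_norm _).trans ?_
  have hDG : 0 ≤ (D : ℝ) * (δ * G) := by
    rcases Nat.eq_zero_or_pos D with h | h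
    · simp [h]
    · have := hG0 0 h
      positivity
  have hterm : ∀ a ∈ (range (gridSize K)).erase 0, ‖T a‖ ≤ D * (δ * G) := by
    intro a ha
    rw [Finset.mem_erase, Finset.mem_range] at ha
    have e1 : -(Complex.I * gridPt K a * n) = ((-(gridPt K a * n) : ℝ) : ℂ) * Complex.I := by
      push_cast; ring
    rw [hT]
    simp only
    rw [norm_mul, e1, Complex.norm_exp_ofReal_mul_I, one_mul]
    calc _ ≤ ∑ k ∈ range D, δ * G := by
          refine norm_sum_le_of_le _ fun k hk => ?_
          rw [norm_mul, Complex.norm_real, Real.norm_eq_abs]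
          have hk' := Finset.mem_range.mp hk
          exact mul_le_mul (hc a ha.2 ha.1 k hk') (hG k hk') (abs_nonneg _) hδ
      _ = _ := by simp
  calc _ ≤ ∑ a ∈ (range (gridSize K)).erase 0, (D * (δ * G) : ℝ) := norm_sum_le_of_le _ hterm
    _ ≤ ∑ a ∈ range (gridSize K), (D * (δ * G) : ℝ) :=
        Finset.sum_le_sum_of_subset_of_nonneg (Finset.erase_subset _ _) fun _ _ _ => hDG
    _ = _ := by simp

namespace Model

/-- Smallness of the conditional characteristic functions at resonances gives conditionally stable
Edgeworth expansions. -/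
theorem condStableEdgeworth_of_small (h : Model μ X κ f C K b) {r : ℕ} (hr : 1 ≤ r)
    (hV : Tendsto (fun N => VN μ X f N) atTop atTop)
    (hsmall : ∀ t : ℝ, IsResonant K t → t ≠ 0 → ∀ ℓ : ℕ, ∀ ε > 0, ∃ N₀, ∀ N ≥ N₀,
      ∀ j : Fin ℓ → ℕ, (∀ i, j i ∈ Finset.Icc 1 N) →
        (∫ ω, ‖condChar μ X f t N j ω‖ ∂μ) ≤ ε * (sigN μ X f N)⁻¹ ^ (r - 1)) :
    CondStableEdgeworth μ X f r := by
  classical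
  intro ℓ
  set D : ℕ := 6 * (r + 1) with hD
  obtain ⟨B, τ₀, R, hB, hτ₀, hR, happ⟩ := h.exists_approx ℓ D
  obtain ⟨A, hA, hmass⟩ := exists_lawMass_approx K D
  obtain ⟨G, hG0, hG⟩ := exists_herm_bound D
  have hL := one_le_gridSize K
  refine ⟨D, B * ∑ k ∈ range D, ∑ i ∈ range D, |(herm k).coeff i|, fun ε hε => ?_⟩
  set W : ℝ := gridSize K * (D * G) with hW
  have hW0 : 0 ≤ W := by positivity
  set ε₁ : ℝ := ε / (2 * (W + 1)) with hε₁
  have hε₁0 : 0 < ε₁ := by positivity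
  obtain ⟨τ₁, N₁, hcoeff⟩ := h.exists_coeff_small ℓ r D hB hR hr (by omega) hsmall hε₁0
  obtain ⟨N₂, hN₂⟩ := exists_scale hV (τ₀ + |τ₁| + gridSize K + 2 * (A * B) / ε)
  refine ⟨max N₁ N₂, fun N hN j hj => ?_⟩
  obtain ⟨τ, hτ, hτ1, hτV, hσ⟩ := hN₂ N (le_of_max_le_right hN)
  have hfr : 0 ≤ 2 * (A * B) / ε := by positivity
  have hτabs := le_abs_self τ₁
  have hτabs0 := abs_nonneg τ₁
  have hτ0 : 0 < τ := by linarith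
  set δ : ℝ := ε₁ * ((τ ^ 6)⁻¹) ^ (r - 1) with hδ
  have hδ0 : 0 ≤ δ := by positivity
  have hmem : ∀ᵐ ω ∂μ, condLaw μ X f K N j ω ∈ approxSet K D (fun i : Vals K N => (i : ℤ))
      (τ ^ 6) (τ ^ 5)⁻¹ (B * (τ ^ D)⁻¹) B δ := by
    refine h.ae_condLaw_mem (isClosed_approxSet _ _ _ _ _ _ _ _) hj fun J A' hJ hJN hA' hpos => ?_
    obtain ⟨c, hc, hca, hdich⟩ := happ N τ (by linarith) hτV J A' hJ hJN hA' hpos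
    refine ⟨c, hc, fun a ha ha0 k hk => ?_, hca⟩
    rcases hdich a ha with h0 | ⟨hres, hvis⟩
    · rw [h0 k, norm_zero]
      exact hδ0
    · exact hcoeff N (le_of_max_le_left hN) τ (by linarith) hτV J A' hJ hJN hA' hpos c hca a ha ha0
        hres hvis k hk
  set good : Ω → Prop := fun ω => condLaw μ X f K N j ω ∈
    approxSet K D (fun i : Vals K N => (i : ℤ)) (τ ^ 6) (τ ^ 5)⁻¹ (B * (τ ^ D)⁻¹) B δ with hgood
  have hex : ∀ ω, ∃ c : ℕ → ℕ → ℂ, (∀ a k, ‖c a k‖ ≤ B) ∧ (good ω →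
      (∀ a < gridSize K, a ≠ 0 → ∀ k < D, ‖c a k‖ ≤ δ) ∧
      Approx K D (fun i : Vals K N => (i : ℤ)) (τ ^ 6) (τ ^ 5)⁻¹ (B * (τ ^ D)⁻¹) c
        (condLaw μ X f K N j ω)) := by
    intro ω
    by_cases hg : good ω
    · obtain ⟨c, hc, hc2⟩ := hg
      exact ⟨c, hc, fun _ => hc2⟩
    · exact ⟨fun _ _ => 0, fun _ _ => by simpa using hB, fun hg' => absurd hg' hg⟩
  choose c hcB hc using hex
  refine ⟨fun n ω => if n = 1 then mainPoly D (c ω 0) else 0, fun n ω => ?_, fun n ω i => ?_, ?_⟩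
  · simp only
    split_ifs
    · exact natDegree_mainPoly_le _ _
    · simp
  · simp only
    split_ifs
    · exact abs_coeff_mainPoly_le hB (hcB ω 0) i
    · simp only [Polynomial.coeff_zero, abs_zero]
      positivity
  filter_upwards [hmem, h.ae_condLaw N j] with ω hω ⟨hmean, _, hprob⟩ k
  obtain ⟨hc1, hc2⟩ := hc ω hω
  rw [hmean, hprob, hσ]
  set e := lawMean (fun i : Vals K N => (i : ℤ)) (condLaw μ X f K N j ω)
  set p := lawMass (fun i : Vals K N => (i : ℤ)) (condLaw μ X f K N j ω) k
  set x : ℝ := ((k : ℝ) - e) / τ ^ 6 with hx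
  have hsum : ∑ n ∈ Finset.Icc 1 r, (τ ^ 6)⁻¹ ^ n *
      Polynomial.eval x (if n = 1 then mainPoly D (c ω 0) else 0) * gaussDensity x =
      (τ ^ 6)⁻¹ * ((mainPoly D (c ω 0)).eval x * gaussDensity x) := by
    rw [Finset.sum_eq_single 1]
    · simp [mul_assoc]
    · intro n _ hn
      simp [hn]
    · intro hn
      exact absurd (Finset.mem_Icc.mpr ⟨le_rfl, hr⟩) hn
  rw [hsum]
  have h1 := hmass _ _ (c ω) B τ (hcB ω) hB hτ1 (by linarith) hc2 k
  have h2 := abs_re_mainTerm_sub_le (K := K) hδ0 (fun k hk => hG k hk x) hc1 k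
  have h3 : |p - (τ ^ 6)⁻¹ * (mainTerm K D (c ω) x k).re| ≤ A * B * (τ ^ D)⁻¹ := by
    refine le_trans ?_ h1
    refine le_trans (le_of_eq ?_) (Complex.abs_re_le_norm _)
    rw [Complex.sub_re, Complex.ofReal_re, Complex.re_ofReal_mul]
  have hτ6 : 0 < (τ ^ 6)⁻¹ := by positivity
  have h4 : |p - (τ ^ 6)⁻¹ * ((mainPoly D (c ω 0)).eval x * gaussDensity x)| ≤
      A * B * (τ ^ D)⁻¹ + (τ ^ 6)⁻¹ * (gridSize K * (D * (δ * G))) := by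
    have e1 : p - (τ ^ 6)⁻¹ * ((mainPoly D (c ω 0)).eval x * gaussDensity x) =
        (p - (τ ^ 6)⁻¹ * (mainTerm K D (c ω) x k).re) + (τ ^ 6)⁻¹ *
          ((mainTerm K D (c ω) x k).re - (mainPoly D (c ω 0)).eval x * gaussDensity x) := by ring
    rw [e1]
    refine (abs_add_le _ _).trans (add_le_add h3 ?_)
    rw [abs_mul, abs_of_pos hτ6]
    gcongr
  refine h4.trans ?_
  set y : ℝ := (τ ^ 6)⁻¹ ^ r with hy
  have hy0 : 0 < y := by positivity
  have b1 : (τ ^ D)⁻¹ ≤ y * τ⁻¹ := by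
    rw [hy, inv_pow, ← pow_mul, ← mul_inv, ← pow_succ]
    exact inv_anti₀ (by positivity) (pow_le_pow_right₀ hτ1 (by omega))
  have b2 : (τ ^ 6)⁻¹ * (gridSize K * (D * (δ * G))) = W * ε₁ * y := by
    have : y = (τ ^ 6)⁻¹ ^ (r - 1) * (τ ^ 6)⁻¹ := by
      rw [hy, ← pow_succ]; congr 1; omega
    rw [this, hδ, hW]
    ring
  have b3 : W * ε₁ ≤ ε / 2 := by
    rw [hε₁, mul_div_assoc', div_le_div_iff₀ (by positivity) (by norm_num)]
    nlinarith
  have b4 : A * B * τ⁻¹ ≤ ε / 2 := by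
    rw [← div_eq_mul_inv, div_le_iff₀ hτ0]
    have : 2 * (A * B) / ε ≤ τ := by linarith
    rw [div_le_iff₀ hε] at this
    linarith
  rw [b2]
  calc A * B * (τ ^ D)⁻¹ + W * ε₁ * y ≤ A * B * (y * τ⁻¹) + W * ε₁ * y := by gcongr
    _ = (A * B * τ⁻¹ + W * ε₁) * y := by ring
    _ ≤ (ε / 2 + ε / 2) * y := by gcongr
    _ = ε * y := by ring

end Model

end

lemma sum_grid_character (K : ℕ) {a a' : ℕ} (ha : a < gridSize K) (ha' : a' < gridSize K) (n : ℤ) :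
    ∑ m ∈ range (gridSize K), Complex.exp (Complex.I * gridPt K a * (n + m : ℤ)) *
      Complex.exp (-(Complex.I * gridPt K a' * (n + m : ℤ))) =
      if a = a' then (gridSize K : ℂ) else 0 := by
  have hL : (gridSize K : ℂ) ≠ 0 := by exact_mod_cast (gridSize_pos K).ne'
  have hpi : (Real.pi : ℂ) ≠ 0 := by exact_mod_cast Real.pi_ne_zero
  split_ifs with haa
  · subst haa
    have : ∀ m ∈ range (gridSize K), Complex.exp (Complex.I * gridPt K a * (n + m : ℤ)) *
        Complex.exp (-(Complex.I * gridPt K a * (n + m : ℤ))) = 1 := fun m _ => by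
      rw [← Complex.exp_add, add_neg_cancel, Complex.exp_zero]
    rw [Finset.sum_congr rfl this]
    simp
  set z : ℂ := Complex.I * (gridPt K a - gridPt K a') with hz
  set ζ : ℂ := Complex.exp z with hζ
  have hterm : ∀ m ∈ range (gridSize K), Complex.exp (Complex.I * gridPt K a * (n + m : ℤ)) *
      Complex.exp (-(Complex.I * gridPt K a' * (n + m : ℤ))) = Complex.exp (z * n) * ζ ^ m := by
    intro m _
    rw [← Complex.exp_add, hζ, ← Complex.exp_nat_mul, ← Complex.exp_add]
    congr 1
    rw [hz]
    push_cast
    ring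
  have hzg : z * gridSize K = ((a : ℤ) - a' : ℤ) * (2 * Real.pi * Complex.I) := by
    rw [hz, gridPt, gridPt]
    push_cast
    field_simp
  have hζ1 : ζ ≠ 1 := by
    intro h1
    obtain ⟨q, hq⟩ := Complex.exp_eq_one_iff.mp h1
    rw [hq] at hzg
    have h2 : ((q * gridSize K : ℤ) : ℂ) = ((a : ℤ) - a' : ℤ) := by
      have h3 : (2 * Real.pi * Complex.I : ℂ) ≠ 0 := by
        simp [hpi]
      apply mul_right_cancel₀ h3
      rw [← hzg]
      push_cast
      ring
    have h4 : q * gridSize K = (a : ℤ) - a' := by exact_mod_cast h2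
    have h5 : |q * gridSize K| < (gridSize K : ℤ) := by
      rw [h4, abs_lt]
      constructor <;> omega
    have hLz : (0 : ℤ) < gridSize K := by exact_mod_cast gridSize_pos K
    rw [abs_mul, abs_of_pos hLz] at h5
    have h6 : |q| < 1 := by
      by_contra hcon
      push Not at hcon
      nlinarith
    rw [Int.abs_lt_one_iff] at h6
    rw [h6, zero_mul] at h4
    omega
  have hζL : ζ ^ gridSize K = 1 := by
    rw [hζ, ← Complex.exp_nat_mul, mul_comm, hzg]
    exact Complex.exp_int_mul_two_pi_mul_I _
  rw [Finset.sum_congr rfl hterm, ← Finset.mul_sum, geom_sum_eq hζ1, hζL]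
  simp

lemma norm_poly_sub_le (M : ℕ) (d : ℕ → ℂ) {x y : ℝ} (hx : |x| ≤ 1) (hy : |y| ≤ 1) :
    ‖∑ i ∈ range M, d i * (x : ℂ) ^ i - ∑ i ∈ range M, d i * (y : ℂ) ^ i‖ ≤
      (∑ i ∈ range M, ‖d i‖) * (M * |x - y|) := by
  rw [← Finset.sum_sub_distrib, Finset.sum_mul]
  refine norm_sum_le_of_le _ fun i hi => ?_
  rw [← mul_sub, norm_mul, ← Complex.ofReal_pow, ← Complex.ofReal_pow, ← Complex.ofReal_sub,
    Complex.norm_real, Real.norm_eq_abs]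
  refine mul_le_mul_of_nonneg_left ?_ (norm_nonneg _)
  refine (abs_pow_sub_pow_le x y i).trans ?_
  have h1 : max |x| |y| ^ (i - 1) ≤ 1 := pow_le_one₀ (by positivity) (max_le hx hy)
  have h2 : (i : ℝ) ≤ M := by exact_mod_cast (Finset.mem_range.mp hi).le
  calc |x - y| * i * max |x| |y| ^ (i - 1) ≤ |x - y| * M * 1 := by gcongr
    _ = _ := by ring

/-- An oscillating polynomial expression that is small at all lattice points of a window has small
coefficients. -/
lemma exists_separation (K M : ℕ) : ∃ Γ σ₀ : ℝ, 0 ≤ Γ ∧ ∀ (σ e θ : ℝ) (d : ℕ → ℕ → ℂ), σ₀ ≤ σ →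
    0 ≤ θ → (∀ n : ℤ, |((n : ℝ) - e) / σ| ≤ 1 → ‖∑ a ∈ range (gridSize K),
      Complex.exp (-(Complex.I * gridPt K a * n)) *
        ∑ i ∈ range M, d a i * ((((n : ℝ) - e) / σ : ℝ) : ℂ) ^ i‖ ≤ θ) →
    ∀ a < gridSize K, ∀ i < M, ‖d a i‖ ≤ Γ * θ := by
  have hL := one_le_gridSize K
  obtain ⟨A₁, hA₁, hinterp⟩ := exists_interpolation (fun k => (Polynomial.X : Polynomial ℝ) ^ k)
    (fun k => Polynomial.monic_X_pow k) (fun k => Polynomial.natDegree_X_pow k)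
    (y := fun j : ℕ => (j : ℝ) / (2 * (M + 1))) (fun i j hij => by
      have : (0 : ℝ) < 2 * (M + 1) := by positivity
      have h2 : (i : ℝ) / (2 * (M + 1)) = j / (2 * (M + 1)) := hij
      rw [div_left_inj' this.ne'] at h2
      exact_mod_cast h2) M
  set L : ℝ := ((gridSize K : ℕ) : ℝ) with hLdef
  refine ⟨2 * (L * (M * A₁)), 2 * L + 2 * (L * (M * A₁)) * (M * L), by positivity, ?_⟩
  intro σ e θ d hσ hθ hsmall
  have hfr : 0 ≤ 2 * (L * (M * A₁)) * (M * L) := by positivity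
  have hσ0 : 0 < σ := by linarith
  set H : ℝ := ∑ a ∈ range (gridSize K), ∑ i ∈ range M, ‖d a i‖ with hH
  have hH0 : 0 ≤ H := by positivity
  have hval : ∀ y : ℝ, 0 ≤ y → y ≤ 1 / 2 → ∀ a < gridSize K,
      ‖∑ i ∈ range M, d a i * (y : ℂ) ^ i‖ ≤ θ + H * (M * (L / σ)) := by
    intro y hy0 hy1 a ha
    set n₀ : ℤ := ⌊e + σ * y⌋ with hn₀
    have hfl := Int.floor_le (e + σ * y)
    have hfl2 := Int.lt_floor_add_one (e + σ * y)
    have hyabs : |y| ≤ 1 := by rw [abs_of_nonneg hy0]; linarith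
    set F : ℕ → ℂ := fun m => ∑ a' ∈ range (gridSize K),
      Complex.exp (-(Complex.I * gridPt K a' * (n₀ + m : ℤ))) *
        ∑ i ∈ range M, d a' i * (y : ℂ) ^ i with hF
    have hFb : ∀ m ∈ range (gridSize K), ‖F m‖ ≤ θ + H * (M * (L / σ)) := by
      intro m hm
      have hmL : (m : ℝ) + 1 ≤ L := by
        rw [hLdef]
        exact_mod_cast Finset.mem_range.mp hm
      set x : ℝ := (((n₀ + m : ℤ) : ℝ) - e) / σ with hx
      have hxy : |x - y| ≤ L / σ := by
        have e1 : x - y = (n₀ + m - e - σ * y) / σ := by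
          rw [hx]; push_cast; field_simp
        rw [e1, abs_div, abs_of_pos hσ0]
        refine div_le_div_of_nonneg_right ?_ hσ0.le
        have hm0 : (0 : ℝ) ≤ m := Nat.cast_nonneg m
        rw [abs_le]
        constructor <;> linarith
      have hLσ : L / σ ≤ 1 / 2 := by
        rw [div_le_div_iff₀ hσ0 (by norm_num)]
        linarith
      have hxabs : |x| ≤ 1 := by
        rw [abs_le] at hxy ⊢
        constructor <;> linarith
      have h1 := hsmall (n₀ + m) hxabs
      rw [← hx] at h1
      set F' : ℂ := ∑ a' ∈ range (gridSize K),
        Complex.exp (-(Complex.I * gridPt K a' * (n₀ + m : ℤ))) *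
          ∑ i ∈ range M, d a' i * (x : ℂ) ^ i
      have h2 : ‖F' - F m‖ ≤ H * (M * (L / σ)) := by
        rw [← Finset.sum_sub_distrib, hH, Finset.sum_mul]
        refine norm_sum_le_of_le _ fun a' _ => ?_
        have e1 : -(Complex.I * gridPt K a' * (n₀ + m : ℤ)) =
            ((-(gridPt K a' * (n₀ + m : ℤ)) : ℝ) : ℂ) * Complex.I := by
          push_cast; ring
        rw [← mul_sub, norm_mul, e1, Complex.norm_exp_ofReal_mul_I, one_mul]
        refine (norm_poly_sub_le M (d a') hxabs hyabs).trans ?_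
        gcongr
      have h3 := norm_le_norm_add_norm_sub F' (F m)
      linarith
    have horth : ∑ m ∈ range (gridSize K), Complex.exp (Complex.I * gridPt K a * (n₀ + m : ℤ)) * F m
        = gridSize K * ∑ i ∈ range M, d a i * (y : ℂ) ^ i := by
      simp only [hF]
      simp_rw [Finset.mul_sum (range (gridSize K))]
      rw [Finset.sum_comm]
      simp_rw [← mul_assoc, ← Finset.sum_mul]
      rw [Finset.sum_congr rfl fun a' ha' => by
        rw [sum_grid_character K ha (Finset.mem_range.mp ha') n₀]]
      simp [ha]
    have hn : ‖∑ m ∈ range (gridSize K), Complex.exp (Complex.I * gridPt K a * (n₀ + m : ℤ)) * F m‖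
        ≤ L * (θ + H * (M * (L / σ))) := by
      calc _ ≤ ∑ m ∈ range (gridSize K), (θ + H * (M * (L / σ))) := by
            refine norm_sum_le_of_le _ fun m hm => ?_
            have e1 : Complex.I * gridPt K a * (n₀ + m : ℤ) =
                ((gridPt K a * (n₀ + m : ℤ) : ℝ) : ℂ) * Complex.I := by
              push_cast; ring
            rw [norm_mul, e1, Complex.norm_exp_ofReal_mul_I, one_mul]
            exact hFb m hm
        _ = _ := by rw [Finset.sum_const, Finset.card_range, nsmul_eq_mul]
    rw [horth, norm_mul, Complex.norm_natCast] at hn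
    exact le_of_mul_le_mul_left hn (by linarith)
  set w : ℝ := θ + H * (M * (L / σ)) with hw
  have hw0 : 0 ≤ w := by positivity
  have hd : ∀ a < gridSize K, ∀ i < M, ‖d a i‖ ≤ A₁ * w := by
    intro a ha
    refine hinterp (d a) w hw0 fun j hj => ?_
    have hj' : (j : ℝ) ≤ M := by exact_mod_cast hj.le
    have := hval ((j : ℝ) / (2 * (M + 1))) (by positivity) (by
      rw [div_le_div_iff₀ (by positivity) (by norm_num)]
      linarith) a ha
    refine le_trans (le_of_eq ?_) this
    congr 1
    refine Finset.sum_congr rfl fun k _ => ?_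
    rw [Polynomial.eval_pow, Polynomial.eval_X, Complex.ofReal_pow]
  have hHle : H ≤ L * (M * (A₁ * w)) := by
    calc H ≤ ∑ a ∈ range (gridSize K), ∑ i ∈ range M, A₁ * w :=
          Finset.sum_le_sum fun a ha => Finset.sum_le_sum fun i hi =>
            hd a (Finset.mem_range.mp ha) i (Finset.mem_range.mp hi)
      _ = _ := by simp [hLdef]
  have hhalf : L * (M * A₁) * (M * (L / σ)) ≤ 1 / 2 := by
    rw [← mul_div_assoc, ← mul_div_assoc, div_le_div_iff₀ hσ0 (by norm_num)]
    linarith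
  have hH2 : H ≤ 2 * (L * (M * A₁)) * θ := by
    have e1 : L * (M * (A₁ * w)) = L * (M * A₁) * θ + L * (M * A₁) * (M * (L / σ)) * H := by
      rw [hw]; ring
    have e2 : L * (M * A₁) * (M * (L / σ)) * H ≤ 1 / 2 * H := by gcongr
    linarith
  intro a ha i hi
  refine le_trans ?_ hH2
  refine (Finset.single_le_sum (f := fun i => ‖d a i‖) (fun _ _ => norm_nonneg _)
    (Finset.mem_range.mpr hi)).trans ?_
  exact Finset.single_le_sum (f := fun a => ∑ i ∈ range M, ‖d a i‖)
    (fun _ _ => Finset.sum_nonneg fun _ _ => norm_nonneg _) (Finset.mem_range.mpr ha)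

/-- If the oscillating expansion is close to a polynomial then the oscillating coefficients are
small. -/
lemma exists_oscillating_small (K D D' : ℕ) : ∃ Γ σ₀ : ℝ, 0 ≤ Γ ∧
    ∀ (σ e θ : ℝ) (c : ℕ → ℕ → ℂ) (P : Polynomial ℝ), σ₀ ≤ σ → 0 ≤ θ → P.natDegree ≤ D' →
    (∀ n : ℤ, ‖mainTerm K D c (((n : ℝ) - e) / σ) n -
      ((P.eval (((n : ℝ) - e) / σ) * gaussDensity (((n : ℝ) - e) / σ) : ℝ) : ℂ)‖ ≤ θ) →
    ∀ a < gridSize K, a ≠ 0 → ∀ k < D, ‖c a k‖ ≤ Γ * θ := by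
  set M : ℕ := D + D' + 1 with hM
  obtain ⟨Γ, σ₀, hΓ, hsep⟩ := exists_separation K M
  obtain ⟨A₁, hA₁, hinterp⟩ := exists_interpolation herm herm_monic natDegree_herm
    (y := fun j : ℕ => (j : ℝ) / (D + 1)) (fun i j hij => by
      have : (0 : ℝ) < D + 1 := by positivity
      have h2 : (i : ℝ) / (D + 1) = j / (D + 1) := hij
      rw [div_left_inj' this.ne'] at h2
      exact_mod_cast h2) D
  set g₀ : ℝ := gaussDensity 1 with hg₀
  have hg0 : 0 < g₀ := by
    rw [hg₀, gaussDensity]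
    have := Real.pi_pos
    positivity
  refine ⟨A₁ * (M * (Γ * g₀⁻¹)), σ₀, by positivity, ?_⟩
  intro σ e θ c P hσ hθ hP hclose
  set d : ℕ → ℕ → ℂ := fun a i => ∑ k ∈ range D, c a k * ((herm k).coeff i : ℂ) -
    if a = 0 then (P.coeff i : ℂ) else 0 with hd
  have heval : ∀ (a : ℕ) (x : ℝ), ∑ i ∈ range M, d a i * (x : ℂ) ^ i =
      ∑ k ∈ range D, c a k * (((herm k).eval x : ℝ) : ℂ) -
        if a = 0 then ((P.eval x : ℝ) : ℂ) else 0 := by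
    intro a x
    simp only [hd, sub_mul, Finset.sum_sub_distrib]
    congr 1
    · simp_rw [Finset.sum_mul]
      rw [Finset.sum_comm]
      refine Finset.sum_congr rfl fun k hk => ?_
      rw [Polynomial.eval_eq_sum_range' (n := M) (by
        rw [natDegree_herm]
        have := Finset.mem_range.mp hk
        omega)]
      push_cast
      rw [Finset.mul_sum]
      exact Finset.sum_congr rfl fun i _ => by ring
    · split_ifs
      · rw [Polynomial.eval_eq_sum_range' (n := M) (by omega)]
        push_cast
        rfl
      · simp
  have hdsmall := hsep σ e (g₀⁻¹ * θ) d hσ (by positivity) (fun n hn => by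
    set x : ℝ := ((n : ℝ) - e) / σ with hx
    have hgx : g₀ ≤ gaussDensity x := by
      rw [hg₀]
      unfold gaussDensity
      have : x ^ 2 ≤ 1 := (sq_le_one_iff_abs_le_one x).mpr hn
      exact mul_le_mul_of_nonneg_left (Real.exp_le_exp.mpr (by linarith)) (by positivity)
    have e1 : mainTerm K D c x n - ((P.eval x * gaussDensity x : ℝ) : ℂ) =
        (gaussDensity x : ℂ) * ∑ a ∈ range (gridSize K),
          Complex.exp (-(Complex.I * gridPt K a * n)) * ∑ i ∈ range M, d a i * (x : ℂ) ^ i := by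
      simp_rw [heval, mul_sub, Finset.sum_sub_distrib, mul_sub]
      congr 1
      · rw [mainTerm, Finset.mul_sum]
        refine Finset.sum_congr rfl fun a _ => ?_
        rw [mul_left_comm]
        congr 1
        rw [Finset.mul_sum]
        refine Finset.sum_congr rfl fun k _ => ?_
        push_cast
        ring
      · rw [Finset.sum_eq_single 0]
        · simp only [gridPt_zero, if_true]
          push_cast
          simp [mul_comm]
        · intro a _ ha
          simp [ha]
        · intro h0
          exact absurd (Finset.mem_range.mpr (gridSize_pos K)) h0
    have h1 := hclose n
    rw [← hx, e1, norm_mul, Complex.norm_real, Real.norm_of_nonneg (hg0.le.trans hgx)] at h1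
    rw [← div_eq_inv_mul, le_div_iff₀' hg0]
    exact (mul_le_mul_of_nonneg_right hgx (norm_nonneg _)).trans h1)
  intro a ha ha0 k hk
  refine (hinterp (c a) (M * (Γ * (g₀⁻¹ * θ))) (by positivity) (fun j hj => ?_) k hk).trans
    (le_of_eq (by ring))
  have hy1 : |(j : ℝ) / (D + 1)| ≤ 1 := by
    rw [abs_of_nonneg (by positivity), div_le_one (by positivity)]
    have : (j : ℝ) ≤ D := by exact_mod_cast hj.le
    linarith
  have h1 := heval a ((j : ℝ) / (D + 1))
  rw [if_neg ha0, sub_zero] at h1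
  rw [← h1]
  calc _ ≤ ∑ i ∈ range M, Γ * (g₀⁻¹ * θ) := by
        refine norm_sum_le_of_le _ fun i hi => ?_
        rw [norm_mul, norm_pow, Complex.norm_real, Real.norm_eq_abs]
        refine (mul_le_of_le_one_right (norm_nonneg _) (pow_le_one₀ (abs_nonneg _) hy1)).trans ?_
        exact hdsmall a ha i (Finset.mem_range.mp hi)
    _ = _ := by rw [Finset.sum_const, Finset.card_range, nsmul_eq_mul]

lemma localApprox_zero {D : ℕ} (hD : 0 < D) (c : ℕ → ℂ) (σ : ℝ) : localApprox D c σ 0 = c 0 := by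
  rw [localApprox, Finset.sum_eq_single 0]
  · simp
  · intro k _ hk
    simp [hk]
  · intro h0
    exact absurd (Finset.mem_range.mpr hD) h0

lemma norm_lawChar_gridPt_le {K D : ℕ} {ι : Type*} [Fintype ι] {val : ι → ℤ} {σ ρ η : ℝ}
    {c : ℕ → ℕ → ℂ} {v : ι → ℝ} (hD : 0 < D) (hρ : 0 ≤ ρ) (h : Approx K D val σ ρ η c v) {a : ℕ}
    (ha : a < gridSize K) : ‖lawChar val v (gridPt K a)‖ ≤ ‖c a 0‖ + η := by
  have h1 := h.1 a ha 0 (by simpa using hρ)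
  rw [localApprox_zero hD] at h1
  simp only [add_zero, Complex.ofReal_zero, mul_zero, zero_mul, neg_zero, Complex.exp_zero,
    mul_one] at h1
  have := norm_le_norm_add_norm_sub (c a 0) (lawChar val v (gridPt K a))
  rw [norm_sub_rev] at this
  linarith

section

variable {μ : Measure Ω} {X : ℕ → Ω → E} {κ : ℕ → Kernel E E} {f : ℕ → E → ℤ} {C : ℝ} {K : ℕ}
  {b : ℕ → ℤ}

namespace Model

/-- Conditionally stable Edgeworth expansions force the conditional characteristic functions to be
small at resonances. -/
theorem small_of_condStableEdgeworth (h : Model μ X κ f C K b) {r : ℕ} (hr : 1 ≤ r)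
    (hV : Tendsto (fun N => VN μ X f N) atTop atTop) (hE : CondStableEdgeworth μ X f r)
    {t : ℝ} (ht : IsResonant K t) (ht0 : t ≠ 0) (ℓ : ℕ) {ε : ℝ} (hε : 0 < ε) :
    ∃ N₀, ∀ N ≥ N₀, ∀ j : Fin ℓ → ℕ, (∀ i, j i ∈ Finset.Icc 1 N) →
      (∫ ω, ‖condChar μ X f t N j ω‖ ∂μ) ≤ ε * (sigN μ X f N)⁻¹ ^ (r - 1) := by
  have := h.prob
  obtain ⟨a, ha, rfl⟩ := ht.exists_gridPt
  have ha0 : a ≠ 0 := by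
    rintro rfl
    exact ht0 (gridPt_zero K)
  set D : ℕ := 6 * (r + 1) with hD
  have hDpos : 0 < D := by omega
  obtain ⟨B, τ₀, R, hB, hτ₀, -, happ⟩ := h.exists_approx ℓ D
  obtain ⟨A, hA, hmass⟩ := exists_lawMass_approx K D
  obtain ⟨D', Cb, hEl⟩ := hE ℓ
  obtain ⟨Γ, σ₀, hΓ, hosc⟩ := exists_oscillating_small K D D'
  set ε₁ : ℝ := ε / (2 * (Γ + 1)) with hε₁
  have hε₁0 : 0 < ε₁ := by positivity
  obtain ⟨N₁, hN₁⟩ := hEl ε₁ hε₁0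
  obtain ⟨N₂, hN₂⟩ := exists_scale hV (τ₀ + |σ₀| + gridSize K + 2 * (Γ * (A * B) + B) / ε)
  refine ⟨max N₁ N₂, fun N hN j hj => ?_⟩
  obtain ⟨τ, hτ, hτ1, hτV, hσ⟩ := hN₂ N (le_of_max_le_right hN)
  obtain ⟨P, hPdeg, -, hP⟩ := hN₁ N (le_of_max_le_left hN) j hj
  have hfr : 0 ≤ 2 * (Γ * (A * B) + B) / ε := by positivity
  have hσabs := le_abs_self σ₀
  have hσabs0 := abs_nonneg σ₀
  have hL0 : (0 : ℝ) ≤ gridSize K := Nat.cast_nonneg _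
  have hτ0 : 0 < τ := by linarith
  have hmem : ∀ᵐ ω ∂μ, condLaw μ X f K N j ω ∈ approxSet K D (fun i : Vals K N => (i : ℤ))
      (τ ^ 6) (τ ^ 5)⁻¹ (B * (τ ^ D)⁻¹) B B := by
    refine h.ae_condLaw_mem (isClosed_approxSet _ _ _ _ _ _ _ _) hj fun J A' hJ hJN hA' hpos => ?_
    obtain ⟨c, hc, hca, -⟩ := happ N τ (by linarith) hτV J A' hJ hJN hA' hpos
    exact ⟨c, hc, fun a _ _ k _ => hc a k, hca⟩
  rw [hσ]
  set y : ℝ := (τ ^ 6)⁻¹ ^ (r - 1) with hy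
  have hy0 : 0 < y := by positivity
  have hyr : (τ ^ 6)⁻¹ ^ r = y * (τ ^ 6)⁻¹ := by
    rw [hy, ← pow_succ]; congr 1; omega
  have b1 : (τ ^ D)⁻¹ * τ ^ 6 ≤ y * τ⁻¹ := by
    have e1 : τ ^ D = τ ^ (6 * r) * τ ^ 6 := by rw [← pow_add]; congr 1
    rw [e1, mul_inv, mul_assoc, inv_mul_cancel₀ (by positivity), mul_one, hy, inv_pow, ← pow_mul,
      ← mul_inv, ← pow_succ]
    exact inv_anti₀ (by positivity) (pow_le_pow_right₀ hτ1 (by omega))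
  have b1' : (τ ^ D)⁻¹ ≤ y * τ⁻¹ :=
    (le_mul_of_one_le_right (by positivity) (one_le_pow₀ hτ1)).trans b1
  set θ : ℝ := ε₁ * y + A * B * ((τ ^ D)⁻¹ * τ ^ 6) with hθ
  have hθ0 : 0 ≤ θ := by positivity
  have hae : ∀ᵐ ω ∂μ, ‖condChar μ X f (gridPt K a) N j ω‖ ≤ ε * y := by
    filter_upwards [hmem, h.ae_condLaw N j, hP] with ω ⟨c, hcB, _, hca⟩ ⟨hmean, hchar, hprob⟩ hPω
    rw [hchar]
    refine (norm_lawChar_gridPt_le hDpos (by positivity) hca ha).trans ?_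
    rw [hmean, hσ] at hPω
    set e := lawMean (fun i : Vals K N => (i : ℤ)) (condLaw μ X f K N j ω)
    set Q : Polynomial ℝ := ∑ n ∈ Finset.Icc 1 r, Polynomial.C ((τ ^ 6)⁻¹ ^ (n - 1)) * P n ω with hQ
    have hQdeg : Q.natDegree ≤ D' := Polynomial.natDegree_sum_le_of_forall_le _ _ fun n _ =>
      (Polynomial.natDegree_C_mul_le _ _).trans (hPdeg n ω)
    have hc0 : ‖c a 0‖ ≤ Γ * θ := by
      refine hosc (τ ^ 6) e θ c Q ?_ hθ0 hQdeg (fun k => ?_) a ha ha0 0 hDpos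
      · have : τ ≤ τ ^ 6 := le_self_pow₀ hτ1 (by norm_num)
        linarith
      have h1 := hmass _ _ c B τ hcB hB hτ1 (by linarith) hca k
      have h2 := hPω k
      rw [hprob] at h2
      set p := lawMass (fun i : Vals K N => (i : ℤ)) (condLaw μ X f K N j ω) k
      set x : ℝ := ((k : ℝ) - e) / τ ^ 6 with hx
      have hsum : ∑ n ∈ Finset.Icc 1 r, (τ ^ 6)⁻¹ ^ n * (P n ω).eval x * gaussDensity x =
          (τ ^ 6)⁻¹ * (Q.eval x * gaussDensity x) := by
        rw [hQ, Polynomial.eval_finsetSum, Finset.sum_mul, Finset.mul_sum]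
        refine Finset.sum_congr rfl fun n hn => ?_
        have e1 : (τ ^ 6)⁻¹ ^ n = (τ ^ 6)⁻¹ * (τ ^ 6)⁻¹ ^ (n - 1) := by
          rw [← pow_succ']
          have := (Finset.mem_Icc.mp hn).1
          congr 1
          omega
        rw [e1, Polynomial.eval_mul, Polynomial.eval_C]
        ring
      rw [hsum, hyr, ← Real.norm_eq_abs, ← Complex.norm_real] at h2
      have hτ6 : (0 : ℝ) < τ ^ 6 := by positivity
      have hτc : ((τ ^ 6 : ℝ) : ℂ) ≠ 0 := by exact_mod_cast hτ6.ne'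
      have e2 : mainTerm K D c x k - ((Q.eval x * gaussDensity x : ℝ) : ℂ) =
          ((τ ^ 6 : ℝ) : ℂ) * (((p - (τ ^ 6)⁻¹ * (Q.eval x * gaussDensity x) : ℝ) : ℂ) -
            ((p : ℂ) - (((τ ^ 6)⁻¹ : ℝ) : ℂ) * mainTerm K D c x k)) := by
        rw [Complex.ofReal_sub, Complex.ofReal_mul (τ ^ 6)⁻¹, Complex.ofReal_inv]
        field_simp
        ring
      rw [e2, norm_mul, Complex.norm_real, Real.norm_of_nonneg hτ6.le]
      calc _ ≤ τ ^ 6 * (ε₁ * (y * (τ ^ 6)⁻¹) + A * B * (τ ^ D)⁻¹) :=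
            mul_le_mul_of_nonneg_left ((norm_sub_le _ _).trans (add_le_add h2 h1)) hτ6.le
        _ = θ := by
            rw [hθ]
            field_simp
    have b3 : Γ * ε₁ ≤ ε / 2 := by
      rw [hε₁, mul_div_assoc', div_le_div_iff₀ (by positivity) (by norm_num)]
      nlinarith
    have b4 : (Γ * (A * B) + B) * τ⁻¹ ≤ ε / 2 := by
      rw [← div_eq_mul_inv, div_le_iff₀ hτ0]
      have : 2 * (Γ * (A * B) + B) / ε ≤ τ := by linarith
      rw [div_le_iff₀ hε] at this
      linarith
    calc ‖c a 0‖ + B * (τ ^ D)⁻¹ ≤ Γ * (ε₁ * y + A * B * (y * τ⁻¹)) + B * (y * τ⁻¹) := by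
          refine add_le_add (hc0.trans ?_) (by gcongr)
          rw [hθ]
          gcongr
      _ = (Γ * ε₁ + (Γ * (A * B) + B) * τ⁻¹) * y := by ring
      _ ≤ (ε / 2 + ε / 2) * y := by gcongr
      _ = ε * y := by ring
  calc _ ≤ ∫ _, ε * y ∂μ :=
        integral_mono_of_nonneg (Eventually.of_forall fun _ => norm_nonneg _) (integrable_const _) hae
    _ = ε * y := by simp

end Model

lemma exists_mode (h : UEChain μ X κ C) (hf : ∀ n, Measurable (f n))
    (hbound : ∀ n x, |f n x| ≤ (K : ℤ)) (n : ℕ) :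
    ∃ d : ℤ, |d| ≤ (K : ℤ) ∧ ((2 * K + 1 : ℝ))⁻¹ ≤ (marg μ X n).real {x | f n x = d} := by
  have hp : IsProbabilityMeasure μ := h.1
  have hX : Measurable (X n) := h.2.1 n
  have hm : IsProbabilityMeasure (marg μ X n) := Measure.isProbabilityMeasure_map hX.aemeasurable
  by_contra hcon
  push Not at hcon
  have hcard : ((Finset.Icc (-(K : ℤ)) K).card : ℝ) = 2 * K + 1 := by
    rw [Int.card_Icc]
    have : ((K : ℤ) + 1 - -(K : ℤ)).toNat = 2 * K + 1 := by omega
    rw [this]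
    push_cast
    ring
  have hsum : ∑ d ∈ Finset.Icc (-(K : ℤ)) K, (marg μ X n).real {x | f n x = d} = 1 := by
    rw [← measureReal_biUnion_finset]
    · have : (⋃ d ∈ Finset.Icc (-(K : ℤ)) K, {x | f n x = d}) = Set.univ := by
        ext x
        have := abs_le.mp (hbound n x)
        simp [this]
      rw [this, probReal_univ]
    · intro d _ d' _ hdd
      exact Set.disjoint_left.mpr fun x hx hx' => hdd (hx.symm.trans hx')
    · intro d _
      exact hf n (measurableSet_singleton d)
  have hlt : ∑ d ∈ Finset.Icc (-(K : ℤ)) K, (marg μ X n).real {x | f n x = d} <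
      ∑ d ∈ Finset.Icc (-(K : ℤ)) K, ((2 * K + 1 : ℝ))⁻¹ := by
    refine Finset.sum_lt_sum_of_nonempty ⟨0, by simp⟩ fun d hd => hcon d ?_
    exact abs_le.mpr (Finset.mem_Icc.mp hd)
  rw [hsum, Finset.sum_const, nsmul_eq_mul, hcard, mul_inv_cancel₀ (by positivity)] at hlt
  exact lt_irrefl _ hlt

lemma condStableEdgeworth_congr {f f' : ℕ → E → ℤ} (hS : S X f = S X f') (r : ℕ) :
    CondStableEdgeworth μ X f r ↔ CondStableEdgeworth μ X f' r := by
  simp only [CondStableEdgeworth, sigN, VN, hS]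

end

/-- Theorem 2.2. `S_N` obeys the Edgeworth expansion of order `r` in a
conditionally stable way if and only if for every nonzero resonant point `t` and every `ℓ`,
`sup_{1 ≤ j_1,…,j_ℓ ≤ N} ‖𝔼[e^{itS_N} | X_{j_1},…,X_{j_ℓ}]‖_{L¹} = o_ℓ(σ_N^{-(r-1)})`. -/
theorem condStableEdgeworth_iff_condChar_small
    (μ : Measure Ω) (X : ℕ → Ω → E) (κ : ℕ → Kernel E E) (f : ℕ → E → ℤ)
    (C : ℝ) (K r : ℕ) (hC : 1 < C) (hK : 1 ≤ K) (hr : 1 ≤ r)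
    (hchain : UEChain μ X κ C) (hf : ∀ n, Measurable (f n))
    (hbound : ∀ n ω, |f n (X n ω)| ≤ (K : ℤ))
    (hV : Tendsto (fun N => VN μ X f N) atTop atTop) :
    CondStableEdgeworth μ X f r ↔
      ∀ t : ℝ, IsResonant K t → t ≠ 0 → ∀ ℓ : ℕ,
        ∀ ε > 0, ∃ N₀, ∀ N ≥ N₀, ∀ j : Fin ℓ → ℕ, (∀ i, j i ∈ Finset.Icc 1 N) →
          (∫ ω, ‖condChar μ X f t N j ω‖ ∂μ) ≤ ε * (sigN μ X f N)⁻¹ ^ (r - 1) := by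
  set f' : ℕ → E → ℤ := fun n x => max (-(K : ℤ)) (min (K : ℤ) (f n x)) with hf'
  have hS : S X f = S X f' := by
    funext N ω
    refine Finset.sum_congr rfl fun n _ => ?_
    obtain ⟨h1, h2⟩ := abs_le.mp (hbound n ω)
    simp only [hf']
    rw [min_eq_right h2, max_eq_right h1]
  have hf'm : ∀ n, Measurable (f' n) := fun n => measurable_const.max (measurable_const.min (hf n))
  have hf'b : ∀ n x, |f' n x| ≤ (K : ℤ) := fun n x => abs_le.mpr
    ⟨le_max_left _ _, max_le (by omega) (min_le_left _ _)⟩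
  choose d hd hdm using exists_mode (μ := μ) (X := X) hchain hf'm hf'b
  have hmodel : Model μ X κ f' C K d := ⟨hC, hchain, hf'm, hf'b, hK, hd, hdm⟩
  have hV' : Tendsto (fun N => VN μ X f' N) atTop atTop := by
    simpa only [VN, hS] using hV
  rw [condStableEdgeworth_congr hS]
  simp only [condChar, sigN, VN, hS]
  exact ⟨fun h t ht ht0 ℓ ε hε => hmodel.small_of_condStableEdgeworth hr hV' h ht ht0 ℓ hε,
    fun h => hmodel.condStableEdgeworth_of_small hr hV' h⟩

end EdgeworthMC
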